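/- Let f : R → R' be a local ring homomorphism of complete noetherian local domains, where R is of mixed characteristic (0,p). Fix absolute integral closures R⁺ of R and R'⁺ of R', and let f⁺ : R⁺ → R'⁺ be any ring homomorphism lifting f (i.e. whose restriction along R → R⁺ agrees with the composite R → R' → R'⁺). Then there exist an R⁺-algebra C which is a (big) Cohen-Macaulay R-algebra, an R'⁺-algebra C' which is a (big) Cohen-Macaulay R'-algebra, and a ring homomorphism C → C' such that the square with maps R⁺ → R'⁺ (given by f⁺), R⁺ → C, R'⁺ → C', C → C' commutes. Moreover, if R' has characteristic p, then C' may be taken to be a perfect ring (the Frobenius endomorphism x ↦ x^p of C' is bijective). -/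

import Mathlib

/-- A finite sequence `y` of elements of a commutative ring `B` is a regular sequence on `B`:
for each `i`, multiplication by `y i` is injective on `B/(y_1,…,y_{i-1})B`,
and `B ≠ (y_1,…,y_m)B`. -/
def IsRegSeq {B : Type*} [CommRing B] {m : ℕ} (y : Fin m → B) : Prop :=
  (∀ i : Fin m, ∀ b : B,
      y i * b ∈ Ideal.span (y '' {j : Fin m | j < i}) →
        b ∈ Ideal.span (y '' {j : Fin m | j < i})) ∧
  Ideal.span (Set.range y) ≠ ⊤

/-- A `B`-algebra (given by a ring hom `φ : R →+* B`) is Cohen-Macaulay with respect to a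
sequence `x` of elements of `R` if `x` becomes a regular sequence in `B`. -/
def IsCMwrt {R B : Type*} [CommRing R] [CommRing B] (φ : R →+* B)
    {d : ℕ} (x : Fin d → R) : Prop :=
  IsRegSeq fun i => φ (x i)

/-- `x` is a system of parameters of the noetherian local ring `R`: `d` is the Krull dimension,
all `x i` lie in the maximal ideal, and they generate an ideal whose radical is the maximal
ideal. -/
def IsSOP (R : Type*) [CommRing R] [IsLocalRing R] {d : ℕ} (x : Fin d → R) : Prop :=
  (d : WithBot ℕ∞) = ringKrullDim R ∧
  (∀ i, x i ∈ IsLocalRing.maximalIdeal R) ∧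
  (Ideal.span (Set.range x)).radical = IsLocalRing.maximalIdeal R

/-- `B` (via the structure map `φ`) is a big Cohen-Macaulay `R`-algebra: it is Cohen-Macaulay
with respect to every system of parameters of `R`. -/
def IsBigCM {R B : Type*} [CommRing R] [IsLocalRing R] [CommRing B] (φ : R →+* B) : Prop :=
  ∀ (d : ℕ) (x : Fin d → R), IsSOP R x → IsCMwrt φ x

/-- `A` (as an `R`-algebra) is an absolute integral closure of the domain `R`:
it is a domain containing `R`, integral over `R`, and absolutely integrally closed
(every monic polynomial of positive degree has a root); equivalently, it is the
integral closure of `R` in an algebraic closure of its fraction field. -/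
structure IsAbsIntClosure (R A : Type*) [CommRing R] [CommRing A] [Algebra R A] : Prop where
  isDomain : IsDomain A
  injective : Function.Injective (algebraMap R A)
  isIntegral : Algebra.IsIntegral R A
  monic_root : ∀ P : Polynomial A, P.Monic → 0 < P.degree → ∃ a : A, P.IsRoot a

/-- `B` is `π^{1/p^∞}`-almost Cohen-Macaulay with respect to `x`, where `π : ℕ → B` is a
compatible system of `p`-th power roots. -/
def IsAlmostCMwrt {R B : Type*} [CommRing R] [CommRing B] (φ : R →+* B)
    (π : ℕ → B) {d : ℕ} (x : Fin d → R) : Prop :=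
  (∀ i : Fin d, ∀ b : B,
      φ (x i) * b ∈ Ideal.span ((fun j => φ (x j)) '' {j : Fin d | j < i}) →
        ∀ e : ℕ, π e * b ∈ Ideal.span ((fun j => φ (x j)) '' {j : Fin d | j < i})) ∧
  ¬ Ideal.span (Set.range π) ≤ Ideal.span (Set.range fun j => φ (x j))

namespace BigCM

section RegMod

variable {C D : Type*} [CommRing C] [CommRing D]

/-- `xs` is a weakly regular sequence on `C ⧸ I`. -/
def RegMod : Ideal C → List C → Prop
  | _, [] => True
  | I, x :: xs => (∀ b, x * b ∈ I → b ∈ I) ∧ RegMod (I ⊔ Ideal.span {x}) xs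

theorem mem_sup_singleton {I : Ideal C} {x c : C} :
    c ∈ I ⊔ Ideal.span {x} ↔ ∃ i ∈ I, ∃ b, i + b * x = c := by
  simp only [Submodule.mem_sup, Ideal.mem_span_singleton', exists_exists_eq_and]

@[simp] theorem regMod_nil (I : Ideal C) : RegMod I [] := trivial

theorem regMod_cons {I : Ideal C} {x : C} {xs : List C} :
    RegMod I (x :: xs) ↔ (∀ b, x * b ∈ I → b ∈ I) ∧ RegMod (I ⊔ Ideal.span {x}) xs := Iff.rfl

theorem sup_ofList_cons (I : Ideal C) (x : C) (xs : List C) :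
    I ⊔ Ideal.ofList (x :: xs) = (I ⊔ Ideal.span {x}) ⊔ Ideal.ofList xs := by
  rw [Ideal.ofList_cons, sup_assoc]

theorem regMod_append {I : Ideal C} {xs ys : List C} :
    RegMod I (xs ++ ys) ↔ RegMod I xs ∧ RegMod (I ⊔ Ideal.ofList xs) ys := by
  induction xs generalizing I with
  | nil => simp [Ideal.ofList_nil]
  | cons x xs ih =>
    rw [List.cons_append, regMod_cons, regMod_cons, ih, sup_ofList_cons, and_assoc]

/-- `0 → C ⧸ I₁ → C ⧸ I → C ⧸ I₃ → 0` is exact, the first map being multiplication by `x`. -/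
def MulExact (I : Ideal C) (x : C) (I₁ I₃ : Ideal C) : Prop :=
  (∀ c, x * c ∈ I ↔ c ∈ I₁) ∧ I₃ = I ⊔ Ideal.span {x}

theorem MulExact.sup {I I₁ I₃ : Ideal C} {x y : C} (h : MulExact I x I₁ I₃)
    (h₃ : ∀ b, y * b ∈ I₃ → b ∈ I₃) :
    MulExact (I ⊔ Ideal.span {y}) x (I₁ ⊔ Ideal.span {y}) (I₃ ⊔ Ideal.span {y}) := by
  obtain ⟨h1, rfl⟩ := h
  refine ⟨fun c => ⟨fun hc => ?_, fun hc => ?_⟩, by rw [sup_right_comm]⟩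
  · obtain ⟨i, hi, z, hz, e⟩ := Submodule.mem_sup.1 hc
    obtain ⟨b, rfl⟩ := Ideal.mem_span_singleton'.1 hz
    have : b ∈ I ⊔ Ideal.span {x} := by
      apply h₃
      have : y * b = c * x - i := by linear_combination e
      rw [this]
      exact Ideal.sub_mem _ (Ideal.mem_sup_right (Ideal.mem_span_singleton'.2 ⟨c, rfl⟩))
        (Ideal.mem_sup_left hi)
    obtain ⟨i', hi', z, hz, e'⟩ := Submodule.mem_sup.1 this
    obtain ⟨c', rfl⟩ := Ideal.mem_span_singleton'.1 hz
    have h2 : c - y * c' ∈ I₁ := by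
      rw [← h1]
      have : x * (c - y * c') = i + y * i' := by linear_combination -e - y * e'
      rw [this]
      exact I.add_mem hi (I.mul_mem_left _ hi')
    have : c = (c - y * c') + c' * y := by ring
    rw [this]
    exact Ideal.add_mem _ (Ideal.mem_sup_left h2)
      (Ideal.mem_sup_right (Ideal.mem_span_singleton'.2 ⟨c', rfl⟩))
  · obtain ⟨i, hi, z, hz, rfl⟩ := Submodule.mem_sup.1 hc
    obtain ⟨b, rfl⟩ := Ideal.mem_span_singleton'.1 hz
    rw [mul_add]
    exact Ideal.add_mem _ (Ideal.mem_sup_left ((h1 _).2 hi))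
      (Ideal.mem_sup_right (Ideal.mem_span_singleton'.2 ⟨x * b, by ring⟩))

theorem MulExact.reg {I I₁ I₃ : Ideal C} {x y : C} (h : MulExact I x I₁ I₃)
    (h₁ : ∀ b, y * b ∈ I₁ → b ∈ I₁) (h₃ : ∀ b, y * b ∈ I₃ → b ∈ I₃) :
    ∀ b, y * b ∈ I → b ∈ I := by
  obtain ⟨h1, rfl⟩ := h
  intro b hb
  obtain ⟨i, hi, z, hz, rfl⟩ := Submodule.mem_sup.1 (h₃ b (Ideal.mem_sup_left hb))
  obtain ⟨c, rfl⟩ := Ideal.mem_span_singleton'.1 hz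
  have : x * (y * c) ∈ I := by
    have : x * (y * c) = y * (i + c * x) - y * i := by ring
    rw [this]
    exact I.sub_mem hb (I.mul_mem_left _ hi)
  have := (h1 c).2 (h₁ _ ((h1 _).1 this))
  rw [mul_comm c x]
  exact I.add_mem hi this

theorem MulExact.regMod {I I₁ I₃ : Ideal C} {x : C} {ys : List C} (h : MulExact I x I₁ I₃)
    (h₁ : RegMod I₁ ys) (h₃ : RegMod I₃ ys) : RegMod I ys := by
  induction ys generalizing I I₁ I₃ with
  | nil => trivial
  | cons y ys ih =>
    exact ⟨h.reg h₁.1 h₃.1, ih (h.sup h₃.1) h₁.2 h₃.2⟩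

theorem MulExact.regMod_left {I I₁ I₃ : Ideal C} {x x' : C} {ys : List C}
    (h : MulExact I x I₁ I₃) (h' : MulExact I x' I₃ I₁) (hr : RegMod I ys) : RegMod I₁ ys := by
  induction ys generalizing I I₁ I₃ with
  | nil => trivial
  | cons y ys ih =>
    have r₁ : ∀ b, y * b ∈ I₁ → b ∈ I₁ := fun b hb => by
      rw [← h.1] at hb ⊢
      exact hr.1 _ (by rwa [mul_left_comm])
    have r₃ : ∀ b, y * b ∈ I₃ → b ∈ I₃ := fun b hb => by
      rw [← h'.1] at hb ⊢
      exact hr.1 _ (by rwa [mul_left_comm])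
    exact ⟨r₁, ih (h.sup r₃) (h'.sup r₁) hr.2⟩

theorem mulExact_mul {I : Ideal C} {x x' : C} (hx : ∀ b, x * b ∈ I → b ∈ I) :
    MulExact (I ⊔ Ideal.span {x * x'}) x (I ⊔ Ideal.span {x'}) (I ⊔ Ideal.span {x}) := by
  refine ⟨fun c => ⟨fun hc => ?_, fun hc => ?_⟩, ?_⟩
  · obtain ⟨i, hi, z, hz, e⟩ := Submodule.mem_sup.1 hc
    obtain ⟨b, rfl⟩ := Ideal.mem_span_singleton'.1 hz
    have : c - b * x' ∈ I := hx _ (by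
      have : x * (c - b * x') = i := by linear_combination -e
      rwa [this])
    have e : c = (c - b * x') + b * x' := by ring
    rw [e]
    exact Ideal.add_mem _ (Ideal.mem_sup_left this)
      (Ideal.mem_sup_right (Ideal.mem_span_singleton'.2 ⟨b, rfl⟩))
  · obtain ⟨i, hi, z, hz, rfl⟩ := Submodule.mem_sup.1 hc
    obtain ⟨b, rfl⟩ := Ideal.mem_span_singleton'.1 hz
    rw [mul_add]
    exact Ideal.add_mem _ (Ideal.mem_sup_left (I.mul_mem_left _ hi))
      (Ideal.mem_sup_right (Ideal.mem_span_singleton'.2 ⟨b, by ring⟩))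
  · rw [sup_assoc, (sup_eq_right (a := Ideal.span {x * x'})).2
      (Ideal.span_singleton_le_span_singleton.2 (Dvd.intro _ rfl))]

theorem RegMod.mul {I : Ideal C} {x x' : C} {ys : List C} (h : RegMod I (x :: ys))
    (h' : RegMod I (x' :: ys)) : RegMod I (x * x' :: ys) :=
  ⟨fun b hb => h'.1 _ (h.1 _ (by rwa [← mul_assoc])), (mulExact_mul h.1).regMod h'.2 h.2⟩

theorem RegMod.of_mul {I : Ideal C} {x x' : C} {ys : List C} (h : RegMod I (x * x' :: ys)) :
    RegMod I (x :: ys) := by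
  have hx : ∀ b, x * b ∈ I → b ∈ I := fun b hb => h.1 _ (by
    rw [mul_right_comm]; exact I.mul_mem_right _ hb)
  have hx' : ∀ b, x' * b ∈ I → b ∈ I := fun b hb => h.1 _ (by
    rw [mul_assoc]; exact I.mul_mem_left _ hb)
  refine ⟨hx, ?_⟩
  have e := mulExact_mul (x' := x) hx'
  rw [mul_comm x' x] at e
  exact e.regMod_left (mulExact_mul hx) h.2

theorem RegMod.pow_head {I : Ideal C} {x : C} {ys : List C} (h : RegMod I (x :: ys)) (n : ℕ) :
    RegMod I (x ^ (n + 1) :: ys) := by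
  induction n with
  | zero => simpa using h
  | succ n ih => rw [pow_succ]; exact ih.mul h

theorem RegMod.pow {I : Ideal C} {xs : List C} (h : RegMod I xs) {n : ℕ} (hn : n ≠ 0) :
    RegMod I (xs.map (· ^ n)) := by
  obtain ⟨n, rfl⟩ := Nat.exists_eq_succ_of_ne_zero hn
  induction xs generalizing I with
  | nil => trivial
  | cons x xs ih => exact RegMod.pow_head (ys := xs.map _) ⟨h.1, ih h.2⟩ n

theorem RegMod.of_pow_head {I : Ideal C} {x : C} {ys : List C} {n : ℕ} (hn : n ≠ 0)
    (h : RegMod I (x ^ n :: ys)) : RegMod I (x :: ys) := by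
  obtain ⟨n, rfl⟩ := Nat.exists_eq_succ_of_ne_zero hn
  rw [Nat.succ_eq_add_one, pow_succ'] at h
  exact h.of_mul

theorem RegMod.swap_tail {I : Ideal C} {x z : C} (hx : ∀ b, x * b ∈ I → b ∈ I)
    (hz : ∀ b, z * b ∈ I ⊔ Ideal.span {x} → b ∈ I ⊔ Ideal.span {x}) :
    ∀ b, x * b ∈ I ⊔ Ideal.span {z} → b ∈ I ⊔ Ideal.span {z} := by
  intro a ha
  obtain ⟨i, hi, w, hw, e⟩ := Submodule.mem_sup.1 ha
  obtain ⟨b, rfl⟩ := Ideal.mem_span_singleton'.1 hw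
  have hb : b ∈ I ⊔ Ideal.span {x} := by
    apply hz
    have : z * b = a * x - i := by linear_combination e
    rw [this]
    exact Ideal.sub_mem _ (Ideal.mem_sup_right (Ideal.mem_span_singleton'.2 ⟨a, rfl⟩))
        (Ideal.mem_sup_left hi)
  obtain ⟨i', hi', w, hw, e'⟩ := Submodule.mem_sup.1 hb
  obtain ⟨b', rfl⟩ := Ideal.mem_span_singleton'.1 hw
  have h2 : a - z * b' ∈ I := hx _ (by
    have : x * (a - z * b') = i + z * i' := by linear_combination -e - z * e'
    rw [this]
    exact I.add_mem hi (I.mul_mem_left _ hi'))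
  have : a = (a - z * b') + b' * z := by ring
  rw [this]
  exact Ideal.add_mem _ (Ideal.mem_sup_left h2)
      (Ideal.mem_sup_right (Ideal.mem_span_singleton'.2 ⟨b', rfl⟩))

/-- The first element of a weakly regular sequence is regular modulo the other ones. -/
theorem RegMod.head_reg {I : Ideal C} {x : C} {ys : List C} (h : RegMod I (x :: ys)) :
    ∀ b, x * b ∈ I ⊔ Ideal.ofList ys → b ∈ I ⊔ Ideal.ofList ys := by
  induction ys generalizing I with
  | nil => simpa [Ideal.ofList_nil] using h.1
  | cons z ys ih =>
    rw [sup_ofList_cons]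
    refine ih ⟨RegMod.swap_tail h.1 h.2.1, ?_⟩
    rw [sup_right_comm]
    exact h.2.2

theorem regMod_comap_iff (φ : C →+* D) (hφ : Function.Surjective φ) (I : Ideal D) (xs : List C) :
    RegMod (I.comap φ) xs ↔ RegMod I (xs.map φ) := by
  induction xs generalizing I with
  | nil => simp
  | cons x xs ih =>
    have e : I.comap φ ⊔ Ideal.span {x} = (I ⊔ Ideal.span {φ x}).comap φ := by
      ext c
      rw [mem_sup_singleton, Ideal.mem_comap, mem_sup_singleton]
      constructor
      · rintro ⟨i, hi, b, rfl⟩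
        exact ⟨φ i, hi, φ b, by simp⟩
      · rintro ⟨i, hi, b, e⟩
        obtain ⟨b, rfl⟩ := hφ b
        refine ⟨c - b * x, ?_, b, by ring⟩
        rw [Ideal.mem_comap, map_sub, ← e, map_mul, add_sub_cancel_right]
        exact hi
    rw [List.map_cons, regMod_cons, regMod_cons, e, ih]
    refine and_congr_left fun _ => ⟨fun h b hb => ?_, fun h b hb => ?_⟩
    · obtain ⟨b, rfl⟩ := hφ b
      exact h b (by simpa using hb)
    · exact h _ (by simpa using hb)

theorem RegMod.localization (M : Submonoid C) [Algebra C D] [IsLocalization M D] {I : Ideal C}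
    {xs : List C} (h : RegMod I xs) :
    RegMod (I.map (algebraMap C D)) (xs.map (algebraMap C D)) := by
  induction xs generalizing I with
  | nil => trivial
  | cons x xs ih =>
    refine ⟨fun b hb => ?_, ?_⟩
    · obtain ⟨⟨c, s⟩, e⟩ := IsLocalization.surj M b
      have : algebraMap C D (x * c) ∈ I.map (algebraMap C D) := by
        rw [map_mul, ← e, ← mul_assoc]
        exact Ideal.mul_mem_right _ _ hb
      obtain ⟨m, hm, hmx⟩ := (IsLocalization.algebraMap_mem_map_algebraMap_iff M D I _).1 this
      have h1 : m * c ∈ I := h.1 _ (by rwa [mul_left_comm])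
      have h2 : algebraMap C D c ∈ I.map (algebraMap C D) :=
        (IsLocalization.algebraMap_mem_map_algebraMap_iff M D I _).2 ⟨m, hm, h1⟩
      rw [← e] at h2
      exact (Ideal.mul_unit_mem_iff_mem _ (IsLocalization.map_units D s)).1 h2
    · have := ih h.2
      rwa [Ideal.map_sup, Ideal.map_span, Set.image_singleton] at this

/-- The ideal of a product of rings given by a family of ideals. -/
def piIdeal {ι : Type*} {C : ι → Type*} [∀ i, CommRing (C i)] (I : ∀ i, Ideal (C i)) :
    Ideal (∀ i, C i) where
  carrier := {x | ∀ i, x i ∈ I i}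
  add_mem' ha hb i := (I i).add_mem (ha i) (hb i)
  zero_mem' i := (I i).zero_mem
  smul_mem' c _ hx i := (I i).mul_mem_left (c i) (hx i)

theorem mem_piIdeal {ι : Type*} {C : ι → Type*} [∀ i, CommRing (C i)] {I : ∀ i, Ideal (C i)}
    {x : ∀ i, C i} : x ∈ piIdeal I ↔ ∀ i, x i ∈ I i := Iff.rfl

theorem piIdeal_bot {ι : Type*} {C : ι → Type*} [∀ i, CommRing (C i)] :
    piIdeal (fun i => (⊥ : Ideal (C i))) = ⊥ := by
  ext x
  simp [mem_piIdeal, funext_iff]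

theorem piIdeal_sup {ι : Type*} {C : ι → Type*} [∀ i, CommRing (C i)] (I : ∀ i, Ideal (C i))
    (x : ∀ i, C i) :
    piIdeal I ⊔ Ideal.span {x} = piIdeal (fun i => I i ⊔ Ideal.span {x i}) := by
  ext c
  simp only [mem_sup_singleton, mem_piIdeal]
  constructor
  · rintro ⟨a, ha, b, rfl⟩ i
    exact ⟨a i, ha i, b i, rfl⟩
  · intro h
    choose a ha b e using h
    exact ⟨a, ha, b, funext e⟩

theorem RegMod.pi {ι : Type*} {C : ι → Type*} [∀ i, CommRing (C i)] {I : ∀ i, Ideal (C i)}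
    {xs : List (∀ i, C i)} (h : ∀ i, RegMod (I i) (xs.map (· i))) : RegMod (piIdeal I) xs := by
  induction xs generalizing I with
  | nil => trivial
  | cons x xs ih =>
    refine ⟨fun b hb i => (h i).1 _ (hb i), ?_⟩
    rw [piIdeal_sup]
    exact ih fun i => (h i).2

theorem piIdeal_sup_ofList {ι : Type*} {C : ι → Type*} [∀ i, CommRing (C i)]
    (I : ∀ i, Ideal (C i)) (xs : List (∀ i, C i)) :
    piIdeal I ⊔ Ideal.ofList xs = piIdeal (fun i => I i ⊔ Ideal.ofList (xs.map (· i))) := by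
  induction xs generalizing I with
  | nil => simp [Ideal.ofList_nil]
  | cons x xs ih =>
    rw [sup_ofList_cons, piIdeal_sup, ih]
    simp only [List.map_cons, sup_ofList_cons]

end RegMod

section Complete

variable {E : Type*} [CommRing E]

theorem exists_limit (J : Ideal E) [IsAdicComplete J E] (f : ℕ → E)
    (h : ∀ n, f (n + 1) - f n ∈ J ^ n) : ∃ L, ∀ n, L - f n ∈ J ^ n := by
  obtain ⟨L, hL⟩ := IsPrecomplete.prec (I := J) (M := E) inferInstance (f := f) (by
    intro m n hmn
    induction n, hmn using Nat.le_induction with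
    | base => rfl
    | succ n hmn ih =>
      refine ih.trans (SModEq.symm ?_)
      rw [SModEq.sub_mem, smul_eq_mul, Ideal.mul_top]
      exact Ideal.pow_le_pow_right hmn (h n))
  refine ⟨L, fun n => ?_⟩
  have := (hL n).symm
  rwa [SModEq.sub_mem, smul_eq_mul, Ideal.mul_top] at this

/-- The ideal `I` is closed for the `J`-adic topology. -/
def ClosedIn (J I : Ideal E) : Prop := ∀ b, (∀ n, b ∈ I ⊔ J ^ n) → b ∈ I

theorem closedIn_bot (J : Ideal E) [IsAdicComplete J E] : ClosedIn J ⊥ := by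
  intro b hb
  refine IsHausdorff.haus (I := J) inferInstance b fun n => ?_
  rw [SModEq.sub_mem, smul_eq_mul, Ideal.mul_top, sub_zero]
  simpa using hb n

theorem closedIn_sup_singleton {J I : Ideal E} [IsAdicComplete J E] {x : E} (hI : ClosedIn J I)
    (h : ∀ n, ∃ m, ∀ b, x * b ∈ I ⊔ J ^ m → b ∈ I ⊔ J ^ n) :
    ClosedIn J (I ⊔ Ideal.span {x}) := by
  intro b hb
  choose M hM using h
  let N : ℕ → ℕ := fun n => n + ∑ i ∈ Finset.range (n + 1), M i
  have hN : ∀ n, M n ≤ N n := fun n =>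
    (Finset.single_le_sum (f := M) (fun _ _ => Nat.zero_le _)
      (Finset.self_mem_range_succ n)).trans (Nat.le_add_left _ _)
  have hnN : ∀ n, n ≤ N n := fun n => Nat.le_add_right _ _
  have hNs : ∀ n, N n ≤ N (n + 1) := fun n => by
    simp only [N]; rw [Finset.sum_range_succ _ (n + 1)]; omega
  have hpow : ∀ {m n : ℕ}, m ≤ n → I ⊔ J ^ n ≤ I ⊔ J ^ m := fun hmn =>
    sup_le_sup_left (Ideal.pow_le_pow_right hmn) I
  have ex : ∀ n, ∃ c, b - x * c ∈ I ⊔ J ^ n := fun n => by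
    have := hb n
    rw [sup_right_comm, mem_sup_singleton] at this
    obtain ⟨i, hi, c, e⟩ := this
    refine ⟨c, ?_⟩
    rwa [← e, mul_comm c x, add_sub_cancel_right]
  have step : ∀ n (c : {c // b - x * c ∈ I ⊔ J ^ N n}),
      ∃ c' : {c' // b - x * c' ∈ I ⊔ J ^ N (n + 1)}, c'.1 - c.1 ∈ J ^ n := by
    rintro n ⟨c, hc⟩
    obtain ⟨c', hc'⟩ := ex (N (n + 1))
    have : c' - c ∈ I ⊔ J ^ n := by
      apply hM n
      apply hpow (hN n)
      have : x * (c' - c) = (b - x * c) - (b - x * c') := by ring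
      rw [this]
      exact Ideal.sub_mem _ hc (hpow (hNs n) hc')
    obtain ⟨i, hi, j, hj, e⟩ := Submodule.mem_sup.1 this
    refine ⟨⟨c' - i, ?_⟩, ?_⟩
    · have : b - x * (c' - i) = (b - x * c') + x * i := by ring
      rw [this]
      exact Ideal.add_mem _ hc' (Ideal.mem_sup_left (I.mul_mem_left _ hi))
    · have : c' - i - c = j := by linear_combination -e
      rwa [this]
  choose s hs using step
  obtain ⟨c0, hc0⟩ := ex (N 0)
  let f : ∀ n, {c // b - x * c ∈ I ⊔ J ^ N n} := fun n => Nat.rec ⟨c0, hc0⟩ (fun n c => s n c) n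
  obtain ⟨L, hL⟩ := exists_limit J (fun n => (f n).1) (fun n => hs n (f n))
  have : b - x * L ∈ I := by
    apply hI
    intro n
    have : b - x * L = (b - x * (f n).1) - x * (L - (f n).1) := by ring
    rw [this]
    exact Ideal.sub_mem _ (hpow (hnN n) (f n).2)
      (Ideal.mem_sup_right (Ideal.mul_mem_left _ _ (hL n)))
  exact mem_sup_singleton.2 ⟨_, this, L, by ring⟩

theorem ofList_le_radical_map_pow (xs : List E) (n : ℕ) :
    Ideal.ofList xs ≤ (Ideal.ofList (xs.map (· ^ n))).radical := by
  rw [Ideal.ofList, Ideal.span_le]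
  intro x hx
  exact ⟨n, Ideal.subset_span (List.mem_map_of_mem hx)⟩

theorem ofList_map_pow_le {J : Ideal E} {xs : List E} (h : ∀ x ∈ xs, x ∈ J) (n : ℕ) :
    Ideal.ofList (xs.map (· ^ n)) ≤ J ^ n := by
  rw [Ideal.ofList, Ideal.span_le]
  intro x hx
  obtain ⟨y, hy, rfl⟩ := List.mem_map.1 hx
  exact Ideal.pow_mem_pow (h y hy) n

theorem RegMod.pow_colon {I J : Ideal E} {x : E} {xs : List E} (h : RegMod I (x :: xs))
    (hJ : J.FG) (hx : ∀ y ∈ x :: xs, y ∈ J) (hr : J ≤ (I ⊔ Ideal.ofList (x :: xs)).radical)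
    (n : ℕ) : ∃ m, ∀ b, x * b ∈ I ⊔ J ^ m → b ∈ I ⊔ J ^ n := by
  have h1 : J ≤ (I ⊔ Ideal.ofList ((x :: xs).map (· ^ (n + 1)))).radical := by
    refine hr.trans (Ideal.radical_le_radical_iff.2 (sup_le ?_ ?_))
    · exact le_sup_left.trans Ideal.le_radical
    · exact (ofList_le_radical_map_pow _ (n + 1)).trans (Ideal.radical_mono le_sup_right)
  obtain ⟨m, hm⟩ := Ideal.exists_pow_le_of_le_radical_of_fg h1 hJ
  refine ⟨m, fun b hb => ?_⟩
  have h2 : RegMod I (x :: xs.map (· ^ (n + 1))) := ⟨h.1, h.2.pow n.succ_ne_zero⟩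
  have hb : x * b ∈ I ⊔ Ideal.ofList ((x :: xs).map (· ^ (n + 1))) := sup_le le_sup_left hm hb
  rw [List.map_cons, sup_ofList_cons, sup_right_comm, mem_sup_singleton] at hb
  obtain ⟨i, hi, c, e⟩ := hb
  have h3 := h2.head_reg (b - c * x ^ n) (by
    have : x * (b - c * x ^ n) = i := by rw [pow_succ] at e; linear_combination -e
    rwa [this])
  have : b = (b - c * x ^ n) + c * x ^ n := by ring
  rw [this]
  have hle : I ⊔ Ideal.ofList (xs.map (· ^ (n + 1))) ≤ I ⊔ J ^ n := sup_le le_sup_left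
    (((ofList_map_pow_le (fun y hy => hx y (List.mem_cons_of_mem _ hy)) _).trans
    (Ideal.pow_le_pow_right n.le_succ)).trans le_sup_right)
  exact Ideal.add_mem _ (hle h3) (Ideal.mem_sup_right
    (Ideal.mul_mem_left _ _ (Ideal.pow_mem_pow (hx x List.mem_cons_self) n)))

theorem RegMod.closedIn_head {I J : Ideal E} [IsAdicComplete J E] {x : E} {xs : List E}
    (h : RegMod I (x :: xs)) (hI : ClosedIn J I) (hJ : J.FG) (hx : ∀ y ∈ x :: xs, y ∈ J)
    (hr : J ≤ (I ⊔ Ideal.ofList (x :: xs)).radical) : ClosedIn J (I ⊔ Ideal.span {x}) :=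
  closedIn_sup_singleton hI (h.pow_colon hJ hx hr)

theorem RegMod.perm {I J : Ideal E} [IsAdicComplete J E] {xs ys : List E} (hp : xs.Perm ys)
    (h : RegMod I xs) (hI : ClosedIn J I) (hJ : J.FG) (hx : ∀ y ∈ xs, y ∈ J)
    (hr : J ≤ (I ⊔ Ideal.ofList xs).radical) : RegMod I ys := by
  induction hp generalizing I with
  | nil => trivial
  | cons x hp ih =>
    refine ⟨h.1, ih h.2 (h.closedIn_head hI hJ hx hr)
      (fun y hy => hx y (List.mem_cons_of_mem _ hy)) ?_⟩
    rwa [sup_ofList_cons] at hr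
  | swap x y l =>
    refine ⟨fun b hb => ?_, RegMod.swap_tail h.1 h.2.1, ?_⟩
    · apply hI
      have key : ∀ n, ∃ c, x * c ∈ I ∧ ∃ i ∈ I, b = i + c * y ^ n := by
        intro n
        induction n with
        | zero => exact ⟨b, hb, 0, I.zero_mem, by simp⟩
        | succ n ih =>
          obtain ⟨c, hc, i, hi, e⟩ := ih
          obtain ⟨i', hi', c', e'⟩ := mem_sup_singleton.1 (h.2.1 c (Ideal.mem_sup_left hc))
          refine ⟨c', h.1 _ ?_, i + i' * y ^ n, I.add_mem hi (I.mul_mem_right _ hi'), ?_⟩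
          · have : y * (x * c') = x * c - x * i' := by rw [← e']; ring
            rw [this]
            exact I.sub_mem hc (I.mul_mem_left _ hi')
          · rw [e, ← e']; ring
      intro n
      obtain ⟨c, -, i, hi, e⟩ := key n
      rw [e]
      exact Ideal.add_mem _ (Ideal.mem_sup_left hi) (Ideal.mem_sup_right
        (Ideal.mul_mem_left _ _ (Ideal.pow_mem_pow (hx y List.mem_cons_self) n)))
    · rw [sup_right_comm]
      exact h.2.2
  | trans hp₁ hp₂ ih₁ ih₂ =>
    refine ih₂ (ih₁ h hI hx hr) hI (fun y hy => hx y (hp₁.mem_iff.2 hy)) ?_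
    have e : ∀ zs ws : List E, zs.Perm ws → Ideal.ofList zs = Ideal.ofList ws := fun zs ws hp =>
      congrArg Ideal.span (Set.ext fun y => hp.mem_iff)
    rwa [← e _ _ hp₁]

theorem RegMod.exchange_last {I : Ideal E} {xs : List E} {x w : E} (h : RegMod I (xs ++ [x]))
    (hx : x ∈ (I ⊔ Ideal.ofList xs ⊔ Ideal.span {w}).radical) : RegMod I (xs ++ [w]) := by
  rw [regMod_append] at h ⊢
  refine ⟨h.1, fun b hb => ?_, trivial⟩
  obtain ⟨n, hn⟩ := hx
  obtain ⟨i, hi, c, e⟩ := mem_sup_singleton.1 hn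
  have h1 : ∀ n b, x ^ n * b ∈ I ⊔ Ideal.ofList xs → b ∈ I ⊔ Ideal.ofList xs := by
    intro n
    induction n with
    | zero => simp
    | succ n ih => intro b hb; exact ih b (h.2.1 _ (by rwa [← mul_assoc, ← pow_succ']))
  apply h1 n
  rw [← e, add_mul, mul_assoc]
  exact Ideal.add_mem _ (Ideal.mul_mem_right _ _ hi) (Ideal.mul_mem_left _ _ hb)

end Complete

section SOP

open IsLocalRing

variable {N : Type*} [CommRing N] [IsNoetherianRing N] [IsLocalRing N]

theorem exists_common_parameter {I I' : Ideal N} {x x' : N}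
    (hx : x ∈ maximalIdeal N) (hx' : x' ∈ maximalIdeal N)
    (h : maximalIdeal N ≤ (I ⊔ Ideal.span {x}).radical)
    (h' : maximalIdeal N ≤ (I' ⊔ Ideal.span {x'}).radical) :
    ∃ w ∈ maximalIdeal N, maximalIdeal N ≤ (I ⊔ Ideal.span {w}).radical ∧
      maximalIdeal N ≤ (I' ⊔ Ideal.span {w}).radical := by
  set m := maximalIdeal N
  let S : Set (Ideal N) := (I.minimalPrimes ∪ I'.minimalPrimes) \ {m}
  have hS : S.Finite := ((I.finite_minimalPrimes_of_isNoetherianRing).union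
    (I'.finite_minimalPrimes_of_isNoetherianRing)).subset Set.sdiff_subset
  have hp : ∀ P ∈ S, P.IsPrime := by
    rintro P ⟨hP | hP, -⟩ <;> exact hP.1.1
  have : ¬ ((m : Set N) ⊆ ⋃ P ∈ hS.toFinset, (P : Set N)) := by
    have := Ideal.subset_union_prime (s := hS.toFinset) (f := id) (I := m) ⊥ ⊥
      (fun P hP _ _ => hp P (hS.mem_toFinset.1 hP))
    simp only [id, Finset.mem_coe] at this
    rw [this]
    rintro ⟨P, hP, hmP⟩
    have hP := hS.mem_toFinset.1 hP
    have := hp P hP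
    exact hP.2 (le_antisymm (le_maximalIdeal this.ne_top) hmP)
  obtain ⟨w, hwm, hw⟩ := Set.not_subset.1 this
  have hw : ∀ P ∈ S, w ∉ P := fun P hP hwP =>
    hw (Set.mem_biUnion (hS.mem_toFinset.2 hP) hwP)
  have key : ∀ (I : Ideal N) (x : N), x ∈ m → m ≤ (I ⊔ Ideal.span {x}).radical →
      I.minimalPrimes \ {m} ⊆ S →
      m ≤ (I ⊔ Ideal.span {w}).radical := by
    intro I x hxm h hI
    rw [Ideal.radical_eq_sInf]
    refine le_sInf ?_
    rintro Q ⟨hQ, hQp⟩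
    by_contra hmQ
    have hQm : Q < m := lt_of_le_of_ne (le_maximalIdeal hQp.ne_top) (fun e => hmQ e.ge)
    have hQI : I ≤ Q := le_sup_left.trans hQ
    have hm : m ∈ (Ideal.span (insert x (I : Set N))).minimalPrimes := by
      refine ⟨⟨inferInstance, ?_⟩, ?_⟩
      · rw [Ideal.span_le]
        rintro y (rfl | hy)
        · exact hxm
        · exact hQm.le (hQI hy)
      · rintro P ⟨hP, hle⟩ -
        refine h.trans (hP.radical_le_iff.2 (le_trans ?_ hle))
        rw [Ideal.span_insert, Ideal.span_eq, sup_comm]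
    have := Ideal.mem_minimalPrimes_span_of_mem_minimalPrimes_span_insert hQm x I hm I hQI
      (fun y hy => Ideal.le_radical (Ideal.subset_span (Or.inr hy)))
    rw [Ideal.span_eq] at this
    exact hw Q (hI ⟨this, fun e => hQm.ne e⟩)
      (hQ (Ideal.mem_sup_right (Ideal.mem_span_singleton_self w)))
  exact ⟨w, hwm, key I x hx h fun P hP => ⟨Or.inl hP.1, hP.2⟩,
    key I' x' hx' h' fun P hP => ⟨Or.inr hP.1, hP.2⟩⟩

theorem RegMod.sop_exchange {E : Type*} [CommRing E] (φ : N →+* E)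
    [IsAdicComplete ((maximalIdeal N).map φ) E] (d : ℕ) {K : Ideal N} {xs ys : List N}
    (hxl : xs.length = d) (hyl : ys.length = d)
    (hx : ∀ x ∈ xs, x ∈ maximalIdeal N) (hy : ∀ x ∈ ys, x ∈ maximalIdeal N)
    (hxr : maximalIdeal N ≤ (K ⊔ Ideal.ofList xs).radical)
    (hyr : maximalIdeal N ≤ (K ⊔ Ideal.ofList ys).radical)
    (hK : ClosedIn ((maximalIdeal N).map φ) (K.map φ))
    (h : RegMod (K.map φ) (xs.map φ)) : RegMod (K.map φ) (ys.map φ) := by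
  have hJ : ((maximalIdeal N).map φ).FG := Ideal.FG.map (IsNoetherian.noetherian (maximalIdeal N)) φ
  have hrad : ∀ (K : Ideal N) (zs : List N), maximalIdeal N ≤ (K ⊔ Ideal.ofList zs).radical →
      (maximalIdeal N).map φ ≤ (K.map φ ⊔ Ideal.ofList (zs.map φ)).radical := by
    intro K zs hz
    rw [← Ideal.map_ofList, ← Ideal.map_sup]
    exact (Ideal.map_mono hz).trans (Ideal.map_radical_le φ)
  have hmem : ∀ zs : List N, (∀ z ∈ zs, z ∈ maximalIdeal N) →
      ∀ z ∈ zs.map φ, z ∈ (maximalIdeal N).map φ := by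
    intro zs h z hz
    obtain ⟨y, hy, rfl⟩ := List.mem_map.1 hz
    exact Ideal.mem_map_of_mem φ (h y hy)
  induction d generalizing K xs ys with
  | zero => rw [List.length_eq_zero_iff.1 hyl]; trivial
  | succ d ih =>
    obtain ⟨xs, x, rfl⟩ : ∃ xs' x, xs = xs' ++ [x] :=
      (List.eq_nil_or_concat' xs).resolve_left (by rintro rfl; simp at hxl)
    obtain ⟨ys, y, rfl⟩ : ∃ xs' x, ys = xs' ++ [x] :=
      (List.eq_nil_or_concat' ys).resolve_left (by rintro rfl; simp at hyl)
    have e : ∀ (zs : List N) z, K ⊔ Ideal.ofList (zs ++ [z]) = K ⊔ Ideal.ofList zs ⊔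
        Ideal.span {z} :=
      fun zs z => by rw [Ideal.ofList_append, Ideal.ofList_singleton, sup_assoc]
    have e' : ∀ (zs : List N) z, K ⊔ Ideal.ofList (z :: zs) = K ⊔ Ideal.ofList zs ⊔
        Ideal.span {z} :=
      fun zs z => by rw [sup_ofList_cons, sup_right_comm]
    have hxr' := hxr
    have hyr' := hyr
    rw [e] at hxr' hyr'
    obtain ⟨w, hw, hwx, hwy⟩ := exists_common_parameter (hx x (by simp)) (hy y (by simp))
      hxr' hyr'
    have hmemc : ∀ zs : List N, (∀ z ∈ zs, z ∈ maximalIdeal N) →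
        ∀ z ∈ w :: zs, z ∈ maximalIdeal N := fun zs hz => List.forall_mem_cons.2 ⟨hw, hz⟩
    have hx0 : ∀ z ∈ xs, z ∈ maximalIdeal N := fun z hz => hx z (by simp [hz])
    have hy0 : ∀ z ∈ ys, z ∈ maximalIdeal N := fun z hz => hy z (by simp [hz])
    have hex : ∀ (zs : List N) (u v : N), u ∈ maximalIdeal N →
        maximalIdeal N ≤ (K ⊔ Ideal.ofList zs ⊔ Ideal.span {v}).radical →
        RegMod (K.map φ) ((zs ++ [u]).map φ) → RegMod (K.map φ) ((zs ++ [v]).map φ) := by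
      intro zs u v hu hv h
      rw [List.map_append] at h ⊢
      refine RegMod.exchange_last h ?_
      rw [← Ideal.map_ofList, ← Ideal.map_sup, ← Set.image_singleton, ← Ideal.map_span,
        ← Ideal.map_sup]
      exact Ideal.map_radical_le φ (Ideal.mem_map_of_mem φ (hv hu))
    have h1 := hex xs x w (hx x (by simp)) hwx h
    have h2 : RegMod (K.map φ) ((w :: xs).map φ) := by
      refine RegMod.perm (List.Perm.map φ (List.perm_append_singleton w xs)) h1 hK hJ
        (hmem (xs ++ [w])
          (fun z hz => hmemc xs hx0 z ((List.perm_append_singleton w xs).mem_iff.1 hz)))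
        (hrad K (xs ++ [w]) (by rw [e]; exact hwx))
    have hK' : ClosedIn ((maximalIdeal N).map φ) ((K ⊔ Ideal.span {w}).map φ) := by
      rw [Ideal.map_sup, Ideal.map_span, Set.image_singleton]
      exact RegMod.closedIn_head (xs := xs.map φ) h2 hK hJ (hmem (w :: xs) (hmemc xs hx0))
        (hrad K (w :: xs) (by rw [e']; exact hwx))
    have h3 : RegMod ((K ⊔ Ideal.span {w}).map φ) (xs.map φ) := by
      rw [Ideal.map_sup, Ideal.map_span, Set.image_singleton]
      exact h2.2
    have h4 := ih (K := K ⊔ Ideal.span {w}) (xs := xs) (ys := ys) (by simpa using hxl)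
      (by simpa using hyl) hx0 hy0
      (by rw [sup_right_comm]; exact hwx) (by rw [sup_right_comm]; exact hwy) hK' h3
    have h5 : RegMod (K.map φ) ((w :: ys).map φ) := by
      rw [Ideal.map_sup, Ideal.map_span, Set.image_singleton] at h4
      exact ⟨h2.1, h4⟩
    have h6 : RegMod (K.map φ) ((ys ++ [w]).map φ) :=
      RegMod.perm (List.Perm.map φ (List.perm_append_singleton w ys).symm) h5 hK hJ
        (hmem (w :: ys) (hmemc ys hy0)) (hrad K (w :: ys) (by rw [e']; exact hwy))
    exact hex ys w y hw hyr' h6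

end SOP

section Completion

variable {C E : Type*} [CommRing C] [CommRing E]

/-- The ring homomorphism `i` exhibits `E` as the `J`-adic completion of `C`. -/
structure IsCompletion (J : Ideal C) (i : C →+* E) : Prop where
  complete : IsAdicComplete (J.map i) E
  comap_pow : ∀ n c, i c ∈ J.map i ^ n → c ∈ J ^ n
  dense : ∀ n b, ∃ c, b - i c ∈ J.map i ^ n

theorem isCompletion_adicCompletion {J : Ideal C} (hJ : J.FG) :
    IsCompletion J (algebraMap C (AdicCompletion J C)) := by
  have key : ∀ n (x : AdicCompletion J C),
      x ∈ J.map (algebraMap C (AdicCompletion J C)) ^ n ↔ AdicCompletion.evalₐ J n x = 0 := by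
    intro n x
    have h1 := AdicCompletion.pow_smul_top_eq_ker_eval (M := C) (n := n) hJ
    have h2 : x ∈ J.map (algebraMap C (AdicCompletion J C)) ^ n ↔
        x ∈ (J ^ n • ⊤ : Submodule C (AdicCompletion J C)) := by
      rw [← Ideal.map_pow, Ideal.smul_top_eq_map]
      rfl
    rw [h2, h1, LinearMap.mem_ker]
    rw [← AdicCompletion.factor_eval_eq_evalₐ (h := by simp)]
    have : Function.Injective (Ideal.Quotient.factor (S := J ^ n • ⊤) (T := J ^ n) (by simp)) := by
      rw [RingHom.injective_iff_ker_eq_bot, Ideal.Quotient.factor_ker]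
      exact Ideal.map_mk_eq_bot_of_le (by simp)
    exact (map_eq_zero_iff _ this).symm
  refine ⟨AdicCompletion.isAdicComplete_self J hJ, fun n c hc => ?_, fun n b => ?_⟩
  · rw [key] at hc
    rw [AlgHom.commutes] at hc
    exact Ideal.Quotient.eq_zero_iff_mem.1 hc
  · obtain ⟨c, hc⟩ := Ideal.Quotient.mk_surjective (AdicCompletion.evalₐ J n b)
    refine ⟨c, ?_⟩
    rw [key, map_sub, ← hc, AlgHom.commutes, sub_eq_zero]
    rfl

theorem exists_isCompletion.{u} {C : Type u} [CommRing C] {J : Ideal C} (hJ : J.FG) :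
    ∃ (E : Type u) (_ : CommRing E) (i : C →+* E), IsCompletion J i :=
  ⟨_, _, _, isCompletion_adicCompletion hJ⟩

namespace IsCompletion

variable {J : Ideal C} {i : C →+* E}

theorem exists_approx (I : Ideal C) (h : IsCompletion J i) (n : ℕ) {z : E} (hz : z ∈ I.map i) :
    ∃ a ∈ I, z - i a ∈ J.map i ^ n := by
  refine Submodule.span_induction ?_ ?_ ?_ ?_ hz
  · rintro _ ⟨a, ha, rfl⟩
    exact ⟨a, ha, by simp⟩
  · exact ⟨0, I.zero_mem, by simp⟩
  · rintro x y - - ⟨a, ha, hxa⟩ ⟨b, hb, hyb⟩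
    refine ⟨a + b, I.add_mem ha hb, ?_⟩
    rw [map_add, add_sub_add_comm]
    exact Ideal.add_mem _ hxa hyb
  · rintro b x - ⟨a, ha, hxa⟩
    obtain ⟨c, hc⟩ := h.dense n b
    refine ⟨c * a, I.mul_mem_left _ ha, ?_⟩
    have : b • x - i (c * a) = b * (x - i a) + i a * (b - i c) := by
      rw [smul_eq_mul, map_mul]; ring
    rw [this]
    exact Ideal.add_mem _ (Ideal.mul_mem_left _ _ hxa) (Ideal.mul_mem_left _ _ hc)

theorem comap_sup (h : IsCompletion J i) (I : Ideal C) (n : ℕ) {c : C}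
    (hc : i c ∈ I.map i ⊔ J.map i ^ n) : c ∈ I ⊔ J ^ n := by
  obtain ⟨x, hx, y, hy, e⟩ := Submodule.mem_sup.1 hc
  obtain ⟨a, ha, hxa⟩ := h.exists_approx I n hx
  have : i (c - a) ∈ J.map i ^ n := by
    have : i (c - a) = (x - i a) + y := by rw [map_sub, ← e]; ring
    rw [this]
    exact Ideal.add_mem _ hxa hy
  have h2 : c = a + (c - a) := by ring
  rw [h2]
  exact Ideal.add_mem _ (Ideal.mem_sup_left ha) (Ideal.mem_sup_right (h.comap_pow _ _ this))

theorem regMod_aux (h : IsCompletion J i) (hJ : J.FG) {I : Ideal C} {xs : List C}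
    (hx : ∀ x ∈ xs, x ∈ J) (hr : J ≤ (I ⊔ Ideal.ofList xs).radical)
    (hI : ClosedIn (J.map i) (I.map i)) (hreg : RegMod I xs) :
    RegMod (I.map i) (xs.map i) := by
  have := h.complete
  induction xs generalizing I with
  | nil => trivial
  | cons x xs ih =>
    have star : ∀ n, ∃ m, ∀ b, i x * b ∈ I.map i ⊔ J.map i ^ m → b ∈ I.map i ⊔ J.map i ^ n := by
      intro n
      obtain ⟨m, hm⟩ := hreg.pow_colon hJ hx hr n
      refine ⟨max m n, fun b hb => ?_⟩
      obtain ⟨c, hc⟩ := h.dense (max m n) b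
      have h1 : i (x * c) ∈ I.map i ⊔ J.map i ^ (max m n) := by
        have : i (x * c) = i x * b - i x * (b - i c) := by rw [map_mul]; ring
        rw [this]
        exact Ideal.sub_mem _ hb (Ideal.mem_sup_right (Ideal.mul_mem_left _ _ hc))
      have h2 := hm c (sup_le_sup_left (Ideal.pow_le_pow_right (le_max_left m n)) I
        (h.comap_sup I _ h1))
      have h3 : i c ∈ I.map i ⊔ J.map i ^ n := by
        rw [← Ideal.map_pow, ← Ideal.map_sup]
        exact Ideal.mem_map_of_mem i h2
      have : b = i c + (b - i c) := by ring
      rw [this]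
      exact Ideal.add_mem _ h3 (Ideal.mem_sup_right
        (Ideal.pow_le_pow_right (le_max_right m n) hc))
    refine ⟨fun b hb => hI b fun n => ?_, ?_⟩
    · obtain ⟨m, hm⟩ := star n
      exact hm b (Ideal.mem_sup_left hb)
    · have e : I.map i ⊔ Ideal.span {i x} = (I ⊔ Ideal.span {x}).map i := by
        rw [Ideal.map_sup, Ideal.map_span, Set.image_singleton]
      rw [e]
      refine ih (fun y hy => hx y (List.mem_cons_of_mem _ hy)) (by rwa [← sup_ofList_cons])
          ?_ hreg.2
      rw [← e]
      exact closedIn_sup_singleton hI star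

theorem regMod (h : IsCompletion J i) (hJ : J.FG) {xs : List C} (hx : ∀ x ∈ xs, x ∈ J)
    (hr : J ≤ (Ideal.ofList xs).radical) (hreg : RegMod ⊥ xs) : RegMod ⊥ (xs.map i) := by
  have := h.complete
  have h1 := h.regMod_aux hJ (I := ⊥) hx (by rwa [bot_sup_eq])
    (by rw [Ideal.map_bot]; exact closedIn_bot _) hreg
  rwa [Ideal.map_bot] at h1

theorem map_ne_top (h : IsCompletion J i) (hJ : J ≠ ⊤) : J.map i ≠ ⊤ := by
  intro e
  apply hJ
  rw [Ideal.eq_top_iff_one]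
  simpa using h.comap_pow 1 1 (by rw [pow_one, e]; trivial)

theorem exists_lift (h : IsCompletion J i) {D : Type*} [CommRing D] (φ : C →+* D) (L : Ideal D)
    [IsAdicComplete L D] (hL : J.map φ ≤ L) : ∃ ψ : E →+* D, ψ.comp i = φ := by
  have hφ : ∀ n, ∀ c ∈ J ^ n, φ c ∈ L ^ n := fun n c hc =>
    Ideal.pow_right_mono hL n (by rw [← Ideal.map_pow]; exact Ideal.mem_map_of_mem φ hc)
  choose a ha using h.dense
  have hsub : ∀ n c c', i c - i c' ∈ J.map i ^ n → φ c - φ c' ∈ L ^ n := fun n c c' hc => by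
    rw [← map_sub] at hc ⊢
    exact hφ n _ (h.comap_pow n _ hc)
  let F : ∀ n, E →+* D ⧸ L ^ n := fun n =>
    { toFun := fun b => Ideal.Quotient.mk _ (φ (a n b))
      map_one' := by
        rw [← map_one (Ideal.Quotient.mk (L ^ n)), Ideal.Quotient.eq, ← map_one φ]
        apply hsub
        rw [map_one, ← neg_sub]
        exact Ideal.neg_mem_iff _ |>.2 (ha n 1)
      map_mul' := fun x y => by
        rw [← map_mul, Ideal.Quotient.eq, ← map_mul]
        apply hsub
        have : i (a n (x * y)) - i (a n x * a n y) =
            x * (y - i (a n y)) + i (a n y) * (x - i (a n x)) - (x * y - i (a n (x * y))) := by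
          rw [map_mul]; ring
        rw [this]
        exact Ideal.sub_mem _ (Ideal.add_mem _ (Ideal.mul_mem_left _ _ (ha n y))
          (Ideal.mul_mem_left _ _ (ha n x))) (ha n _)
      map_zero' := by
        rw [← map_zero (Ideal.Quotient.mk (L ^ n)), Ideal.Quotient.eq, ← map_zero φ]
        apply hsub
        rw [map_zero, ← neg_sub]
        exact Ideal.neg_mem_iff _ |>.2 (ha n 0)
      map_add' := fun x y => by
        rw [← map_add, Ideal.Quotient.eq, ← map_add]
        apply hsub
        have : i (a n (x + y)) - i (a n x + a n y) =
            (y - i (a n y)) + (x - i (a n x)) - (x + y - i (a n (x + y))) := by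
          rw [map_add]; ring
        rw [this]
        exact Ideal.sub_mem _ (Ideal.add_mem _ (ha n y) (ha n x)) (ha n _) }
  have hF : ∀ {m n : ℕ} (hle : m ≤ n), (Ideal.Quotient.factorPow L hle).comp (F n) = F m := by
    intro m n hle
    ext b
    change Ideal.Quotient.mk (L ^ m) (φ (a n b)) = Ideal.Quotient.mk (L ^ m) (φ (a m b))
    rw [Ideal.Quotient.eq]
    apply hsub
    have : i (a n b) - i (a m b) = (b - i (a m b)) - (b - i (a n b)) := by ring
    rw [this]
    exact Ideal.sub_mem _ (ha m b) (Ideal.pow_le_pow_right hle (ha n b))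
  refine ⟨IsAdicComplete.liftRingHom L F hF, ?_⟩
  ext c
  rw [← sub_eq_zero]
  refine IsHausdorff.haus (I := L) inferInstance _ fun n => ?_
  rw [SModEq.sub_mem, smul_eq_mul, Ideal.mul_top, sub_zero, ← Ideal.Quotient.eq_zero_iff_mem,
    map_sub, RingHom.comp_apply, IsAdicComplete.mk_liftRingHom, sub_eq_zero]
  change Ideal.Quotient.mk (L ^ n) (φ (a n (i c))) = _
  rw [Ideal.Quotient.eq]
  apply hsub
  rw [← neg_sub]
  exact Ideal.neg_mem_iff _ |>.2 (ha n _)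

end IsCompletion

end Completion

section Prefix

variable {C : Type*} [CommRing C]

theorem regMod_iff_forall_append {I : Ideal C} {xs : List C} :
    RegMod I xs ↔ ∀ ys x zs, xs = ys ++ x :: zs →
      ∀ b, x * b ∈ I ⊔ Ideal.ofList ys → b ∈ I ⊔ Ideal.ofList ys := by
  induction xs generalizing I with
  | nil => simp
  | cons x xs ih =>
    rw [regMod_cons, ih]
    constructor
    · rintro ⟨h1, h2⟩ ys y zs e
      cases ys with
      | nil =>
        obtain ⟨rfl, rfl⟩ : x = y ∧ xs = zs := by simpa using e
        simpa [Ideal.ofList_nil] using h1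
      | cons w ys =>
        obtain ⟨rfl, rfl⟩ : x = w ∧ xs = ys ++ y :: zs := by simpa using e
        rw [sup_ofList_cons]
        exact h2 ys y zs rfl
    · intro h
      refine ⟨by simpa [Ideal.ofList_nil] using h [] x xs rfl, fun ys y zs e => ?_⟩
      rw [← sup_ofList_cons]
      exact h (x :: ys) y zs (by rw [e, List.cons_append])

end Prefix

section Perfect

variable {T P : Type*} [CommRing T] [CommRing P] (p : ℕ) [Fact p.Prime] [CharP T p] [CharP P p]

theorem exists_pow_mem_of_isPRadical (φ : T →+* P) [IsPRadical φ p] (K : Ideal T) {z : P}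
    (hz : z ∈ K.map φ) :
    ∃ n, ∃ s ∈ K.map (iterateFrobenius T p n), z ^ p ^ n = φ s := by
  have mono : ∀ {n : ℕ} (m : ℕ) {s : T}, s ∈ K.map (iterateFrobenius T p n) →
      s ^ p ^ m ∈ K.map (iterateFrobenius T p (n + m)) := by
    intro n m s hs
    have : iterateFrobenius T p (n + m) =
        (iterateFrobenius T p m).comp (iterateFrobenius T p n) := by
      ext x; simp [iterateFrobenius_def, pow_add, pow_mul]
    rw [this, ← Ideal.map_map]
    exact Ideal.mem_map_of_mem (iterateFrobenius T p m) hs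
  refine Submodule.span_induction ?_ ?_ ?_ ?_ hz
  · rintro _ ⟨a, ha, rfl⟩
    exact ⟨0, a, by simpa [iterateFrobenius_zero] using ha, by simp⟩
  · exact ⟨0, 0, Ideal.zero_mem _, by simp⟩
  · rintro x y - - ⟨n, s, hs, hx⟩ ⟨m, t, ht, hy⟩
    refine ⟨n + m, s ^ p ^ m + t ^ p ^ n, Ideal.add_mem _ (mono m hs) ?_, ?_⟩
    · rw [add_comm n m]; exact mono n ht
    · rw [add_pow_char_pow, map_add, map_pow, map_pow, ← hx, ← hy, ← pow_mul, ← pow_mul, ← pow_add,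
        ← pow_add, add_comm m n]
  · rintro b x - ⟨n, s, hs, hx⟩
    obtain ⟨m, c, hc⟩ := IsPRadical.pow_mem φ p b
    refine ⟨n + m, c ^ p ^ n * s ^ p ^ m, Ideal.mul_mem_left _ _ (mono m hs), ?_⟩
    rw [smul_eq_mul, mul_pow, map_mul, map_pow, map_pow, hc, ← hx, ← pow_mul, ← pow_mul, ← pow_add,
      ← pow_add, add_comm m n]

theorem pow_mem_of_isPRadical (φ : T →+* P) [IsPRadical φ p] (K : Ideal T) {s : T}
    (hs : φ s ∈ K.map φ) : ∃ n, s ^ p ^ n ∈ K.map (iterateFrobenius T p n) := by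
  obtain ⟨n, t, ht, e⟩ := exists_pow_mem_of_isPRadical p φ K hs
  have : s ^ p ^ n - t ∈ RingHom.ker φ := by rw [RingHom.mem_ker, map_sub, map_pow, e, sub_self]
  obtain ⟨m, hm⟩ := mem_pNilradical.1 (IsPRadical.ker_le φ p this)
  refine ⟨n + m, ?_⟩
  rw [sub_pow_char_pow, sub_eq_zero] at hm
  rw [pow_add, pow_mul, hm]
  have : iterateFrobenius T p (n + m) =
      (iterateFrobenius T p m).comp (iterateFrobenius T p n) := by
    ext x; simp [iterateFrobenius_def, pow_add, pow_mul]
  rw [this, ← Ideal.map_map]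
  exact Ideal.mem_map_of_mem (iterateFrobenius T p m) ht

theorem mem_of_pow_mem_map_iterateFrobenius [PerfectRing P p] (K : Ideal P) (n : ℕ) {b : P}
    (hb : b ^ p ^ n ∈ K.map (iterateFrobenius P p n)) : b ∈ K := by
  have : (K.map (iterateFrobenius P p n)).comap (iterateFrobenius P p n) = K :=
    Ideal.comap_map_of_bijective (f := (iterateFrobenius P p n))
      (iterateFrobeniusEquiv P p n).bijective
  rw [← this]
  exact hb

theorem RegMod.isPRadical [PerfectRing P p] (φ : T →+* P) [IsPRadical φ p] {xs : List T}
    (h : RegMod ⊥ xs) : RegMod ⊥ (xs.map φ) := by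
  have hp : 0 < p := (Fact.out : p.Prime).pos
  rw [regMod_iff_forall_append]
  intro ys' x' zs' e b hb
  obtain ⟨ys, w, rfl, rfl, hw⟩ := List.map_eq_append_iff.1 e
  obtain ⟨x, zs, rfl, rfl, rfl⟩ := List.map_eq_cons_iff.1 hw
  rw [bot_sup_eq, ← Ideal.map_ofList] at hb ⊢
  set K := Ideal.ofList ys with hK
  obtain ⟨m, c, hc⟩ := IsPRadical.pow_mem φ p b
  have h1 : φ (x ^ p ^ m * c) ∈ (K.map (iterateFrobenius T p m)).map φ := by
    rw [map_mul, hc, map_pow, ← mul_pow]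
    have e : (K.map (iterateFrobenius T p m)).map φ =
        (K.map φ).map (iterateFrobenius P p m) := by
      rw [Ideal.map_map, Ideal.map_map]
      congr 1
      ext x
      simp [iterateFrobenius_def]
    rw [e]
    exact Ideal.mem_map_of_mem (iterateFrobenius P p m) hb
  obtain ⟨n, hn⟩ := pow_mem_of_isPRadical p φ _ h1
  have e2 : iterateFrobenius T p (m + n) =
      (iterateFrobenius T p n).comp (iterateFrobenius T p m) := by
    ext x; simp [iterateFrobenius_def, pow_add, pow_mul]
  rw [Ideal.map_map, ← e2] at hn
  have h2 := regMod_iff_forall_append.1 (h.pow (n := p ^ (m + n)) (by positivity))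
      (ys.map (· ^ p ^ (m + n)))
    (x ^ p ^ (m + n)) (zs.map (· ^ p ^ (m + n))) (by simp) (c ^ p ^ n)
  have e3 : Ideal.ofList (ys.map (· ^ p ^ (m + n))) = K.map (iterateFrobenius T p (m + n)) := by
    rw [hK, Ideal.map_ofList]
    rfl
  rw [bot_sup_eq, e3] at h2
  have h3 := h2 (by rw [mul_pow, ← pow_mul, ← pow_add] at hn; exact hn)
  apply mem_of_pow_mem_map_iterateFrobenius p _ (m + n)
  have h4 := Ideal.mem_map_of_mem φ h3
  rw [map_pow, hc, ← pow_mul, ← pow_add, Ideal.map_map] at h4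
  rw [Ideal.map_map]
  convert h4 using 2
  ext x
  simp [iterateFrobenius_def]

theorem ofList_ne_top_of_isPRadical [PerfectRing P p] (φ : T →+* P) [IsPRadical φ p] {xs : List T}
    (h : Ideal.ofList xs ≠ ⊤) : Ideal.ofList (xs.map φ) ≠ ⊤ := by
  intro e
  apply h
  rw [Ideal.eq_top_iff_one] at e ⊢
  rw [← Ideal.map_ofList, ← map_one φ] at e
  obtain ⟨n, hn⟩ := pow_mem_of_isPRadical p φ _ e
  rw [one_pow, ← Ideal.eq_top_iff_one] at hn
  by_contra h
  rw [← Ideal.eq_top_iff_one] at h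
  obtain ⟨M, hM, hle⟩ := Ideal.exists_le_maximal _ h
  apply hM.ne_top
  rw [← top_le_iff, ← hn, Ideal.map_le_iff_le_comap]
  exact fun a ha => Ideal.pow_mem_of_mem _ (hle ha) _ (pow_pos (Fact.out : p.Prime).pos _)

end Perfect

section Adjunction

open MvPolynomial in
/-- `E[X₀, X₁, …] ≃ E[Y][X₀, X₁, …]`, with `X₀ ↦ Y` and `Xₙ₊₁ ↦ Xₙ`. -/
noncomputable def peel (E : Type*) [CommRing E] :
    MvPolynomial ℕ E ≃ₐ[E] MvPolynomial ℕ (Polynomial E) :=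
  (renameEquiv E (⟨fun n => n.casesOn none some, fun o => o.elim 0 Nat.succ,
    fun n => by cases n <;> rfl, fun o => by cases o <;> rfl⟩ : ℕ ≃ Option ℕ)).trans
  (optionEquivRight E ℕ)

section peel
open MvPolynomial
variable {E : Type*} [CommRing E]

@[simp] theorem peel_X_zero : peel E (X 0) = C Polynomial.X := by
  simp [peel]

@[simp] theorem peel_X_succ (n : ℕ) : peel E (X (n + 1)) = X n := by
  simp [peel]

@[simp] theorem peel_C (a : E) : peel E (C a) = C (Polynomial.C a) := by
  simp [peel]

theorem mvPolynomial_C_reg {σ : Type*} {a : E} (ha : ∀ b, a * b = 0 → b = 0)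
    (b : MvPolynomial σ E) (hb : C a * b = 0) : b = 0 := by
  ext m
  have := congrArg (coeff m) hb
  rw [coeff_C_mul, coeff_zero] at this
  rw [ha _ this, coeff_zero]

theorem nontrivial_adjoinRoot [Nontrivial E] {q : Polynomial E} (hq : q.Monic)
    (hd : 0 < q.degree) : Nontrivial (AdjoinRoot q) := by
  refine Ideal.Quotient.nontrivial_iff.2 fun e => ?_
  rw [Ideal.span_singleton_eq_top, hq.isUnit_iff] at e
  rw [e, Polynomial.degree_one] at hd
  exact lt_irrefl _ hd

theorem regMod_X_pow_sub_C {p : ℕ} (hp : p ≠ 0) (N : ℕ) : ∀ {E : Type*} [CommRing E] (f : ℕ → E),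
    RegMod (⊥ : Ideal (MvPolynomial ℕ E)) ((List.range N).map fun i => X i ^ p - C (f i)) ∧
    (Nontrivial E →
      Ideal.ofList ((List.range N).map fun i => (X i ^ p - C (f i) : MvPolynomial ℕ E)) ≠ ⊤) := by
  induction N with
  | zero =>
    intro E _ f
    refine ⟨trivial, fun _ => ?_⟩
    simp [Ideal.ofList_nil]
  | succ N ih =>
    intro E _ f
    set q : Polynomial E := Polynomial.X ^ p - Polynomial.C (f 0) with hq
    have hqm : q.Monic := Polynomial.monic_X_pow_sub_C _ hp
    let Ψ : MvPolynomial ℕ E →+* MvPolynomial ℕ (AdjoinRoot q) :=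
      (MvPolynomial.map (AdjoinRoot.mk q)).comp (peel E).toRingEquiv.toRingHom
    have hΨ : Function.Surjective Ψ :=
      (MvPolynomial.map_surjective _ (AdjoinRoot.mk_surjective)).comp (peel E).surjective
    have hker : (⊥ : Ideal _).comap Ψ = Ideal.span {X 0 ^ p - C (f 0)} := by
      have h1 : (⊥ : Ideal (MvPolynomial ℕ (AdjoinRoot q))).comap
          (MvPolynomial.map (AdjoinRoot.mk q))
          = Ideal.span {C q} := by
        have := MvPolynomial.ker_map (σ := ℕ) (AdjoinRoot.mk q)
        rw [RingHom.ker_eq_comap_bot] at this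
        rw [this]
        have h2 : RingHom.ker (AdjoinRoot.mk q) = Ideal.span {q} := Ideal.mk_ker
        rw [h2, Ideal.map_span, Set.image_singleton]
      rw [← Ideal.comap_comap, h1]
      ext b
      rw [Ideal.mem_comap, Ideal.mem_span_singleton, Ideal.mem_span_singleton]
      have : C q = peel E (X 0 ^ p - C (f 0)) := by simp [hq]
      rw [this]
      exact map_dvd_iff (peel E)
    have hlist : (List.range (N + 1)).map (fun i => (X i ^ p - C (f i) : MvPolynomial ℕ E)) =
        (X 0 ^ p - C (f 0)) :: (List.range N).map fun i => X (i + 1) ^ p - C (f (i + 1)) := by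
      rw [List.range_succ_eq_map, List.map_cons, List.map_map]; rfl
    have hmap : ((List.range N).map fun i =>
        (X (i + 1) ^ p - C (f (i + 1)) : MvPolynomial ℕ E)).map Ψ =
        (List.range N).map fun i => X i ^ p - C (AdjoinRoot.of q (f (i + 1))) := by
      rw [List.map_map]
      congr 1
      ext1 i
      simp only [Function.comp_apply, map_sub, map_pow]
      congr 1
      · congr 1
        exact (congrArg _ (peel_X_succ i)).trans (MvPolynomial.map_X _ _)
      · exact (congrArg _ (peel_C _)).trans (MvPolynomial.map_C _ _)
    rw [hlist]
    constructor
    · rw [regMod_cons]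
      constructor
      · intro b hb
        rw [Ideal.mem_bot] at hb ⊢
        have := congrArg (peel E) hb
        rw [map_mul, map_zero] at this
        have h3 : C q = peel E (X 0 ^ p - C (f 0)) := by simp [hq]
        rw [← h3] at this
        exact (map_eq_zero_iff _ (peel E).injective).1
          (mvPolynomial_C_reg (fun b hb => hqm.isRegular.left (by simpa using hb)) _ this)
      · rw [bot_sup_eq, ← hker, regMod_comap_iff Ψ hΨ, hmap]
        exact (ih _).1
    · intro hE
      have : Nontrivial (AdjoinRoot q) := nontrivial_adjoinRoot hqm (by
        rw [hq, Polynomial.degree_X_pow_sub_C (Nat.pos_of_ne_zero hp)]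
        exact_mod_cast Nat.pos_of_ne_zero hp)
      have h := (ih fun i => AdjoinRoot.of q (f (i + 1))).2 this
      rw [← hmap, ← Ideal.map_ofList] at h
      intro e
      apply h
      rw [Ideal.ofList_cons, ← hker] at e
      have := congrArg (Ideal.map Ψ) e
      rw [Ideal.map_sup, Ideal.map_comap_of_surjective _ hΨ, bot_sup_eq, Ideal.map_top] at this
      exact this

end peel

end Adjunction

section Adjunction

open MvPolynomial

variable (p : ℕ) [hp : Fact p.Prime] {T : Type*} [CommRing T] (ϖ : T)
    (h : Polynomial (WittVector p T))

/-- The value of `h` at the Teichmüller lift of a new variable. -/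
noncomputable def adjValue : WittVector p (Polynomial T) :=
  h.eval₂ (WittVector.map Polynomial.C) (WittVector.teichmuller p Polynomial.X)

theorem adjValue_coeff_zero : (adjValue p h).coeff 0 = h.map WittVector.constantCoeff := by
  have := Polynomial.hom_eval₂ h (WittVector.map Polynomial.C)
    (WittVector.constantCoeff : WittVector p (Polynomial T) →+* Polynomial T)
    (WittVector.teichmuller p Polynomial.X)
  refine this.trans ?_
  have h1 : (WittVector.constantCoeff : WittVector p (Polynomial T) →+* Polynomial T).comp
      (WittVector.map Polynomial.C) = Polynomial.C.comp WittVector.constantCoeff := by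
    ext x
    simp [WittVector.constantCoeff_apply]
  rw [h1, ← Polynomial.eval₂_map, WittVector.constantCoeff_apply, WittVector.teichmuller_coeff_zero,
    Polynomial.eval₂_C_X]

/-- The generic Witt vector. -/
noncomputable def genericWitt (P : Type*) [CommRing P] : WittVector p (MvPolynomial ℕ P) :=
  WittVector.mk p X

/-- The coefficients of `(p - [ϖ]) w - h([X])`, `w` being the generic Witt vector. -/
noncomputable def adjRel (n : ℕ) : MvPolynomial ℕ (Polynomial T) :=
  (genericWitt p _ * p).coeff n -
    (WittVector.teichmuller p (C (Polynomial.C ϖ)) * genericWitt p _ +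
      WittVector.map C (adjValue p h)).coeff n

variable (T) in
/-- The constants of `T[X][w₀, w₁, …]`. -/
noncomputable abbrev adjConst : T →+* MvPolynomial ℕ (Polynomial T) := C.comp Polynomial.C

theorem map_adjRel_aux {E : Type*} [CommRing E] (φ : T →+* E) (hφ : φ ϖ = 0) (n : ℕ) :
    MvPolynomial.map (Polynomial.mapRingHom φ) ((WittVector.teichmuller p (C (Polynomial.C ϖ)) *
      genericWitt p _ + WittVector.map C (adjValue p h)).coeff n) =
      C (((adjValue p h).coeff n).map φ) := by
  rw [← WittVector.map_coeff, map_add, map_mul, WittVector.map_teichmuller, MvPolynomial.map_C,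
    Polynomial.coe_mapRingHom, Polynomial.map_C, hφ, map_zero, map_zero,
        WittVector.teichmuller_zero,
    zero_mul, zero_add, WittVector.map_coeff, WittVector.map_coeff, MvPolynomial.map_C]
  rfl

variable [CharP T p]

theorem map_adjRel_zero {E : Type*} [CommRing E] (φ : T →+* E) (hφ : φ ϖ = 0) :
    MvPolynomial.map (Polynomial.mapRingHom φ) (adjRel p ϖ h 0) =
      - C ((h.map WittVector.constantCoeff).map φ) := by
  rw [adjRel, map_sub, map_adjRel_aux p ϖ h φ hφ, WittVector.mul_charP_coeff_zero, map_zero,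
    zero_sub, adjValue_coeff_zero]

theorem map_adjRel_succ {E : Type*} [CommRing E] (φ : T →+* E) (hφ : φ ϖ = 0) (n : ℕ) :
    MvPolynomial.map (Polynomial.mapRingHom φ) (adjRel p ϖ h (n + 1)) =
      X n ^ p - C (((adjValue p h).coeff (n + 1)).map φ) := by
  rw [adjRel, map_sub, map_adjRel_aux p ϖ h φ hφ, WittVector.mul_charP_coeff_succ, map_pow]
  simp [genericWitt]

theorem regMod_adjRel_aux (hh : h.Monic) (hd : 0 < h.degree) {E : Type*} [CommRing E] (φ : T →+* E)
    (hφs : Function.Surjective φ) (hφ : φ ϖ = 0) (N : ℕ) :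
    RegMod ((RingHom.ker φ).map (adjConst T)) ((List.range (N + 1)).map (adjRel p ϖ h)) ∧
    (Nontrivial E → (RingHom.ker φ).map (adjConst T) ⊔
      Ideal.ofList ((List.range (N + 1)).map (adjRel p ϖ h)) ≠ ⊤) := by
  let Φ : MvPolynomial ℕ (Polynomial T) →+* MvPolynomial ℕ (Polynomial (E)) :=
    MvPolynomial.map (Polynomial.mapRingHom φ)
  have hΦs : Function.Surjective Φ :=
    MvPolynomial.map_surjective _ (Polynomial.map_surjective _ hφs)
  have hker : (⊥ : Ideal _).comap Φ = (RingHom.ker φ).map (adjConst T) := by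
    rw [← RingHom.ker_eq_comap_bot, MvPolynomial.ker_map, Polynomial.ker_mapRingHom,
      Ideal.map_map]
  set q : Polynomial (E) := (h.map WittVector.constantCoeff).map φ with hq
  have hqm : q.Monic := (hh.map _).map _
  let Ψ : MvPolynomial ℕ (Polynomial (E)) →+* MvPolynomial ℕ (AdjoinRoot q) :=
    MvPolynomial.map (AdjoinRoot.mk q)
  have hΨ : Function.Surjective Ψ := MvPolynomial.map_surjective _ AdjoinRoot.mk_surjective
  have hkerΨ : (⊥ : Ideal _).comap Ψ = Ideal.span {- C q} := by
    rw [Ideal.span_singleton_neg]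
    have := MvPolynomial.ker_map (σ := ℕ) (AdjoinRoot.mk q)
    rw [RingHom.ker_eq_comap_bot] at this
    rw [this]
    have h2 : RingHom.ker (AdjoinRoot.mk q) = Ideal.span {q} := Ideal.mk_ker
    rw [h2, Ideal.map_span, Set.image_singleton]
  have hl : ((List.range (N + 1)).map (adjRel p ϖ h)).map Φ =
      (- C q) :: (List.range N).map fun n => X n ^ p - C (((adjValue p h).coeff (n + 1)).map φ) := by
    rw [List.range_succ_eq_map, List.map_cons, List.map_cons, List.map_map, List.map_map]
    congr 1
    · exact map_adjRel_zero p ϖ h φ hφ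
    congr 1
    ext1 n
    exact map_adjRel_succ p ϖ h φ hφ n
  have hl2 : ((List.range N).map fun n =>
      (X n ^ p - C (((adjValue p h).coeff (n + 1)).map φ) : MvPolynomial ℕ _)).map Ψ =
      (List.range N).map fun n =>
        X n ^ p - C (AdjoinRoot.mk q (((adjValue p h).coeff (n + 1)).map φ)) := by
    rw [List.map_map]
    congr 1
    ext1 n
    simp only [Function.comp_apply, map_sub, map_pow]
    congr 1
    · congr 1
      exact MvPolynomial.map_X _ _
    · exact MvPolynomial.map_C _ _
  have key := regMod_X_pow_sub_C hp.out.ne_zero N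
    fun n => AdjoinRoot.mk q (((adjValue p h).coeff (n + 1)).map φ)
  rw [← hl2] at key
  constructor
  · rw [← hker]
    refine (regMod_comap_iff Φ hΦs ⊥ _).2 ?_
    rw [hl, regMod_cons]
    constructor
    · intro b hb
      rw [Ideal.mem_bot] at hb ⊢
      refine mvPolynomial_C_reg (a := q) (fun b hb => hqm.isRegular.left (by simpa using hb)) b ?_
      exact neg_eq_zero.1 ((neg_mul _ _).symm.trans hb)
    · rw [bot_sup_eq, ← hkerΨ]
      exact (regMod_comap_iff Ψ hΨ ⊥ _).2 key.1
  · intro hE e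
    have := φ.domain_nontrivial
    have hq0 : 0 < q.degree := by
      rwa [hq, (hh.map _).degree_map, hh.degree_map]
    refine key.2 (nontrivial_adjoinRoot hqm hq0) ?_
    have e1 := congrArg (Ideal.map Φ) e
    rw [Ideal.map_sup, ← hker, Ideal.map_comap_of_surjective _ hΦs, bot_sup_eq, Ideal.map_top,
      Ideal.map_ofList, hl, Ideal.ofList_cons, ← hkerΨ] at e1
    have e2 := congrArg (Ideal.map Ψ) e1
    rwa [Ideal.map_sup, Ideal.map_comap_of_surjective _ hΨ, bot_sup_eq, Ideal.map_top,
      Ideal.map_ofList] at e2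

/-- The relations form a regular sequence modulo any ideal containing `ϖ`. -/
theorem regMod_adjRel (hh : h.Monic) (hd : 0 < h.degree) (K : Ideal T) (hK : ϖ ∈ K) (N : ℕ) :
    RegMod (K.map (adjConst T)) ((List.range (N + 1)).map (adjRel p ϖ h)) ∧
    (K ≠ ⊤ → K.map (adjConst T) ⊔ Ideal.ofList ((List.range (N + 1)).map (adjRel p ϖ h)) ≠ ⊤) := by
  have := regMod_adjRel_aux p ϖ h hh hd (Ideal.Quotient.mk K) Ideal.Quotient.mk_surjective
    (Ideal.Quotient.eq_zero_iff_mem.2 hK) N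
  rwa [Ideal.mk_ker, Ideal.Quotient.nontrivial_iff] at this

theorem mem_ofList_range_of_mem_span {P : Type*} [CommRing P] {f : ℕ → P} {J : Ideal P} {b : P}
    (hb : b ∈ Ideal.span (Set.range f) ⊔ J) :
    ∃ N, b ∈ J ⊔ Ideal.ofList ((List.range (N + 1)).map f) := by
  obtain ⟨a, ha, c, hc, rfl⟩ := Submodule.mem_sup.1 hb
  suffices ∃ N, a ∈ Ideal.ofList ((List.range (N + 1)).map f) by
    obtain ⟨N, hN⟩ := this
    exact ⟨N, add_comm a c ▸ Submodule.add_mem_sup hc hN⟩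
  have mono : ∀ {m n : ℕ}, m ≤ n → Ideal.ofList ((List.range (m + 1)).map f) ≤
      Ideal.ofList ((List.range (n + 1)).map f) := by
    intro m n hmn
    apply Ideal.span_mono
    simp only [List.mem_map, List.mem_range, Set.ofPred_subset_ofPred]
    rintro _ ⟨i, hi, rfl⟩
    exact ⟨i, by omega, rfl⟩
  refine Submodule.span_induction ?_ ⟨0, Ideal.zero_mem _⟩ ?_ ?_ ha
  · rintro _ ⟨n, rfl⟩
    exact ⟨n, Ideal.subset_span (by
      simp only [List.mem_map, List.mem_range, Set.mem_ofPred]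
      exact ⟨n, by omega, rfl⟩)⟩
  · rintro x y - - ⟨m, hm⟩ ⟨n, hn⟩
    exact ⟨max m n, Ideal.add_mem _ (mono (le_max_left _ _) hm) (mono (le_max_right _ _) hn)⟩
  · rintro x y - ⟨m, hm⟩
    exact ⟨m, Ideal.mul_mem_left _ _ hm⟩

theorem adjConst_reg {T : Type*} [CommRing T] {K : Ideal T} {x : T} (hx : ∀ b, x * b ∈ K → b ∈ K)
    (b : MvPolynomial ℕ (Polynomial T)) (hb : adjConst T x * b ∈ K.map (adjConst T)) :
    b ∈ K.map (adjConst T) := by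
  rw [← Ideal.map_map, MvPolynomial.mem_map_C_iff] at hb ⊢
  intro m
  have h1 := hb m
  rw [Ideal.mem_map_C_iff] at h1 ⊢
  intro n
  apply hx
  have h2 := h1 n
  rwa [adjConst, RingHom.comp_apply, coeff_C_mul, Polynomial.coeff_C_mul] at h2

/-- Roots of monic polynomials can be adjoined in a way that keeps `ϖ :: xs` regular. -/
theorem regMod_adjRing {A : Type*} [CommRing A] (χ : MvPolynomial ℕ (Polynomial T) →+* A)
    (hs : Function.Surjective χ) (hk : RingHom.ker χ = Ideal.span (Set.range (adjRel p ϖ h)))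
    (hh : h.Monic) (hd : 0 < h.degree) {xs : List T} (hx : RegMod ⊥ (ϖ :: xs)) :
    RegMod ⊥ ((ϖ :: xs).map (χ.comp (adjConst T))) := by
  rw [RingHom.coe_comp, ← List.map_map]
  refine (regMod_comap_iff χ hs ⊥ _).1 ?_
  rw [← RingHom.ker_eq_comap_bot, hk, regMod_iff_forall_append]
  intro ys' x' zs' e b hb
  obtain ⟨ys, w, e1, rfl, hw⟩ := List.map_eq_append_iff.1 e
  obtain ⟨x, zs, rfl, rfl, rfl⟩ := List.map_eq_cons_iff.1 hw
  have hreg := regMod_iff_forall_append.1 hx ys x zs e1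
  rw [bot_sup_eq] at hreg
  have hϖ : ϖ ∈ Ideal.ofList ys ⊔ Ideal.span {x} := by
    rcases ys with _ | ⟨y, ys⟩
    · rw [List.nil_append, List.cons.injEq] at e1
      rw [e1.1]
      exact Ideal.mem_sup_right (Ideal.mem_span_singleton_self x)
    · rw [List.cons_append, List.cons.injEq] at e1
      rw [e1.1]
      exact Ideal.mem_sup_left (Ideal.subset_span (by simp))
  rw [← Ideal.map_ofList] at hb ⊢
  obtain ⟨N, hN⟩ := mem_ofList_range_of_mem_span hb
  have h1 : RegMod ((Ideal.ofList ys).map (adjConst T))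
      (adjConst T x :: (List.range (N + 1)).map (adjRel p ϖ h)) := by
    refine ⟨adjConst_reg hreg, ?_⟩
    have := (regMod_adjRel p ϖ h hh hd _ hϖ N).1
    rwa [Ideal.map_sup, Ideal.map_span (adjConst T) {x}, Set.image_singleton] at this
  have h2 := h1.head_reg b hN
  have h3 : Ideal.ofList ((List.range (N + 1)).map (adjRel p ϖ h)) ≤
      Ideal.span (Set.range (adjRel p ϖ h)) := by
    rw [Ideal.ofList, Ideal.span_le]
    intro y hy
    obtain ⟨n, -, rfl⟩ := List.mem_map.1 hy
    exact Ideal.subset_span ⟨n, rfl⟩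
  rw [sup_comm]
  exact sup_le_sup le_rfl h3 h2

theorem ofList_adjRing_ne_top {A : Type*} [CommRing A] (χ : MvPolynomial ℕ (Polynomial T) →+* A)
    (hs : Function.Surjective χ) (hk : RingHom.ker χ = Ideal.span (Set.range (adjRel p ϖ h)))
    (hh : h.Monic) (hd : 0 < h.degree) {xs : List T} (hx : Ideal.ofList (ϖ :: xs) ≠ ⊤) :
    Ideal.ofList ((ϖ :: xs).map (χ.comp (adjConst T))) ≠ ⊤ := by
  intro e
  rw [← Ideal.map_ofList, ← Ideal.map_map] at e
  have e1 := congrArg (Ideal.comap χ) e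
  rw [Ideal.comap_map_of_surjective _ hs, ← RingHom.ker_eq_comap_bot,
    hk, Ideal.comap_top, sup_comm, Ideal.eq_top_iff_one] at e1
  obtain ⟨N, hN⟩ := mem_ofList_range_of_mem_span e1
  exact (regMod_adjRel p ϖ h hh hd _ (Ideal.subset_span (by simp)) N).2 hx
    ((Ideal.eq_top_iff_one _).2 hN)

theorem charP_of_natCast_eq_zero {A : Type*} [CommRing A] [Nontrivial A] (h0 : (p : A) = 0) :
    CharP A p := by
  obtain ⟨q, hq⟩ := CharP.exists A
  rcases (Nat.dvd_prime hp.out).1 ((CharP.cast_eq_zero_iff A q p).1 h0) with h1 | h1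
  · exact absurd h1 (CharP.char_ne_one A q)
  · exact h1 ▸ hq

omit [CharP T p] in
theorem eval₂_mem_of_adjRel {P : Type*} [CommRing P]
    (χ : MvPolynomial ℕ (Polynomial T) →+* P) (hχ : ∀ n, χ (adjRel p ϖ h n) = 0) :
    h.eval₂ (WittVector.map (χ.comp (adjConst T))) (WittVector.teichmuller p (χ (C Polynomial.X))) ∈
        Ideal.span {(p : WittVector p P) - WittVector.teichmuller p (χ.comp (adjConst T) ϖ)} := by
  have e1 : h.eval₂ (WittVector.map (χ.comp (adjConst T)))
      (WittVector.teichmuller p (χ (C Polynomial.X))) =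
      WittVector.map χ (WittVector.map C (adjValue p h)) := by
    rw [adjValue, Polynomial.hom_eval₂, Polynomial.hom_eval₂, WittVector.map_teichmuller,
      WittVector.map_teichmuller]
    congr 1
  have e2 : WittVector.map χ
      (genericWitt p (Polynomial T) * (p : WittVector p (MvPolynomial ℕ (Polynomial T)))) = WittVector.map χ
      (WittVector.teichmuller p (C (Polynomial.C ϖ)) * genericWitt p _ +
        WittVector.map C (adjValue p h)) := by
    ext n
    rw [WittVector.map_coeff, WittVector.map_coeff, ← sub_eq_zero, ← map_sub]
    exact hχ n
  rw [map_mul, map_add, map_mul, WittVector.map_teichmuller, map_natCast,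
    ← sub_eq_iff_eq_add'] at e2
  rw [e1, ← e2, Ideal.mem_span_singleton]
  refine ⟨WittVector.map χ (genericWitt p _), ?_⟩
  rw [sub_mul, mul_comm]
  rfl

theorem exists_quotient.{u} {Q : Type u} [CommRing Q] (I : Ideal Q) :
    ∃ (A : Type u) (_ : CommRing A) (χ : Q →+* A), Function.Surjective χ ∧ RingHom.ker χ = I :=
  ⟨Q ⧸ I, inferInstance, Ideal.Quotient.mk I, Ideal.Quotient.mk_surjective, Ideal.mk_ker⟩

/-- Every monic polynomial over `W(T)` acquires a Teichmüller root modulo `p - [ϖ]` in some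
perfect extension of `T` in which `ϖ :: xs` is still regular. -/
theorem exists_root_extension.{u} {T : Type u} [CommRing T] [CharP T p] {ϖ : T}
    (h : Polynomial (WittVector p T)) (hh : h.Monic) (hd : 0 < h.degree)
    {xs : List T} (hx : RegMod ⊥ (ϖ :: xs)) (hxt : Ideal.ofList (ϖ :: xs) ≠ ⊤) :
    ∃ (P : Type u) (_ : CommRing P) (_ : CharP P p) (_ : PerfectRing P p) (φ : T →+* P) (a : P),
      RegMod ⊥ ((ϖ :: xs).map φ) ∧ Ideal.ofList ((ϖ :: xs).map φ) ≠ ⊤ ∧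
      h.eval₂ (WittVector.map φ) (WittVector.teichmuller p a) ∈
        Ideal.span {(p : WittVector p P) - WittVector.teichmuller p (φ ϖ)} := by
  obtain ⟨A, _, χ, hs, hk⟩ := exists_quotient (Ideal.span (Set.range (adjRel p ϖ h)))
  have hA1 := regMod_adjRing p ϖ h χ hs hk hh hd hx
  have hA2 := ofList_adjRing_ne_top p ϖ h χ hs hk hh hd hxt
  have hχ : ∀ n, χ (adjRel p ϖ h n) = 0 := fun n => by
    rw [← RingHom.mem_ker, hk]
    exact Ideal.subset_span ⟨n, rfl⟩
  have : Nontrivial A := by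
    by_contra hc
    rw [not_nontrivial_iff_subsingleton] at hc
    exact hA2 (Subsingleton.elim _ _)
  have : CharP A p := charP_of_natCast_eq_zero p (by
    rw [← map_natCast (χ.comp (adjConst T)), CharP.cast_eq_zero, map_zero])
  let i : A →+* PerfectClosure A p := PerfectClosure.of A p
  refine ⟨PerfectClosure A p, inferInstance, inferInstance, inferInstance,
    (i.comp χ).comp (adjConst T), i.comp χ (C Polynomial.X), ?_, ?_, eval₂_mem_of_adjRel p ϖ h _ ?_⟩
  · rw [RingHom.comp_assoc, RingHom.coe_comp, ← List.map_map]
    exact RegMod.isPRadical p i hA1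
  · rw [RingHom.comp_assoc, RingHom.coe_comp, ← List.map_map]
    exact ofList_ne_top_of_isPRadical p i hA2
  · intro n
    rw [RingHom.comp_apply, hχ, map_zero]

end Adjunction

section WittQuotient

open WittVector

variable (p : ℕ) [hp : Fact p.Prime] {T : Type*} [CommRing T] [CharP T p] [PerfectRing T p]

/-- The element `p - [ϖ]` of `W(T)`. -/
noncomputable def primElt {T : Type*} [CommRing T] (ϖ : T) : WittVector p T :=
  (p : WittVector p T) - teichmuller p ϖ

theorem constantCoeff_teichmuller {T : Type*} [CommRing T] (x : T) :
    (constantCoeff : WittVector p T →+* T) (teichmuller p x) = x := teichmuller_coeff_zero p x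

theorem constantCoeff_primElt {T : Type*} [CommRing T] [CharP T p] (ϖ : T) :
    (constantCoeff : WittVector p T →+* T) (primElt p ϖ) = -ϖ := by
  rw [primElt, map_sub, map_natCast, CharP.cast_eq_zero, zero_sub, constantCoeff_teichmuller]

theorem mem_span_primElt_of_p_mul {ϖ : T} (hϖ : ∀ b, ϖ * b = 0 → b = 0) {b : WittVector p T}
    (hb : (p : WittVector p T) * b ∈ Ideal.span {primElt p ϖ}) : b ∈ Ideal.span {primElt p ϖ} := by
  rw [Ideal.mem_span_singleton] at hb ⊢
  obtain ⟨c, hc⟩ := hb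
  have h0 : (constantCoeff : WittVector p T →+* T) c = 0 := by
    apply hϖ
    have := congrArg (constantCoeff : WittVector p T →+* T) hc
    rw [map_mul, map_mul, map_natCast, CharP.cast_eq_zero, zero_mul, constantCoeff_primElt,
      neg_mul, eq_comm, neg_eq_zero] at this
    exact this
  rw [← RingHom.mem_ker, ker_constantCoeff, Ideal.mem_span_singleton] at h0
  obtain ⟨d, rfl⟩ := h0
  refine ⟨d, ?_⟩
  rw [← sub_eq_zero]
  apply eq_zero_of_p_mul_eq_zero
  rw [sub_mul, mul_comm b, hc]
  ring

theorem span_primElt_sup_p (ϖ : T) :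
    Ideal.span {primElt p ϖ} ⊔ Ideal.span {(p : WittVector p T)} =
      (Ideal.span {ϖ}).comap (constantCoeff : WittVector p T →+* T) := by
  have h1 : (Ideal.span {primElt p ϖ}).map (constantCoeff : WittVector p T →+* T) =
      Ideal.span {ϖ} := by
    rw [Ideal.map_span, Set.image_singleton, constantCoeff_primElt, Ideal.span_singleton_neg]
  rw [← h1, Ideal.comap_map_of_surjective _ (constantCoeff_surjective p),
      ← RingHom.ker_eq_comap_bot,
    ker_constantCoeff]

theorem regMod_span_primElt {ϖ : T} {xs : List T} (h : RegMod ⊥ (ϖ :: xs)) :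
    RegMod (Ideal.span {primElt p ϖ}) ((p : WittVector p T) :: xs.map (teichmuller p)) := by
  rw [regMod_cons, bot_sup_eq] at h
  refine ⟨fun b hb => mem_span_primElt_of_p_mul p
      (fun b hb => by simpa using h.1 b (by simpa using hb)) hb, ?_⟩
  rw [span_primElt_sup_p]
  refine (regMod_comap_iff _ (constantCoeff_surjective p) _ _).2 ?_
  rw [List.map_map]
  convert h.2
  exact (List.map_congr_left fun x _ => constantCoeff_teichmuller p x).trans (List.map_id _)

omit [PerfectRing T p] in
theorem span_primElt_ne_top {ϖ : T} {xs : List T} (h : Ideal.ofList (ϖ :: xs) ≠ ⊤) :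
    Ideal.span {primElt p ϖ} ⊔ Ideal.ofList ((p : WittVector p T) :: xs.map (teichmuller p)) ≠ ⊤ := by
  intro e
  have e1 := congrArg (Ideal.map (constantCoeff : WittVector p T →+* T)) e
  rw [Ideal.map_top, Ideal.map_sup, Ideal.map_ofList, List.map_cons, List.map_map, map_natCast,
    CharP.cast_eq_zero, Ideal.map_span, Set.image_singleton, constantCoeff_primElt,
    Ideal.span_singleton_neg, Ideal.ofList_cons, Ideal.span_singleton_zero, bot_sup_eq] at e1
  rw [Ideal.ofList_cons] at h
  apply h
  convert e1
  exact ((List.map_congr_left fun x _ => constantCoeff_teichmuller p x).trans (List.map_id _)).symm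

end WittQuotient

section Riemann

variable (p : ℕ) [hp : Fact p.Prime]

theorem isReduced_of_perfectRing (T : Type*) [CommRing T] [CharP T p] [PerfectRing T p] :
    IsReduced T := ⟨fun x ⟨n, hn⟩ => by
  apply (bijective_iterateFrobenius T p n).1
  rw [map_zero, iterateFrobenius_def, ← Nat.sub_add_cancel (Nat.lt_pow_self hp.out.one_lt).le,
    pow_add, hn, mul_zero]⟩

theorem perfectRing_localization.{u} {T L : Type u} [CommRing T] [CharP T p] [PerfectRing T p]
    [CommRing L] [Algebra T L] [Nontrivial L] (M : Submonoid T) [IsLocalization M L] :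
    ∃ _ : CharP L p, PerfectRing L p := by
  have hL : CharP L p := charP_of_natCast_eq_zero p (by
    rw [← map_natCast (algebraMap T L), CharP.cast_eq_zero, map_zero])
  have : IsReduced T := isReduced_of_perfectRing p T
  have : IsReduced L := isReduced_localizationPreserves M L ‹_›
  refine ⟨hL, PerfectRing.ofSurjective L p fun z => ?_⟩
  obtain ⟨x, y, rfl⟩ := IsLocalization.exists_mk'_eq M z
  obtain ⟨w, hw⟩ := surjective_frobenius T p (x * y ^ (p - 1))
  refine ⟨IsLocalization.mk' L w y, ?_⟩
  rw [frobenius_def] at hw ⊢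
  rw [← IsLocalization.mk'_pow, hw, IsLocalization.mk'_eq_iff_eq]
  congr 1
  have : (y : T) ^ p = y ^ (p - 1) * y := by
    rw [← pow_succ, Nat.sub_add_cancel hp.out.one_le]
  rw [SubmonoidClass.coe_pow, this]
  ring

section Level

variable {T L : Type*} [CommRing T] [CommRing L] [Algebra T L]

/-- Elements of `L` which, up to powers of `ζ`, lie in `I * (I + (ζ)) ^ N`. -/
def smallElts (I : Ideal T) (ζ : T) : Set L :=
  {x | ∃ N, ∃ y ∈ I * (I ⊔ Ideal.span {ζ}) ^ N, algebraMap T L ζ ^ (N + 1) * x = algebraMap T L y}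

variable {I : Ideal T} {ζ : T}

theorem smallElts_raise {N : ℕ} {x : L}
    (h : ∃ y ∈ I * (I ⊔ Ideal.span {ζ}) ^ N, algebraMap T L ζ ^ (N + 1) * x = algebraMap T L y)
    (M : ℕ) : ∃ y ∈ I * (I ⊔ Ideal.span {ζ}) ^ (N + M),
      algebraMap T L ζ ^ (N + M + 1) * x = algebraMap T L y := by
  obtain ⟨y, hy, e⟩ := h
  refine ⟨y * ζ ^ M, ?_, ?_⟩
  · rw [pow_add, ← mul_assoc]
    exact Ideal.mul_mem_mul hy (Ideal.pow_mem_pow (Ideal.mem_sup_right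
      (Ideal.mem_span_singleton_self ζ)) M)
  · rw [map_mul, ← e, map_pow]
    ring

theorem smallElts_add {x y : L} (hx : x ∈ smallElts I ζ) (hy : y ∈ smallElts I ζ) :
    x + y ∈ smallElts I ζ := by
  obtain ⟨N, hx⟩ := hx
  obtain ⟨M, hy⟩ := hy
  obtain ⟨a, ha, e⟩ := smallElts_raise hx M
  obtain ⟨b, hb, e'⟩ := smallElts_raise hy N
  rw [add_comm M N] at hb e'
  exact ⟨N + M, a + b, Ideal.add_mem _ ha hb, by rw [mul_add, e, e', map_add]⟩

theorem smallElts_mul {x y : L} (hx : x ∈ smallElts I ζ) (hy : y ∈ smallElts I ζ) :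
    x * y ∈ smallElts I ζ := by
  obtain ⟨N, a, ha, e⟩ := hx
  obtain ⟨M, b, hb, e'⟩ := hy
  refine ⟨N + (M + 1), a * b, ?_, ?_⟩
  · rw [pow_add, ← mul_assoc]
    refine Ideal.mul_mem_mul ha ?_
    rw [pow_succ']
    exact Ideal.mul_mono_left le_sup_left hb
  · rw [map_mul, ← e, ← e']
    ring

theorem smallElts_smul {x : L} (c : T) (hx : x ∈ smallElts I ζ) :
    algebraMap T L c * x ∈ smallElts I ζ := by
  obtain ⟨N, a, ha, e⟩ := hx
  exact ⟨N, c * a, Ideal.mul_mem_left _ _ ha, by rw [map_mul, ← e]; ring⟩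

theorem exists_smallElts {t s : L} (ht : t ∈ smallElts I ζ) (hs : s ∈ smallElts I ζ) {x : L}
    (hx : x ∈ Algebra.adjoin T {t, s}) : ∃ c : T, x - algebraMap T L c ∈ smallElts I ζ := by
  have h0 : (0 : L) ∈ smallElts I ζ := ⟨0, 0, Ideal.zero_mem _, by simp⟩
  induction hx using Algebra.adjoin_induction with
  | mem x hx =>
    refine ⟨0, ?_⟩
    rcases hx with rfl | rfl
    · simpa using ht
    · simpa using hs
  | algebraMap c => exact ⟨c, by simpa using h0⟩
  | add x y _ _ hx hy =>
    obtain ⟨c, hc⟩ := hx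
    obtain ⟨d, hd⟩ := hy
    refine ⟨c + d, ?_⟩
    convert smallElts_add hc hd using 1
    rw [map_add]; ring
  | mul x y _ _ hx hy =>
    obtain ⟨c, hc⟩ := hx
    obtain ⟨d, hd⟩ := hy
    refine ⟨c * d, ?_⟩
    convert smallElts_add (smallElts_mul hc hd)
      (smallElts_add (smallElts_smul c hd) (smallElts_smul d hc)) using 1
    rw [map_mul]; ring

omit [CommRing L] [Algebra T L] in
theorem sup_pow_succ_le (I Z : Ideal T) (n : ℕ) : (I ⊔ Z) ^ (n + 1) ≤ I * (I ⊔ Z) ^ n ⊔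
    Z ^ (n + 1) := by
  induction n with
  | zero => simp
  | succ n ih =>
    rw [pow_succ', Ideal.sup_mul]
    refine sup_le le_sup_left ?_
    refine (Ideal.mul_mono_right ih).trans ?_
    rw [Ideal.mul_sup]
    refine sup_le (le_sup_of_le_left ?_) (le_sup_of_le_right (pow_succ' Z _).ge)
    rw [mul_left_comm, pow_succ' (I ⊔ Z)]
    exact Ideal.mul_mono_right (Ideal.mul_mono_left le_sup_right)

/-- If `1 - ϖ c` is small, then `ζ` is integral over `I` modulo all powers of `ϖ`. -/
theorem pow_mem_of_smallElts [IsLocalization.Away ζ L] {ϖ : T} (c : T)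
    (h : (1 - algebraMap T L (ϖ * c) : L) ∈ smallElts I ζ) :
    ∃ D, ∀ N K, ζ ^ (N + D) ∈ I ^ N ⊔ Ideal.span {ϖ ^ K} := by
  obtain ⟨N, y, hy, e⟩ := h
  rw [← map_pow, ← map_one (algebraMap T L), ← map_sub, ← map_mul,
    IsLocalization.eq_iff_exists (Submonoid.powers ζ)] at e
  obtain ⟨⟨_, m, rfl⟩, e⟩ := e
  set H := I ⊔ Ideal.span {ζ} with hH
  have hζ : ζ ∈ H := Ideal.mem_sup_right (Ideal.mem_span_singleton_self ζ)
  refine ⟨m + N, fun M K => ?_⟩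
  have h1 : ζ ^ (m + N + 1) ∈ I * H ^ (m + N) ⊔ Ideal.span {ϖ ^ K} := by
    obtain ⟨d, hd⟩ : 1 - ϖ * c ∣ 1 - (ϖ * c) ^ K := by
      simpa using sub_dvd_pow_sub_pow 1 (ϖ * c) K
    have h2 : ζ ^ (m + N + 1) = ζ ^ m * y * d + ϖ ^ K * (c ^ K * ζ ^ (m + N + 1)) := by
      have : ζ ^ m * y * d = ζ ^ m * ζ ^ (N + 1) * (1 - (ϖ * c) ^ K) := by
        rw [hd, ← e]; ring
      rw [this]; ring
    rw [h2]
    refine Ideal.add_mem _ (Ideal.mem_sup_left (Ideal.mul_mem_right _ _ ?_))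
      (Ideal.mem_sup_right (Ideal.mul_mem_right _ _ (Ideal.mem_span_singleton_self _)))
    rw [pow_add, mul_left_comm]
    exact Ideal.mul_mem_mul (Ideal.pow_mem_pow hζ m) hy
  have h3 : H ^ (m + N + 1) ≤ I * H ^ (m + N) ⊔ Ideal.span {ϖ ^ K} := by
    refine (sup_pow_succ_le I _ _).trans (sup_le le_sup_left ?_)
    rw [Ideal.span_singleton_pow, Ideal.span_singleton_le_iff_mem]
    exact h1
  have h4 : ∀ M, H ^ (M + (m + N)) ≤ I ^ M * H ^ (m + N) ⊔ Ideal.span {ϖ ^ K} := by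
    intro M
    induction M with
    | zero => simp
    | succ M ih =>
      rw [add_right_comm, pow_succ]
      refine (Ideal.mul_mono_left ih).trans ?_
      rw [Ideal.sup_mul]
      refine sup_le ?_ (le_sup_of_le_right Ideal.mul_le_left)
      rw [mul_assoc, ← pow_succ]
      refine (Ideal.mul_mono_right h3).trans ?_
      rw [Ideal.mul_sup, ← mul_assoc, ← pow_succ]
      exact sup_le le_sup_left (le_sup_of_le_right Ideal.mul_le_right)
  exact (h4 M).trans (sup_le_sup_right Ideal.mul_le_left _) (Ideal.pow_mem_pow hζ _)

end Level

/-- The perfect closure of a subring inside a ring of characteristic `p`. -/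
def perfHull {L : Type*} [CommRing L] [CharP L p] (A : Subring L) : Subring L where
  carrier := {x | ∃ j, x ^ p ^ j ∈ A}
  one_mem' := ⟨0, by simp⟩
  zero_mem' := ⟨0, by simp⟩
  neg_mem' := by
    rintro x ⟨j, hj⟩
    refine ⟨j, ?_⟩
    have := neg_mem hj
    rw [← zero_sub, sub_pow_char_pow, zero_pow (pow_ne_zero _ hp.out.ne_zero), zero_sub]
    exact this
  add_mem' := by
    rintro x y ⟨i, hi⟩ ⟨j, hj⟩
    refine ⟨i + j, ?_⟩
    rw [add_pow_char_pow, pow_add, pow_mul, mul_comm (p ^ i), pow_mul]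
    exact add_mem (pow_mem hi _) (pow_mem hj _)
  mul_mem' := by
    rintro x y ⟨i, hi⟩ ⟨j, hj⟩
    refine ⟨i + j, ?_⟩
    rw [mul_pow, pow_add, pow_mul, mul_comm (p ^ i), pow_mul]
    exact mul_mem (pow_mem hi _) (pow_mem hj _)

theorem perfectRing_perfHull {L : Type*} [CommRing L] [CharP L p] [PerfectRing L p]
    (A : Subring L) : ∃ _ : CharP (perfHull p A) p, PerfectRing (perfHull p A) p := by
  have h1 : CharP (perfHull p A) p := inferInstance
  refine ⟨h1, ⟨fun x y hxy => ?_, fun x => ?_⟩⟩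
  · apply Subtype.ext
    apply injective_pow_p L p
    simpa [frobenius_def] using congrArg Subtype.val hxy
  · obtain ⟨y, hy⟩ := surjective_frobenius L p x.1
    rw [frobenius_def] at hy
    obtain ⟨j, hj⟩ := x.2
    refine ⟨⟨y, j + 1, ?_⟩, Subtype.ext (by simpa [frobenius_def] using hy)⟩
    rw [pow_succ', pow_mul, hy]
    exact hj

section Witt

open WittVector

theorem mem_span_primElt_of_teichmuller_pow_mul {X : Type*} [CommRing X] [CharP X p]
    [PerfectRing X p] {ϖ : X} (hϖ : ∀ b, ϖ * b = 0 → b = 0) (n : ℕ) {b : WittVector p X}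
    (hb : teichmuller p ϖ ^ n * b ∈ Ideal.span {primElt p ϖ}) :
    b ∈ Ideal.span {primElt p ϖ} := by
  induction n with
  | zero => simpa using hb
  | succ n ih =>
    apply ih
    apply mem_span_primElt_of_p_mul p hϖ
    have : (p : WittVector p X) * (teichmuller p ϖ ^ n * b) =
        teichmuller p ϖ ^ (n + 1) * b + primElt p ϖ * (teichmuller p ϖ ^ n * b) := by
      rw [primElt]; ring
    rw [this]
    exact Ideal.add_mem _ hb (Ideal.mul_mem_right _ _ (Ideal.mem_span_singleton_self _))

/-- The Witt vector `[ζ]ⁿ + ∑ [αᵢ] [γ]ⁱ⁺¹ [ζ]ⁿ⁻¹⁻ⁱ`. -/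
noncomputable def homogRel {T : Type*} [CommRing T] (n : ℕ) (α : ℕ → T) (γ ζ : T) :
    WittVector p T :=
  teichmuller p ζ ^ n + ∑ i ∈ Finset.range n,
    teichmuller p (α i) * teichmuller p γ ^ (i + 1) * teichmuller p ζ ^ (n - 1 - i)

theorem exists_eq_of_homogRel {X : Type*} [CommRing X] [CharP X p]
    [PerfectRing X p] {ϖ : X} (hϖ : ∀ b, ϖ * b = 0 → b = 0) (n k : ℕ) (α : ℕ → X) {γ ζ t s : X}
    (ht : t * ζ = γ) (hs : s * ζ = ϖ ^ k) (h : homogRel p n α γ ζ ∈ Ideal.span {primElt p ϖ}) :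
    ∃ c, 1 + ∑ i ∈ Finset.range n, α i * t ^ (i + 1) = ϖ * c := by
  set G : WittVector p X := 1 + ∑ i ∈ Finset.range n, teichmuller p (α i * t ^ (i + 1)) with hG
  have h1 : teichmuller p s ^ n * homogRel p n α γ ζ = teichmuller p ϖ ^ (k * n) * G := by
    have e1 : (teichmuller p ϖ) ^ (k * n) = teichmuller p (s ^ n * ζ ^ n) := by
      rw [← map_pow, pow_mul, ← hs, mul_pow]
    rw [homogRel, hG, mul_add, mul_add, e1, mul_one, ← map_pow, ← map_pow, ← map_mul,
      Finset.mul_sum, Finset.mul_sum]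
    congr 1
    refine Finset.sum_congr rfl fun i hi => ?_
    rw [Finset.mem_range] at hi
    rw [← map_pow, ← map_pow, ← map_mul, ← map_mul, ← map_mul, ← map_mul, ← ht]
    congr 1
    have : ζ ^ n = ζ ^ (i + 1) * ζ ^ (n - 1 - i) := by
      rw [← pow_add]; congr 1; omega
    rw [this]; ring
  have h2 := mem_span_primElt_of_teichmuller_pow_mul p hϖ (k * n)
    (h1 ▸ Ideal.mul_mem_left _ (teichmuller p s ^ n) h)
  rw [Ideal.mem_span_singleton] at h2
  obtain ⟨w, hw⟩ := h2
  refine ⟨-constantCoeff w, ?_⟩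
  have h3 := congrArg (constantCoeff : WittVector p X →+* X) hw
  rw [map_mul, constantCoeff_primElt, hG, map_add, map_one, map_sum] at h3
  simp only [constantCoeff_teichmuller] at h3
  rw [h3]; ring

theorem map_homogRel {T X : Type*} [CommRing T] [CommRing X] (f : T →+* X) (n : ℕ) (α : ℕ → T)
    (γ ζ : T) : WittVector.map f (homogRel p n α γ ζ) =
      homogRel p n (fun i => f (α i)) (f γ) (f ζ) := by
  simp only [homogRel, map_add, map_pow, map_sum, map_mul, map_teichmuller]

theorem map_primElt {T X : Type*} [CommRing T] [CommRing X] (f : T →+* X) (ϖ : T) :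
    WittVector.map f (primElt p ϖ) = primElt p (f ϖ) := by
  simp only [primElt, map_sub, map_natCast, map_teichmuller]

theorem exists_pow_mem_of_homogRel {T : Type*} [CommRing T] [CharP T p] [PerfectRing T p] {ϖ : T}
    (hϖ : ∀ b, ϖ * b = 0 → b = 0) (n k : ℕ) (α : ℕ → T) {γ ζ : T}
    (h : homogRel p n α γ ζ ∈ Ideal.span {primElt p ϖ}) :
    ∃ D, ∀ N K, ζ ^ (N + D) ∈ (Ideal.span {γ} ⊔ Ideal.span {ϖ ^ k}) ^ N ⊔ Ideal.span {ϖ ^ K} := by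
  have : IsReduced T := isReduced_of_perfectRing p T
  by_cases hζ : ζ = 0
  · exact ⟨1, fun N K => by simp [hζ]⟩
  let L := Localization.Away ζ
  have : Nontrivial L := by
    by_contra hc
    rw [not_nontrivial_iff_subsingleton, IsLocalization.subsingleton_iff (M := Submonoid.powers ζ)]
        at hc
    obtain ⟨n, hn⟩ := hc
    exact hζ (IsNilpotent.eq_zero ⟨n, hn⟩)
  obtain ⟨_, _⟩ := perfectRing_localization p (L := L) (Submonoid.powers ζ)
  let u : L := IsLocalization.Away.invSelf ζ
  have hu : algebraMap T L ζ * u = 1 := IsLocalization.Away.mul_invSelf ζ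
  let t : L := algebraMap T L γ * u
  let s : L := algebraMap T L (ϖ ^ k) * u
  let A := (Algebra.adjoin T {t, s}).toSubring
  let X := perfHull p A
  obtain ⟨_, _⟩ := perfectRing_perfHull p A
  have hAX : ∀ x ∈ Algebra.adjoin T {t, s}, x ∈ X := fun x hx =>
      ⟨0, by rw [pow_zero, pow_one]; exact hx⟩
  let f : T →+* X := (algebraMap T L).codRestrict X fun x => hAX _ (Subalgebra.algebraMap_mem _ x)
  have hϖX : ∀ b : X, f ϖ * b = 0 → b = 0 := by
    intro b hb
    have h1 : RegMod (⊥ : Ideal T) [ϖ] := ⟨fun b hb => hϖ b hb, trivial⟩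
    have h2 := (h1.localization (D := L) (Submonoid.powers ζ)).1 b.1
    rw [Ideal.map_bot, Ideal.mem_bot, Ideal.mem_bot] at h2
    exact Subtype.ext (h2 (congrArg Subtype.val hb))
  obtain ⟨c, hc⟩ := exists_eq_of_homogRel p hϖX n k (fun i => f (α i)) (γ := f γ) (ζ := f ζ)
    (t := ⟨t, hAX t (Algebra.subset_adjoin (by simp))⟩)
    (s := ⟨s, hAX s (Algebra.subset_adjoin (by simp))⟩)
    (Subtype.ext (show t * algebraMap T L ζ = algebraMap T L γ by
      rw [mul_assoc, mul_comm u, hu, mul_one]))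
    (by rw [← map_pow]; exact (Subtype.ext (show s * algebraMap T L ζ = algebraMap T L (ϖ ^ k) by
      rw [mul_assoc, mul_comm u, hu, mul_one])))
    (by
      rw [← map_homogRel, ← map_primElt]
      rw [Ideal.mem_span_singleton] at h ⊢
      exact map_dvd _ h)
  have hc' : 1 + ∑ i ∈ Finset.range n, algebraMap T L (α i) * t ^ (i + 1) =
      algebraMap T L ϖ * c.1 := by
    have := congrArg X.subtype hc
    simp only [map_add, map_one, map_sum, map_mul, map_pow] at this
    exact this
  obtain ⟨j, hj⟩ := c.2
  set I : Ideal T := Ideal.span {γ} ⊔ Ideal.span {ϖ ^ k} with hI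
  have h0 : (0 : L) ∈ smallElts I ζ := ⟨0, 0, Ideal.zero_mem _, by simp⟩
  have ht : t ∈ smallElts I ζ := ⟨0, γ, by
    simpa using Ideal.mem_sup_left (Ideal.mem_span_singleton_self γ), by
    rw [zero_add, pow_one, mul_left_comm, hu, mul_one]⟩
  have hs : s ∈ smallElts I ζ := ⟨0, ϖ ^ k, by
    simpa using Ideal.mem_sup_right (Ideal.mem_span_singleton_self (ϖ ^ k)), by
    rw [zero_add, pow_one, mul_left_comm, hu, mul_one]⟩
  have hpow : ∀ {x : L}, x ∈ smallElts I ζ → ∀ m, x ^ (m + 1) ∈ smallElts I ζ := by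
    intro x hx m
    induction m with
    | zero => simpa using hx
    | succ m ih => rw [pow_succ]; exact smallElts_mul ih hx
  obtain ⟨q, hq⟩ : ∃ q, p ^ j = q + 1 :=
    ⟨p ^ j - 1, (Nat.sub_add_cancel (Nat.one_le_pow _ _ hp.out.pos)).symm⟩
  have hsum : ∑ i ∈ Finset.range n, algebraMap T L (α i) * t ^ (i + 1) ∈ smallElts I ζ :=
    Finset.sum_induction _ (· ∈ smallElts I ζ) (fun _ _ => smallElts_add) h0
      fun i _ => smallElts_smul _ (hpow ht i)
  obtain ⟨c₀, hc₀⟩ := exists_smallElts ht hs (x := c.1 ^ p ^ j) hj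
  refine pow_mem_of_smallElts (L := L) (ϖ ^ q * c₀) ?_
  have h4 : (∑ i ∈ Finset.range n, algebraMap T L (α i) * t ^ (i + 1)) ^ p ^ j ∈ smallElts I ζ := by
    rw [hq]; exact hpow hsum q
  convert smallElts_add (smallElts_smul (ϖ ^ p ^ j) hc₀) (smallElts_smul (-1) h4) using 1
  have h5 := congrArg (· ^ p ^ j) hc'
  simp only [add_pow_char_pow, one_pow, mul_pow] at h5
  rw [← mul_assoc, ← pow_succ', ← hq, map_mul, map_pow, mul_sub, ← h5, map_neg, map_one]
  ring

/-- The Riemann extension theorem for `W(T) / (p - [ϖ])`, on the level of `T`. -/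
theorem mem_sup_of_homogRel {T : Type*} [CommRing T] [CharP T p] [PerfectRing T p] {ϖ : T}
    (hϖ : ∀ b, ϖ * b = 0 → b = 0) (n : ℕ) (α : ℕ → T) {γ ζ : T}
    (h : homogRel p n α γ ζ ∈ Ideal.span {primElt p ϖ}) (e k : ℕ) {y : T} (hy : y ^ p ^ e = γ) :
    ζ ∈ Ideal.span {y ^ (p ^ e - 1)} ⊔ Ideal.span {ϖ ^ k} := by
  obtain ⟨D, hD⟩ := exists_pow_mem_of_homogRel p hϖ n (k * p ^ (e + 1)) α h
  obtain ⟨b, hb⟩ : ∃ b, D ≤ p ^ b := ⟨D, (Nat.lt_pow_self hp.out.one_lt).le⟩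
  set a := b + 1 + e with ha
  apply mem_of_pow_mem_map_iterateFrobenius p _ a
  have hpb : 0 < p ^ b := pow_pos hp.out.pos _
  have hpe : 1 ≤ p ^ e := Nat.one_le_pow _ _ hp.out.pos
  have hpa : p ^ a = (p ^ e - 1) * p ^ (b + 1) + p ^ (b + 1) := by
    rw [← Nat.succ_mul, Nat.succ_eq_add_one, Nat.sub_add_cancel hpe, ha, pow_add, mul_comm]
  have hp2 : 2 * p ^ b ≤ p ^ (b + 1) := by
    rw [pow_succ']
    exact Nat.mul_le_mul_right _ hp.out.two_le
  have h1 := hD (p ^ a - D) (k * p ^ a)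
  rw [Nat.sub_add_cancel (by omega)] at h1
  rw [Ideal.map_sup, Ideal.map_span, Ideal.map_span, Set.image_singleton, Set.image_singleton,
    iterateFrobenius_def, iterateFrobenius_def]
  refine (show _ ⊔ _ ≤ (_ : Ideal T) from sup_le ?_ ?_) h1
  · refine (Ideal.pow_le_pow_right (n := p ^ a - D)
      (m := (p ^ e - 1) * p ^ (b + 1) + p ^ b) (by omega)).trans
      (Ideal.sup_pow_add_le_pow_sup_pow.trans (sup_le_sup ?_ ?_))
    · rw [Ideal.span_singleton_pow, Ideal.span_singleton_le_span_singleton]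
      apply dvd_of_eq
      rw [← hy, ← pow_mul, ← pow_mul]
      congr 1
      rw [ha, pow_add]; ring
    · rw [Ideal.span_singleton_pow, Ideal.span_singleton_le_span_singleton]
      apply dvd_of_eq
      rw [← pow_mul, ← pow_mul]
      congr 1
      rw [ha]; ring
  · rw [Ideal.span_singleton_le_iff_mem]
    refine Ideal.mem_sup_right ?_
    rw [pow_mul]
    exact Ideal.mem_span_singleton_self _

end Witt

end Riemann

section Sharp

open WittVector

variable (p : ℕ) [hp : Fact p.Prime] {T : Type*} [CommRing T] [CharP T p] [PerfectRing T p]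

theorem teichmuller_add_sub_mem (a b : T) :
    teichmuller p (a + b) - (teichmuller p a + teichmuller p b) ∈
      Ideal.span {(p : WittVector p T)} := by
  rw [← ker_constantCoeff, RingHom.mem_ker, RingHom.map_sub, RingHom.map_add,
    constantCoeff_teichmuller, constantCoeff_teichmuller, constantCoeff_teichmuller, sub_self]

variable {S : Type*} [CommRing S] (σ : WittVector p T →+* S)

/-- The Riemann extension theorem for untilts. -/
theorem sharp_mem_of_homogRel {ϖ : T} (hϖ : ∀ b, ϖ * b = 0 → b = 0)
    (hker : Ideal.comap σ (⊥ : Ideal S) = Ideal.span {primElt p ϖ}) (n : ℕ) (α : ℕ → T) {γ ζ : T}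
    (h : σ (homogRel p n α γ ζ) = 0) (e m : ℕ) {y : T} (hy : y ^ p ^ e = γ) :
    σ (teichmuller p ζ) ∈ Ideal.span {σ (teichmuller p y) ^ (p ^ e - 1)} ⊔
      Ideal.span {(p : S) ^ m} := by
  have h1 : homogRel p n α γ ζ ∈ Ideal.span {primElt p ϖ} := by rwa [← hker]
  have h2 := mem_sup_of_homogRel p hϖ n α h1 e (p ^ m) hy
  obtain ⟨_, ha, b, hb⟩ := mem_sup_singleton.1 h2
  obtain ⟨a, rfl⟩ := Ideal.mem_span_singleton'.1 ha
  let φ := iterateFrobeniusEquiv T p m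
  have hφ : ∀ x, φ.symm x ^ p ^ m = x := fun x => by
    rw [← iterateFrobeniusEquiv_def]; exact φ.apply_symm_apply x
  have hp0 : σ (teichmuller p ϖ) = p := by
    have : σ (primElt p ϖ) = 0 := by
      rw [← Ideal.mem_bot, ← Ideal.mem_comap, hker]; exact Ideal.mem_span_singleton_self _
    rw [primElt, map_sub, map_natCast, sub_eq_zero] at this
    exact this.symm
  have h3 : φ.symm ζ = φ.symm a * φ.symm y ^ (p ^ e - 1) + φ.symm b * ϖ := by
    rw [← hb, map_add, map_mul, map_mul, map_pow]
    congr 2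
    rw [RingEquiv.symm_apply_eq]
    exact (iterateFrobeniusEquiv_def T p m ϖ).symm
  have h4 : (p : S) ∣ σ (teichmuller p (φ.symm ζ)) -
      σ (teichmuller p (φ.symm a * φ.symm y ^ (p ^ e - 1))) := by
    have h5 := teichmuller_add_sub_mem p (φ.symm a * φ.symm y ^ (p ^ e - 1)) (φ.symm b * ϖ)
    obtain ⟨c, hc⟩ := Ideal.mem_span_singleton.1 h5
    refine ⟨σ (c + teichmuller p (φ.symm b)), ?_⟩
    have h6 := congrArg σ hc
    rw [h3]
    simp only [map_sub, map_add, map_mul, map_natCast, hp0] at h6 ⊢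
    linear_combination h6
  obtain ⟨c, hc⟩ := dvd_sub_pow_of_dvd_sub h4 m
  simp only [← map_pow, hφ] at hc
  rw [mul_pow, hφ, hφ, map_mul, map_mul, map_pow, map_pow] at hc
  refine mem_sup_singleton.2 ⟨_, Ideal.mul_mem_left _ (σ (teichmuller p a))
    (Ideal.mem_span_singleton_self _), p * c, ?_⟩
  linear_combination -hc

theorem regMod_sharp (hσ : Function.Surjective σ) {ϖ : T}
    (hker : Ideal.comap σ (⊥ : Ideal S) = Ideal.span {primElt p ϖ}) {xs : List T}
    (h : RegMod ⊥ (ϖ :: xs)) :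
    RegMod (⊥ : Ideal S) ((p : S) :: xs.map fun x => σ (teichmuller p x)) := by
  have h1 := regMod_span_primElt p h
  rw [← hker, regMod_comap_iff σ hσ] at h1
  rw [List.map_cons, List.map_map, map_natCast] at h1
  exact h1

omit [PerfectRing T p] in
theorem ofList_sharp_ne_top (hσ : Function.Surjective σ) {ϖ : T}
    (hker : Ideal.comap σ (⊥ : Ideal S) = Ideal.span {primElt p ϖ}) {xs : List T}
    (h : Ideal.ofList (ϖ :: xs) ≠ ⊤) :
    Ideal.ofList ((p : S) :: xs.map fun x => σ (teichmuller p x)) ≠ ⊤ := by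
  intro e
  apply span_primElt_ne_top p h
  have e1 : Ideal.ofList ((p : S) :: xs.map fun x => σ (teichmuller p x)) =
      (Ideal.ofList ((p : WittVector p T) :: xs.map (teichmuller p))).map σ := by
    rw [Ideal.map_ofList, List.map_cons, List.map_map, map_natCast]
    rfl
  rw [e1] at e
  have e2 := congrArg (Ideal.comap σ) e
  rwa [Ideal.comap_map_of_surjective _ hσ, Ideal.comap_top, hker,
    sup_comm] at e2

end Sharp

section TeichmullerLifts

variable (p : ℕ) [hp : Fact p.Prime]

theorem wittMap_comp {A B D : Type*} [CommRing A] [CommRing B] [CommRing D] (φ : A →+* B)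
    (ψ : B →+* D) (x : WittVector p A) :
    WittVector.map (ψ.comp φ) x = WittVector.map ψ (WittVector.map φ x) := by
  ext n
  simp only [WittVector.map_coeff, RingHom.comp_apply]

/-- Finitely many elements become Teichmüller after an extension. -/
theorem exists_teichmuller_extension.{u} {ι : Type*} (s : Finset ι) {T : Type u} [CommRing T]
    [CharP T p]
    [PerfectRing T p] {ϖ : T} {xs : List T} (hx : RegMod ⊥ (ϖ :: xs))
    (hxt : Ideal.ofList (ϖ :: xs) ≠ ⊤) (w : ι → WittVector p T) :
    ∃ (P : Type u) (_ : CommRing P) (_ : CharP P p) (_ : PerfectRing P p) (φ : T →+* P),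
      RegMod ⊥ ((ϖ :: xs).map φ) ∧ Ideal.ofList ((ϖ :: xs).map φ) ≠ ⊤ ∧
      ∀ i ∈ s, ∃ a : P, WittVector.map φ (w i) - WittVector.teichmuller p a ∈
        Ideal.span {primElt p (φ ϖ)} := by
  classical
  induction s using Finset.induction_on with
  | empty => exact ⟨T, inferInstance, inferInstance, inferInstance, RingHom.id T, by simpa using hx,
      by simpa using hxt, by simp⟩
  | insert j s hj ih =>
    obtain ⟨P, _, _, _, φ, h1, h2, h3⟩ := ih
    have : Nontrivial P := by
      by_contra hc
      rw [not_nontrivial_iff_subsingleton] at hc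
      exact h2 (Subsingleton.elim _ _)
    obtain ⟨P', _, _, _, φ', a, h1', h2', h3'⟩ := exists_root_extension p
      (Polynomial.X - Polynomial.C (WittVector.map φ (w j))) (Polynomial.monic_X_sub_C _)
      (by rw [Polynomial.degree_X_sub_C]; exact one_pos) h1 h2
    refine ⟨P', inferInstance, inferInstance, inferInstance, φ'.comp φ, ?_, ?_, ?_⟩
    · simpa using h1'
    · simpa using h2'
    · intro i hi
      rcases Finset.mem_insert.1 hi with rfl | hi
      · refine ⟨a, ?_⟩
        rw [Polynomial.eval₂_sub, Polynomial.eval₂_X, Polynomial.eval₂_C] at h3'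
        rw [← neg_mem_iff, neg_sub]
        rw [wittMap_comp]
        exact h3'
      · obtain ⟨b, hb⟩ := h3 i hi
        refine ⟨φ' b, ?_⟩
        rw [Ideal.mem_span_singleton] at hb ⊢
        have := map_dvd (WittVector.map φ') hb
        rw [map_primElt, map_sub, WittVector.map_teichmuller] at this
        rw [wittMap_comp]
        exact this

end TeichmullerLifts

section

open IsLocalRing

section Parameters

variable {N : Type*} [CommRing N] [IsNoetherianRing N] [IsLocalRing N]

theorem le_radical_of_mem_minimalPrimes {Q : Type*} [CommRing Q] [IsLocalRing Q] {I : Ideal Q}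
    (h : maximalIdeal Q ∈ I.minimalPrimes) : maximalIdeal Q ≤ I.radical := by
  rw [Ideal.radical_eq_sInf]
  refine le_sInf fun P hP => ?_
  have := hP.2
  exact h.2 ⟨hP.2, hP.1⟩ (le_maximalIdeal hP.2.ne_top)

theorem ringKrullDim_le_length {D : Type*} [CommRing D] [IsNoetherianRing D] [IsLocalRing D]
    {xs : List D} (hx : ∀ x ∈ xs, x ∈ maximalIdeal D)
    (h : maximalIdeal D ≤ (Ideal.ofList xs).radical) : ringKrullDim D ≤ xs.length := by
  classical
  rw [← maximalIdeal_height_eq_ringKrullDim]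
  have h1 : maximalIdeal D ∈ (Ideal.span (xs.toFinset : Set D)).minimalPrimes := by
    have e : Ideal.span (xs.toFinset : Set D) = Ideal.ofList xs := by
      rw [Ideal.ofList]; congr 1; ext; simp
    rw [e]
    refine ⟨⟨inferInstance, ?_⟩, fun P hP _ => h.trans (hP.1.radical_le_iff.2 hP.2)⟩
    rw [Ideal.ofList, Ideal.span_le]
    exact hx
  have h2 := Ideal.height_le_card_of_mem_minimalPrimes_span_finset h1
  have h3 : (maximalIdeal D).height ≤ (xs.length : ℕ∞) :=
    h2.trans (Nat.cast_le.2 (List.toFinset_card_le xs))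
  exact_mod_cast h3

theorem exists_ofList_radical (Q : Type*) [CommRing Q] [IsNoetherianRing Q] [IsLocalRing Q] :
    ∃ ts : List Q, (ts.length : WithBot ℕ∞) = ringKrullDim Q ∧ (∀ t ∈ ts, t ∈ maximalIdeal Q) ∧
      maximalIdeal Q ≤ (Ideal.ofList ts).radical := by
  obtain ⟨s, hs, hc⟩ := Ideal.exists_finset_card_eq_height_of_isNoetherianRing (maximalIdeal Q)
  have e : Ideal.span (s : Set Q) = Ideal.ofList s.toList := by
    rw [Ideal.ofList]; congr 1; ext; simp
  refine ⟨s.toList, ?_, fun t ht => hs.1.2 (Ideal.subset_span (by simpa using ht)), ?_⟩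
  · rw [← maximalIdeal_height_eq_ringKrullDim, ← hc, Finset.length_toList]
    rfl
  · rw [← e]
    exact le_radical_of_mem_minimalPrimes hs

omit [IsNoetherianRing N] in
theorem mem_maximalIdeal_map_iff {Q : Type*} [CommRing Q] [IsLocalRing Q] {χ : N →+* Q}
    (hχ : Function.Surjective χ) {x : N} : χ x ∈ maximalIdeal Q ↔ x ∈ maximalIdeal N := by
  have := hχ.isLocalHom
  rw [mem_maximalIdeal, mem_maximalIdeal, mem_nonunits_iff, mem_nonunits_iff, isUnit_map_iff]

omit [IsNoetherianRing N] in
theorem maximalIdeal_le_radical_map_iff {Q : Type*} [CommRing Q] [IsLocalRing Q] {χ : N →+* Q}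
    (hχ : Function.Surjective χ) {I : Ideal N} :
    maximalIdeal Q ≤ (I.map χ).radical ↔ maximalIdeal N ≤ (RingHom.ker χ ⊔ I).radical := by
  have e : (RingHom.ker χ ⊔ I).radical = (I.map χ).radical.comap χ := by
    rw [Ideal.comap_radical, Ideal.comap_map_of_surjective χ hχ, sup_comm,
        ← RingHom.ker_eq_comap_bot]
  rw [e]
  constructor
  · intro h x hx
    exact h ((mem_maximalIdeal_map_iff hχ).2 hx)
  · intro h x hx
    obtain ⟨x, rfl⟩ := hχ x
    exact h ((mem_maximalIdeal_map_iff hχ).1 hx)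

theorem exists_sop_cons {K : Ideal N} (hK : K.IsPrime) {xs : List N}
    (hx : ∀ x ∈ xs, x ∈ maximalIdeal N) (hr : maximalIdeal N ≤ (K ⊔ Ideal.ofList xs).radical)
    {g : N} (hg : g ∈ maximalIdeal N) (hgK : g ∉ K) :
    ∃ ys : List N, (g :: ys).length = xs.length ∧ (∀ y ∈ ys, y ∈ maximalIdeal N) ∧
      maximalIdeal N ≤ (K ⊔ Ideal.ofList (g :: ys)).radical := by
  let D := N ⧸ K
  let q : N →+* D := Ideal.Quotient.mk K
  have hq : Function.Surjective q := Ideal.Quotient.mk_surjective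
  have hqk : RingHom.ker q = K := Ideal.mk_ker
  have : IsLocalRing D := IsLocalRing.of_surjective' q hq
  have hD : ringKrullDim D ≤ xs.length := by
    have := ringKrullDim_le_length (D := D) (xs := xs.map q) ?_ ?_
    · simpa using this
    · intro x hx'
      obtain ⟨y, hy, rfl⟩ := List.mem_map.1 hx'
      exact (mem_maximalIdeal_map_iff hq).2 (hx y hy)
    · rw [← Ideal.map_ofList, maximalIdeal_le_radical_map_iff hq, hqk]
      exact hr
  let Q := D ⧸ Ideal.span {q g}
  let q' : D →+* Q := Ideal.Quotient.mk _
  have hq' : Function.Surjective q' := Ideal.Quotient.mk_surjective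
  have hgD : q g ∈ maximalIdeal D := (mem_maximalIdeal_map_iff hq).2 hg
  have : Nontrivial Q := Ideal.Quotient.nontrivial_iff.2 fun h =>
    (maximalIdeal.isMaximal D).ne_top (eq_top_iff.2 (h ▸ (Ideal.span_singleton_le_iff_mem _).2 hgD))
  have : IsLocalRing Q := IsLocalRing.of_surjective' q' hq'
  have hg0 : q g ≠ 0 := fun h => hgK (by rwa [← hqk, RingHom.mem_ker])
  have hQ : ringKrullDim Q + 1 ≤ ringKrullDim D :=
    ringKrullDim_quotient_succ_le_of_nonZeroDivisor (mem_nonZeroDivisors_of_ne_zero hg0)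
  obtain ⟨ts, ht1, ht2, ht3⟩ := exists_ofList_radical Q
  let χ : N →+* Q := q'.comp q
  have hχ : Function.Surjective χ := hq'.comp hq
  have hlen : ts.length + 1 ≤ xs.length := by
    have := hQ.trans hD
    rw [← ht1] at this
    exact_mod_cast this
  let l : Q → N := Function.surjInv hχ
  have hl : ∀ t, χ (l t) = t := Function.surjInv_eq hχ
  have hker : RingHom.ker χ = K ⊔ Ideal.span {g} := by
    rw [← RingHom.comap_ker, Ideal.mk_ker, ← Set.image_singleton, ← Ideal.map_span,
      Ideal.comap_map_of_surjective q hq, ← RingHom.ker_eq_comap_bot, hqk, sup_comm]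
  refine ⟨ts.map l ++ List.replicate (xs.length - (ts.length + 1)) 0, ?_, ?_, ?_⟩
  · simp; omega
  · intro y hy
    rcases List.mem_append.1 hy with hy | hy
    · obtain ⟨t, ht, rfl⟩ := List.mem_map.1 hy
      rw [← mem_maximalIdeal_map_iff hχ, hl]
      exact ht2 t ht
    · rw [List.eq_of_mem_replicate hy]
      exact zero_mem _
  · rw [sup_ofList_cons, ← hker, Ideal.ofList_append]
    refine le_trans ?_ (Ideal.radical_mono (sup_le_sup_left le_sup_left _))
    rw [← maximalIdeal_le_radical_map_iff hχ, Ideal.map_ofList, List.map_map]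
    convert ht3
    exact (List.map_congr_left fun t _ => hl t).trans (List.map_id _)

/-- Elements outside a prime ideal `K` are nonzerodivisors on complete Cohen-Macaulay algebras
over the quotient by `K`. -/
theorem RegMod.reg_of_notMem {E : Type*} [CommRing E] (φ : N →+* E)
    [IsAdicComplete ((maximalIdeal N).map φ) E] {K : Ideal N} (hK : K.IsPrime) {xs : List N}
    (hx : ∀ x ∈ xs, x ∈ maximalIdeal N) (hr : maximalIdeal N ≤ (K ⊔ Ideal.ofList xs).radical)
    (hK0 : K.map φ = ⊥) (h : RegMod ⊥ (xs.map φ)) {g : N} (hg : g ∉ K) :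
    ∀ b, φ g * b = 0 → b = 0 := by
  by_cases hgm : g ∈ maximalIdeal N
  · obtain ⟨ys, h1, h2, h3⟩ := exists_sop_cons hK hx hr hgm hg
    have h4 := RegMod.sop_exchange φ xs.length (K := K) (xs := xs) (ys := g :: ys) rfl h1 hx
      (by simpa using ⟨hgm, h2⟩) hr h3 (by rw [hK0]; exact closedIn_bot _) (by rwa [hK0])
    rw [hK0] at h4
    intro b hb
    exact h4.1 b (by simpa using hb)
  · intro b hb
    have : IsUnit (φ g) := ((IsLocalRing.notMem_maximalIdeal).1 hgm).map φ
    exact (this.mul_right_eq_zero).1 hb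

end Parameters

end

section

open IsLocalRing

section CompleteCM

variable {N : Type*} [CommRing N] [IsNoetherianRing N] [IsLocalRing N]

/-- A complete nonzero algebra on which the sequence `xs` is regular. -/
structure CompleteCM {E : Type*} [CommRing E] (φ : N →+* E) (xs : List N) : Prop where
  complete : IsAdicComplete ((maximalIdeal N).map φ) E
  reg : RegMod ⊥ (xs.map φ)
  ne_top : (maximalIdeal N).map φ ≠ ⊤

/-- `xs` is a sequence in the maximal ideal, primary to it modulo `K`. -/
structure IsParam (K : Ideal N) (xs : List N) : Prop where
  mem : ∀ x ∈ xs, x ∈ maximalIdeal N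
  le_radical : maximalIdeal N ≤ (K ⊔ Ideal.ofList xs).radical

omit [IsNoetherianRing N] in
theorem IsParam.map_le_radical {K : Ideal N} {xs : List N} (h : IsParam K xs) {E : Type*}
    [CommRing E] {φ : N →+* E} (hK : K.map φ = ⊥) :
    (maximalIdeal N).map φ ≤ (Ideal.ofList (xs.map φ)).radical := by
  have := Ideal.map_mono (f := φ) h.le_radical
  refine this.trans ((Ideal.map_radical_le φ).trans ?_)
  rw [Ideal.map_sup, hK, bot_sup_eq, Ideal.map_ofList]

theorem exists_completeCM.{u} {K : Ideal N} {xs : List N} (h : IsParam K xs) {D : Type u}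
    [CommRing D]
    (φ : N →+* D) (hK : K.map φ = ⊥) (hreg : RegMod ⊥ (xs.map φ))
    (hne : (maximalIdeal N).map φ ≠ ⊤) :
    ∃ (E : Type u) (_ : CommRing E) (i : D →+* E), IsCompletion ((maximalIdeal N).map φ) i ∧
      CompleteCM (i.comp φ) xs := by
  have hJ : ((maximalIdeal N).map φ).FG := Ideal.FG.map (IsNoetherian.noetherian (maximalIdeal N)) φ
  obtain ⟨E, _, i, hi⟩ := exists_isCompletion hJ
  refine ⟨E, inferInstance, i, hi, ?_, ?_, ?_⟩
  · rw [← Ideal.map_map]; exact hi.complete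
  · have hc : xs.map (i.comp φ) = (xs.map φ).map i := by rw [List.map_map]; rfl
    rw [hc]
    refine hi.regMod hJ ?_ (h.map_le_radical hK) hreg
    intro x hx
    obtain ⟨y, hy, rfl⟩ := List.mem_map.1 hx
    exact Ideal.mem_map_of_mem φ (h.mem y hy)
  · rw [← Ideal.map_map]; exact hi.map_ne_top hne

theorem CompleteCM.reg_of_notMem {E : Type*} [CommRing E] {φ : N →+* E} {xs : List N}
    (h : CompleteCM φ xs) {K : Ideal N} (hK : K.IsPrime) (hx : IsParam K xs) (hK0 : K.map φ = ⊥)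
    {g : N} (hg : g ∉ K) : ∀ b, φ g * b = 0 → b = 0 :=
  have := h.complete
  RegMod.reg_of_notMem φ hK hx.mem hx.le_radical hK0 h.reg hg

theorem CompleteCM.exchange {E : Type*} [CommRing E] {φ : N →+* E} {xs ys : List N}
    (h : CompleteCM φ xs) {K : Ideal N} (hx : IsParam K xs) (hy : IsParam K ys)
    (hl : xs.length = ys.length) (hK0 : K.map φ = ⊥) : CompleteCM φ ys := by
  have := h.complete
  refine ⟨h.complete, ?_, h.ne_top⟩
  have h4 := RegMod.sop_exchange φ xs.length (K := K) (xs := xs) (ys := ys) rfl hl.symm hx.mem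
      hy.mem hx.le_radical hy.le_radical (by rw [hK0]; exact closedIn_bot _)
          (by rw [hK0]; exact h.reg)
  rwa [hK0] at h4

omit [IsNoetherianRing N] in
theorem CompleteCM.nontrivial {E : Type*} [CommRing E] {φ : N →+* E} {xs : List N}
    (h : CompleteCM φ xs) : Nontrivial E := by
  by_contra hc
  rw [not_nontrivial_iff_subsingleton] at hc
  exact h.ne_top (Subsingleton.elim _ _)

theorem CompleteCM.closedIn_span {E : Type*} [CommRing E] {φ : N →+* E} {xs : List N}
    (h : CompleteCM φ xs) {K : Ideal N} (hK : K.IsPrime) (hx : IsParam K xs) (hK0 : K.map φ = ⊥)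
    {g : N} (hg : g ∉ K) : ClosedIn ((maximalIdeal N).map φ) (Ideal.span {φ g}) := by
  have := h.complete
  by_cases hgm : g ∈ maximalIdeal N
  · obtain ⟨ys, h1, h2, h3⟩ := exists_sop_cons hK hx.mem hx.le_radical hgm hg
    have hp : IsParam K (g :: ys) := ⟨by simpa using ⟨hgm, h2⟩, h3⟩
    have h4 := h.exchange hx hp h1.symm hK0
    have hJ : ((maximalIdeal N).map φ).FG :=
      Ideal.FG.map (IsNoetherian.noetherian (maximalIdeal N)) φ
    have := h4.reg.closedIn_head (J := (maximalIdeal N).map φ) (closedIn_bot _) hJ ?_ ?_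
    · rwa [bot_sup_eq] at this
    · intro x hx
      obtain ⟨y, hy, rfl⟩ := List.mem_map.1 (show x ∈ (g :: ys).map φ from hx)
      exact Ideal.mem_map_of_mem φ (hp.mem y hy)
    · rw [bot_sup_eq]
      exact hp.map_le_radical hK0
  · have : IsUnit (φ g) := ((IsLocalRing.notMem_maximalIdeal).1 hgm).map φ
    rw [Ideal.span_singleton_eq_top.2 this]
    exact fun _ _ => trivial

end CompleteCM

section AlmostToHonest

variable {A : Type*} [CommRing A] [IsNoetherianRing A] [IsLocalRing A] [IsDomain A]

theorem exists_completeCM_of_almost.{u} {S : Type u} [CommRing S] (ρ : A →+* S) {xs : List A}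
    (hx : IsParam (⊥ : Ideal A) xs) (hreg : RegMod ⊥ (xs.map ρ)) (hne : (maximalIdeal A).map ρ ≠ ⊤)
    {p : ℕ} (hp : 1 < p) {g : A} (hg : g ≠ 0) (y : ℕ → S) (hy : ∀ e, y e ^ p ^ e = ρ g)
    {q : A} (hq : q ∈ maximalIdeal A) :
    ∃ (C : Type u) (_ : CommRing C) (ψ : S →+* C), CompleteCM (ψ.comp ρ) xs ∧
      ∀ z, (∀ e k, ∃ u v, y e * z = u * ρ g + v * ρ q ^ k) → ∃ c, ψ (ρ g) * c = ψ z := by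
  have hpt : (⊥ : Ideal A).IsPrime := Ideal.isPrime_bot
  -- powers of `g` survive
  have key : ∀ n, ∃ e, y e ^ n ∉ Ideal.ofList (xs.map ρ) := by
    by_contra! hc
    obtain ⟨n, hn⟩ := hc
    obtain ⟨E, _, i, hi, hE⟩ := exists_completeCM hx ρ Ideal.map_bot hreg hne
    have h1 : ∀ k, ρ g ∈ (maximalIdeal A).map ρ ^ k := by
      intro k
      obtain ⟨e, he⟩ : ∃ e, n * k ≤ p ^ e := ⟨n * k, (Nat.lt_pow_self hp).le⟩
      rw [← hy e, ← Nat.sub_add_cancel he, pow_add, pow_mul]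
      refine Ideal.mul_mem_left _ _ (Ideal.pow_mem_pow ?_ k)
      refine (?_ : Ideal.ofList (xs.map ρ) ≤ _) (hn e)
      rw [← Ideal.map_ofList]
      refine Ideal.map_mono ?_
      rw [Ideal.ofList, Ideal.span_le]
      exact hx.mem
    have h2 : i (ρ g) = 0 := by
      have := hE.complete
      refine IsHausdorff.haus (I := (maximalIdeal A).map (i.comp ρ)) inferInstance _ fun k => ?_
      rw [SModEq.sub_mem, smul_eq_mul, Ideal.mul_top, sub_zero, ← Ideal.map_map, ← Ideal.map_pow]
      exact Ideal.mem_map_of_mem i (h1 k)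
    have := hE.nontrivial
    exact one_ne_zero (hE.reg_of_notMem hpt hx Ideal.map_bot (g := g) (by simpa using hg) (1 : E)
      (by rw [RingHom.comp_apply, h2, zero_mul]))
  let κ : S →+* (ℕ → S) := Pi.constRingHom ℕ S
  let G : ℕ → S := y
  let L := Localization.Away G
  let χ : S →+* L := (algebraMap (ℕ → S) L).comp κ
  have h1 : RegMod (⊥ : Ideal (ℕ → S)) ((xs.map ρ).map κ) := by
    rw [← piIdeal_bot]
    refine RegMod.pi fun i => ?_
    rw [List.map_map]
    convert hreg
    exact List.map_id' _
  have h2 : RegMod (⊥ : Ideal L) (xs.map (χ.comp ρ)) := by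
    have := h1.localization (D := L) (Submonoid.powers G)
    rwa [Ideal.map_bot, List.map_map, List.map_map] at this
  have h3 : (maximalIdeal A).map (χ.comp ρ) ≠ ⊤ := by
    intro e
    have h4 := hx.map_le_radical (φ := χ.comp ρ) Ideal.map_bot
    rw [e, top_le_iff, Ideal.radical_eq_top] at h4
    have h5 : (Ideal.ofList ((xs.map ρ).map κ)).map (algebraMap (ℕ → S) L) = ⊤ := by
      rw [Ideal.map_ofList, List.map_map, List.map_map]; exact h4
    by_contra
    refine (IsLocalization.map_algebraMap_ne_top_iff_disjoint (Submonoid.powers G) L _).2 ?_ h5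
    rw [Set.disjoint_left]
    rintro _ ⟨n, rfl⟩ hn
    obtain ⟨e, he⟩ := key n
    have h6 : G ^ n ∈ piIdeal (fun _ : ℕ => (⊥ : Ideal S)) ⊔ Ideal.ofList ((xs.map ρ).map κ) :=
      Ideal.mem_sup_right hn
    rw [piIdeal_sup_ofList] at h6
    have h7 : (G ^ n) e ∈ (⊥ ⊔ Ideal.ofList (((xs.map ρ).map κ).map (· e)) : Ideal S) := h6 e
    rw [bot_sup_eq, List.map_map] at h7
    apply he
    have h8 : (xs.map ρ).map ((fun x : ℕ → S => x e) ∘ κ) = xs.map ρ := List.map_id' _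
    rw [h8] at h7
    exact h7
  obtain ⟨C, _, i, hi, hC⟩ := exists_completeCM hx (χ.comp ρ) Ideal.map_bot h2 h3
  refine ⟨C, inferInstance, i.comp χ, hC, fun z hz => ?_⟩
  have hG : IsUnit (i (algebraMap _ L G)) :=
    (IsLocalization.Away.algebraMap_isUnit G).map i
  choose u v huv using hz
  have h8 : i (χ z) * i (algebraMap _ L G) ∈ Ideal.span {i (χ (ρ g))} := by
    refine hC.closedIn_span hpt hx Ideal.map_bot (g := g) (by simpa using hg) _ fun k => ?_
    have h9 : κ z * G = (fun e => u e k) * κ (ρ g) + (fun e => v e k) * κ (ρ q) ^ k := by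
      funext e
      show z * y e = u e k * ρ g + v e k * ρ q ^ k
      rw [mul_comm]; exact huv e k
    have h10 := congrArg (fun t => i (algebraMap _ L t)) h9
    simp only [map_add, map_mul, map_pow] at h10
    refine (show i (χ z) * i (algebraMap _ L G) = _ from h10) ▸ add_mem ?_ ?_
    · exact Ideal.mem_sup_left (Ideal.mul_mem_left _ _ (Ideal.mem_span_singleton_self _))
    · refine Ideal.mem_sup_right (Ideal.mul_mem_left _ _ (Ideal.pow_mem_pow ?_ k))
      exact Ideal.mem_map_of_mem (i.comp (χ.comp ρ)) hq
  obtain ⟨c, hc⟩ := Ideal.mem_span_singleton.1 h8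
  obtain ⟨w, hw⟩ := hG
  refine ⟨c * ↑w⁻¹, ?_⟩
  show i (χ (ρ g)) * _ = i (χ z)
  rw [← mul_assoc, ← hc, ← hw, mul_assoc, Units.mul_inv, mul_one]

end AlmostToHonest

end

section

open IsLocalRing Polynomial

section Base

variable (p : ℕ) [hp : Fact p.Prime]

/-- A perfect base: a map from `A` to the Witt vectors of a perfect ring sending the parameters
`xs` to Teichmüller lifts of a regular sequence. -/
structure PerfectBase {A : Type*} [CommRing A] (xs : List A) (T : Type*) [CommRing T] where
  charP : CharP T p
  perfect : PerfectRing T p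
  ϖ : T
  xs' : List T
  reg : RegMod ⊥ (ϖ :: xs')
  ne_top : Ideal.ofList (ϖ :: xs') ≠ ⊤
  ρ : A →+* WittVector p T
  map_eq : xs.map ρ = xs'.map (WittVector.teichmuller p)

theorem exists_completeCM_of_polys.{u} {A : Type*} [CommRing A] [IsNoetherianRing A] [IsLocalRing A]
    [IsDomain A] {xs : List A} (hx : IsParam (⊥ : Ideal A) ((p : A) :: xs)) {T : Type u}
    [CommRing T]
    (b : PerfectBase p xs T) {f : A[X]} (hf : f.Monic) (hd : 0 < f.degree) {g : A} (hg : g ≠ 0)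
    {ι : Type*} (s : Finset ι) (n : ι → ℕ) (a : ι → ℕ → A) (h : ι → A[X])
    (hdvd : ∀ i ∈ s, f ∣ h i ^ n i + ∑ j ∈ Finset.range (n i),
      C (a i j) * C g ^ (j + 1) * h i ^ (n i - 1 - j)) :
    ∃ (D : Type u) (_ : CommRing D) (ψ : A →+* D) (θ : D), CompleteCM ψ ((p : A) :: xs) ∧
      f.eval₂ ψ θ = 0 ∧ ∀ i ∈ s, ∃ c, ψ g * c = (h i).eval₂ ψ θ := by
  classical
  obtain ⟨_, _, ϖ, xs', hreg, hne, ρ, hρ⟩ := b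
  have : Nontrivial T := by
    by_contra hc
    rw [not_nontrivial_iff_subsingleton] at hc
    exact hne (Subsingleton.elim _ _)
  obtain ⟨T1, _, _, _, φ1, a1, h11, h12, h13⟩ := exists_root_extension p (f.map ρ) (hf.map ρ)
    (by rwa [hf.degree_map ρ]) hreg hne
  rw [List.map_cons] at h11 h12
  let ρ1 : A →+* WittVector p T1 := (WittVector.map φ1).comp ρ
  let θ1 : WittVector p T1 := WittVector.teichmuller p a1
  let F : Finset (WittVector p T1) := insert (ρ1 g) ((s.image fun i => (h i).eval₂ ρ1 θ1) ∪
    s.biUnion fun i => (Finset.range (n i)).image fun j => ρ1 (a i j))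
  obtain ⟨T2, _, _, _, φ2, h21, h22, h23⟩ := exists_teichmuller_extension p F h11 h12 id
  rw [List.map_cons] at h21 h22
  choose! τ hτ using h23
  obtain ⟨S, _, σ, hσ, hker⟩ := exists_quotient (Ideal.span {primElt p (φ2 (φ1 ϖ))})
  have hker' : Ideal.comap σ (⊥ : Ideal S) = Ideal.span {primElt p (φ2 (φ1 ϖ))} := by
    rw [← RingHom.ker_eq_comap_bot, hker]
  let ρ2 : A →+* S := σ.comp ((WittVector.map φ2).comp ρ1)
  let θ2 : S := σ (WittVector.map φ2 θ1)
  have hτ' : ∀ w ∈ F, σ (WittVector.map φ2 w) = σ (WittVector.teichmuller p (τ w)) := by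
    intro w hw
    have := hτ w hw
    rw [← hker, RingHom.mem_ker, RingHom.map_sub, sub_eq_zero] at this
    exact this
  have hroot : f.eval₂ ρ2 θ2 = 0 := by
    rw [eval₂_map] at h13
    have h1 : f.eval₂ ρ2 θ2 = σ (WittVector.map φ2 (f.eval₂ ρ1 θ1)) := by
      rw [hom_eval₂, hom_eval₂]
    rw [h1, ← RingHom.mem_ker, hker]
    have := Ideal.mem_map_of_mem (WittVector.map φ2) h13
    rw [Ideal.map_span, Set.image_singleton] at this
    convert this using 3
    exact (map_primElt p φ2 (φ1 ϖ)).symm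
  have hmap : ((p : A) :: xs).map ρ2 =
      (p : S) :: ((xs'.map φ1).map φ2).map fun x => σ (WittVector.teichmuller p x) := by
    have h1 : xs.map ρ2 = (xs.map ρ).map (fun w => σ (WittVector.map φ2 (WittVector.map φ1 w))) := by
      rw [List.map_map]; rfl
    rw [List.map_cons, map_natCast, h1, hρ, List.map_map, List.map_map, List.map_map]
    congr 1
    refine List.map_congr_left fun x _ => ?_
    simp only [Function.comp_apply, WittVector.map_teichmuller]
  have hreg2 : RegMod ⊥ (((p : A) :: xs).map ρ2) := by
    rw [hmap]; exact regMod_sharp p σ hσ hker' h21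
  have hne2 : (maximalIdeal A).map ρ2 ≠ ⊤ := by
    intro e
    have h4 := hx.map_le_radical (φ := ρ2) Ideal.map_bot
    rw [e, top_le_iff, Ideal.radical_eq_top, hmap] at h4
    exact ofList_sharp_ne_top p σ hσ hker' h22 h4
  have hgF : ρ1 g ∈ F := Finset.mem_insert_self _ _
  let γ := τ (ρ1 g)
  let y : ℕ → T2 := fun e => (iterateFrobeniusEquiv T2 p e).symm γ
  have hy : ∀ e, y e ^ p ^ e = γ := fun e => by
    rw [← iterateFrobeniusEquiv_def]; exact (iterateFrobeniusEquiv T2 p e).apply_symm_apply γ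
  have hpm : (p : A) ∈ maximalIdeal A := hx.mem _ (by simp)
  obtain ⟨D, _, ψ, hψ, hz⟩ := exists_completeCM_of_almost ρ2 hx hreg2 hne2 hp.out.one_lt hg
    (fun e => σ (WittVector.teichmuller p (y e)))
    (fun e => by rw [← map_pow, ← map_pow, hy]; exact (hτ' _ hgF).symm) hpm
  refine ⟨D, inferInstance, ψ.comp ρ2, ψ θ2, hψ, by rw [← hom_eval₂, hroot, map_zero], ?_⟩
  intro i hi
  have hh : (h i).eval₂ ρ2 θ2 = σ (WittVector.teichmuller p (τ ((h i).eval₂ ρ1 θ1))) := by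
    rw [← hτ' _ (Finset.mem_insert_of_mem (Finset.mem_union_left _
      (Finset.mem_image_of_mem _ hi))), hom_eval₂, hom_eval₂]
  rw [← hom_eval₂]
  refine hz _ fun e k => ?_
  have hrel : σ (homogRel p (n i) (fun j => τ (ρ1 (a i j))) γ (τ ((h i).eval₂ ρ1 θ1))) = 0 := by
    obtain ⟨w, hw⟩ := hdvd i hi
    have h1 := congrArg (eval₂ ρ2 θ2) hw
    rw [eval₂_mul, hroot, zero_mul] at h1
    rw [← h1]
    simp only [homogRel, eval₂_add, eval₂_pow, eval₂_finsetSum, eval₂_mul, eval₂_C, map_add,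
      map_pow, map_sum, map_mul, hh]
    congr 1
    refine Finset.sum_congr rfl fun j hj => ?_
    rw [← hτ' _ hgF, ← hτ' (ρ1 (a i j)) (Finset.mem_insert_of_mem (Finset.mem_union_right _
      (Finset.mem_biUnion.2 ⟨i, hi, Finset.mem_image_of_mem _ hj⟩)))]
    rfl
  have h3 := sharp_mem_of_homogRel p σ (fun b hb => h21.1 b hb) hker' (n i) _ hrel e k (hy e)
  rw [← hh] at h3
  obtain ⟨_, hu, v, huv⟩ := mem_sup_singleton.1 h3
  obtain ⟨u, rfl⟩ := Ideal.mem_span_singleton'.1 hu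
  refine ⟨u, v * σ (WittVector.teichmuller p (y e)), ?_⟩
  have h4 : ρ2 g = σ (WittVector.teichmuller p (y e)) ^ p ^ e := by
    rw [← map_pow, ← map_pow, hy]; exact hτ' _ hgF
  have h5 : σ (WittVector.teichmuller p (y e)) ^ p ^ e =
      σ (WittVector.teichmuller p (y e)) * σ (WittVector.teichmuller p (y e)) ^ (p ^ e - 1) := by
    rw [← pow_succ', Nat.sub_add_cancel (Nat.one_le_pow _ _ hp.out.pos)]
  rw [← huv, h4, h5, map_natCast]
  ring

end Base

end

section

open IsLocalRing Polynomial

theorem exists_integral_primitive {A : Type*} [CommRing A] [IsDomain A] [CharZero A] {L : Type*}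
    [Field L] [Algebra A L] [FaithfulSMul A L] (s : Finset L) (hs : ∀ r ∈ s, IsIntegral A r) :
    ∃ θ : L, IsIntegral A θ ∧ ∃ g : A, g ≠ 0 ∧
      ∀ r ∈ s, ∃ h : A[X], algebraMap A L g * r = aeval θ h := by
  classical
  let K := FractionRing A
  let : Algebra K L := FractionRing.liftAlgebra A L
  have : IsScalarTower A K L := FractionRing.isScalarTower_liftAlgebra A L
  have hsK : ∀ r ∈ (s : Set L), IsIntegral K r := fun r hr => (hs r hr).tower_top
  have : FiniteDimensional K (IntermediateField.adjoin K (s : Set L)) :=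
    IntermediateField.finiteDimensional_adjoin hsK
  obtain ⟨α, hα⟩ := Field.exists_primitive_element K (IntermediateField.adjoin K (s : Set L))
  have hαi : IsIntegral K α := Algebra.IsIntegral.isIntegral α
  have hpoly : ∀ r ∈ s, ∃ q : K[X], r = aeval (α : L) q := by
    intro r hr
    let r' : IntermediateField.adjoin K (s : Set L) := ⟨r, IntermediateField.subset_adjoin K _ hr⟩
    have h1 : r' ∈ IntermediateField.adjoin K {α} := hα ▸ IntermediateField.mem_top
    rw [← IntermediateField.mem_toSubalgebra,
      IntermediateField.adjoin_simple_toSubalgebra_of_isAlgebraic hαi.isAlgebraic,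
      Algebra.adjoin_singleton_eq_range_aeval] at h1
    obtain ⟨q, hq⟩ := h1
    refine ⟨q, ?_⟩
    have := congrArg (IntermediateField.val _) hq
    rw [AlgHom.toRingHom_eq_coe, RingHom.coe_coe, ← Polynomial.aeval_algHom_apply] at this
    exact this.symm
  have hαL : IsIntegral K (α : L) := hαi.map (IntermediateField.val _)
  obtain ⟨m, hm⟩ := IsIntegral.exists_multiple_integral_of_isLocalization (nonZeroDivisors A)
      (α : L) hαL
  refine ⟨m • (α : L), hm, ?_⟩
  have hmK : algebraMap A K m ≠ 0 := IsFractionRing.to_map_ne_zero_of_mem_nonZeroDivisors m.2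
  have key : ∀ r ∈ s, ∃ g : A, g ≠ 0 ∧ ∃ h : A[X], algebraMap A L g * r = aeval (m • (α : L)) h := by
    intro r hr
    obtain ⟨q, hq⟩ := hpoly r hr
    have hq2 : r = aeval (m • (α : L)) (q.comp (C (algebraMap A K m)⁻¹ * X)) := by
      rw [hq, aeval_comp]
      congr 1
      rw [map_mul, aeval_C, aeval_X, Submonoid.smul_def, Algebra.smul_def, ← mul_assoc,
        IsScalarTower.algebraMap_apply A K L, ← map_mul, inv_mul_cancel₀ hmK, map_one, one_mul]
    obtain ⟨b, hbM, hb⟩ := IsLocalization.integerNormalization_spec (nonZeroDivisors A)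
      (q.comp (C (algebraMap A K m)⁻¹ * X))
    refine ⟨b, nonZeroDivisors.ne_zero hbM, IsLocalization.integerNormalization (nonZeroDivisors A) 
      (q.comp (C (algebraMap A K m)⁻¹ * X)), ?_⟩
    rw [← aeval_map_algebraMap K, hb, ← IsScalarTower.algebraMap_smul K b, map_smul, ← hq2,
      algebraMap_smul, Algebra.smul_def]
  choose! g hg h hh using key
  refine ⟨∏ r ∈ s, g r, Finset.prod_ne_zero_iff.2 hg, fun r hr => ?_⟩
  refine ⟨C (∏ r ∈ s.erase r, g r) * h r, ?_⟩
  rw [map_mul, aeval_C, ← hh r hr, ← Finset.mul_prod_erase s g hr, map_mul]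
  ring

theorem exists_subring_hom.{u} (p : ℕ) [hp : Fact p.Prime] {A : Type u} [CommRing A]
    [IsNoetherianRing A] [IsLocalRing A] [IsDomain A] [CharZero A] [IsIntegrallyClosed A]
    {xs : List A} (hx : IsParam (⊥ : Ideal A) ((p : A) :: xs)) {T : Type u} [CommRing T]
    (b : PerfectBase p xs T) {L : Type u} [Field L] [Algebra A L] [FaithfulSMul A L] (s : Finset L)
    (hs : ∀ r ∈ s, IsIntegral A r) :
    ∃ (D : Type u) (_ : CommRing D) (ψ : A →+* D) (V : Subring L) (Ψ : V →+* D),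
      CompleteCM ψ ((p : A) :: xs) ∧ (∀ a, algebraMap A L a ∈ V) ∧ (∀ r ∈ s, r ∈ V) ∧
      ∀ a (h : algebraMap A L a ∈ V), Ψ ⟨_, h⟩ = ψ a := by
  classical
  obtain ⟨θ, hθ, g, hg, hh⟩ := exists_integral_primitive s hs
  choose! h hh using hh
  let n : L → ℕ := fun r => (minpoly A r).natDegree
  let a : L → ℕ → A := fun r j => (minpoly A r).coeff (n r - 1 - j)
  have hdvd : ∀ r ∈ s, minpoly A θ ∣ h r ^ n r + ∑ j ∈ Finset.range (n r),
      C (a r j) * C g ^ (j + 1) * h r ^ (n r - 1 - j) := by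
    intro r hr
    refine minpoly.isIntegrallyClosed_dvd hθ ?_
    have h1 : aeval r (minpoly A r) = 0 := minpoly.aeval A r
    rw [aeval_eq_sum_range, Finset.sum_range_succ, (minpoly.monic (hs r hr)).coeff_natDegree,
      one_smul, ← Finset.sum_range_reflect] at h1
    simp only [map_add, map_pow, map_sum, map_mul, aeval_C, ← hh r hr]
    rw [← mul_zero (algebraMap A L g ^ n r), ← h1, mul_add, add_comm, mul_pow, Finset.mul_sum]
    congr 1
    refine Finset.sum_congr rfl fun j hj => ?_
    have hj' : j < n r := Finset.mem_range.1 hj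
    rw [Algebra.smul_def, mul_pow]
    have : n r = (j + 1) + (n r - 1 - j) := by omega
    have h2 : algebraMap A L g ^ n r = algebraMap A L g ^ (j + 1) *
        algebraMap A L g ^ (n r - 1 - j) := by
      rw [← pow_add, ← this]
    rw [h2]
    ring
  obtain ⟨D, _, ψ, θD, hψ, hroot, hc⟩ := exists_completeCM_of_polys p hx b (minpoly.monic hθ)
    (minpoly.degree_pos hθ) hg s n a h hdvd
  have hgD : ∀ (N : ℕ) c, ψ g ^ N * c = 0 → c = 0 := by
    intro N
    induction N with
    | zero => intro c hc; simpa using hc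
    | succ N ih =>
      intro c hc
      refine ih c (hψ.reg_of_notMem (Ideal.isPrime_bot) hx Ideal.map_bot (g := g)
          (by simpa using hg) _ ?_)
      rw [← hc, pow_succ']; ring
  have hpolys : ∀ q : A[X], aeval θ q = 0 → q.eval₂ ψ θD = 0 := by
    intro q hq
    obtain ⟨w, rfl⟩ := minpoly.isIntegrallyClosed_dvd hθ hq
    rw [eval₂_mul, hroot, zero_mul]
  have hC : ∀ (a : A) (q : A[X]), eval₂ ψ θD (C a * q) = ψ a * eval₂ ψ θD q := fun a q => by
    rw [eval₂_mul, eval₂_C]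
  let G : Subring (L × D) :=
    { carrier := {x | ∃ (N : ℕ) (q : A[X]), algebraMap A L g ^ N * x.1 = aeval θ q ∧
        ψ g ^ N * x.2 = q.eval₂ ψ θD}
      mul_mem' := by
        rintro x y ⟨N, q, h1, h2⟩ ⟨N', q', h1', h2'⟩
        refine ⟨N + N', q * q', ?_, ?_⟩
        · rw [map_mul, ← h1, ← h1', Prod.fst_mul]; ring
        · rw [eval₂_mul, ← h2, ← h2', Prod.snd_mul]; ring
      one_mem' := ⟨0, 1, by simp, by simp⟩
      add_mem' := by
        rintro x y ⟨N, q, h1, h2⟩ ⟨N', q', h1', h2'⟩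
        refine ⟨N + N', C g ^ N' * q + C g ^ N * q', ?_, ?_⟩
        · simp only [map_add, map_mul, map_pow, aeval_C, ← h1, ← h1', Prod.fst_add]; ring
        · simp only [eval₂_add, eval₂_mul, eval₂_pow, eval₂_C, ← h2, ← h2', Prod.snd_add]; ring
      zero_mem' := ⟨0, 0, by simp, by simp⟩
      neg_mem' := by
        rintro x ⟨N, q, h1, h2⟩
        refine ⟨N, -q, by simp [← h1], by simp [← h2]⟩ }
  let π : G →+* L := (RingHom.fst L D).comp G.subtype
  have hπ : Function.Injective π := by
    rw [injective_iff_map_eq_zero]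
    rintro ⟨⟨x, y⟩, N, q, h1, h2⟩ (h3 : x = 0)
    have h1' : algebraMap A L g ^ N * x = aeval θ q := h1
    rw [h3, mul_zero] at h1'
    have h4 : y = 0 := hgD N y (h2.trans (hpolys q h1'.symm))
    subst h3 h4
    rfl
  let e : G ≃+* π.range := RingEquiv.ofBijective π.rangeRestrict
    ⟨fun x y hxy => hπ (congrArg Subtype.val hxy), π.rangeRestrict_surjective⟩
  have he : ∀ (x : G) (h : x.1.1 ∈ π.range), e.symm ⟨x.1.1, h⟩ = x := by
    intro x h
    rw [RingEquiv.symm_apply_eq]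
    rfl
  have hA : ∀ a : A, (algebraMap A L a, ψ a) ∈ G := fun a => ⟨0, C a, by simp, by simp⟩
  refine ⟨D, inferInstance, ψ, π.range, ((RingHom.snd L D).comp G.subtype).comp e.symm.toRingHom,
      hψ,
    fun a => ⟨⟨_, hA a⟩, rfl⟩, ?_, ?_⟩
  · intro r hr
    obtain ⟨c, hc⟩ := hc r hr
    exact ⟨⟨(r, c), 1, h r, by simpa using hh r hr, by simpa using hc⟩, rfl⟩
  · intro a ha
    show (e.symm ⟨_, ha⟩).1.2 = ψ a
    rw [he ⟨_, hA a⟩]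

end

section

open IsLocalRing

/-- Elements of a product over finite sets that are eventually `1`. -/
def eventuallyOne {α : Type*} (D : Finset α → Type*) [∀ s, CommRing (D s)] :
    Submonoid (∀ s, D s) where
  carrier := {e | ∃ s₀, ∀ s, s₀ ⊆ s → e s = 1}
  one_mem' := ⟨∅, fun _ _ => rfl⟩
  mul_mem' := by
    classical
    rintro a b ⟨s, hs⟩ ⟨t, ht⟩
    refine ⟨s ∪ t, fun r hr => ?_⟩
    rw [Pi.mul_apply, hs r (Finset.union_subset_left hr), ht r (Finset.union_subset_right hr),
        one_mul]

theorem eventuallyOne.eq_of_eventually {α : Type*} {D : Finset α → Type*} [∀ s, CommRing (D s)]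
    {L : Type*} [CommRing L] [Algebra (∀ s, D s) L] [IsLocalization (eventuallyOne D) L]
    {a b : ∀ s, D s} (s₀ : Finset α) (h : ∀ s, s₀ ⊆ s → a s = b s) :
    algebraMap (∀ s, D s) L a = algebraMap (∀ s, D s) L b := by
  classical
  refine (IsLocalization.eq_iff_exists (eventuallyOne D) L).2
    ⟨⟨fun s => if s₀ ⊆ s then 1 else 0, s₀, fun s hs => if_pos hs⟩, ?_⟩
  funext s
  by_cases hs : s₀ ⊆ s <;> simp [hs, h]

theorem exists_completeCM_of_isIntegral.{u} (p : ℕ) [hp : Fact p.Prime] {A : Type u} [CommRing A]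
    [IsNoetherianRing A] [IsLocalRing A] [IsDomain A] [CharZero A] [IsIntegrallyClosed A]
    {xs : List A} (hx : IsParam (⊥ : Ideal A) ((p : A) :: xs)) {T : Type u} [CommRing T]
    (b : PerfectBase p xs T) (U : Type u) [CommRing U] [IsDomain U] [Algebra A U] [FaithfulSMul A U]
    [Algebra.IsIntegral A U] :
    ∃ (E : Type u) (_ : CommRing E) (j : U →+* E),
      CompleteCM (j.comp (algebraMap A U)) ((p : A) :: xs) := by
  classical
  let K := FractionRing U
  have hinj : Function.Injective (algebraMap U K) := IsFractionRing.injective U K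
  have : FaithfulSMul A K := by
    rw [faithfulSMul_iff_algebraMap_injective, IsScalarTower.algebraMap_eq A U K]
    exact hinj.comp (FaithfulSMul.algebraMap_injective A U)
  have h (s : Finset U) := exists_subring_hom p hx b (L := K) (s.image (algebraMap U K)) (by
    intro r hr
    obtain ⟨u, _, rfl⟩ := Finset.mem_image.1 hr
    exact (Algebra.IsIntegral.isIntegral (R := A) u).map (IsScalarTower.toAlgHom A U K))
  choose D iD ψ V Ψ hψ hA hs hΨ using h
  let c : U → ∀ s, D s := fun u s => if h : algebraMap U K u ∈ V s then Ψ s ⟨_, h⟩ else 0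
  have hc : ∀ u s (h : algebraMap U K u ∈ V s), c u s = Ψ s ⟨_, h⟩ := fun u s h => dif_pos h
  have hV : ∀ u s, u ∈ s → algebraMap U K u ∈ V s := fun u s h =>
    hs s _ (Finset.mem_image_of_mem _ h)
  have hcA : ∀ a, c (algebraMap A U a) = fun s => ψ s a := by
    intro a
    funext s
    have h1 : algebraMap U K (algebraMap A U a) ∈ V s := by
      rw [← IsScalarTower.algebraMap_apply]; exact hA s a
    rw [hc _ _ h1, ← hΨ s a (hA s a)]
    congr 1
  let L := Localization (eventuallyOne D)
  let q : (∀ s, D s) →+* L := algebraMap _ L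
  let j : U →+* L :=
    { toFun := fun u => q (c u)
      map_one' := by
        have := hcA 1
        rw [map_one] at this
        rw [this]
        simp only [map_one]
        exact map_one q
      map_zero' := by
        have := hcA 0
        rw [map_zero] at this
        rw [this]
        simp only [map_zero]
        exact map_zero q
      map_mul' := fun u v => by
        rw [← map_mul]
        refine eventuallyOne.eq_of_eventually {u, v} fun s hs => ?_
        have hu := hV u s (hs (by simp))
        have hv := hV v s (hs (by simp))
        have huv : algebraMap U K (u * v) ∈ V s := by rw [map_mul]; exact mul_mem hu hv
        rw [Pi.mul_apply, hc _ _ hu, hc _ _ hv, hc _ _ huv, ← map_mul]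
        congr 1
        exact Subtype.ext (map_mul _ _ _)
      map_add' := fun u v => by
        rw [← map_add]
        refine eventuallyOne.eq_of_eventually {u, v} fun s hs => ?_
        have hu := hV u s (hs (by simp))
        have hv := hV v s (hs (by simp))
        have huv : algebraMap U K (u + v) ∈ V s := by rw [map_add]; exact add_mem hu hv
        rw [Pi.add_apply, hc _ _ hu, hc _ _ hv, hc _ _ huv, ← map_add]
        congr 1
        exact Subtype.ext (map_add _ _ _) }
  let ψ' : A →+* (∀ s, D s) := RingHom.pi ψ
  have hj : j.comp (algebraMap A U) = q.comp ψ' := by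
    ext a
    show q (c (algebraMap A U a)) = q (ψ' a)
    rw [hcA]
    rfl
  have hmap : ∀ (ys : List A) s, (ys.map ψ').map (· s) = ys.map (ψ s) := fun ys s => by
    rw [List.map_map]; rfl
  have hreg : RegMod ⊥ (((p : A) :: xs).map (j.comp (algebraMap A U))) := by
    have h1 : RegMod (⊥ : Ideal (∀ s, D s)) (((p : A) :: xs).map ψ') := by
      rw [← piIdeal_bot]
      refine RegMod.pi fun s => ?_
      rw [hmap]
      exact (hψ s).reg
    have h2 := h1.localization (D := L) (eventuallyOne D)
    rw [Ideal.map_bot, List.map_map] at h2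
    rw [hj]
    exact h2
  have hne : (maximalIdeal A).map (j.comp (algebraMap A U)) ≠ ⊤ := by
    rw [hj, ← Ideal.map_map]
    refine (IsLocalization.map_algebraMap_ne_top_iff_disjoint (eventuallyOne D) L _).2 ?_
    rw [Set.disjoint_left]
    rintro e ⟨s, hs⟩ he
    have h1 : (maximalIdeal A).map ψ' ≤ ((maximalIdeal A).map (ψ s)).comap (Pi.evalRingHom D s) := by
      rw [Ideal.map_le_iff_le_comap]
      intro x hx
      exact Ideal.mem_map_of_mem (ψ s) hx
    have h2 : e s ∈ (maximalIdeal A).map (ψ s) := h1 he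
    rw [hs s (Finset.Subset.refl s)] at h2
    exact (hψ s).ne_top ((Ideal.eq_top_iff_one _).2 h2)
  obtain ⟨E, _, i, hi, hE⟩ := exists_completeCM hx (j.comp (algebraMap A U)) Ideal.map_bot hreg hne
  exact ⟨E, inferInstance, i.comp j, hE⟩

end

section

open IsLocalRing Polynomial

section AIC

/-- Every monic polynomial of positive degree has a root. -/
def HasMonicRoots (U : Type*) [CommRing U] : Prop :=
  ∀ P : U[X], P.Monic → 0 < P.degree → ∃ a : U, P.IsRoot a

variable {U : Type*} [CommRing U]

theorem HasMonicRoots.exists_pow [Nontrivial U] (h : HasMonicRoots U) {n : ℕ} (hn : n ≠ 0) (v : U) :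
    ∃ u, u ^ n = v := by
  obtain ⟨a, ha⟩ := h (X ^ n - C v) (monic_X_pow_sub_C v hn) (by
    rw [degree_X_pow_sub_C (Nat.pos_of_ne_zero hn)]; exact_mod_cast Nat.pos_of_ne_zero hn)
  refine ⟨a, ?_⟩
  simpa [sub_eq_zero] using ha

theorem HasMonicRoots.of_surjective (h : HasMonicRoots U) {U' : Type*} [CommRing U'] [Nontrivial U']
    (χ : U →+* U') (hχ : Function.Surjective χ) : HasMonicRoots U' := by
  intro P hP hd
  obtain ⟨Q, hQ, hQd, hQm⟩ := lifts_and_degree_eq_and_monic (f := χ) (p := P)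
    ((lifts_iff_coeff_lifts P).2 fun n => hχ _) hP
  obtain ⟨a, ha⟩ := h Q hQm (by rwa [hQd])
  refine ⟨χ a, ?_⟩
  rw [← hQ]
  exact ha.map

theorem HasMonicRoots.mem_of_root (h : HasMonicRoots U) {K : Type*} [CommRing K] [IsDomain K]
    (φ : U →+* K) [Nontrivial U] {P : U[X]} (hP : P.Monic) {x : K} (hx : P.eval₂ φ x = 0) :
    ∃ u, φ u = x := by
  induction hn : P.natDegree generalizing P with
  | zero =>
    rw [hP.natDegree_eq_zero.1 hn, eval₂_one] at hx
    exact absurd hx one_ne_zero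
  | succ n ih =>
    obtain ⟨a, ha⟩ := h P hP (natDegree_pos_iff_degree_pos.1 (by omega))
    obtain ⟨Q, rfl⟩ := dvd_iff_isRoot.2 ha
    have hQ : Q.Monic := (monic_X_sub_C a).of_mul_monic_left hP
    rw [eval₂_mul, mul_eq_zero] at hx
    rcases hx with hx | hx
    · refine ⟨a, ?_⟩
      rw [eval₂_sub, eval₂_X, eval₂_C, sub_eq_zero] at hx
      exact hx.symm
    · refine ih hQ hx ?_
      rw [(monic_X_sub_C a).natDegree_mul hQ, natDegree_X_sub_C] at hn
      omega

theorem HasMonicRoots.isIntegrallyClosed [IsDomain U] (h : HasMonicRoots U) :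
    IsIntegrallyClosed U := by
  refine (isIntegrallyClosed_iff (FractionRing U)).2 fun {x} hx => ?_
  obtain ⟨P, hP, hPx⟩ := hx
  exact h.mem_of_root _ hP hPx

end AIC

theorem RegMod.iSup {C : Type*} [CommRing C] {I : ℕ → Ideal C} (hI : Monotone I) {xs : List C}
    (h : ∀ n, RegMod (I n) xs) : RegMod (⨆ n, I n) xs := by
  induction xs generalizing I with
  | nil => trivial
  | cons x xs ih =>
    refine ⟨fun b hb => ?_, ?_⟩
    · obtain ⟨n, hn⟩ := (Submodule.mem_iSup_of_directed I hI.directed_le).1 hb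
      exact Submodule.mem_iSup_of_mem n ((h n).1 b hn)
    · rw [iSup_sup]
      exact ih (fun a b hab => sup_le_sup_right (hI hab) _) fun n => (h n).2

theorem exists_mul_pow_mem_of_isIntegral {B U : Type*} [CommRing B] [CommRing U] (φ : B →+* U)
    (hφ : φ.IsIntegral) {P I : Ideal U} [P.IsPrime] (hI : P.comap φ ≤ I.comap φ) {v : U}
    (hv : v ∈ P) :
    ∃ h ∉ P, ∃ n, h * v ^ n ∈ I := by
  by_contra! hc
  have hd : Disjoint (I : Set U) (P.primeCompl ⊔ Submonoid.powers v : Submonoid U) := by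
    rw [Set.disjoint_left]
    intro x hx hx'
    obtain ⟨h, hh, _, ⟨n, rfl⟩, rfl⟩ := Submonoid.mem_sup.1 hx'
    exact hc h hh n hx
  obtain ⟨Q, hQ, hIQ, hdQ⟩ := Ideal.exists_le_prime_disjoint I _ hd
  rw [Set.disjoint_left] at hdQ
  have hQP : Q ≤ P := by
    intro x hx
    by_contra hxP
    exact hdQ hx ((le_sup_left : P.primeCompl ≤ _) hxP)
  have hvQ : v ∉ Q := fun h =>
    hdQ h ((le_sup_right : Submonoid.powers v ≤ P.primeCompl ⊔ _) (Submonoid.mem_powers v))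
  algebraize [φ]
  have := Ideal.comap_lt_comap_of_integral_mem_sdiff (R := B) hQP (x := v) ⟨hv, hvQ⟩ (hφ v)
  exact this.not_ge (hI.trans (Ideal.comap_mono hIQ))

end

section

open IsLocalRing Polynomial

/-- Constant-diagonal elements admitting `p^e`-th powers equal to a fixed element outside `P`. -/
def rootSeqs (p : ℕ) {U D : Type*} [CommRing U] [CommRing D] (τ : U →+* D) (P : Ideal U)
    [P.IsPrime] :
    Submonoid (ℕ → D) where
  carrier := {x | ∃ h ∉ P, ∃ u : ℕ → U, (∀ e, u e ^ p ^ e = h) ∧ ∀ e, x e = τ (u e)}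
  one_mem' := ⟨1, (Ideal.ne_top_iff_one P).1 (Ideal.IsPrime.ne_top inferInstance), fun _ => 1,
    fun _ => one_pow _, fun _ => (map_one τ).symm⟩
  mul_mem' := by
    rintro a b ⟨h, hh, u, hu, ha⟩ ⟨h', hh', u', hu', hb⟩
    refine ⟨h * h', ?_, fun e => u e * u' e, fun e => by rw [mul_pow, hu, hu'], fun e => ?_⟩
    · intro hc
      rcases Ideal.IsPrime.mem_or_mem inferInstance hc with hc | hc
      exacts [hh hc, hh' hc]
    · rw [Pi.mul_apply, ha, hb, map_mul]

theorem exists_kill_step.{u} (p : ℕ) [hp : Fact p.Prime] {B : Type*} [CommRing B]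
    [IsNoetherianRing B]
    [IsLocalRing B] {U : Type u} [CommRing U] [IsDomain U] (φ : B →+* U) (hφ : φ.IsIntegral)
    (hU : HasMonicRoots U) {C : Type u} [CommRing C] (j : U →+* C) {g : B} {xs : List B}
    (h : CompleteCM (j.comp φ) (g :: xs)) (hx : IsParam (RingHom.ker φ) (g :: xs))
    (hK : (RingHom.ker φ ⊔ Ideal.span {g}).IsPrime) :
    ∃ (P : Ideal U), P.IsPrime ∧ P.comap φ = RingHom.ker φ ⊔ Ideal.span {g} ∧
      ∃ (C' : Type u) (_ : CommRing C') (π : C →+* C'), P ≤ RingHom.ker (π.comp j) ∧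
        CompleteCM ((π.comp j).comp φ) xs := by
  classical
  have hxs : IsParam (RingHom.ker φ ⊔ Ideal.span {g}) xs :=
    ⟨fun x hx' => hx.mem x (List.mem_cons_of_mem _ hx'), by
      rw [← sup_ofList_cons]; exact hx.le_radical⟩
  -- compatible roots of `g`
  choose r hr using fun v : U => hU.exists_pow hp.out.ne_zero v
  let G : ℕ → U := fun e => r^[e] (φ g)
  have hG1 : ∀ e, G (e + 1) ^ p = G e := fun e => by
    show r^[e + 1] (φ g) ^ p = _
    rw [Function.iterate_succ_apply', hr]
  have hG : ∀ e, G e ^ p ^ e = φ g := by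
    intro e
    induction e with
    | zero => simp [G]
    | succ e ih => rw [pow_succ', pow_mul, hG1, ih]
  let I : ℕ → Ideal C := fun e => Ideal.span {j (G e)}
  have hI : Monotone I := by
    refine monotone_nat_of_le_succ fun e => ?_
    rw [Ideal.span_singleton_le_span_singleton, ← hG1 e, map_pow]
    exact dvd_pow_self _ hp.out.ne_zero
  have hreg : RegMod (⨆ e, I e) (xs.map (j.comp φ)) := by
    refine RegMod.iSup hI fun e => ?_
    have h1 : RegMod ⊥ (j (G e) ^ p ^ e :: xs.map (j.comp φ)) := by
      rw [← map_pow, hG]; exact h.reg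
    have h2 := (h1.of_pow_head (pow_ne_zero _ hp.out.ne_zero)).2
    rwa [bot_sup_eq] at h2
  obtain ⟨D, _, τ, hτ, hker⟩ := exists_quotient (⨆ e, I e)
  have hkerD : (RingHom.ker φ ⊔ Ideal.span {g}).map ((τ.comp j).comp φ) = ⊥ := by
    rw [← le_bot_iff, Ideal.map_le_iff_le_comap, ← RingHom.ker_eq_comap_bot]
    refine sup_le (fun b hb => ?_) ?_
    · rw [RingHom.mem_ker] at hb ⊢
      rw [RingHom.comp_apply, hb, map_zero]
    · rw [Ideal.span_singleton_le_iff_mem, RingHom.mem_ker]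
      show τ (j (φ g)) = 0
      rw [← RingHom.mem_ker, hker]
      refine Submodule.mem_iSup_of_mem 0 ?_
      exact Ideal.mem_span_singleton_self _
  have hregD : RegMod ⊥ (xs.map ((τ.comp j).comp φ)) := by
    have h1 : RegMod ((⊥ : Ideal D).comap τ) (xs.map (j.comp φ)) := by
      rw [← RingHom.ker_eq_comap_bot, hker]; exact hreg
    have h2 := (regMod_comap_iff τ hτ ⊥ _).1 h1
    rw [List.map_map] at h2
    exact h2
  have hmG : ∀ e, I e ≤ ((maximalIdeal B).map (j.comp φ)).radical := by
    intro e
    rw [Ideal.span_singleton_le_iff_mem]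
    refine ⟨p ^ e, ?_⟩
    rw [← map_pow, hG]
    exact Ideal.mem_map_of_mem (j.comp φ) (hx.mem g (by simp))
  have hneD : (maximalIdeal B).map ((τ.comp j).comp φ) ≠ ⊤ := by
    intro e
    rw [RingHom.comp_assoc, ← Ideal.map_map] at e
    have e1 := congrArg (Ideal.comap τ) e
    rw [Ideal.comap_map_of_surjective _ hτ, Ideal.comap_top, ← RingHom.ker_eq_comap_bot, hker] at e1
    have e2 : ((maximalIdeal B).map (j.comp φ)).radical = ⊤ := by
      rw [← top_le_iff, ← e1]
      exact sup_le Ideal.le_radical (iSup_le hmG)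
    exact h.ne_top (Ideal.radical_eq_top.1 e2)
  obtain ⟨E, _, i, hi, hE⟩ := exists_completeCM hxs ((τ.comp j).comp φ) hkerD hregD hneD
  have hEcomp : i.comp ((τ.comp j).comp φ) = (i.comp (τ.comp j)).comp φ := rfl
  have hkerE : (RingHom.ker φ ⊔ Ideal.span {g}).map (i.comp ((τ.comp j).comp φ)) = ⊥ := by
    rw [← Ideal.map_map, hkerD, Ideal.map_bot]
  have hcomapE : (RingHom.ker (i.comp (τ.comp j))).comap φ ≤ RingHom.ker φ ⊔ Ideal.span {g} := by
    intro b hb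
    by_contra hbK
    have := hE.nontrivial
    refine one_ne_zero (hE.reg_of_notMem hK hxs hkerE hbK (1 : E) ?_)
    rw [mul_one]
    exact hb
  obtain ⟨P, hPE, hP, hPc⟩ : ∃ P ≥ RingHom.ker (i.comp (τ.comp j)), P.IsPrime ∧
      P.comap φ = RingHom.ker φ ⊔ Ideal.span {g} := by
    algebraize [φ]
    exact Ideal.exists_ideal_over_prime_of_isIntegral (RingHom.ker φ ⊔ Ideal.span {g}) _ hcomapE
  refine ⟨P, hP, hPc, ?_⟩
  let M := rootSeqs p (τ.comp j) P
  let κ : D →+* (ℕ → D) := Pi.constRingHom ℕ D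
  let L := Localization M
  let χ : D →+* L := (algebraMap (ℕ → D) L).comp κ
  let ρ : B →+* D := (τ.comp j).comp φ
  have hmap : ∀ (ys : List D) (n : ℕ), (ys.map κ).map (fun x => x n) = ys := fun ys n => by
    rw [List.map_map]; exact List.map_id' _
  have h2 : RegMod (⊥ : Ideal L) (xs.map (χ.comp ρ)) := by
    have h1 : RegMod (⊥ : Ideal (ℕ → D)) ((xs.map ρ).map κ) := by
      rw [← piIdeal_bot]
      refine RegMod.pi fun n => ?_
      rw [hmap]
      exact hregD
    have := h1.localization (D := L) M
    rwa [Ideal.map_bot, List.map_map, List.map_map] at this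
  have h3 : (maximalIdeal B).map (χ.comp ρ) ≠ ⊤ := by
    have e0 : (maximalIdeal B).map (χ.comp ρ) =
        (((maximalIdeal B).map ρ).map κ).map (algebraMap (ℕ → D) L) := by
      rw [Ideal.map_map, Ideal.map_map]
    rw [e0]
    refine (IsLocalization.map_algebraMap_ne_top_iff_disjoint M L _).2 ?_
    rw [Set.disjoint_left]
    rintro x ⟨w, hw, u, hu, hxu⟩ hx'
    have h4 : ∀ e, τ (j (u e)) ∈ (maximalIdeal B).map ρ := by
      intro e
      have h5 : ((maximalIdeal B).map ρ).map κ ≤ ((maximalIdeal B).map ρ).comap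
          (Pi.evalRingHom (fun _ : ℕ => D) e) := by
        rw [Ideal.map_le_iff_le_comap]
        intro y hy
        exact hy
      have := h5 hx'
      rw [Ideal.mem_comap, Pi.evalRingHom_apply, hxu] at this
      exact this
    apply hw
    apply hPE
    rw [RingHom.mem_ker]
    have := hE.complete
    refine IsHausdorff.haus (I := (maximalIdeal B).map (i.comp ρ)) inferInstance _ fun k => ?_
    rw [SModEq.sub_mem, smul_eq_mul, Ideal.mul_top, sub_zero, ← Ideal.map_map, ← Ideal.map_pow]
    refine Ideal.mem_map_of_mem i ?_
    refine Ideal.pow_le_pow_right (Nat.lt_pow_self hp.out.one_lt).le (n := p ^ k) ?_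
    rw [RingHom.comp_apply, ← hu k, map_pow, map_pow]
    exact Ideal.pow_mem_pow (h4 k) _
  obtain ⟨C', _, i', hi', hC'⟩ := exists_completeCM hxs (χ.comp ρ)
    (by rw [← Ideal.map_map, hkerD, Ideal.map_bot]) h2 h3
  refine ⟨C', inferInstance, i'.comp (χ.comp τ), fun v hv => ?_, hC'⟩
  -- elements of `P` die
  obtain ⟨w, hw, n, u, hwu⟩ : ∃ w ∉ P, ∃ n u, w * v ^ n = u * φ g := by
    obtain ⟨w, hw, n, hn⟩ := exists_mul_pow_mem_of_isIntegral φ hφ (P := P) (I := Ideal.span {φ g})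
      (by
        rw [hPc]
        refine sup_le (fun b hb => ?_) ?_
        · rw [RingHom.mem_ker] at hb
          rw [Ideal.mem_comap, hb]; exact zero_mem _
        · rw [Ideal.span_singleton_le_iff_mem]
          exact Ideal.mem_span_singleton_self _) hv
    obtain ⟨u, hu⟩ := Ideal.mem_span_singleton'.1 hn
    exact ⟨w, hw, n, u, hu.symm⟩
  have := hU.isIntegrallyClosed
  choose s hs using fun e : ℕ => hU.exists_pow (pow_ne_zero e hp.out.ne_zero) w
  have hdvd : ∀ e, n ≤ p ^ e → G e ∣ s e * v := by
    intro e he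
    refine (IsIntegrallyClosed.pow_dvd_pow_iff (pow_ne_zero e hp.out.ne_zero)).1 ?_
    rw [hG, mul_pow, hs, ← Nat.sub_add_cancel he, pow_add, mul_comm (v ^ _), ← mul_assoc, hwu]
    exact ⟨u * v ^ (p ^ e - n), by ring⟩
  have hGD : ∀ e, τ (j (G e)) = 0 := by
    intro e
    rw [← RingHom.mem_ker, hker]
    exact Submodule.mem_iSup_of_mem e (Ideal.mem_span_singleton_self _)
  have hn : n ≤ p ^ n := (Nat.lt_pow_self hp.out.one_lt).le
  let t : ℕ → U := fun e => if e ≤ n then s n ^ p ^ (n - e) else s e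
  have ht : ∀ e, t e ^ p ^ e = w := by
    intro e
    by_cases he : e ≤ n
    · simp only [t, if_pos he]
      rw [← pow_mul, ← pow_add, Nat.sub_add_cancel he, hs]
    · simp only [t, if_neg he]
      exact hs e
  have htv : ∀ e, τ (j (t e)) * τ (j v) = 0 := by
    intro e
    rw [← map_mul, ← map_mul]
    have : ∃ e', G e' ∣ t e * v := by
      by_cases he : e ≤ n
      · refine ⟨n, (hdvd n hn).trans ?_⟩
        simp only [t, if_pos he]
        exact mul_dvd_mul_right (dvd_pow_self _ (pow_ne_zero _ hp.out.ne_zero)) _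
      · refine ⟨e, ?_⟩
        simp only [t, if_neg he]
        exact hdvd e (hn.trans (Nat.pow_le_pow_right hp.out.pos (le_of_not_ge he)))
    obtain ⟨e', c, hc⟩ := this
    rw [hc, map_mul, map_mul, hGD, zero_mul]
  have hχ : χ (τ (j v)) = 0 := by
    show algebraMap (ℕ → D) L (κ (τ (j v))) = 0
    rw [IsLocalization.map_eq_zero_iff M]
    exact ⟨⟨fun e => τ (j (t e)), w, hw, t, ht, fun e => rfl⟩, funext htv⟩
  rw [RingHom.mem_ker]
  show i' (χ (τ (j v))) = 0
  rw [hχ, map_zero]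

/-- Every partial ideal `q + (y_1, …, y_i)` is prime. -/
def PrimeChain {B : Type*} [CommRing B] : Ideal B → List B → Prop
  | _, [] => True
  | q, y :: ys => (q ⊔ Ideal.span {y}).IsPrime ∧ PrimeChain (q ⊔ Ideal.span {y}) ys

theorem exists_kill.{u} (p : ℕ) [hp : Fact p.Prime] {B : Type*} [CommRing B] [IsNoetherianRing B]
    [IsLocalRing B] {U : Type u} [CommRing U] [IsDomain U] (φ : B →+* U) (hφ : φ.IsIntegral)
    (hU : HasMonicRoots U) {C : Type u} [CommRing C] (j : U →+* C) {ys zs : List B}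
    (h : CompleteCM (j.comp φ) (ys ++ zs)) (hx : IsParam (RingHom.ker φ) (ys ++ zs))
    (hK : PrimeChain (RingHom.ker φ) ys) :
    ∃ (U' : Type u) (_ : CommRing U') (_ : IsDomain U') (χ : U →+* U') (C' : Type u)
        (_ : CommRing C')
      (π : C →+* C') (j' : U' →+* C'), Function.Surjective χ ∧
      RingHom.ker (χ.comp φ) = RingHom.ker φ ⊔ Ideal.ofList ys ∧ π.comp j = j'.comp χ ∧
      CompleteCM ((j'.comp χ).comp φ) zs := by
  induction ys generalizing U C with
  | nil =>
    exact ⟨U, inferInstance, inferInstance, RingHom.id U, C, inferInstance, RingHom.id C, j,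
      Function.surjective_id, by simp [Ideal.ofList_nil], rfl, h⟩
  | cons y ys ih =>
    obtain ⟨P, hP, hPc, C', _, π, hπ, hC'⟩ := exists_kill_step p φ hφ hU j h hx hK.1
    obtain ⟨V, _, χ, hχ, hker⟩ := exists_quotient P
    have hV : IsDomain V := by
      have : (RingHom.ker χ).IsPrime := hker ▸ hP
      exact (RingHom.quotientKerEquivOfSurjective hχ).toMulEquiv.symm.isDomain _
    let j' : V →+* C' := RingHom.liftOfSurjective χ hχ ⟨π.comp j, hker ▸ hπ⟩
    have hj' : j'.comp χ = π.comp j := RingHom.liftOfRightInverse_comp _ _ _ _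
    have hker' : RingHom.ker (χ.comp φ) = RingHom.ker φ ⊔ Ideal.span {y} := by
      rw [← RingHom.comap_ker, hker, hPc]
    obtain ⟨U', _, _, χ', C'', _, π', j'', h1, h2, h3, h4⟩ := ih (χ.comp φ)
      (hφ.trans _ _ (RingHom.isIntegral_of_surjective χ hχ)) (hU.of_surjective χ hχ) j'
      (by rw [← RingHom.comp_assoc, hj']; exact hC')
      ⟨fun x hx' => hx.mem x (List.mem_cons_of_mem _ hx'), by
        rw [hker', ← sup_ofList_cons]; exact hx.le_radical⟩ (by rw [hker']; exact hK.2)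
    refine ⟨U', inferInstance, inferInstance, χ'.comp χ, C'', inferInstance, π'.comp π, j'',
      h1.comp hχ, ?_, ?_, h4⟩
    · rw [RingHom.comp_assoc, h2, hker', sup_ofList_cons]
    · rw [RingHom.comp_assoc, ← hj', ← RingHom.comp_assoc, h3, RingHom.comp_assoc]

end

section

open Polynomial

section Good

variable {O K : Type*} [CommRing O] [Field K] (π : O →+* K) (p : ℕ)

/-- A subring on which the kernel of `π` is generated by `p`. -/
def IsPGood (Λ : Subring O) : Prop := ∀ x ∈ Λ, π x = 0 → ∃ y ∈ Λ, x = p * y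

theorem isPGood_adjoin {Λ : Subring O} (h : IsPGood π p Λ) {θ : O}
    (H : ∀ h : Λ[X], π (h.eval₂ Λ.subtype θ) = 0 →
      ∃ h' : Λ[X], (∀ i, π (h'.coeff i) = 0) ∧ h.eval₂ Λ.subtype θ = h'.eval₂ Λ.subtype θ) :
    IsPGood π p (eval₂RingHom Λ.subtype θ).range := by
  rintro _ ⟨g, rfl⟩ hg
  obtain ⟨h', h0, he⟩ := H g hg
  have h1 : ∀ i, ∃ y : Λ, h'.coeff i = p * y := by
    intro i
    obtain ⟨y, hy, e⟩ := h _ (h'.coeff i).2 (h0 i)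
    exact ⟨⟨y, hy⟩, Subtype.ext (by simpa using e)⟩
  obtain ⟨q, hq⟩ : C (p : Λ) ∣ h' := (C_dvd_iff_dvd_coeff _ _).2 h1
  refine ⟨eval₂RingHom Λ.subtype θ q, ⟨q, rfl⟩, ?_⟩
  change eval₂RingHom Λ.subtype θ g = _
  have : eval₂RingHom Λ.subtype θ g = eval₂RingHom Λ.subtype θ h' := he
  rw [this, hq, RingHom.map_mul]
  simp

theorem exists_isPGood [IsLocalHom π] (k : Subfield K) {S₀ : Subring O} (h₀ : IsPGood π p S₀)
    (hk : S₀.map π ≤ k.toSubring)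
    (H : ∀ Λ : Subring O, S₀ ≤ Λ → IsPGood π p Λ → ∀ k₀ : Subfield K, k₀.toSubring = Λ.map π →
      ∀ a ∈ k, a ∉ k₀ → ∃ θ, π θ = a ∧ ∀ h : Λ[X], π (h.eval₂ Λ.subtype θ) = 0 →
        ∃ h' : Λ[X], (∀ i, π (h'.coeff i) = 0) ∧
          h.eval₂ Λ.subtype θ = h'.eval₂ Λ.subtype θ) :
    ∃ Λ : Subring O, S₀ ≤ Λ ∧ IsPGood π p Λ ∧ Λ.map π = k.toSubring := by
  obtain ⟨Λ, hΛ₀, hΛ⟩ := zorn_le_nonempty₀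
    {Λ : Subring O | IsPGood π p Λ ∧ Λ.map π ≤ k.toSubring} (by
      intro c hc hch y hy
      refine ⟨sSup c, ⟨?_, ?_⟩, fun z hz => le_sSup hz⟩
      · intro x hx h
        obtain ⟨s, hs, hxs⟩ := (Subring.mem_sSup_of_directedOn ⟨y, hy⟩ hch.directedOn).1 hx
        obtain ⟨z, hz, e⟩ := (hc hs).1 x hxs h
        exact ⟨z, (le_sSup hs : s ≤ sSup c) hz, e⟩
      · rintro _ ⟨x, hx, rfl⟩
        obtain ⟨s, hs, hxs⟩ := (Subring.mem_sSup_of_directedOn ⟨y, hy⟩ hch.directedOn).1 hx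
        exact (hc hs).2 ⟨x, hxs, rfl⟩) S₀ ⟨h₀, hk⟩
  obtain ⟨hg, hk'⟩ := hΛ.prop
  have hinv : ∀ x u : O, u ∈ Λ → π u ≠ 0 → u * x ∈ Λ → x ∈ Λ := by
    let Λ' : Subring O :=
      { carrier := {x | ∃ u ∈ Λ, π u ≠ 0 ∧ u * x ∈ Λ}
        mul_mem' := by
          rintro a b ⟨u, hu, hu', h⟩ ⟨v, hv, hv', h'⟩
          refine ⟨u * v, Λ.mul_mem hu hv, by simp [hu', hv'], ?_⟩
          convert Λ.mul_mem h h' using 1; ring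
        one_mem' := ⟨1, Λ.one_mem, by simp, by simp⟩
        add_mem' := by
          rintro a b ⟨u, hu, hu', h⟩ ⟨v, hv, hv', h'⟩
          refine ⟨u * v, Λ.mul_mem hu hv, by simp [hu', hv'], ?_⟩
          convert Λ.add_mem (Λ.mul_mem hv h) (Λ.mul_mem hu h') using 1; ring
        zero_mem' := ⟨1, Λ.one_mem, by simp, by simp⟩
        neg_mem' := by
          rintro a ⟨u, hu, hu', h⟩
          exact ⟨u, hu, hu', by simpa using h⟩ }
    have hle : Λ ≤ Λ' := fun x hx => ⟨1, Λ.one_mem, by simp, by simpa using hx⟩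
    have hgood : IsPGood π p Λ' := by
      rintro x ⟨u, hu, hu', h⟩ hx
      obtain ⟨y, hy, e⟩ := hg _ h (by simp [hx])
      obtain ⟨w, rfl⟩ : IsUnit u := isUnit_of_map_unit π u (isUnit_iff_ne_zero.2 hu')
      refine ⟨↑w⁻¹ * y, ⟨w, hu, hu', by simpa using hy⟩, ?_⟩
      rw [mul_left_comm, ← e, ← mul_assoc]
      simp
    have hmap : Λ'.map π ≤ k.toSubring := by
      rintro _ ⟨x, ⟨u, hu, hu', h⟩, rfl⟩
      have h1 : π u ∈ k := hk' ⟨u, hu, rfl⟩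
      have h2 : π u * π x ∈ k := by
        rw [← π.map_mul]; exact hk' ⟨_, h, rfl⟩
      have := k.mul_mem (k.inv_mem h1) h2
      rwa [inv_mul_cancel_left₀ hu'] at this
    exact fun x u hu hu' h => hΛ.le_of_ge ⟨hgood, hmap⟩ hle ⟨u, hu, hu', h⟩
  let k₀ : Subfield K :=
    { Λ.map π with
      inv_mem' := by
        rintro _ ⟨x, hx, rfl⟩
        by_cases h0 : π x = 0
        · rw [h0, inv_zero]; exact (Λ.map π).zero_mem
        obtain ⟨w, rfl⟩ : IsUnit x := isUnit_of_map_unit π x (isUnit_iff_ne_zero.2 h0)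
        exact ⟨↑w⁻¹, hinv _ w hx h0 (by simp), by simp⟩ }
  refine ⟨Λ, hΛ₀, hg, le_antisymm hk' ?_⟩
  intro a ha
  by_contra hna
  obtain ⟨θ, rfl, hθ⟩ := H Λ hΛ₀ hg k₀ rfl a ha hna
  refine hna ⟨θ, hΛ.le_of_ge ⟨isPGood_adjoin π p hg hθ, ?_⟩ ?_ (⟨X, by simp⟩), rfl⟩
  · rintro _ ⟨_, ⟨g, rfl⟩, rfl⟩
    simp only [coe_eval₂RingHom, eval₂_eq_sum_range, map_sum, map_mul, map_pow]
    exact k.toSubring.sum_mem fun i _ => k.toSubring.mul_mem (hk' ⟨_, (g.coeff i).2, rfl⟩)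
      (k.toSubring.pow_mem ha _)
  · exact fun x hx => ⟨C ⟨x, hx⟩, by simp⟩

theorem eval₂_reduce_of_minpoly {Λ : Subring O} {k₀ : Subfield K}
    (hk₀ : k₀.toSubring = Λ.map π) {θ : O} {f : Λ[X]} (hf : f.Monic)
    (hθ : f.eval₂ Λ.subtype θ = 0) (hd : f.natDegree ≤ (minpoly k₀ (π θ)).natDegree)
    (h : Λ[X]) (hh : π (h.eval₂ Λ.subtype θ) = 0) :
    ∃ h' : Λ[X], (∀ i, π (h'.coeff i) = 0) ∧
      h.eval₂ Λ.subtype θ = h'.eval₂ Λ.subtype θ := by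
  have hmem : ∀ x : Λ, π x ∈ k₀ := fun x =>
    (hk₀.ge : Λ.map π ≤ k₀.toSubring) ⟨x, x.2, rfl⟩
  let ρ : Λ →+* k₀ := (π.comp Λ.subtype).codRestrict k₀ hmem
  have hev : h.eval₂ Λ.subtype θ = (h %ₘ f).eval₂ Λ.subtype θ := by
    conv_lhs => rw [← modByMonic_add_div h f]
    rw [eval₂_add, eval₂_mul, hθ, zero_mul, add_zero]
  refine ⟨h %ₘ f, ?_, hev⟩
  by_cases hf1 : f = 1
  · simp [hf1]
  have h0 : (h %ₘ f).map ρ = 0 := by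
    by_contra hne
    have h1 : aeval (π θ) ((h %ₘ f).map ρ) = 0 := by
      rw [hev, Polynomial.hom_eval₂] at hh
      rw [aeval_def, eval₂_map]
      exact hh
    have h2 := natDegree_le_of_dvd (minpoly.dvd k₀ _ h1) hne
    have h3 := (natDegree_map_le (p := h %ₘ f) (f := ρ)).trans_lt
      (natDegree_modByMonic_lt h hf hf1)
    omega
  intro i
  have := congrArg (fun q => q.coeff i) h0
  rw [coeff_map, coeff_zero] at this
  exact congrArg Subtype.val this

theorem eval₂_reduce_of_transcendental {Λ : Subring O} {k₀ : Subfield K}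
    (hk₀ : k₀.toSubring = Λ.map π) {θ : O} (hθ : Transcendental k₀ (π θ))
    (h : Λ[X]) (hh : π (h.eval₂ Λ.subtype θ) = 0) :
    ∃ h' : Λ[X], (∀ i, π (h'.coeff i) = 0) ∧
      h.eval₂ Λ.subtype θ = h'.eval₂ Λ.subtype θ := by
  have hmem : ∀ x : Λ, π x ∈ k₀ := fun x =>
    (hk₀.ge : Λ.map π ≤ k₀.toSubring) ⟨x, x.2, rfl⟩
  let ρ : Λ →+* k₀ := (π.comp Λ.subtype).codRestrict k₀ hmem
  refine ⟨h, ?_, rfl⟩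
  have h0 : h.map ρ = 0 := by
    refine (transcendental_iff.1 hθ) _ ?_
    rw [Polynomial.hom_eval₂] at hh
    rw [aeval_def, eval₂_map]
    exact hh
  intro i
  have := congrArg (fun q => q.coeff i) h0
  rw [coeff_map, coeff_zero] at this
  exact congrArg Subtype.val this

end Good

theorem HasMonicRoots.exists_root_lift {U : Type*} [CommRing U] (hU : HasMonicRoots U)
    {K : Type*} [CommRing K] [IsDomain K] (φ : U →+* K) {P : U[X]} (hP : P.Monic) {x : K}
    (hx : P.eval₂ φ x = 0) : ∃ u, φ u = x ∧ P.eval₂ (RingHom.id U) u = 0 := by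
  induction hn : P.natDegree using Nat.strong_induction_on generalizing P with
  | _ n ih =>
  by_cases h0 : P.natDegree = 0
  · rw [hP.natDegree_eq_zero.1 h0] at hx
    simp at hx
  obtain ⟨a, ha⟩ := hU P hP (natDegree_pos_iff_degree_pos.1 (Nat.pos_of_ne_zero h0))
  obtain ⟨Q, rfl⟩ := dvd_iff_isRoot.2 ha
  have hQ : Q.Monic := (monic_X_sub_C a).of_mul_monic_left hP
  rw [eval₂_mul] at hx
  rcases mul_eq_zero.1 hx with h | h
  · refine ⟨a, ?_, by simp⟩
    simp only [eval₂_sub, eval₂_X, eval₂_C] at h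
    exact (sub_eq_zero.1 h).symm
  · have : ((X - C a) * Q).natDegree = 1 + Q.natDegree := by
      have := (nontrivial_of_ne _ _ (fun h => h0 (by rw [h]; simp : _) : ((X - C a) * Q) ≠ 1))
      have : Nontrivial U := Polynomial.nontrivial_iff.1 this
      rw [(monic_X_sub_C a).natDegree_mul hQ, natDegree_X_sub_C]
    obtain ⟨u, hu, hr⟩ := ih Q.natDegree (by omega) hQ h rfl
    exact ⟨u, hu, by rw [eval₂_mul, hr, mul_zero]⟩

end

section

open Polynomial

theorem exists_isLocalHom_hasMonicRoots.{u} (D : Type u) [CommRing D] [IsDomain D]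
    [IsLocalRing D] : ∃ (O : Type u) (_ : CommRing O) (_ : IsDomain O) (_ : IsLocalRing O)
      (g : D →+* O), IsLocalHom g ∧ Function.Injective g ∧ HasMonicRoots O := by
  let Ω := AlgebraicClosure (FractionRing D)
  let g : D →+* Ω := (algebraMap (FractionRing D) Ω).comp (algebraMap D (FractionRing D))
  have hg : Function.Injective g :=
    (algebraMap (FractionRing D) Ω).injective.comp (IsFractionRing.injective D (FractionRing D))
  obtain ⟨B, hB⟩ := LocalSubring.exists_le_valuationSubring (LocalSubring.range g)
  obtain ⟨hle, hloc⟩ := LocalSubring.le_def.1 hB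
  have hmem : ∀ x, g x ∈ B := fun x => hle (⟨x, rfl⟩ : g x ∈ g.range)
  refine ⟨B, inferInstance, inferInstance, inferInstance, g.codRestrict B hmem, ?_, ?_, ?_⟩
  · constructor
    intro a ha
    have h1 : IsUnit (⟨g a, ⟨a, rfl⟩⟩ : (LocalSubring.range g).toSubring) := hloc.map_nonunit _ ha
    obtain ⟨⟨_, ⟨b, rfl⟩⟩, hb⟩ := isUnit_iff_exists_inv.1 h1
    have hb' : g a * g b = 1 := congrArg Subtype.val hb
    rw [← g.map_mul, ← g.map_one] at hb'
    exact IsUnit.of_mul_eq_one _ (hg hb')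
  · intro a b h
    exact hg (congrArg Subtype.val h)
  · intro P hP hd
    obtain ⟨x, hx⟩ := IsAlgClosed.exists_root (P.map (algebraMap B Ω))
      (by rw [hP.degree_map]; exact hd.ne')
    have hxi : IsIntegral B x := ⟨P, hP, by rwa [IsRoot, eval_map] at hx⟩
    obtain ⟨y, rfl⟩ := IsIntegrallyClosed.isIntegral_iff.1 hxi
    refine ⟨y, ?_⟩
    rw [IsRoot, eval_map, eval₂_at_apply] at hx
    exact (FaithfulSMul.algebraMap_injective B Ω) (by rw [hx, map_zero])

/-- `Λ` is a Cohen ring with residue field `k`. -/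
structure IsCohenRing (p : ℕ) {Λ k : Type*} [CommRing Λ] [CommRing k] (π : Λ →+* k) : Prop where
  surjective : Function.Surjective π
  ker : RingHom.ker π = Ideal.span {(p : Λ)}
  reg : ∀ b : Λ, p * b = 0 → b = 0
  complete : IsAdicComplete (Ideal.span {(p : Λ)}) Λ

theorem exists_subring_residue.{u} (p : ℕ) [Fact p.Prime] (k : Type u) [Field k] [CharP k p] :
    ∃ (Λ : Type u) (_ : CommRing Λ) (_ : IsDomain Λ) (π : Λ →+* k), Function.Surjective π ∧
      RingHom.ker π = Ideal.span {(p : Λ)} ∧ (p : Λ) ≠ 0 := by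
  let κ := AlgebraicClosure k
  have : CharP κ p := charP_of_injective_algebraMap (algebraMap k κ).injective p
  obtain ⟨O, _, _, _, g, hg, hinj, hO⟩ := exists_isLocalHom_hasMonicRoots (WittVector p κ)
  let π : O →+* IsLocalRing.ResidueField O := IsLocalRing.residue O
  have hπs : Function.Surjective π := IsLocalRing.residue_surjective
  have hgp : g (p : WittVector p κ) = (p : O) := map_natCast g p
  have hp : π p = 0 := by
    rw [IsLocalRing.residue_eq_zero_iff, IsLocalRing.mem_maximalIdeal, mem_nonunits_iff]
    intro h
    have h1 : IsUnit (p : WittVector p κ) := hg.map_nonunit _ (by rwa [hgp])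
    have h2 := h1.map (WittVector.constantCoeff : WittVector p κ →+* κ)
    simp at h2
  have hcs : Function.Surjective (WittVector.constantCoeff : WittVector p κ →+* κ) := fun a =>
    ⟨WittVector.teichmuller p a, by simp [WittVector.constantCoeff]⟩
  let ψ : κ →+* IsLocalRing.ResidueField O := RingHom.liftOfSurjective WittVector.constantCoeff hcs
    ⟨π.comp g, by
      rw [WittVector.ker_constantCoeff, Ideal.span_le, Set.singleton_subset_iff]
      change π (g _) = 0
      rw [hgp, hp]⟩
  let φ : k →+* IsLocalRing.ResidueField O := ψ.comp (algebraMap k κ)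
  have hp0 : (p : O) ≠ 0 := by
    intro h
    have : (p : WittVector p κ) = 0 := hinj (by rw [hgp, h, map_zero])
    exact WittVector.p_nonzero p κ this
  have hcharK : CharP (IsLocalRing.ResidueField O) p :=
    charP_of_injective_ringHom φ.injective p
  have hbot : IsPGood π p (⊥ : Subring O) := by
    intro x hx h
    obtain ⟨n, rfl⟩ := Subring.mem_bot.1 hx
    rw [map_intCast, CharP.intCast_eq_zero_iff _ p] at h
    obtain ⟨m, rfl⟩ := h
    exact ⟨m, Subring.mem_bot.2 ⟨m, rfl⟩, by push_cast; rfl⟩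
  obtain ⟨Λ, -, hΛ, hmap⟩ := exists_isPGood π p φ.fieldRange hbot (by
      rintro _ ⟨x, hx, rfl⟩
      obtain ⟨n, rfl⟩ := Subring.mem_bot.1 hx
      rw [map_intCast]
      exact intCast_mem _ n) (by
    intro Λ _ hΛ k₀ hk₀ a ha hna
    by_cases hint : IsIntegral k₀ a
    · have hsub : ∀ y : k₀, ∃ x : Λ, π x = y := by
        intro y
        obtain ⟨x, hx, e⟩ := (hk₀.le : k₀.toSubring ≤ Λ.map π) y.2
        exact ⟨⟨x, hx⟩, e⟩
      let ρ : Λ →+* k₀ := (π.comp Λ.subtype).codRestrict k₀ fun x =>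
        (hk₀.ge : Λ.map π ≤ k₀.toSubring) ⟨x, x.2, rfl⟩
      have hρ : Function.Surjective ρ := fun y => by
        obtain ⟨x, hx⟩ := hsub y
        exact ⟨x, Subtype.ext hx⟩
      obtain ⟨f, hf, hfd, hfm⟩ := lifts_and_natDegree_eq_and_monic
        ((mem_lifts _).2 (map_surjective ρ hρ (minpoly k₀ a))) (minpoly.monic hint)
      have h1 : (f.map Λ.subtype).eval₂ π a = 0 := by
        have h2 := minpoly.aeval k₀ a
        rw [← hf, aeval_def, eval₂_map] at h2
        rw [eval₂_map]
        exact h2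
      obtain ⟨θ, rfl, hθ⟩ := hO.exists_root_lift π (hfm.map Λ.subtype) h1
      rw [eval₂_map] at hθ
      exact ⟨θ, rfl, fun h hh => eval₂_reduce_of_minpoly π hk₀ hfm hθ hfd.le h hh⟩
    · obtain ⟨θ, rfl⟩ := hπs a
      exact ⟨θ, rfl, fun h hh => eval₂_reduce_of_transcendental π hk₀
        (fun h => hint h.isIntegral) h hh⟩)
  have hφ : ∀ x : Λ, π x ∈ φ.range := fun x =>
    (hmap.le : Λ.map π ≤ φ.fieldRange.toSubring) ⟨x, x.2, rfl⟩
  let e : k ≃+* φ.range := RingEquiv.ofBijective φ.rangeRestrict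
    ⟨fun a b h => φ.injective (congrArg Subtype.val h), φ.rangeRestrict_surjective⟩
  let π' : Λ →+* k := (e.symm : φ.range →+* k).comp ((π.comp Λ.subtype).codRestrict φ.range hφ)
  have hπ' : ∀ x : Λ, φ (π' x) = π x := by
    intro x
    have : e (π' x) = ⟨π x, hφ x⟩ := e.apply_symm_apply _
    exact congrArg Subtype.val this
  refine ⟨Λ, inferInstance, inferInstance, π', ?_, ?_, ?_⟩
  · intro a
    obtain ⟨x, hx, e⟩ := (hmap.ge : φ.fieldRange.toSubring ≤ Λ.map π) ⟨a, rfl⟩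
    exact ⟨⟨x, hx⟩, φ.injective (by rw [hπ']; exact e)⟩
  · ext x
    rw [RingHom.mem_ker, Ideal.mem_span_singleton, ← map_eq_zero_iff φ φ.injective, hπ']
    · constructor
      · intro h
        obtain ⟨y, hy, e⟩ := hΛ x x.2 h
        exact ⟨⟨y, hy⟩, Subtype.ext (by simpa using e)⟩
      · rintro ⟨y, rfl⟩
        simp [hp]
  · intro h
    exact hp0 (by simpa using congrArg Subtype.val h)

theorem exists_isCohenRing.{u} (p : ℕ) [Fact p.Prime] (k : Type u) [Field k] [CharP k p] :
    ∃ (Λ : Type u) (_ : CommRing Λ) (π : Λ →+* k), IsCohenRing p π := by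
  obtain ⟨Λ, _, _, π, hs, hk, h0⟩ := exists_subring_residue p k
  obtain ⟨E, _, i, hi⟩ := exists_isCompletion (C := Λ) (J := Ideal.span {(p : Λ)})
    ⟨{(p : Λ)}, by simp⟩
  have hmap : (Ideal.span {(p : Λ)}).map i = Ideal.span {(p : E)} := by
    rw [Ideal.map_span, Set.image_singleton, map_natCast]
  obtain ⟨ψ, hψ⟩ := hi.exists_lift π ⊥ (by
    rw [← hk, Ideal.map_le_iff_le_comap]
    exact le_rfl)
  have hψi : ∀ x, ψ (i x) = π x := fun x => by rw [← hψ]; rfl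
  have hψp : ψ p = 0 := by rw [map_natCast, CharP.cast_eq_zero]
  have hr := hi.regMod ⟨{(p : Λ)}, by simp⟩ (xs := [(p : Λ)])
    (by simp)
    (by rw [Ideal.ofList_singleton]; exact Ideal.le_radical)
    ⟨fun b hb => by simpa [h0] using hb, trivial⟩
  refine ⟨E, inferInstance, ψ, ?_, ?_, ?_, hmap ▸ hi.complete⟩
  · intro a
    obtain ⟨x, rfl⟩ := hs a
    exact ⟨i x, hψi x⟩
  · refine le_antisymm (fun x hx => ?_) ?_
    · obtain ⟨c, hc⟩ := hi.dense 1 x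
      rw [pow_one, hmap] at hc
      have h1 : ψ (x - i c) = 0 := by
        obtain ⟨y, hy⟩ := Ideal.mem_span_singleton.1 hc
        rw [hy, map_mul, hψp, zero_mul]
      have h2 : c ∈ RingHom.ker π := by
        rw [map_sub, RingHom.mem_ker.1 hx, zero_sub, neg_eq_zero, hψi] at h1
        exact h1
      rw [hk] at h2
      have h3 := Ideal.mem_map_of_mem i h2
      rw [hmap] at h3
      simpa using Ideal.add_mem _ hc h3
    · rw [Ideal.span_le, Set.singleton_subset_iff]
      exact hψp
  · intro b hb
    have := hr.1 b
    simpa [hb] using this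

end

section

open Polynomial

theorem exists_residue_section (p : ℕ) [hp : Fact p.Prime] {E k : Type*} [CommRing E] [CharP E p]
    [Field k] (π : E →+* k) (hπ : Function.Surjective π) (h2 : ∀ x, π x = 0 → x ^ 2 = 0) :
    ∃ S : Subring E, (∀ x ∈ S, π x = 0 → x = 0) ∧ S.map π = ⊤ := by
  have hpow : ∀ x, π x = 0 → x ^ p = 0 := fun x hx =>
    pow_eq_zero_of_le hp.out.two_le (h2 x hx)
  have hloc : IsLocalHom π := by
    constructor
    intro a ha
    obtain ⟨b, hb⟩ := hπ (π a)⁻¹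
    have h1 : π (a * b - 1) = 0 := by
      rw [map_sub, map_mul, hb, mul_inv_cancel₀ ha.ne_zero, map_one, sub_self]
    have h3 : IsNilpotent (a * b - 1) := ⟨2, h2 _ h1⟩
    have h4 : IsUnit (a * b) := by simpa using h3.isUnit_add_one
    exact isUnit_of_mul_isUnit_left h4
  have hgood : IsPGood π p (frobenius E p).range := by
    rintro _ ⟨x, rfl⟩ hx
    rw [frobenius_def, map_pow] at hx
    refine ⟨0, Subring.zero_mem _, ?_⟩
    rw [frobenius_def, hpow x (pow_eq_zero_iff hp.out.ne_zero |>.1 hx), mul_zero]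
  obtain ⟨S, -, hS, hmap⟩ := exists_isPGood π p ⊤ hgood (fun _ _ => trivial) (by
    intro Λ hΛ hg k₀ hk₀ a _ hna
    obtain ⟨θ, rfl⟩ := hπ a
    refine ⟨θ, rfl, fun h hh => ?_⟩
    have hθ : θ ^ p ∈ Λ := hΛ ⟨θ, rfl⟩
    have hθ' : π θ ^ p ∈ k₀ := by
      have : π (θ ^ p) ∈ Λ.map π := ⟨_, hθ, rfl⟩
      rw [← hk₀, map_pow] at this
      exact this
    have hch : CharP k₀ p := by
      have : CharP k p := charP_of_natCast_eq_zero p (by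
        rw [← map_natCast π, CharP.cast_eq_zero, map_zero])
      exact (RingHom.charP_iff_charP k₀.subtype p).2 this
    have hmin : minpoly k₀ (π θ) = X ^ p - C (⟨π θ ^ p, hθ'⟩ : k₀) := by
      refine (minpoly.eq_of_irreducible_of_monic ?_ ?_ (monic_X_pow_sub_C _ hp.out.ne_zero)).symm
      · refine X_pow_sub_C_irreducible_of_prime hp.out fun b hb => hna ?_
        have h3 : (b : k) ^ p = π θ ^ p := congrArg Subtype.val hb
        have : CharP k p := charP_of_injective_ringHom k₀.subtype.injective p
        rw [← frobenius_inj k p h3]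
        exact b.2
      · simp only [map_sub, map_pow, aeval_X, aeval_C]
        exact sub_self _
    have hm : (X ^ p - C (⟨θ ^ p, hθ⟩ : Λ)).Monic := monic_X_pow_sub_C _ hp.out.ne_zero
    refine eval₂_reduce_of_minpoly π hk₀ hm (by simp) ?_ h hh
    have : Nontrivial Λ := ⟨0, 1, fun h => by simpa using congrArg (fun x : Λ => π x) h⟩
    rw [hmin, natDegree_X_pow_sub_C, natDegree_X_pow_sub_C])
  refine ⟨S, fun x hx h => ?_, by rw [hmap]; rfl⟩
  obtain ⟨y, _, rfl⟩ := hS x hx h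
  rw [CharP.cast_eq_zero, zero_mul]

theorem IsCohenRing.exists_lift_of_sq {p : ℕ} [hp : Fact p.Prime] {Λ k : Type*} [CommRing Λ]
    [Field k] {π : Λ →+* k} (h : IsCohenRing p π) {B B' : Type*} [CommRing B] [CommRing B']
    {χ : B →+* B'} (hχ : Function.Surjective χ) (hsq : ∀ a b, χ a = 0 → χ b = 0 → a * b = 0)
    (hpz : ∀ a, χ a = 0 → p * a = 0) (l₀ : Λ →+* B') : ∃ l : Λ →+* B, χ.comp l = l₀ := by
  have hπp : π p = 0 := by
    rw [← RingHom.mem_ker, h.ker]; exact Ideal.mem_span_singleton_self _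
  let E : Subring (Λ × B) :=
    RingHom.eqLocus (l₀.comp (RingHom.fst Λ B)) (χ.comp (RingHom.snd Λ B))
  let f : E →+* Λ := (RingHom.fst Λ B).comp E.subtype
  let g : E →+* B := (RingHom.snd Λ B).comp E.subtype
  have hfg : ∀ e, χ (g e) = l₀ (f e) := fun e => e.2.symm
  have hf : Function.Surjective f := fun x => by
    obtain ⟨b, hb⟩ := hχ (l₀ x)
    exact ⟨⟨(x, b), hb.symm⟩, rfl⟩
  have hext : ∀ e e' : E, f e = f e' → g e = g e' → e = e' := fun e e' h1 h2 =>
    Subtype.ext (Prod.ext h1 h2)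
  obtain ⟨E', _, q, hq, hker⟩ := exists_quotient (Ideal.span {(p : E)})
  have hqp : q p = 0 := by
    rw [← RingHom.mem_ker, hker]; exact Ideal.mem_span_singleton_self _
  let π' : E' →+* k := RingHom.liftOfSurjective q hq ⟨π.comp f, by
    rw [hker, Ideal.span_le, Set.singleton_subset_iff]
    change π (f p) = 0
    rw [map_natCast f, hπp]⟩
  have hπ' : ∀ e, π' (q e) = π (f e) := fun e =>
    RingHom.liftOfRightInverse_comp_apply _ _ _ _ e
  have hπ's : Function.Surjective π' := fun a => by
    obtain ⟨x, rfl⟩ := h.surjective a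
    obtain ⟨e, rfl⟩ := hf x
    exact ⟨q e, hπ' e⟩
  have hE' : CharP E' p := by
    have h1 : (p : E') = 0 := by rw [← map_natCast q, hqp]
    have : Nontrivial E' := π'.domain_nontrivial
    exact charP_of_natCast_eq_zero p h1
  have hpart : ∀ e, π (f e) = 0 → ∃ c d, e = p * c + d ∧ f d = 0 := by
    intro e he
    rw [← RingHom.mem_ker, h.ker] at he
    obtain ⟨y, hy⟩ := Ideal.mem_span_singleton.1 he
    obtain ⟨c, rfl⟩ := hf y
    exact ⟨c, e - p * c, by ring, by rw [map_sub, hy, map_mul, map_natCast, sub_self]⟩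
  obtain ⟨S, hS, hSm⟩ := exists_residue_section p π' hπ's (by
    intro x hx
    obtain ⟨e, rfl⟩ := hq x
    rw [hπ'] at hx
    obtain ⟨c, d, rfl, hd⟩ := hpart e hx
    rw [map_add, map_mul, hqp, zero_mul, zero_add, ← map_pow]
    have : d ^ 2 = 0 := hext _ _ (by rw [map_pow, hd]; simp) (by
      have h1 : χ (g d) = 0 := by rw [hfg, hd, map_zero]
      rw [pow_two, map_mul, hsq _ _ h1 h1, map_zero])
    rw [this, map_zero])
  let ES : Subring E := S.comap q
  let F : ES →+* Λ := f.comp ES.subtype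
  have hF : Function.Bijective F := by
    constructor
    · refine (injective_iff_map_eq_zero F).2 fun e he => Subtype.ext ?_
      have he' : f e = 0 := he
      have h1 : q e = 0 := hS _ e.2 (by rw [hπ', he', map_zero])
      rw [← RingHom.mem_ker, hker] at h1
      obtain ⟨y, hy⟩ := Ideal.mem_span_singleton.1 h1
      refine hext _ _ (by rw [he']; simp) ?_
      rw [hy, map_mul, map_natCast] at he'
      have h3 := h.reg _ he'
      rw [hy, map_mul, map_natCast, hpz _ (by rw [hfg, h3, map_zero])]
      simp
    · intro x
      obtain ⟨e, rfl⟩ := hf x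
      obtain ⟨s, hs, hse⟩ : π (f e) ∈ S.map π' := by rw [hSm]; trivial
      obtain ⟨e', rfl⟩ := hq s
      rw [hπ', eq_comm, ← sub_eq_zero, ← map_sub, ← map_sub] at hse
      obtain ⟨c, d, hcd, hd⟩ := hpart _ hse
      refine ⟨⟨e' + p * c, ?_⟩, ?_⟩
      · change q _ ∈ S
        rw [map_add, map_mul, hqp, zero_mul, add_zero]
        exact hs
      · change f _ = _
        have : e = e' + p * c + d := by linear_combination hcd
        rw [this]
        exact ((RingHom.map_add f _ _).trans (by rw [hd, add_zero]; rfl)).symm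
  let G := RingEquiv.ofBijective F hF
  refine ⟨(g.comp ES.subtype).comp (G.symm : Λ →+* ES), RingHom.ext fun x => ?_⟩
  change χ (g (G.symm x)) = l₀ x
  rw [hfg]
  exact congrArg l₀ (G.apply_symm_apply x)

end

theorem IsCohenRing.exists_lift {p : ℕ} [hp : Fact p.Prime] {Λ k : Type*} [CommRing Λ]
    [Field k] {π : Λ →+* k} (h : IsCohenRing p π) {B B' : Type*} [CommRing B] [CommRing B']
    {χ : B →+* B'} (hχ : Function.Surjective χ) (hc : IsAdicComplete (RingHom.ker χ) B)
    (hpB : χ p = 0) (l₀ : Λ →+* B') : ∃ l : Λ →+* B, χ.comp l = l₀ := by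
  set J := RingHom.ker χ with hJ
  have hpJ : (p : B) ∈ J := hpB
  have step : ∀ n (l : Λ →+* B ⧸ J ^ (n + 1)), ∃ l' : Λ →+* B ⧸ J ^ (n + 1 + 1),
      (Ideal.Quotient.factorPow J (n + 1).le_succ).comp l' = l := by
    intro n l
    have hker : ∀ a, Ideal.Quotient.factorPow J (n + 1).le_succ a = 0 →
        ∃ b ∈ J ^ (n + 1), Ideal.Quotient.mk (J ^ (n + 1 + 1)) b = a := by
      intro a ha
      obtain ⟨b, rfl⟩ := Ideal.Quotient.mk_surjective a
      exact ⟨b, Ideal.Quotient.eq_zero_iff_mem.1 ha, rfl⟩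
    refine h.exists_lift_of_sq (Ideal.Quotient.factor_surjective _) ?_ ?_ l
    · intro a b ha hb
      obtain ⟨a, ha', rfl⟩ := hker a ha
      obtain ⟨b, hb', rfl⟩ := hker b hb
      rw [← map_mul, Ideal.Quotient.eq_zero_iff_mem]
      have := Ideal.mul_mem_mul ha' hb'
      rw [← pow_add] at this
      exact Ideal.pow_le_pow_right (by omega) this
    · intro a ha
      obtain ⟨a, ha', rfl⟩ := hker a ha
      rw [← map_natCast (Ideal.Quotient.mk (J ^ (n + 1 + 1))), ← map_mul,
        Ideal.Quotient.eq_zero_iff_mem, pow_succ']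
      exact Ideal.mul_mem_mul hpJ ha'
  choose s hs using step
  let t : B' →+* B ⧸ J ^ (0 + 1) := RingHom.liftOfSurjective χ hχ
    ⟨Ideal.Quotient.mk (J ^ (0 + 1)), by rw [Ideal.mk_ker, zero_add, pow_one]⟩
  have ht : ∀ b, t (χ b) = Ideal.Quotient.mk _ b := fun b =>
    RingHom.liftOfRightInverse_comp_apply _ _ _ _ b
  let f : ∀ n, Λ →+* B ⧸ J ^ (n + 1) := fun n => Nat.rec (t.comp l₀) (fun n l => s n l) n
  have ha : StrictMono (fun n : ℕ => n + 1) := fun a b h => Nat.succ_lt_succ h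
  refine ⟨IsAdicComplete.StrictMono.liftRingHom J ha f fun {m} => hs m (f m),
    RingHom.ext fun x => ?_⟩
  have h1 := IsAdicComplete.StrictMono.mk_liftRingHom J ha f (fun {m} => hs m (f m)) (n := 0) x
  obtain ⟨b, hb⟩ := hχ (l₀ x)
  have h2 : f 0 x = Ideal.Quotient.mk _ b := by
    change t (l₀ x) = _
    rw [← hb, ht]
  rw [h2, Ideal.Quotient.eq, zero_add, pow_one] at h1
  have h3 := RingHom.mem_ker.1 (hJ.le h1)
  rw [map_sub, sub_eq_zero, hb] at h3
  exact h3

section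

open PowerSeries IsLocalRing

/-- A separated and complete decreasing filtration by ideals. -/
structure CompleteFiltration {D : Type*} [CommRing D] (F : ℕ → Ideal D) : Prop where
  anti : Antitone F
  haus : ∀ b, (∀ n, b ∈ F n) → b = 0
  lim : ∀ f : ℕ → D, (∀ n, f (n + 1) - f n ∈ F n) → ∃ L, ∀ n, L - f n ∈ F n

theorem completeFiltration_pow {D : Type*} [CommRing D] (J : Ideal D) [IsAdicComplete J D] :
    CompleteFiltration fun n => J ^ n where
  anti := fun _ _ h => Ideal.pow_le_pow_right h
  haus := fun b hb => by simpa using closedIn_bot J b fun n => by simpa using hb n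
  lim := fun f hf => exists_limit J f hf

theorem isAdicComplete_of_completeFiltration {D : Type*} [CommRing D] (J : Ideal D)
    (h : CompleteFiltration fun n => J ^ n) : IsAdicComplete J D where
  haus' := fun b hb => h.haus b fun n => by
    have := hb n
    rwa [SModEq.sub_mem, smul_eq_mul, Ideal.mul_top, sub_zero] at this
  prec' := fun f hf => by
    obtain ⟨L, hL⟩ := h.lim f fun n => by
      have := (hf (Nat.le_succ n)).symm
      rwa [SModEq.sub_mem, smul_eq_mul, Ideal.mul_top] at this
    refine ⟨L, fun n => SModEq.symm ?_⟩
    rw [SModEq.sub_mem, smul_eq_mul, Ideal.mul_top]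
    exact hL n

theorem CompleteFiltration.sub_mem {D : Type*} [CommRing D] {F : ℕ → Ideal D}
    (h : CompleteFiltration F) {f : ℕ → D} (hf : ∀ n, f (n + 1) - f n ∈ F n) {m n : ℕ}
    (hmn : m ≤ n) : f n - f m ∈ F m := by
  induction n, hmn using Nat.le_induction with
  | base => simp
  | succ n hmn ih =>
    have := Ideal.add_mem _ (h.anti hmn (hf n)) ih
    simpa using this

/-- A homomorphism from a ring to a filtered complete ring extends to the completion. -/
theorem IsCompletion.exists_lift_filtration {C E : Type*} [CommRing C] [CommRing E] {J : Ideal C}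
    {i : C →+* E} (h : IsCompletion J i) {D : Type*} [CommRing D] (φ : C →+* D)
    {F : ℕ → Ideal D} (hF : CompleteFiltration F) (hJ : ∀ N, ∃ M, (J ^ M).map φ ≤ F N) :
    ∃ ψ : E →+* D, ψ.comp i = φ := by
  choose M hM using hJ
  have key : ∀ N c, i c ∈ J.map i ^ M N → φ c ∈ F N := fun N c hc =>
    hM N (Ideal.mem_map_of_mem φ (h.comap_pow _ c hc))
  let S : ℕ → ℕ := fun N => ∑ k ∈ Finset.range (N + 1), M k
  have hS : ∀ N, M N ≤ S N := fun N =>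
    Finset.single_le_sum (f := M) (fun _ _ => Nat.zero_le _) (Finset.self_mem_range_succ N)
  have hS' : ∀ N, S N ≤ S (N + 1) := fun N => by
    simp only [S]; rw [Finset.sum_range_succ _ (N + 1)]; omega
  have ex : ∀ b : E, ∃ L : D, ∀ N c, b - i c ∈ J.map i ^ S N → L - φ c ∈ F N := fun b => by
    choose c hc using fun N => h.dense (S N) b
    obtain ⟨L, hL⟩ := hF.lim (fun N => φ (c N)) fun N => by
      rw [← map_sub]
      apply key
      rw [map_sub]
      have h1 := Ideal.pow_le_pow_right (hS' N) (hc (N + 1))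
      have := Ideal.sub_mem _ (hc N) h1
      rw [sub_sub_sub_cancel_left] at this
      exact Ideal.pow_le_pow_right (hS N) this
    refine ⟨L, fun N d hd => ?_⟩
    have h1 : φ (c N) - φ d ∈ F N := by
      rw [← map_sub]
      apply key
      rw [map_sub]
      have := Ideal.sub_mem _ hd (hc N)
      rw [sub_sub_sub_cancel_left] at this
      exact Ideal.pow_le_pow_right (hS N) this
    simpa using Ideal.add_mem _ (hL N) h1
  choose ψ hψ using ex
  have uniq : ∀ b L, (∀ N, ∃ c, b - i c ∈ J.map i ^ S N ∧ L - φ c ∈ F N) → ψ b = L :=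
    fun b L hL => by
    rw [← sub_eq_zero]
    refine hF.haus _ fun N => ?_
    obtain ⟨c, hc, hc'⟩ := hL N
    simpa using Ideal.sub_mem _ (hψ b N c hc) hc'
  have hi : ∀ c, ψ (i c) = φ c := fun c => uniq _ _ fun N => ⟨c, by simp, by simp⟩
  refine ⟨{ toFun := ψ, map_one' := ?_, map_zero' := ?_, map_mul' := ?_, map_add' := ?_ }, ?_⟩
  · simpa using hi 1
  · intro a b
    refine uniq _ _ fun N => ?_
    obtain ⟨c, hc⟩ := h.dense (S N) a
    obtain ⟨d, hd⟩ := h.dense (S N) b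
    refine ⟨c * d, ?_, ?_⟩
    · rw [map_mul, show a * b - i c * i d = (a - i c) * b + i c * (b - i d) by ring]
      exact Ideal.add_mem _ (Ideal.mul_mem_right _ _ hc) (Ideal.mul_mem_left _ _ hd)
    · rw [map_mul, show ψ a * ψ b - φ c * φ d = (ψ a - φ c) * ψ b + φ c * (ψ b - φ d) by ring]
      exact Ideal.add_mem _ (Ideal.mul_mem_right _ _ (hψ a N c hc))
        (Ideal.mul_mem_left _ _ (hψ b N d hd))
  · simpa using hi 0
  · intro a b
    refine uniq _ _ fun N => ?_
    obtain ⟨c, hc⟩ := h.dense (S N) a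
    obtain ⟨d, hd⟩ := h.dense (S N) b
    refine ⟨c + d, ?_, ?_⟩
    · rw [map_add, add_sub_add_comm]
      exact Ideal.add_mem _ hc hd
    · rw [map_add, add_sub_add_comm]
      exact Ideal.add_mem _ (hψ a N c hc) (hψ b N d hd)
  · exact RingHom.ext hi

theorem isCompletion_coeToPowerSeries (B : Type*) [CommRing B] :
    IsCompletion (Ideal.span {(Polynomial.X : Polynomial B)})
      (Polynomial.coeToPowerSeries.ringHom (R := B)) := by
  have hmap : (Ideal.span {(Polynomial.X : Polynomial B)}).map
      (Polynomial.coeToPowerSeries.ringHom (R := B)) = Ideal.span {(X : B⟦X⟧)} := by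
    rw [Ideal.map_span, Set.image_singleton, Polynomial.coeToPowerSeries.ringHom_apply,
      Polynomial.coe_X]
  have hmem : ∀ n (a : B⟦X⟧), a ∈ Ideal.span {(X : B⟦X⟧)} ^ n ↔ ∀ m < n, coeff m a = 0 :=
    fun n a => by rw [Ideal.span_singleton_pow, Ideal.mem_span_singleton, X_pow_dvd_iff]
  refine ⟨?_, fun n c hc => ?_, fun n b => ?_⟩
  · rw [hmap]
    refine isAdicComplete_of_completeFiltration _ ⟨fun _ _ h => Ideal.pow_le_pow_right h,
      fun b hb => ?_, fun f hf => ?_⟩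
    · ext m
      exact (hmem (m + 1) b).1 (hb _) m (Nat.lt_succ_self m)
    · refine ⟨PowerSeries.mk fun m => coeff m (f (m + 1)), fun n => (hmem n _).2 fun m hm => ?_⟩
      rw [map_sub, coeff_mk]
      induction n, (show m + 1 ≤ n from hm) using Nat.le_induction with
      | base => simp
      | succ n hn ih =>
        have h1 := (hmem n _).1 (hf n) m hn
        rw [map_sub] at h1
        have h2 := ih hn
        rw [← sub_add_sub_cancel _ (coeff m (f n)), h2, zero_add, ← neg_sub, h1, neg_zero]
  · rw [hmap, hmem] at hc
    rw [Ideal.span_singleton_pow, Ideal.mem_span_singleton, Polynomial.X_pow_dvd_iff]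
    intro d hd
    simpa using hc d hd
  · refine ⟨trunc n b, ?_⟩
    rw [hmap, hmem]
    intro m hm
    rw [map_sub, Polynomial.coeToPowerSeries.ringHom_apply, Polynomial.coeff_coe, coeff_trunc,
      if_pos hm, sub_self]

/-- `A` is a formal power series ring over `Λ` in the variables `xs`. -/
structure IsFormalPower {Λ A : Type} [CommRing Λ] [CommRing A] (ι : Λ →+* A) (xs : List A) :
    Prop where
  exists_hom : ∀ {D : Type} [CommRing D] {F : ℕ → Ideal D}, CompleteFiltration F →
    ∀ (l : Λ →+* D) (bs : List D), bs.length = xs.length → (∀ b ∈ bs, ∀ N, ∃ M, b ^ M ∈ F N) →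
    ∃ φ : A →+* D, φ.comp ι = l ∧ xs.map φ = bs
  hom_ext : ∀ {D : Type} [CommRing D] {F : ℕ → Ideal D}, CompleteFiltration F →
    ∀ (φ ψ : A →+* D), φ.comp ι = ψ.comp ι → xs.map φ = xs.map ψ →
    (∀ x ∈ xs, ∀ N, ∃ M, φ x ^ M ∈ F N) → φ = ψ

theorem isFormalPower_id (Λ : Type) [CommRing Λ] : IsFormalPower (RingHom.id Λ) [] where
  exists_hom := fun _ l bs hbs _ => ⟨l, l.comp_id, by
    rw [List.length_nil, List.length_eq_zero_iff] at hbs; simp [hbs]⟩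
  hom_ext := fun _ φ ψ h _ _ => h

theorem IsFormalPower.powerSeries {Λ B : Type} [CommRing Λ] [CommRing B] {ι : Λ →+* B}
    {xs : List B} (h : IsFormalPower ι xs) :
    IsFormalPower ((C (R := B)).comp ι) (X :: xs.map (C (R := B))) where
  exists_hom := by
    intro D _ F hF l bs hbs hb
    obtain _ | ⟨b, bs⟩ := bs
    · simp at hbs
    obtain ⟨φ, hφ, hx⟩ := h.exists_hom hF l bs (by simpa using hbs)
      fun c hc => hb c (List.mem_cons_of_mem _ hc)
    obtain ⟨ψ, hψ⟩ := (isCompletion_coeToPowerSeries B).exists_lift_filtration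
      (Polynomial.eval₂RingHom φ b) hF (fun N => by
        obtain ⟨M, hM⟩ := hb b List.mem_cons_self N
        refine ⟨M, ?_⟩
        rw [Ideal.span_singleton_pow, Ideal.map_span, Set.image_singleton, Ideal.span_le,
          Set.singleton_subset_iff]
        simpa using hM)
    have hψC : ψ.comp (C (R := B)) = φ := by
      ext a
      have := RingHom.congr_fun hψ (Polynomial.C a)
      simpa using this
    have hψX : ψ X = b := by
      have := RingHom.congr_fun hψ Polynomial.X
      simpa using this
    refine ⟨ψ, by rw [← RingHom.comp_assoc, hψC, hφ], ?_⟩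
    rw [List.map_cons, hψX, List.map_map, ← hx, ← hψC]
    rfl
  hom_ext := by
    intro D _ F hF φ ψ hι hx hn
    rw [List.map_cons, List.map_cons, List.cons.injEq, List.map_map, List.map_map] at hx
    have hC : φ.comp (C (R := B)) = ψ.comp (C (R := B)) :=
      h.hom_ext hF _ _ hι hx.2 fun x hx' N =>
        hn (C x) (List.mem_cons_of_mem _ (List.mem_map_of_mem hx')) N
    have hpoly : φ.comp (Polynomial.coeToPowerSeries.ringHom (R := B)) =
        ψ.comp (Polynomial.coeToPowerSeries.ringHom (R := B)) := by
      refine Polynomial.ringHom_ext (fun a => ?_) ?_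
      · simpa using RingHom.congr_fun hC a
      · simpa using hx.1
    ext a
    rw [← sub_eq_zero]
    refine hF.haus _ fun N => ?_
    obtain ⟨M, hM⟩ := hn X List.mem_cons_self N
    obtain ⟨c, hc⟩ := (isCompletion_coeToPowerSeries B).dense M a
    rw [Ideal.map_span, Set.image_singleton, Polynomial.coeToPowerSeries.ringHom_apply,
      Polynomial.coe_X, Ideal.span_singleton_pow, Ideal.mem_span_singleton] at hc
    obtain ⟨d, hd⟩ := hc
    have h1 : φ a - ψ a = φ X ^ M * (φ d - ψ d) := by
      have h2 := RingHom.congr_fun hpoly c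
      simp only [RingHom.comp_apply] at h2
      have h3 : φ a - φ (Polynomial.coeToPowerSeries.ringHom c) = φ X ^ M * φ d := by
        rw [← map_sub, hd, map_mul, map_pow]
      have h4 : ψ a - ψ (Polynomial.coeToPowerSeries.ringHom c) = φ X ^ M * ψ d := by
        rw [← map_sub, hd, map_mul, map_pow, hx.1]
      rw [mul_sub, ← h3, ← h4, h2]
      ring
    rw [h1]
    exact Ideal.mul_mem_right _ _ hM

end

section

open PowerSeries IsLocalRing

section PowerSeries

variable {B : Type*} [CommRing B] [IsLocalRing B]

omit [IsLocalRing B] in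
theorem isLocalHom_constantCoeff : IsLocalHom (constantCoeff (R := B)) :=
  ⟨fun _ ha => isUnit_iff_constantCoeff.2 ha⟩

theorem isLocalRing_powerSeries : IsLocalRing B⟦X⟧ := by
  have := isLocalHom_constantCoeff (B := B)
  exact RingHom.domain_isLocalRing (constantCoeff (R := B))

theorem mem_maximalIdeal_powerSeries [IsLocalRing B⟦X⟧] {a : B⟦X⟧} :
    a ∈ maximalIdeal B⟦X⟧ ↔ constantCoeff a ∈ maximalIdeal B := by
  rw [mem_maximalIdeal, mem_maximalIdeal, mem_nonunits_iff, mem_nonunits_iff,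
    isUnit_iff_constantCoeff]

theorem maximalIdeal_powerSeries [IsLocalRing B⟦X⟧] :
    maximalIdeal B⟦X⟧ = Ideal.span {(X : B⟦X⟧)} ⊔ (maximalIdeal B).map (C (R := B)) := by
  refine le_antisymm (fun a ha => ?_) (sup_le ?_ ?_)
  · rw [eq_X_mul_shift_add_const a]
    refine Ideal.add_mem _ ?_ ?_
    · exact Ideal.mul_mem_right _ _ (Ideal.mem_sup_left (Ideal.mem_span_singleton_self _))
    · exact Ideal.mem_sup_right (Ideal.mem_map_of_mem _ (mem_maximalIdeal_powerSeries.1 ha))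
  · rw [Ideal.span_le, Set.singleton_subset_iff]
    exact mem_maximalIdeal_powerSeries.2 (by simp)
  · rw [Ideal.map_le_iff_le_comap]
    intro b hb
    rw [Ideal.mem_comap, mem_maximalIdeal_powerSeries]
    simpa using hb

theorem mem_maximalIdeal_pow_powerSeries [IsLocalRing B⟦X⟧] {n : ℕ} {a : B⟦X⟧} :
    a ∈ maximalIdeal B⟦X⟧ ^ n ↔ ∀ i, coeff i a ∈ maximalIdeal B ^ (n - i) := by
  constructor
  · intro ha
    induction n generalizing a with
    | zero => simp
    | succ n ih =>
      rw [pow_succ'] at ha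
      refine Submodule.mul_induction_on ha (fun c hc d hd i => ?_) fun c d hc hd i => ?_
      · rw [coeff_mul]
        refine Ideal.sum_mem _ fun jk hjk => ?_
        rw [Finset.HasAntidiagonal.mem_antidiagonal] at hjk
        obtain ⟨_ | j, k⟩ := jk
        · have h1 : coeff 0 c ∈ maximalIdeal B := by
            simpa using mem_maximalIdeal_powerSeries.1 hc
          have h2 := Ideal.mul_mem_mul h1 (ih hd k)
          rw [← pow_succ'] at h2
          exact Ideal.pow_le_pow_right (by simp at hjk; omega) h2
        · exact Ideal.mul_mem_left _ _ (Ideal.pow_le_pow_right (by simp at hjk; omega) (ih hd k))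
      · rw [map_add]
        exact Ideal.add_mem _ (hc i) (hd i)
  · intro ha
    induction n generalizing a with
    | zero => simp
    | succ n ih =>
      rw [eq_X_mul_shift_add_const a]
      refine Ideal.add_mem _ ?_ ?_
      · rw [pow_succ']
        refine Ideal.mul_mem_mul (mem_maximalIdeal_powerSeries.2 (by simp)) (ih fun i => ?_)
        rw [coeff_mk]
        simpa using ha (i + 1)
      · have h0 := ha 0
        rw [coeff_zero_eq_constantCoeff_apply, Nat.sub_zero] at h0
        have h1 := Ideal.mem_map_of_mem (C (R := B)) h0
        rw [Ideal.map_pow] at h1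
        refine Ideal.pow_right_mono ?_ _ h1
        rw [maximalIdeal_powerSeries]
        exact le_sup_right

theorem isAdicComplete_powerSeries [IsLocalRing B⟦X⟧] [IsAdicComplete (maximalIdeal B) B] :
    IsAdicComplete (maximalIdeal B⟦X⟧) B⟦X⟧ := by
  have hB := completeFiltration_pow (maximalIdeal B)
  refine isAdicComplete_of_completeFiltration _ ⟨fun _ _ h => Ideal.pow_le_pow_right h,
      fun b hb => ?_, fun f hf => ?_⟩
  · ext i
    refine hB.haus _ fun n => ?_
    simpa using mem_maximalIdeal_pow_powerSeries.1 (hb (n + i)) i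
  · have ex : ∀ i, ∃ L, ∀ n, L - coeff i (f (n + i)) ∈ maximalIdeal B ^ n := fun i =>
      hB.lim (fun n => coeff i (f (n + i))) fun n => by
        have := mem_maximalIdeal_pow_powerSeries.1 (hf (n + i)) i
        rw [map_sub, Nat.add_sub_cancel] at this
        rwa [add_right_comm]
    choose L hL using ex
    refine ⟨PowerSeries.mk L, fun n => mem_maximalIdeal_pow_powerSeries.2 fun i => ?_⟩
    rw [map_sub, coeff_mk]
    rcases le_total i n with h | h
    · have := hL i (n - i)
      rwa [Nat.sub_add_cancel h] at this
    · simp [Nat.sub_eq_zero_of_le h]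

end PowerSeries

theorem ofList_map_C {B : Type*} [CommRing B] (xs : List B) :
    Ideal.ofList (xs.map (C (R := B))) = (Ideal.ofList xs).map (C (R := B)) :=
  (Ideal.map_ofList _ _).symm

theorem regMod_powerSeries {B : Type*} [CommRing B] {zs : List B} (h : RegMod ⊥ zs) :
    RegMod ⊥ ((X : B⟦X⟧) :: zs.map (C (R := B))) := by
  refine ⟨fun b hb => ?_, ?_⟩
  · rw [Ideal.mem_bot] at hb ⊢
    rw [← sub_eq_zero]
    ext n
    have := congrArg (coeff (n + 1)) hb
    rw [coeff_succ_X_mul] at this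
    simpa using this
  · have hker : (⊥ : Ideal B).comap (constantCoeff (R := B)) = ⊥ ⊔ Ideal.span {(X : B⟦X⟧)} := by
      ext a
      rw [bot_sup_eq, Ideal.mem_span_singleton, X_dvd_iff, Ideal.mem_comap, Ideal.mem_bot]
    rw [← hker]
    refine (regMod_comap_iff _ constantCoeff_surj ⊥ _).2 ?_
    rw [List.map_map]
    convert h
    conv_rhs => rw [← List.map_id zs]
    congr 1

theorem exists_isFormalPower (Λ : Type) [CommRing Λ] [IsNoetherianRing Λ] [IsLocalRing Λ]
    [IsAdicComplete (maximalIdeal Λ) Λ] {zs : List Λ} (hm : maximalIdeal Λ = Ideal.ofList zs)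
    (hreg : RegMod ⊥ zs) (n : ℕ) :
    ∃ (A : Type) (_ : CommRing A) (_ : IsNoetherianRing A) (_ : IsLocalRing A) (ι : Λ →+* A)
      (xs : List A), xs.length = n ∧ IsFormalPower ι xs ∧ IsAdicComplete (maximalIdeal A) A ∧
      maximalIdeal A = Ideal.ofList (xs ++ zs.map ι) ∧ RegMod ⊥ (xs ++ zs.map ι) := by
  induction n with
  | zero =>
    refine ⟨Λ, inferInstance, inferInstance, inferInstance, RingHom.id Λ, [], rfl,
      isFormalPower_id Λ, inferInstance, ?_, ?_⟩
    · simpa using hm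
    · simpa using hreg
  | succ n ih =>
    obtain ⟨B, _, _, _, ι, xs, hn, h, hc, hB, hr⟩ := ih
    have := isLocalRing_powerSeries (B := B)
    have e : X :: xs.map (C (R := B)) ++ zs.map ((C (R := B)).comp ι) =
        X :: (xs ++ zs.map ι).map (C (R := B)) := by
      simp
    refine ⟨B⟦X⟧, inferInstance, inferInstance, this, (C (R := B)).comp ι,
      X :: xs.map (C (R := B)), by simp [hn], h.powerSeries, isAdicComplete_powerSeries, ?_, ?_⟩
    · rw [e, Ideal.ofList_cons, ofList_map_C, ← hB, maximalIdeal_powerSeries]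
    · rw [e]
      exact regMod_powerSeries hr

end

section

open IsLocalRing

/-- `A` is completely integrally closed (in its total ring of fractions). -/
def ComplIntClosed (A : Type*) [CommRing A] : Prop :=
  ∀ a b c : A, b ≠ 0 → c ≠ 0 → (∀ n, b ^ n ∣ c * a ^ n) → b ∣ a

theorem maximalIdeal_eq_map_of_surjective {A Q : Type*} [CommRing A] [IsLocalRing A] [CommRing Q]
    [IsLocalRing Q] (χ : A →+* Q) (hχ : Function.Surjective χ) :
    maximalIdeal Q = (maximalIdeal A).map χ := by
  ext y
  obtain ⟨a, rfl⟩ := hχ y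
  rw [mem_maximalIdeal_map_iff hχ]
  refine ⟨fun h => Ideal.mem_map_of_mem χ h, fun h => ?_⟩
  obtain ⟨b, hb, e⟩ := (Ideal.mem_map_iff_of_surjective χ hχ).1 h
  rw [← mem_maximalIdeal_map_iff hχ, ← e]
  exact (mem_maximalIdeal_map_iff hχ).2 hb

section

variable {A : Type*} [CommRing A] [IsNoetherianRing A] [IsLocalRing A]

theorem closedIn_maximalIdeal (I : Ideal A) {b : A}
    (hb : ∀ n, b ∈ I ⊔ maximalIdeal A ^ n) : b ∈ I := by
  by_cases hI : I = ⊤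
  · rw [hI]; trivial
  obtain ⟨Q, _, χ, hχ, hker⟩ := exists_quotient I
  have : Nontrivial Q := by
    rw [nontrivial_iff]
    refine ⟨0, 1, fun h => hI ?_⟩
    rw [← hker, Ideal.eq_top_iff_one, RingHom.mem_ker, map_one, h]
  have : IsNoetherianRing Q := isNoetherianRing_of_surjective _ _ χ hχ
  have : IsLocalRing Q := IsLocalRing.of_surjective' χ hχ
  rw [← hker, RingHom.mem_ker, ← Ideal.mem_bot, ← Ideal.iInf_pow_eq_bot_of_isLocalRing
    (maximalIdeal Q) (Ideal.IsMaximal.ne_top inferInstance), Ideal.mem_iInf]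
  intro n
  have h1 := Ideal.mem_map_of_mem χ (hb n)
  rw [Ideal.map_sup, Ideal.map_pow, (Ideal.map_eq_bot_iff_le_ker χ).2 hker.ge, bot_sup_eq] at h1
  rwa [maximalIdeal_eq_map_of_surjective χ hχ]

end

section

variable {A : Type*} [CommRing A] [IsNoetherianRing A] [IsLocalRing A] {x : A}

theorem exists_eq_pow_mul_of_mem_maximalIdeal (hx : x ∈ maximalIdeal A) {a : A} (ha : a ≠ 0) :
    ∃ n a', a = x ^ n * a' ∧ ¬ x ∣ a' := by
  have hf : FiniteMultiplicity x a := by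
    by_contra h
    rw [FiniteMultiplicity.not_iff_forall] at h
    refine ha ?_
    have := closedIn_maximalIdeal (⊥ : Ideal A) (b := a) fun n => by
      rw [bot_sup_eq]
      exact Ideal.mem_of_dvd _ (h n) (Ideal.pow_mem_pow hx n)
    simpa using this
  obtain ⟨c, hc, hc'⟩ := hf.exists_eq_pow_mul_and_not_dvd
  exact ⟨_, c, hc, hc'⟩

theorem isDomain_of_prime (hx : x ∈ maximalIdeal A) (hreg : ∀ b, x * b = 0 → b = 0)
    (hp : ∀ a b, x ∣ a * b → x ∣ a ∨ x ∣ b) : IsDomain A := by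
  have hpow : ∀ n b, x ^ n * b = 0 → b = 0 := fun n => by
    induction n with
    | zero => simp
    | succ n ih => intro b hb; rw [pow_succ, mul_assoc] at hb; exact hreg _ (ih _ hb)
  have : NoZeroDivisors A := ⟨fun {a b} hab => by
    by_contra h
    rw [not_or] at h
    obtain ⟨m, a', rfl, ha'⟩ := exists_eq_pow_mul_of_mem_maximalIdeal hx h.1
    obtain ⟨n, b', rfl, hb'⟩ := exists_eq_pow_mul_of_mem_maximalIdeal hx h.2
    have h0 : a' * b' = 0 := hpow (m + n) _ (by rw [← hab]; ring)
    rcases hp a' b' (h0 ▸ dvd_zero x) with h | h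
    · exact ha' h
    · exact hb' h⟩
  exact NoZeroDivisors.to_isDomain A

theorem complIntClosed_of_prime [IsDomain A] (hx : x ∈ maximalIdeal A) (hp : Prime x)
    (hq : ∀ a b c : A, ¬ x ∣ b → ¬ x ∣ c → (∀ n, ∃ r s, c * a ^ n = b ^ n * r + x * s) →
      ∃ r s, a = b * r + x * s) : ComplIntClosed A := by
  have swap : ∀ b, ¬ x ∣ b → ∀ n k y, b ^ n ∣ x ^ k * y → b ^ n ∣ y := by
    intro b hb n k
    induction k with
    | zero => simp
    | succ k ih =>
      intro y hy
      refine ih y ?_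
      rw [pow_succ', mul_assoc] at hy
      obtain ⟨d, hd⟩ := hy
      rcases hp.dvd_or_dvd (Dvd.intro _ hd) with h | ⟨e, rfl⟩
      · exact (hb (hp.dvd_of_dvd_pow h)).elim
      · exact ⟨e, mul_left_cancel₀ hp.ne_zero (by rw [hd]; ring)⟩
  have core : ∀ b c, ¬ x ∣ b → ¬ x ∣ c → ∀ a, (∀ n, b ^ n ∣ c * a ^ n) → b ∣ a := by
    intro b c hb hc a ha
    have step : ∀ k a, (∀ n, b ^ n ∣ c * a ^ n) → a ∈ Ideal.span {b} ⊔ maximalIdeal A ^ k := by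
      intro k
      induction k with
      | zero => intro a _; simp
      | succ k ih =>
        intro a ha
        obtain ⟨r, s, e⟩ := hq a b c hb hc fun n => by
          obtain ⟨r, hr⟩ := ha n
          exact ⟨r, 0, by rw [hr]; ring⟩
        have hs : ∀ n, b ^ n ∣ c * s ^ n := fun n => by
          refine swap b hb n n _ ?_
          have e1 : x ^ n * (c * s ^ n) = ∑ m ∈ Finset.range (n + 1),
              c * (a ^ m * (-(b * r)) ^ (n - m) * (n.choose m)) := by
            rw [← Finset.mul_sum, ← add_pow, e]
            ring
          rw [e1]
          refine Finset.dvd_sum fun m hm => ?_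
          have hmn : m ≤ n := Nat.lt_succ_iff.1 (Finset.mem_range.1 hm)
          have h1 : b ^ n ∣ (c * a ^ m) * (-(b * r)) ^ (n - m) := by
            conv_lhs => rw [← Nat.add_sub_cancel' hmn, pow_add]
            exact mul_dvd_mul (ha m) (pow_dvd_pow_of_dvd (Dvd.dvd.neg_right (Dvd.intro _ rfl)) _)
          rw [mul_assoc (a ^ m), ← mul_assoc c, ← mul_assoc (c * a ^ m)]
          exact h1.mul_right _
        rw [e]
        refine Ideal.add_mem _ (Ideal.mem_sup_left
          (Ideal.mul_mem_right _ _ (Ideal.mem_span_singleton_self b))) ?_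
        have h2 := ih s hs
        obtain ⟨u, hu, v, hv, e3⟩ := Submodule.mem_sup.1 h2
        rw [← e3, mul_add]
        refine Ideal.add_mem _ (Ideal.mem_sup_left (Ideal.mul_mem_left _ _ hu))
          (Ideal.mem_sup_right ?_)
        rw [pow_succ']
        exact Ideal.mul_mem_mul hx hv
    exact Ideal.mem_span_singleton.1 (closedIn_maximalIdeal _ fun k => step k a ha)
  intro a b c hb hc h
  rcases eq_or_ne a 0 with rfl | ha
  · exact dvd_zero b
  obtain ⟨k, c', rfl, hc'⟩ := exists_eq_pow_mul_of_mem_maximalIdeal hx hc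
  obtain ⟨l, b', rfl, hb'⟩ := exists_eq_pow_mul_of_mem_maximalIdeal hx hb
  obtain ⟨j, a', rfl, ha'⟩ := exists_eq_pow_mul_of_mem_maximalIdeal hx ha
  have hlj : l ≤ j := by
    by_contra hlj
    rw [not_le] at hlj
    obtain ⟨d, hd⟩ := h (k + 1)
    have e1 : k + j * (k + 1) + 1 ≤ l * (k + 1) := by nlinarith
    obtain ⟨t, ht⟩ := Nat.exists_eq_add_of_le e1
    have e2 : x ^ (k + j * (k + 1)) * (c' * a' ^ (k + 1)) =
        x ^ (k + j * (k + 1)) * (x * (x ^ t * b' ^ (k + 1) * d)) := by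
      rw [mul_pow, mul_pow, ← pow_mul, ← pow_mul, ht] at hd
      linear_combination hd
    have e3 := mul_left_cancel₀ (pow_ne_zero _ hp.ne_zero) e2
    rcases hp.dvd_or_dvd (Dvd.intro _ e3.symm) with h | h
    · exact hc' h
    · exact ha' (hp.dvd_of_dvd_pow h)
  obtain ⟨i, rfl⟩ := Nat.exists_eq_add_of_le hlj
  have := core b' c' hb' hc' (x ^ i * a') fun n => by
    refine swap b' hb' n k _ ?_
    obtain ⟨d, hd⟩ := h n
    refine ⟨d, mul_left_cancel₀ (pow_ne_zero (l * n) hp.ne_zero) ?_⟩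
    rw [mul_pow, mul_pow, ← pow_mul, ← pow_mul] at hd
    rw [mul_pow, ← pow_mul]
    linear_combination hd
  obtain ⟨d, hd⟩ := this
  exact ⟨d, by rw [pow_add, mul_assoc, hd]; ring⟩

end

theorem ComplIntClosed.isIntegrallyClosed {A : Type*} [CommRing A] [IsDomain A]
    (h : ComplIntClosed A) : IsIntegrallyClosed A := by
  rw [isIntegrallyClosed_iff (FractionRing A)]
  intro z hz
  obtain ⟨a, b, hb, rfl⟩ := IsFractionRing.div_surjective (A := A) z
  have hb0 : b ≠ 0 := nonZeroDivisors.ne_zero hb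
  have hinj := IsFractionRing.injective A (FractionRing A)
  have hbK : algebraMap A (FractionRing A) b ≠ 0 := by simpa using hb0
  obtain ⟨P, hP, hPz⟩ := hz
  suffices b ∣ a by
    obtain ⟨d, rfl⟩ := this
    exact ⟨d, by rw [map_mul]; field_simp⟩
  set z : FractionRing A := algebraMap A (FractionRing A) a / algebraMap A (FractionRing A) b
  have hbz : algebraMap A (FractionRing A) b * z = algebraMap A (FractionRing A) a := by
    simp only [z]; field_simp
  -- every power of `z` is a combination of the first `P.natDegree` powers
  have hpow : ∀ n, ∃ r : Polynomial A, r.natDegree ≤ P.natDegree ∧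
      z ^ n = r.eval₂ (algebraMap A (FractionRing A)) z := fun n => by
    refine ⟨Polynomial.X ^ n %ₘ P, Polynomial.natDegree_modByMonic_le _ hP, ?_⟩
    have h1 := Polynomial.modByMonic_add_div (Polynomial.X ^ n : Polynomial A) P
    have h2 := congrArg (Polynomial.eval₂ (algebraMap A (FractionRing A)) z) h1
    simp only [Polynomial.eval₂_add, Polynomial.eval₂_mul, hPz, zero_mul, add_zero,
      Polynomial.eval₂_pow, Polynomial.eval₂_X] at h2
    exact h2.symm
  refine h a b (b ^ P.natDegree) hb0 (pow_ne_zero _ hb0) fun n => ?_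
  obtain ⟨r, hr, hrn⟩ := hpow n
  refine ⟨∑ i ∈ Finset.range (P.natDegree + 1), r.coeff i * (a ^ i * b ^ (P.natDegree - i)),
    hinj ?_⟩
  rw [map_mul, map_mul, map_pow (algebraMap A (FractionRing A)) a, ← hbz, mul_pow, hrn,
    Polynomial.eval₂_eq_sum_range' _ (Nat.lt_succ_of_le hr), map_sum]
  simp only [map_mul, map_pow, ← hbz, Finset.mul_sum]
  refine Finset.sum_congr rfl fun i hi => ?_
  have hi' := Nat.add_sub_cancel' (Nat.lt_succ_iff.1 (Finset.mem_range.1 hi))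
  rw [mul_pow]
  conv_lhs => rw [← hi', pow_add]
  ring

/-- A noetherian local ring whose maximal ideal is generated by a regular sequence is a
completely integrally closed domain. -/
theorem isDomain_and_complIntClosed {A : Type*} [CommRing A] [IsNoetherianRing A] [IsLocalRing A]
    {zs : List A} (h : RegMod ⊥ zs) (hm : maximalIdeal A = Ideal.ofList zs) :
    IsDomain A ∧ ComplIntClosed A := by
  obtain ⟨n, hn⟩ : ∃ n, zs.length = n := ⟨_, rfl⟩
  induction n generalizing A with
  | zero =>
    rw [List.length_eq_zero_iff] at hn
    subst hn
    rw [Ideal.ofList_nil] at hm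
    have hf : IsField A := (isField_iff_maximalIdeal_eq).2 hm
    have hd := hf.isDomain
    refine ⟨hd, fun a b c hb _ _ => ?_⟩
    obtain ⟨d, hd⟩ := hf.mul_inv_cancel hb
    exact ⟨d * a, by rw [← mul_assoc, hd, one_mul]⟩
  | succ n ih =>
    obtain _ | ⟨x, zs⟩ := zs
    · simp at hn
    have hx : x ∈ maximalIdeal A := by
      rw [hm, Ideal.ofList_cons]
      exact Ideal.mem_sup_left (Ideal.mem_span_singleton_self x)
    obtain ⟨Q, _, χ, hχ, hker⟩ := exists_quotient (Ideal.span {x})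
    have hk : ∀ a, χ a = 0 ↔ x ∣ a := fun a => by
      rw [← RingHom.mem_ker, hker, Ideal.mem_span_singleton]
    have : Nontrivial Q := by
      rw [nontrivial_iff]
      refine ⟨0, 1, fun h => ?_⟩
      rw [eq_comm, ← map_one χ, hk] at h
      exact (mem_maximalIdeal _).1 hx (isUnit_of_dvd_one h)
    have : IsNoetherianRing Q := isNoetherianRing_of_surjective _ _ χ hχ
    have : IsLocalRing Q := IsLocalRing.of_surjective' χ hχ
    have hmQ : maximalIdeal Q = Ideal.ofList (zs.map χ) := by
      rw [maximalIdeal_eq_map_of_surjective χ hχ, hm, Ideal.map_ofList, List.map_cons,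
        (hk x).2 dvd_rfl, Ideal.ofList_cons, Ideal.span_singleton_eq_bot.2 rfl, bot_sup_eq]
    have hr : RegMod ⊥ (zs.map χ) := by
      refine (regMod_comap_iff χ hχ ⊥ _).1 ?_
      rw [← RingHom.ker_eq_comap_bot, hker]
      simpa using h.2
    obtain ⟨hd, hc⟩ := ih hr hmQ (by simpa using hn)
    have hA : IsDomain A :=
        isDomain_of_prime hx (fun b hb => by simpa using h.1 b (by simpa using hb))
      fun a b hab => by
        rw [← hk, map_mul, mul_eq_zero, hk, hk] at hab
        exact hab
    have hx0 : x ≠ 0 := by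
      rintro rfl
      exact one_ne_zero (α := A) (by simpa using h.1 1 (by simp))
    have hxp : Prime x := ⟨hx0, (mem_maximalIdeal _).1 hx, fun a b hab => by
        rw [← hk, map_mul, mul_eq_zero, hk, hk] at hab
        exact hab⟩
    refine ⟨hA, complIntClosed_of_prime hx hxp fun a b c hb hc' hn => ?_⟩
    rw [← hk] at hb hc'
    obtain ⟨e, he⟩ := hc (χ a) (χ b) (χ c) hb hc' fun n => by
      obtain ⟨r, s, e⟩ := hn n
      have := congrArg χ e
      rw [map_add, map_mul χ x, (hk x).2 dvd_rfl, zero_mul, add_zero, map_mul, map_mul, map_pow,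
        map_pow] at this
      exact ⟨_, this⟩
    obtain ⟨r, rfl⟩ := hχ e
    have : χ (a - b * r) = 0 := by rw [map_sub, map_mul, he, sub_self]
    obtain ⟨s, hs⟩ := (hk _).1 this
    exact ⟨r, s, by rw [← hs]; ring⟩

end

section

open IsLocalRing

theorem isPrime_of_regMod {A : Type*} [CommRing A] [IsNoetherianRing A] [IsLocalRing A]
    {I : Ideal A} {zs : List A} (h : RegMod I zs) (hm : I ⊔ Ideal.ofList zs = maximalIdeal A) :
    I.IsPrime := by
  obtain ⟨Q, _, χ, hχ, hker⟩ := exists_quotient I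
  have hI : I ≠ ⊤ := by
    rintro rfl
    rw [top_sup_eq] at hm
    exact Ideal.IsMaximal.ne_top (maximalIdeal.isMaximal A) hm.symm
  have : Nontrivial Q := by
    rw [nontrivial_iff]
    refine ⟨0, 1, fun h => hI ?_⟩
    rw [← hker, Ideal.eq_top_iff_one, RingHom.mem_ker, map_one, h]
  have : IsNoetherianRing Q := isNoetherianRing_of_surjective _ _ χ hχ
  have : IsLocalRing Q := IsLocalRing.of_surjective' χ hχ
  have hr : RegMod ⊥ (zs.map χ) := by
    refine (regMod_comap_iff χ hχ ⊥ _).1 ?_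
    rwa [← RingHom.ker_eq_comap_bot, hker]
  obtain ⟨hd, -⟩ := isDomain_and_complIntClosed hr (by
    rw [maximalIdeal_eq_map_of_surjective χ hχ, ← hm, Ideal.map_sup, Ideal.map_ofList,
      (Ideal.map_eq_bot_iff_le_ker χ).2 hker.ge, bot_sup_eq])
  rw [← hker]
  exact RingHom.ker_isPrime χ

theorem primeChain_of_regMod {A : Type*} [CommRing A] [IsNoetherianRing A] [IsLocalRing A]
    {I : Ideal A} {ys zs : List A} (h : RegMod I (ys ++ zs))
    (hm : I ⊔ Ideal.ofList (ys ++ zs) = maximalIdeal A) : PrimeChain I ys := by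
  induction ys generalizing I with
  | nil => trivial
  | cons y ys ih =>
    rw [List.cons_append, sup_ofList_cons] at hm
    exact ⟨isPrime_of_regMod h.2 hm, ih h.2 hm⟩

section Cohen

variable {p : ℕ} {Λ k : Type*} [CommRing Λ] [Field k] {π : Λ →+* k}

theorem IsCohenRing.isMaximal (h : IsCohenRing p π) : (Ideal.span {(p : Λ)}).IsMaximal := by
  rw [← h.ker]
  exact RingHom.ker_isMaximal_of_surjective π h.surjective

theorem IsCohenRing.isLocalRing (h : IsCohenRing p π) : IsLocalRing Λ := by
  have := h.isMaximal
  have := h.complete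
  exact isLocalRing_of_isAdicComplete_maximal (Ideal.span {(p : Λ)})

theorem IsCohenRing.maximalIdeal_eq (h : IsCohenRing p π) [IsLocalRing Λ] :
    maximalIdeal Λ = Ideal.span {(p : Λ)} :=
  (eq_maximalIdeal h.isMaximal).symm

theorem IsCohenRing.isNoetherianRing (h : IsCohenRing p π) : IsNoetherianRing Λ := by
  have := h.isMaximal
  refine IsNoetherianRing.of_prime fun P hP => ?_
  by_cases hp : (p : Λ) ∈ P
  · rw [← h.isMaximal.eq_of_le hP.ne_top ((Ideal.span_singleton_le_iff_mem P).2 hp)]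
    exact ⟨{(p : Λ)}, by simp⟩
  · have hle : P ≤ Ideal.span {(p : Λ)} := by
      have := h.isLocalRing
      rw [← h.maximalIdeal_eq]
      exact le_maximalIdeal hP.ne_top
    have key : ∀ n, ∀ x ∈ P, x ∈ Ideal.span {(p : Λ)} ^ n := fun n => by
      induction n with
      | zero => simp
      | succ n ih =>
        intro x hx
        obtain ⟨y, rfl⟩ := Ideal.mem_span_singleton'.1 (hle hx)
        rw [pow_succ]
        exact Ideal.mul_mem_mul (ih y ((hP.mem_or_mem hx).resolve_right hp))
          (Ideal.mem_span_singleton_self _)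
    have : P = ⊥ := by
      rw [eq_bot_iff]
      intro x hx
      have := h.complete
      exact closedIn_bot (Ideal.span {(p : Λ)}) x fun n => by simpa using key n x hx
    rw [this]
    exact Submodule.fg_bot

end Cohen

section Nakayama

variable {A M ι : Type*} [CommRing A] [CommRing M] [Algebra A M] [Fintype ι] {I : Ideal A}

theorem mem_map_pow_iff_exists_sum {g : ι → M} (hg : ∀ x, ∃ c : ι → A, x = ∑ i, c i • g i) {n : ℕ}
    {x : M} (hx : x ∈ I.map (algebraMap A M) ^ n) :
    ∃ c : ι → A, (∀ i, c i ∈ I ^ n) ∧ x = ∑ i, c i • g i := by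
  rw [← Ideal.map_pow] at hx
  refine Submodule.span_induction ?_ ⟨0, by simp, by simp⟩ ?_ ?_ hx
  · rintro _ ⟨a, ha, rfl⟩
    obtain ⟨c, hc⟩ := hg 1
    refine ⟨fun i => a * c i, fun i => Ideal.mul_mem_right _ _ ha, ?_⟩
    rw [Algebra.algebraMap_eq_smul_one, hc, Finset.smul_sum]
    simp only [smul_smul]
  · rintro _ _ - - ⟨c, hc, rfl⟩ ⟨d, hd, rfl⟩
    exact ⟨c + d, fun i => Ideal.add_mem _ (hc i) (hd i), by
      simp only [Pi.add_apply, add_smul, Finset.sum_add_distrib]⟩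
  · rintro r _ - ⟨c, hc, rfl⟩
    choose d hd using fun i => hg (r * g i)
    refine ⟨fun j => ∑ i, c i * d i j, fun j => Ideal.sum_mem _ fun i _ =>
      Ideal.mul_mem_right _ _ (hc i), ?_⟩
    simp only [Finset.sum_smul, smul_eq_mul]
    rw [Finset.sum_comm, Finset.mul_sum]
    refine Finset.sum_congr rfl fun i _ => ?_
    rw [mul_smul_comm, hd i, Finset.smul_sum]
    simp only [smul_smul]

theorem exists_sum_limit [IsAdicComplete I A] (g : ι → M) (c : ℕ → ι → A)
    (hc : ∀ n i, c n i ∈ I ^ n) :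
    ∃ L : ι → A, ∀ n, ∑ i, L i • g i - ∑ k ∈ Finset.range n, ∑ i, c k i • g i ∈
      I.map (algebraMap A M) ^ n := by
  have ex : ∀ i, ∃ L, ∀ n, L - ∑ k ∈ Finset.range n, c k i ∈ I ^ n := fun i =>
    exists_limit I _ fun n => by
      rw [Finset.sum_range_succ, add_sub_cancel_left]
      exact hc n i
  choose L hL using ex
  refine ⟨L, fun n => ?_⟩
  rw [Finset.sum_comm, ← Finset.sum_sub_distrib]
  refine Ideal.sum_mem _ fun i _ => ?_
  rw [← Finset.sum_smul, ← sub_smul, Algebra.smul_def, ← Ideal.map_pow]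
  exact Ideal.mul_mem_right _ _ (Ideal.mem_map_of_mem _ (hL i n))

theorem isAdicComplete_of_span [IsAdicComplete I A] {g : ι → M}
    (hg : ∀ x, ∃ c : ι → A, x = ∑ i, c i • g i)
    (hM : ∀ b, (∀ n, b ∈ I.map (algebraMap A M) ^ n) → b = 0) :
    IsAdicComplete (I.map (algebraMap A M)) M := by
  refine isAdicComplete_of_completeFiltration _ ⟨fun _ _ h => Ideal.pow_le_pow_right h, hM,
    fun f hf => ?_⟩
  choose c hc hc' using fun n => mem_map_pow_iff_exists_sum hg (hf n)
  obtain ⟨L, hL⟩ := exists_sum_limit (I := I) g c hc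
  refine ⟨f 0 + ∑ i, L i • g i, fun n => ?_⟩
  convert hL n using 1
  simp only [← hc']
  rw [Finset.sum_range_sub]
  ring

/-- Nakayama's lemma over a complete base. -/
theorem exists_sum_of_exists_sum_add [IsAdicComplete I A] {g : ι → M}
    (hg : ∀ x, ∃ c : ι → A, x - ∑ i, c i • g i ∈ I.map (algebraMap A M))
    (hM : ∀ b, (∀ n, b ∈ I.map (algebraMap A M) ^ n) → b = 0) (x : M) :
    ∃ c : ι → A, x = ∑ i, c i • g i := by
  have step : ∀ n x, x ∈ I.map (algebraMap A M) ^ n → ∃ c : ι → A, (∀ i, c i ∈ I ^ n) ∧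
      x - ∑ i, c i • g i ∈ I.map (algebraMap A M) ^ (n + 1) := by
    intro n x hx
    rw [← Ideal.map_pow] at hx
    refine Submodule.smul_induction_on (p := fun x => ∃ c : ι → A, (∀ i, c i ∈ I ^ n) ∧
      x - ∑ i, c i • g i ∈ I.map (algebraMap A M) ^ (n + 1)) (I := I ^ n)
      (N := (⊤ : Submodule A M)) ?_ ?_ ?_
    · rw [Ideal.smul_top_eq_map]
      exact hx
    · intro a ha m _
      obtain ⟨c, hc⟩ := hg m
      refine ⟨fun i => a * c i, fun i => Ideal.mul_mem_right _ _ ha, ?_⟩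
      have : a • m - ∑ i, (a * c i) • g i = algebraMap A M a * (m - ∑ i, c i • g i) := by
        rw [mul_sub, ← Algebra.smul_def, ← Algebra.smul_def, Finset.smul_sum]
        simp only [smul_smul]
      rw [this, pow_succ, ← Ideal.map_pow]
      exact Ideal.mul_mem_mul (Ideal.mem_map_of_mem _ ha) hc
    · rintro x y ⟨c, hc, h1⟩ ⟨d, hd, h2⟩
      refine ⟨c + d, fun i => Ideal.add_mem _ (hc i) (hd i), ?_⟩
      simp only [Pi.add_apply, add_smul, Finset.sum_add_distrib]
      rw [add_sub_add_comm]
      exact Ideal.add_mem _ h1 h2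
  choose! c hc hc' using step
  let r : ℕ → M := fun n => n.rec x fun n y => y - ∑ i, c n y i • g i
  have hr : ∀ n, r n ∈ I.map (algebraMap A M) ^ n := fun n => by
    induction n with
    | zero => simp
    | succ n ih => exact hc' n _ ih
  obtain ⟨L, hL⟩ := exists_sum_limit (I := I) g (fun n => c n (r n)) fun n => hc n _ (hr n)
  refine ⟨L, ?_⟩
  rw [← sub_eq_zero]
  refine hM _ fun n => ?_
  have e : ∀ n, ∑ k ∈ Finset.range n, ∑ i, c k (r k) i • g i = x - r n := fun n => by
    induction n with
    | zero => simp [r]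
    | succ n ih =>
      rw [Finset.sum_range_succ, ih]
      simp only [r]
      ring
  have h1 := hL n
  rw [e] at h1
  have := Ideal.sub_mem _ (hr n) h1
  convert this using 1
  ring

end Nakayama

theorem isAdicComplete_of_le_maximalIdeal {N : Type*} [CommRing N] [IsNoetherianRing N]
    [IsLocalRing N] [IsAdicComplete (maximalIdeal N) N] {J : Ideal N} (hJ : J ≤ maximalIdeal N) :
    IsAdicComplete J N := by
  refine isAdicComplete_of_completeFiltration _ ⟨fun _ _ h => Ideal.pow_le_pow_right h,
    fun b hb => ?_, fun f hf => ?_⟩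
  · have := closedIn_bot (maximalIdeal N) b fun n => Ideal.mem_sup_right
      (Ideal.pow_right_mono hJ n (hb n))
    simpa using this
  · obtain ⟨L, hL⟩ := exists_limit (maximalIdeal N) f fun n => Ideal.pow_right_mono hJ n (hf n)
    refine ⟨L, fun n => closedIn_maximalIdeal _ fun m => ?_⟩
    have hmono : ∀ {m n : ℕ}, m ≤ n → f n - f m ∈ J ^ m := fun {m n} hmn => by
      induction n, hmn using Nat.le_induction with
      | base => simp
      | succ n hmn ih =>
        have := Ideal.add_mem _ (Ideal.pow_le_pow_right hmn (hf n)) ih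
        simpa using this
    have h1 := hL (n + m)
    have h2 := hmono (Nat.le_add_right n m)
    have h3 := Ideal.pow_le_pow_right (Nat.le_add_left m n) h1
    have := Ideal.add_mem _ (Ideal.mem_sup_left (T := maximalIdeal N ^ m) h2)
      (Ideal.mem_sup_right h3)
    simpa using this

end

section

open IsLocalRing

theorem isAdicComplete_of_comparable {E : Type*} [CommRing E] {J J' : Ideal E} [IsAdicComplete J E]
    (h : J ≤ J') {k : ℕ} (hk : J' ^ k ≤ J) : IsAdicComplete J' E := by
  have hpow : ∀ n, J' ^ ((k + 1) * n) ≤ J ^ n := fun n => by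
    rw [pow_mul]
    exact Ideal.pow_right_mono ((Ideal.pow_le_pow_right (Nat.le_succ k)).trans hk) n
  have hF := completeFiltration_pow J
  refine isAdicComplete_of_completeFiltration _ ⟨fun _ _ h => Ideal.pow_le_pow_right h,
    fun b hb => hF.haus b fun n => hpow n (hb _), fun f hf => ?_⟩
  have hmono : ∀ {m n : ℕ}, m ≤ n → f n - f m ∈ J' ^ m := fun {m n} hmn => by
    induction n, hmn using Nat.le_induction with
    | base => simp
    | succ n hmn ih =>
      have := Ideal.add_mem _ (Ideal.pow_le_pow_right hmn (hf n)) ih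
      simpa using this
  obtain ⟨L, hL⟩ := hF.lim (fun n => f ((k + 1) * n)) fun n =>
    hpow n (hmono (Nat.mul_le_mul_left _ (Nat.le_succ n)))
  refine ⟨L, fun n => ?_⟩
  have h1 := Ideal.pow_right_mono h n (hL n)
  have h2 := hmono (Nat.le_mul_of_pos_left n (Nat.succ_pos k))
  have := Ideal.add_mem _ h1 h2
  simpa using this

theorem isAdicComplete_of_le_radical {E : Type*} [CommRing E] {J J' : Ideal E}
    [IsAdicComplete J E] (h : J ≤ J') (hfg : J'.FG) (hr : J' ≤ J.radical) :
    IsAdicComplete J' E := by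
  obtain ⟨k, hk⟩ := Ideal.exists_pow_le_of_le_radical_of_fg hr hfg
  exact isAdicComplete_of_comparable h hk

section Finite

variable {B N : Type*} [CommRing B] [IsNoetherianRing B] [IsLocalRing B]
  [IsAdicComplete (maximalIdeal B) B] [CommRing N] [Algebra B N] [Module.Finite B N]

theorem isAdicComplete_of_finite :
    IsAdicComplete ((maximalIdeal B).map (algebraMap B N)) N := by
  obtain ⟨n, g, hg⟩ := Module.Finite.exists_fin (R := B) (M := N)
  refine isAdicComplete_of_span (g := g) (fun x => ?_) fun b hb => ?_
  · have : x ∈ Submodule.span B (Set.range g) := by rw [hg]; trivial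
    obtain ⟨c, hc⟩ := (Submodule.mem_span_range_iff_exists_fun B).1 this
    exact ⟨c, hc.symm⟩
  · have := Ideal.iInf_pow_smul_eq_bot_of_isLocalRing (M := N) (maximalIdeal B)
      (Ideal.IsMaximal.ne_top inferInstance)
    rw [← Submodule.mem_bot B, ← this, Submodule.mem_iInf]
    intro i
    have := hb i
    rw [Ideal.smul_top_eq_map, Ideal.map_pow]
    exact this

variable [IsDomain N]

omit [IsNoetherianRing B] [IsAdicComplete (maximalIdeal B) B] [IsDomain N] in
theorem exists_pow_mul_one_sub_mem (a : N) : ∃ e y,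
    a ^ e * (1 - a * y) ∈ (maximalIdeal B).map (algebraMap B N) := by
  obtain ⟨P, hP, hPa⟩ := Algebra.IsIntegral.isIntegral (R := B) a
  have hex : ∃ e, P.coeff e ∉ maximalIdeal B := ⟨P.natDegree, by
    rw [hP.coeff_natDegree]
    exact fun h => (Ideal.ne_top_iff_one _).1 (Ideal.IsMaximal.ne_top inferInstance) h⟩
  classical
  let e := Nat.find hex
  have he : IsUnit (P.coeff e) := by
    have := Nat.find_spec hex
    rwa [mem_maximalIdeal, mem_nonunits_iff, not_not] at this
  obtain ⟨u, hu⟩ := he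
  have hsum : ∑ i ∈ Finset.range (P.natDegree + 1), algebraMap B N (P.coeff i) * a ^ i = 0 := by
    rw [← hPa, Polynomial.eval₂_eq_sum_range]
  let y : N := - ∑ i ∈ Finset.range (P.natDegree + 1),
    if e < i then algebraMap B N ((u⁻¹ : Bˣ) * P.coeff i) * a ^ (i - e - 1) else 0
  refine ⟨e, y, ?_⟩
  have hele : e < P.natDegree + 1 := by
    by_contra h
    rw [not_lt] at h
    have := P.coeff_eq_zero_of_natDegree_lt (n := e) (by omega)
    rw [this] at hu
    exact (Nat.find_spec hex) (by change P.coeff e ∈ _; rw [this]; exact zero_mem _)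
  have key : ∑ i ∈ Finset.range (P.natDegree + 1),
      (algebraMap B N ((u⁻¹ : Bˣ) * P.coeff i) * a ^ i - (if i = e then a ^ e else 0) -
        if e < i then algebraMap B N ((u⁻¹ : Bˣ) * P.coeff i) * a ^ (i - e - 1) * a ^ (e + 1)
        else 0) ∈ (maximalIdeal B).map (algebraMap B N) := by
    refine Ideal.sum_mem _ fun i _ => ?_
    rcases lt_trichotomy i e with h | h | h
    · rw [if_neg h.ne, if_neg h.not_gt, sub_zero, sub_zero]
      have := Nat.find_min hex h
      rw [not_not] at this
      exact Ideal.mul_mem_right _ _ (Ideal.mem_map_of_mem _ (Ideal.mul_mem_left _ _ this))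
    · rw [if_pos h, if_neg (h ▸ lt_irrefl _), h, ← hu, Units.inv_mul]
      simp
    · rw [if_neg h.ne', if_pos h, mul_assoc, ← pow_add, show i - e - 1 + (e + 1) = i by omega]
      simp
  rw [Finset.sum_sub_distrib, Finset.sum_sub_distrib] at key
  have h1 : ∑ i ∈ Finset.range (P.natDegree + 1),
      algebraMap B N ((u⁻¹ : Bˣ) * P.coeff i) * a ^ i = 0 := by
    simp only [map_mul, mul_assoc]
    rw [← Finset.mul_sum, hsum, mul_zero]
  rw [h1, Finset.sum_ite_eq' , if_pos (Finset.mem_range.2 hele)] at key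
  have h2 : (∑ i ∈ Finset.range (P.natDegree + 1), if e < i then
      algebraMap B N ((u⁻¹ : Bˣ) * P.coeff i) * a ^ (i - e - 1) * a ^ (e + 1) else 0) =
      - y * a ^ (e + 1) := by
    simp only [y, neg_neg]
    rw [Finset.sum_mul]
    simp only [ite_mul, zero_mul]
  rw [h2] at key
  have := Ideal.neg_mem_iff _ |>.2 key
  convert this using 1
  ring

theorem isUnit_or_exists_pow_mem (a : N) :
    IsUnit a ∨ ∃ e, a ^ e ∈ (maximalIdeal B).map (algebraMap B N) := by
  have hc := isAdicComplete_of_finite (B := B) (N := N)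
  obtain ⟨e, y, h⟩ := exists_pow_mul_one_sub_mem (B := B) a
  set J := (maximalIdeal B).map (algebraMap B N)
  have hjac := IsAdicComplete.le_jacobson_bot J
  have hunit : ∀ j ∈ J, IsUnit (1 - j) := fun j hj => by
    have := Ideal.mem_jacobson_bot.1 (hjac hj) (-1)
    rwa [mul_neg_one, neg_add_eq_sub] at this
  have ht : (a * y) ^ e * (1 - a * y) ∈ J := by
    rw [mul_pow, mul_right_comm]
    exact Ideal.mul_mem_right _ _ h
  have hmul : ∀ z, z * (1 - a * y) ∈ J → ∀ k, z - z * (a * y) ^ k ∈ J := fun z hz k => by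
    induction k with
    | zero => simp
    | succ k ih =>
      have := Ideal.add_mem _ ih (Ideal.mul_mem_right ((a * y) ^ k) _ hz)
      convert this using 1
      ring
  have hidem : (a * y) ^ e - (a * y) ^ e * (a * y) ^ e ∈ J := hmul _ ht e
  obtain ⟨E, hE, hEt⟩ := HenselianRing.is_henselian (I := J)
    (Polynomial.X ^ 2 - Polynomial.X : Polynomial N)
    (by
      refine (Polynomial.monic_X_pow 2).sub_of_left ?_
      rw [Polynomial.degree_X_pow, Polynomial.degree_X]
      norm_num) ((a * y) ^ e) (by
        rw [← Ideal.neg_mem_iff]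
        convert hidem using 1
        simp
        ring) (by
        refine IsUnit.of_mul_eq_one (Ideal.Quotient.mk J (2 * (a * y) ^ e - 1)) ?_
        rw [← map_mul, ← map_one (Ideal.Quotient.mk J), Ideal.Quotient.eq]
        have := J.mul_mem_left (-4) hidem
        convert this using 1
        simp
        ring)
  have hE' : E * (E - 1) = 0 := by
    have : E ^ 2 - E = 0 := by simpa using hE
    linear_combination this
  rcases mul_eq_zero.1 hE' with h0 | h0
  · right
    refine ⟨e, ?_⟩
    rw [h0, zero_sub, Ideal.neg_mem_iff] at hEt
    have := Ideal.add_mem _ (hmul _ h e) (Ideal.mul_mem_left _ (a ^ e) hEt)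
    simpa using this
  · left
    rw [sub_eq_zero] at h0
    rw [h0] at hEt
    have h1 := hunit _ hEt
    rw [sub_sub_cancel] at h1
    rcases Nat.eq_zero_or_pos e with he | he
    · rw [he, pow_zero, one_mul] at h
      have := hunit _ h
      rw [sub_sub_cancel] at this
      exact isUnit_of_mul_isUnit_left this
    · rw [isUnit_pow_iff he.ne'] at h1
      exact isUnit_of_mul_isUnit_left h1

theorem isLocalRing_of_finite (B : Type*) {N : Type*} [CommRing B] [IsNoetherianRing B]
    [IsLocalRing B] [IsAdicComplete (maximalIdeal B) B] [CommRing N] [Algebra B N]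
    [Module.Finite B N] [IsDomain N] :
    IsLocalRing N := by
  have hc := isAdicComplete_of_finite (B := B) (N := N)
  refine IsLocalRing.of_isUnit_or_isUnit_one_sub_self fun a => ?_
  refine (isUnit_or_exists_pow_mem (B := B) a).imp_right fun ⟨e, he⟩ => ?_
  have := Ideal.mem_jacobson_bot.1 (IsAdicComplete.le_jacobson_bot _ he) (-1)
  rw [mul_neg_one, neg_add_eq_sub, ← one_pow e] at this
  exact isUnit_of_dvd_unit (sub_dvd_pow_sub_pow 1 a e) this

theorem maximalIdeal_le_radical_of_finite [IsLocalRing N] :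
    maximalIdeal N ≤ ((maximalIdeal B).map (algebraMap B N)).radical := by
  intro a ha
  rcases isUnit_or_exists_pow_mem (B := B) a with h | h
  · exact ((mem_maximalIdeal _).1 ha h).elim
  · exact h

omit [IsDomain N] in
theorem map_le_maximalIdeal_of_finite [IsLocalRing N] :
    (maximalIdeal B).map (algebraMap B N) ≤ maximalIdeal N := by
  have hc := isAdicComplete_of_finite (B := B) (N := N)
  refine (IsAdicComplete.le_jacobson_bot _).trans ?_
  exact (jacobson_eq_maximalIdeal ⊥ bot_ne_top).le

theorem isAdicComplete_maximalIdeal_of_finite (B : Type*) {N : Type*} [CommRing B]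
    [IsNoetherianRing B]
    [IsLocalRing B] [IsAdicComplete (maximalIdeal B) B] [CommRing N] [Algebra B N]
    [Module.Finite B N] [IsDomain N] [IsLocalRing N] :
    IsAdicComplete (maximalIdeal N) N := by
  have hc := isAdicComplete_of_finite (B := B) (N := N)
  have : IsNoetherianRing N := IsNoetherianRing.of_finite B N
  exact isAdicComplete_of_le_radical (map_le_maximalIdeal_of_finite (B := B))
    (IsNoetherian.noetherian _) maximalIdeal_le_radical_of_finite

end Finite

end

section

open IsLocalRing

/-- `A` is a formal power series ring in the variables `xs` over the Cohen ring `Λ`. -/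
structure IsCohenPower (p : ℕ) {Λ k A : Type} [CommRing Λ] [CommRing k] [CommRing A]
    [IsLocalRing A] (π : Λ →+* k) (ι : Λ →+* A) (xs : List A) : Prop where
  cohen : IsCohenRing p π
  formal : IsFormalPower ι xs
  complete : IsAdicComplete (maximalIdeal A) A
  max_eq : maximalIdeal A = Ideal.ofList (xs ++ [(p : A)])
  reg : RegMod ⊥ (xs ++ [(p : A)])

theorem exists_isCohenPower (p : ℕ) [Fact p.Prime] (k : Type) [Field k] [CharP k p] (n : ℕ) :
    ∃ (Λ A : Type) (_ : CommRing Λ) (_ : CommRing A) (_ : IsNoetherianRing A) (_ : IsLocalRing A)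
      (π : Λ →+* k) (ι : Λ →+* A) (xs : List A), IsCohenPower p π ι xs ∧ xs.length = n := by
  obtain ⟨Λ, _, π, h⟩ := exists_isCohenRing p k
  have := h.isLocalRing
  have := h.isNoetherianRing
  have hc : IsAdicComplete (maximalIdeal Λ) Λ := by
    rw [h.maximalIdeal_eq]
    exact h.complete
  obtain ⟨A, _, _, _, ι, xs, hn, hf, hA, hm, hr⟩ := exists_isFormalPower Λ (zs := [(p : Λ)])
    (by rw [h.maximalIdeal_eq, Ideal.ofList_singleton])
    ⟨fun b hb => by simpa using h.reg b (by simpa using hb), trivial⟩ n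
  have e : [(p : Λ)].map ι = [(p : A)] := by rw [List.map_singleton, map_natCast]
  rw [e] at hm hr
  exact ⟨Λ, A, inferInstance, inferInstance, inferInstance, inferInstance, π, ι, xs,
    ⟨h, hf, hA, hm, hr⟩, hn⟩

theorem natCast_ne_zero_of_coprime {A : Type*} [CommRing A] [IsLocalRing A] {p q : ℕ}
    (hp : (p : A) ∈ maximalIdeal A) (hpq : p.Coprime q) : (q : A) ∉ maximalIdeal A := by
  intro hq
  have h := Nat.isCoprime_iff_coprime.2 hpq
  obtain ⟨a, b, e⟩ := h
  have e' := congrArg (Int.cast (R := A)) e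
  push_cast at e'
  refine (Ideal.ne_top_iff_one (maximalIdeal A)).1 (Ideal.IsMaximal.ne_top inferInstance) ?_
  rw [← e']
  exact Ideal.add_mem _ (Ideal.mul_mem_left _ _ hp) (Ideal.mul_mem_left _ _ hq)

theorem charZero_of_mem_maximalIdeal {A : Type*} [CommRing A] [IsDomain A] [IsLocalRing A] {p : ℕ}
    (hpp : p.Prime) (hp : (p : A) ∈ maximalIdeal A) (hp0 : (p : A) ≠ 0) : CharZero A := by
  obtain ⟨q, hq⟩ := CharP.exists A
  rcases CharP.char_is_prime_or_zero A q with h | rfl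
  · exfalso
    have hne : p ≠ q := by
      rintro rfl
      exact hp0 (CharP.cast_eq_zero A p)
    refine natCast_ne_zero_of_coprime hp ((Nat.coprime_primes hpp h).2 hne) ?_
    rw [CharP.cast_eq_zero]
    exact zero_mem _
  · exact CharP.charP_to_charZero A

theorem mem_of_mem_ofList {A : Type*} [CommRing A] {I : Ideal A} {xs : List A}
    (h : I = Ideal.ofList xs) : ∀ x ∈ xs, x ∈ I := fun x hx => by
  rw [h]; exact Ideal.subset_span hx

namespace IsCohenPower

variable {p : ℕ} {Λ k A : Type} [CommRing Λ] [CommRing A] [IsLocalRing A]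
  [IsNoetherianRing A]

section CommRing

variable [CommRing k] {π : Λ →+* k} {ι : Λ →+* A} {xs : List A}

theorem reg_perm (h : IsCohenPower p π ι xs) {zs : List A} (hz : (xs ++ [(p : A)]).Perm zs) :
    RegMod ⊥ zs := by
  have := h.complete
  refine RegMod.perm (J := maximalIdeal A) hz h.reg (closedIn_bot _) (IsNoetherian.noetherian _)
    (mem_of_mem_ofList h.max_eq) ?_
  rw [bot_sup_eq, h.max_eq]
  exact Ideal.le_radical

omit [IsNoetherianRing A] in
theorem max_eq_perm (h : IsCohenPower p π ι xs) {zs : List A} (hz : (xs ++ [(p : A)]).Perm zs) :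
    maximalIdeal A = Ideal.ofList zs := by
  rw [h.max_eq]
  unfold Ideal.ofList
  congr 1
  ext x
  exact hz.mem_iff

theorem isDomain (h : IsCohenPower p π ι xs) : IsDomain A :=
  (isDomain_and_complIntClosed h.reg h.max_eq).1

theorem isIntegrallyClosed (h : IsCohenPower p π ι xs) : IsIntegrallyClosed A := by
  have := h.isDomain
  exact (isDomain_and_complIntClosed h.reg h.max_eq).2.isIntegrallyClosed

omit [IsNoetherianRing A] in
theorem p_mem (h : IsCohenPower p π ι xs) : (p : A) ∈ maximalIdeal A :=
  mem_of_mem_ofList h.max_eq _ (by simp)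

omit [IsNoetherianRing A] in
theorem mem (h : IsCohenPower p π ι xs) {x : A} (hx : x ∈ xs) : x ∈ maximalIdeal A :=
  mem_of_mem_ofList h.max_eq _ (by simp [hx])

theorem p_ne_zero (h : IsCohenPower p π ι xs) : (p : A) ≠ 0 := by
  intro h0
  have := (h.reg_perm (zs := (p : A) :: xs) (by simp)).1 1 (by simp [h0])
  exact one_ne_zero (α := A) (by simp at this)

theorem charZero [hp : Fact p.Prime] (h : IsCohenPower p π ι xs) : CharZero A := by
  have := h.isDomain
  exact charZero_of_mem_maximalIdeal hp.out h.p_mem h.p_ne_zero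

omit [IsNoetherianRing A] in
theorem isParam (h : IsCohenPower p π ι xs) : IsParam (⊥ : Ideal A) ((p : A) :: xs) where
  mem := mem_of_mem_ofList (h.max_eq_perm (by simp))
  le_radical := by
    rw [bot_sup_eq, h.max_eq_perm (zs := (p : A) :: xs) (by simp)]
    exact Ideal.le_radical

omit [IsNoetherianRing A] in
theorem isParam_p (h : IsCohenPower p π ι xs) : IsParam (Ideal.span {(p : A)}) xs where
  mem := fun x hx => h.mem hx
  le_radical := by
    rw [← Ideal.ofList_cons, h.max_eq_perm (zs := (p : A) :: xs) (by simp)]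
    exact Ideal.le_radical

theorem isPrime_p (h : IsCohenPower p π ι xs) : (Ideal.span {(p : A)}).IsPrime := by
  refine isPrime_of_regMod (zs := xs) ?_ ?_
  · have := (h.reg_perm (zs := (p : A) :: xs) (by simp)).2
    rwa [bot_sup_eq] at this
  · rw [← Ideal.ofList_cons, ← h.max_eq_perm (by simp)]

end CommRing

end IsCohenPower

theorem finite_of_residue {A R : Type*} [CommRing A] [IsLocalRing A]
    [IsAdicComplete (maximalIdeal A) A] [CommRing R] [IsNoetherianRing R] [IsLocalRing R]
    (ψ : A →+* R) (hψ : (maximalIdeal A).map ψ ≤ maximalIdeal R)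
    (hr : maximalIdeal R ≤ ((maximalIdeal A).map ψ).radical)
    (hs : ∀ r : R, ∃ a, r - ψ a ∈ maximalIdeal R) : ψ.Finite := by
  classical
  algebraize [ψ]
  have hfin : ∀ n, ∃ S : Submodule A R, S.FG ∧
      (⊤ : Submodule A R) ≤ S ⊔ (maximalIdeal R ^ n).restrictScalars A := fun n => by
    induction n with
    | zero => exact ⟨⊥, Submodule.fg_bot, by simp⟩
    | succ n ih =>
      obtain ⟨S, hS, hS'⟩ := ih
      obtain ⟨G, hG⟩ := IsNoetherian.noetherian (maximalIdeal R ^ n)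
      refine ⟨S ⊔ Submodule.span A (G : Set R), hS.sup (Submodule.fg_span G.finite_toSet), ?_⟩
      refine hS'.trans (sup_le (le_sup_left.trans le_sup_left) ?_)
      intro x hx
      rw [Submodule.restrictScalars_mem, ← hG] at hx
      refine Submodule.span_induction (p := fun x _ => x ∈ S ⊔ Submodule.span A (G : Set R) ⊔
        (maximalIdeal R ^ (n + 1)).restrictScalars A) ?_ (zero_mem _)
        (fun _ _ _ _ h1 h2 => add_mem h1 h2) ?_ hx
      · intro x hx
        exact Submodule.mem_sup_left (Submodule.mem_sup_right (Submodule.subset_span hx))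
      · intro r x hx hx'
        obtain ⟨a, ha⟩ := hs r
        have e : r • x = a • x + (r - ψ a) * x := by
          have h2 : a • x = ψ a * x := Algebra.smul_def a x
          rw [smul_eq_mul, h2]
          ring
        rw [e]
        refine add_mem (Submodule.smul_mem _ _ hx') (Submodule.mem_sup_right ?_)
        rw [Submodule.restrictScalars_mem, pow_succ']
        exact Ideal.mul_mem_mul ha (hG ▸ hx)
  obtain ⟨n, hn⟩ := Ideal.exists_pow_le_of_le_radical_of_fg hr (IsNoetherian.noetherian _)
  obtain ⟨S, hS, hS'⟩ := hfin n
  obtain ⟨m, g, hg⟩ := Submodule.fg_iff_exists_fin_generating_family.1 hS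
  refine ⟨⟨Finset.univ.image g, ?_⟩⟩
  rw [eq_top_iff]
  intro x _
  obtain ⟨c, rfl⟩ := exists_sum_of_exists_sum_add (I := maximalIdeal A) (g := g) (fun x => by
    obtain ⟨s, hs, t, ht, e⟩ := Submodule.mem_sup.1 (hS' (x := x) trivial)
    rw [← hg] at hs
    obtain ⟨c, hc⟩ := (Submodule.mem_span_range_iff_exists_fun A).1 hs
    refine ⟨c, ?_⟩
    rw [hc, ← e, add_sub_cancel_left]
    exact hn ht) (fun b hb => by
      have := closedIn_maximalIdeal (⊥ : Ideal R) (b := b) fun n => by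
        rw [bot_sup_eq]
        exact Ideal.pow_right_mono hψ n (hb n)
      simpa using this) x
  refine Submodule.sum_mem _ fun i _ => Submodule.smul_mem _ _ (Submodule.subset_span ?_)
  simp

theorem ker_eq_of_length {A R : Type*} [CommRing A] [IsNoetherianRing A] [IsLocalRing A]
    [CommRing R] [IsNoetherianRing R] [IsLocalRing R] (ψ : A →+* R)
    (hψ : (maximalIdeal A).map ψ ≤ maximalIdeal R)
    (hr : maximalIdeal R ≤ ((maximalIdeal A).map ψ).radical) {K : Ideal A} (hK : K.IsPrime)
    (hKψ : K ≤ RingHom.ker ψ) {zs : List A} (hz : IsParam K zs)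
    (hd : (zs.length : WithBot ℕ∞) = ringKrullDim R) : RingHom.ker ψ = K := by
  refine le_antisymm (fun g hg => ?_) hKψ
  by_contra hgK
  have hgm : g ∈ maximalIdeal A := by
    rw [mem_maximalIdeal, mem_nonunits_iff]
    intro hu
    have := hu.map ψ
    rw [(RingHom.mem_ker).1 hg] at this
    exact not_isUnit_zero this
  obtain ⟨ys, hl, hy, hyr⟩ := exists_sop_cons hK hz.mem hz.le_radical hgm hgK
  have h1 : maximalIdeal R ≤ (Ideal.ofList (ys.map ψ)).radical := by
    refine hr.trans ?_
    rw [← Ideal.radical_idem (Ideal.ofList (ys.map ψ))]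
    refine Ideal.radical_mono ?_
    refine (Ideal.map_mono hyr).trans ((Ideal.map_radical_le ψ).trans (Ideal.radical_mono ?_))
    rw [Ideal.map_sup, (Ideal.map_eq_bot_iff_le_ker ψ).2 hKψ, bot_sup_eq, Ideal.map_ofList,
      List.map_cons, (RingHom.mem_ker).1 hg, Ideal.ofList_cons, Ideal.span_singleton_eq_bot.2 rfl,
      bot_sup_eq]
  have h2 := ringKrullDim_le_length (fun x hx => by
    obtain ⟨y, hy', rfl⟩ := List.mem_map.1 hx
    exact hψ (Ideal.mem_map_of_mem ψ (hy y hy'))) h1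
  rw [← hd, ← hl, List.length_map, List.length_cons] at h2
  have : ys.length + 1 ≤ ys.length := by exact_mod_cast h2
  omega

/-- Finite maps from a power series ring over a Cohen ring. -/
theorem IsCohenPower.exists_finite {p : ℕ} [Fact p.Prime] {Λ A R : Type} [CommRing Λ] [CommRing A]
    [IsLocalRing A] [IsNoetherianRing A] [CommRing R] [IsNoetherianRing R] [IsLocalRing R]
    [IsAdicComplete (maximalIdeal R) R] {π : Λ →+* ResidueField R} {ι : Λ →+* A} {xs : List A}
    (h : IsCohenPower p π ι xs) (hp : (p : R) ∈ maximalIdeal R) {ts : List R}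
    (hl : ts.length = xs.length) (ht : ∀ t ∈ ts, t ∈ maximalIdeal R)
    (hr : maximalIdeal R ≤ (Ideal.ofList ((p : R) :: ts)).radical) :
    ∃ ψ : A →+* R, ψ.Finite ∧ xs.map ψ = ts ∧ (maximalIdeal A).map ψ ≤ maximalIdeal R ∧
      maximalIdeal R ≤ ((maximalIdeal A).map ψ).radical ∧
      (residue R).comp (ψ.comp ι) = π := by
  have hk : RingHom.ker (residue R) = maximalIdeal R := ker_residue
  obtain ⟨l, hl'⟩ := h.cohen.exists_lift (χ := residue R) residue_surjective
    (by rw [hk]; infer_instance) (by rwa [← RingHom.mem_ker, hk]) π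
  obtain ⟨ψ, hψ, hx⟩ := h.formal.exists_hom (completeFiltration_pow (maximalIdeal R)) l ts hl
    fun b hb N => ⟨N, Ideal.pow_mem_pow (ht b hb) N⟩
  have hmap : (maximalIdeal A).map ψ = Ideal.ofList ((p : R) :: ts) := by
    rw [h.max_eq_perm (zs := (p : A) :: xs) (by simp), Ideal.map_ofList, List.map_cons, hx,
      map_natCast]
  have h1 : (maximalIdeal A).map ψ ≤ maximalIdeal R := by
    rw [hmap, Ideal.ofList, Ideal.span_le]
    intro x hx
    rcases List.mem_cons.1 hx with rfl | hx
    · exact hp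
    · exact ht x hx
  have h2 : maximalIdeal R ≤ ((maximalIdeal A).map ψ).radical := by rwa [hmap]
  have := h.complete
  refine ⟨ψ, finite_of_residue ψ h1 h2 fun r => ?_, hx, h1, h2, by rw [hψ, hl']⟩
  obtain ⟨a, ha⟩ := h.cohen.surjective (residue R r)
  refine ⟨ι a, ?_⟩
  rw [← hk, RingHom.mem_ker, map_sub, ← ha, ← hl', ← hψ, sub_eq_zero]
  rfl

end

section

open IsLocalRing MvPolynomial

section Profinite

variable {A V G : Type*} [CommRing A] [CommRing V] [Algebra A V] [Group G] [MulSemiringAction G V]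

theorem smul_eq_map (σ : Type*) (g : G) (P : MvPolynomial σ V) :
    g • P = map (MulSemiringAction.toRingHom G V g) P := by
  ext m
  rw [coeff_smul, coeff_map]
  rfl

/-- The action on the coefficients of polynomials. -/
@[reducible] noncomputable def coeffAction (σ G V : Type*) [CommRing V] [Group G]
    [MulSemiringAction G V] : MulSemiringAction G (MvPolynomial σ V) where
  smul_one g := by rw [smul_eq_map, map_one]
  smul_mul g P Q := by rw [smul_eq_map, smul_eq_map, smul_eq_map, map_mul]

/-- Two homomorphisms to a domain that agree on the invariants are conjugate. -/
theorem exists_smul_of_comp_eq [SMulCommClass G A V]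
    [TopologicalSpace G] [CompactSpace G] [TotallyDisconnectedSpace G] [IsTopologicalGroup G]
    [Algebra.IsInvariant A V G] (hst : ∀ v : V, IsOpen (MulAction.stabilizer G v : Set G))
    {W : Type*} [CommRing W] [IsDomain W] (h₁ h₂ : V →+* W)
    (h : h₁.comp (algebraMap A V) = h₂.comp (algebraMap A V)) :
    ∃ g : G, ∀ v, h₁ v = h₂ (g • v) := by
  let := coeffAction V G V
  let : TopologicalSpace (MvPolynomial V V) := ⊥
  have : DiscreteTopology (MvPolynomial V V) := ⟨rfl⟩
  have hsmul : ∀ (g : G) (P : MvPolynomial V V) m, coeff m (g • P) = g • coeff m P := fun g P m =>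
    coeff_smul m g P
  have : ContinuousSMul G (MvPolynomial V V) := by
    refine continuousSMul_iff_stabilizer_isOpen.2 fun P => ?_
    have : IsOpen (⋂ m ∈ P.support, (MulAction.stabilizer G (coeff m P) : Set G)) :=
      P.support.finite_toSet.isOpen_biInter fun m _ => hst _
    convert this using 1
    ext g
    simp only [SetLike.mem_coe, MulAction.mem_stabilizer_iff, Set.mem_iInter]
    constructor
    · intro hg m _
      rw [← hsmul, hg]
    · intro hg
      ext m
      rw [hsmul]
      by_cases hm : m ∈ P.support
      · exact hg m hm
      · rw [notMem_support_iff.1 hm, smul_zero]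
  let := (map (σ := V) (algebraMap A V)).toAlgebra
  have hinv : Algebra.IsInvariant (MvPolynomial V A) (MvPolynomial V V) G := by
    refine ⟨fun P hP => ?_⟩
    have : P ∈ Set.range (map (σ := V) (algebraMap A V)) := by
      rw [mem_range_map_iff_coeffs_subset]
      intro c hc
      obtain ⟨m, -, rfl⟩ := mem_coeffs_iff.1 hc
      exact Algebra.IsInvariant.isInvariant (G := G) _ fun g => by rw [← hsmul, hP]
    exact this
  have hcomm : SMulCommClass G (MvPolynomial V A) (MvPolynomial V V) := by
    refine ⟨fun g P Q => ?_⟩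
    rw [Algebra.smul_def, Algebra.smul_def, smul_mul']
    congr 1
    ext m
    rw [hsmul]
    change g • coeff m (map (algebraMap A V) P) = coeff m (map (algebraMap A V) P)
    rw [coeff_map, smul_algebraMap]
  let H₁ : MvPolynomial V V →+* W := eval₂Hom h₁ h₁
  let H₂ : MvPolynomial V V →+* W := eval₂Hom h₂ h₁
  have e : H₁.comp (map (algebraMap A V)) = H₂.comp (map (algebraMap A V)) := by
    refine ringHom_ext (fun a => ?_) fun v => ?_
    · simp only [RingHom.comp_apply, map_C, H₁, H₂, coe_eval₂Hom, eval₂_C]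
      exact DFunLike.congr_fun h a
    · simp [H₁, H₂]
  have hP₁ : (RingHom.ker H₁).IsPrime := RingHom.ker_isPrime H₁
  have hP₂ : (RingHom.ker H₂).IsPrime := RingHom.ker_isPrime H₂
  obtain ⟨g, hg⟩ := Algebra.IsInvariant.exists_smul_of_under_eq_of_profinite (A := MvPolynomial V A)
    (G := G) (RingHom.ker H₁) (RingHom.ker H₂) (by
      change (RingHom.ker H₁).comap (map (algebraMap A V)) =
        (RingHom.ker H₂).comap (map (algebraMap A V))
      rw [RingHom.comap_ker, RingHom.comap_ker, e])
  refine ⟨g, fun v => ?_⟩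
  have h1 : X v - C v ∈ RingHom.ker H₁ := by simp [RingHom.mem_ker, H₁]
  have h2 : g • (X v - C v) ∈ RingHom.ker H₂ := by
    rw [hg]
    exact Ideal.smul_mem_pointwise_smul g _ _ h1
  have h3 : g • (X v - C v : MvPolynomial V V) = X v - C (g • v) := by
    rw [smul_eq_map, RingHom.map_sub, map_X, map_C]
    rfl
  rw [h3, RingHom.mem_ker] at h2
  simpa [H₂, sub_eq_zero] using h2

end Profinite

theorem HasMonicRoots.isAlgClosed {V L : Type*} [CommRing V] [IsDomain V] (hV : HasMonicRoots V)
    [Field L] [Algebra V L] [IsFractionRing V L] : IsAlgClosed L := by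
  refine IsAlgClosed.of_exists_root L fun P hP hirr => ?_
  obtain ⟨Q, hQ, hQd, hQm⟩ := Polynomial.lifts_and_degree_eq_and_monic
    (IsLocalization.scaleRoots_commonDenom_mem_lifts (nonZeroDivisors V) P
      (by rw [hP.leadingCoeff]; exact one_mem _))
    ((Polynomial.monic_scaleRoots_iff _).2 hP)
  set b : V := (IsLocalization.commonDenom (nonZeroDivisors V) P.support P.coeff : V) with hb
  have hb0 : algebraMap V L b ≠ 0 := by
    rw [Ne, IsFractionRing.to_map_eq_zero_iff]
    exact nonZeroDivisors.ne_zero (SetLike.coe_mem _)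
  obtain ⟨v, hv⟩ := hV Q hQm (by
    rw [hQd, Polynomial.degree_scaleRoots]
    exact Polynomial.degree_pos_of_irreducible hirr)
  refine ⟨algebraMap V L v / algebraMap V L b, ?_⟩
  have h0 : (P.scaleRoots (algebraMap V L b)).eval (algebraMap V L v) = 0 := by
    rw [← hQ, Polynomial.eval_map, Polynomial.eval₂_at_apply, hv.eq_zero, map_zero]
  have h1 := Polynomial.scaleRoots_eval₂_mul (p := P) (RingHom.id L)
      (algebraMap V L v / algebraMap V L b) (algebraMap V L b)
  rw [RingHom.id_apply, mul_div_cancel₀ _ hb0, Polynomial.eval₂_id, Polynomial.eval₂_id, h0] at h1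
  simpa [hb0] using h1.symm

theorem exists_ringEquiv_of_comp_eq {A V W : Type*} [CommRing A] [IsDomain A] [IsIntegrallyClosed A]
    [CharZero A] [CommRing V] [IsDomain V] (hV : HasMonicRoots V) (φ : A →+* V)
    (hφ : Function.Injective φ) (hi : φ.IsIntegral) [CommRing W] [IsDomain W] (h₁ h₂ : V →+* W)
    (h : h₁.comp φ = h₂.comp φ) :
    ∃ σ : V →+* V, σ.comp φ = φ ∧ h₁ = h₂.comp σ := by
  let := φ.toAlgebra
  have : FaithfulSMul A V := (faithfulSMul_iff_algebraMap_injective A V).2 hφ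
  have : Algebra.IsIntegral A V := ⟨hi⟩
  let K := FractionRing A
  let L := FractionRing V
  have : IsIntegrallyClosed V := hV.isIntegrallyClosed
  let : Algebra K L := FractionRing.liftAlgebra A L
  have : IsScalarTower A K L := FractionRing.isScalarTower_liftAlgebra A L
  have : Algebra.IsAlgebraic K L := isAlgebraic_of_isFractionRing A V K L
  have : IsAlgClosed L := hV.isAlgClosed (V := V)
  have : IsIntegralClosure V A L := IsIntegralClosure.of_isIntegrallyClosed V A L
  have : IsAlgClosure K L := ⟨inferInstance, inferInstance⟩
  have : CharZero K := IsFractionRing.charZero A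
  have : IsGalois K L := IsAlgClosure.isGalois K L
  let := IsIntegralClosure.MulSemiringAction A K L V
  have hL : ∀ (g : Gal(L/K)) (v : V), algebraMap V L (g • v) = g (algebraMap V L v) := fun g v =>
    algebraMap_galRestrictHom_apply A K L V g v
  have hinj : Function.Injective (algebraMap V L) := IsFractionRing.injective V L
  have : SMulCommClass Gal(L/K) A V := by
    refine ⟨fun g a v => hinj ?_⟩
    rw [hL, Algebra.smul_def, Algebra.smul_def, map_mul, map_mul, map_mul, hL,
      ← IsScalarTower.algebraMap_apply, IsScalarTower.algebraMap_apply A K L, AlgEquiv.commutes]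
  have : Algebra.IsInvariant A V Gal(L/K) := by
    refine ⟨fun v hv => ?_⟩
    obtain ⟨k, hk⟩ := IntermediateField.mem_bot.1 ((InfiniteGalois.mem_bot_iff_fixed
      (k := K) (algebraMap V L v)).2 fun g => by rw [← hL, hv])
    have hk' : IsIntegral A k := by
      rw [← isIntegral_algebraMap_iff (B := L) (algebraMap K L).injective, hk]
      exact IsIntegral.algebraMap (hi v : IsIntegral A v)
    obtain ⟨a, rfl⟩ := IsIntegrallyClosed.algebraMap_eq_of_integral hk'
    refine ⟨a, hinj ?_⟩
    rw [← hk, ← IsScalarTower.algebraMap_apply, ← IsScalarTower.algebraMap_apply]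
  obtain ⟨g, hg⟩ := exists_smul_of_comp_eq (A := A) (G := Gal(L/K)) (fun v => by
    have := stabilizer_isOpen_of_isIntegral (K := K) (algebraMap V L v)
    convert this using 1
    ext g
    simp only [SetLike.mem_coe, MulAction.mem_stabilizer_iff]
    rw [← hinj.eq_iff, hL]
    rfl) h₁ h₂ h
  refine ⟨MulSemiringAction.toRingHom _ V g, ?_, RingHom.ext hg⟩
  ext a
  exact smul_algebraMap g a

end

section

open IsLocalRing

theorem isDomain_of_isPrime_ker {V W : Type*} [CommRing V] [CommRing W] (χ : V →+* W)
    (hχ : Function.Surjective χ) (h : (RingHom.ker χ).IsPrime) : IsDomain W :=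
  (RingHom.quotientKerEquivOfSurjective hχ).symm.toMulEquiv.isDomain _

/-- Homomorphisms to absolutely integrally closed domains extend along integral maps. -/
theorem HasMonicRoots.exists_extension {A V W : Type*} [CommRing A] [CommRing V] [CommRing W]
    [IsDomain W] (hW : HasMonicRoots W) (φ : A →+* V) (hφ : φ.IsIntegral) (g : A →+* W)
    (hker : RingHom.ker φ ≤ RingHom.ker g) : ∃ h : V →+* W, h.comp φ = g := by
  have hP : (RingHom.ker g).IsPrime := RingHom.ker_isPrime g
  obtain ⟨Q, hQ, hQc⟩ : ∃ Q : Ideal V, Q.IsPrime ∧ Q.comap φ = RingHom.ker g := by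
    algebraize [φ]
    have : Algebra.IsIntegral A V := ⟨hφ⟩
    obtain ⟨Q, -, hQ⟩ := Ideal.exists_ideal_over_prime_of_isIntegral (S := V) (RingHom.ker g) ⊥
      (by rw [← RingHom.ker_eq_comap_bot]; exact hker)
    exact ⟨Q, hQ⟩
  obtain ⟨A₁, _, α, hα, hαk⟩ := exists_quotient (RingHom.ker g)
  obtain ⟨V₁, _, χ, hχ, hχk⟩ := exists_quotient Q
  have : IsDomain A₁ := isDomain_of_isPrime_ker α hα (by rwa [hαk])
  have : IsDomain V₁ := isDomain_of_isPrime_ker χ hχ (by rwa [hχk])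
  let g₁ : A₁ →+* W := α.liftOfSurjective hα ⟨g, hαk.le⟩
  have hg₁ : g₁.comp α = g := RingHom.liftOfRightInverse_comp _ _ _ _
  have hk : RingHom.ker (χ.comp φ) = RingHom.ker α := by rw [← RingHom.comap_ker, hχk, hQc, hαk]
  let φ₁ : A₁ →+* V₁ := α.liftOfSurjective hα ⟨χ.comp φ, hk.ge⟩
  have hφ₁ : φ₁.comp α = χ.comp φ := RingHom.liftOfRightInverse_comp _ _ _ _
  have hg₁i : Function.Injective g₁ := by
    rw [injective_iff_map_eq_zero]
    intro x hx
    obtain ⟨a, rfl⟩ := hα x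
    rw [← RingHom.mem_ker, hαk, RingHom.mem_ker, ← hg₁]
    exact hx
  have hφ₁i : Function.Injective φ₁ := by
    rw [injective_iff_map_eq_zero]
    intro x hx
    obtain ⟨a, rfl⟩ := hα x
    rw [← RingHom.mem_ker, ← hk, RingHom.mem_ker, ← hφ₁]
    exact hx
  have hφ₁int : φ₁.IsIntegral := by
    refine RingHom.IsIntegral.tower_top α φ₁ ?_
    rw [hφ₁]
    exact RingHom.IsIntegral.trans φ χ hφ (RingHom.isIntegral_of_surjective χ hχ)
  let Ω := AlgebraicClosure (FractionRing W)
  let j : W →+* Ω := (algebraMap (FractionRing W) Ω).comp (algebraMap W (FractionRing W))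
  have hj : Function.Injective j :=
    (algebraMap (FractionRing W) Ω).injective.comp (IsFractionRing.injective W _)
  let := φ₁.toAlgebra
  let := (j.comp g₁).toAlgebra
  have : FaithfulSMul A₁ Ω := (faithfulSMul_iff_algebraMap_injective _ _).2 (hj.comp hg₁i)
  have : FaithfulSMul A₁ V₁ := (faithfulSMul_iff_algebraMap_injective _ _).2 hφ₁i
  have : Algebra.IsIntegral A₁ V₁ := ⟨hφ₁int⟩
  have : Algebra.IsAlgebraic A₁ V₁ := inferInstance
  let l : V₁ →ₐ[A₁] Ω := IsAlgClosed.lift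
  have hl : ∀ v, ∃ w, j w = l v := fun v => by
    obtain ⟨P, hP, hv⟩ := hφ₁int v
    refine hW.mem_of_root j (P := P.map g₁) (hP.map _) ?_
    rw [Polynomial.eval₂_map]
    have : j.comp g₁ = (l : V₁ →+* Ω).comp φ₁ := by
      ext a
      exact (l.commutes a).symm
    rw [this]
    have e := congrArg (l : V₁ →+* Ω) hv
    rw [Polynomial.hom_eval₂, map_zero] at e
    exact e
  choose h hh using hl
  let H : V₁ →+* W :=
    { toFun := h
      map_one' := hj (by rw [hh, map_one, map_one])
      map_zero' := hj (by rw [hh, map_zero, map_zero])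
      map_add' := fun a b => hj (by rw [hh, map_add, map_add, hh, hh])
      map_mul' := fun a b => hj (by rw [hh, map_mul, map_mul, hh, hh]) }
  refine ⟨H.comp χ, ?_⟩
  rw [RingHom.comp_assoc, ← hφ₁, ← RingHom.comp_assoc, ← hg₁]
  congr 1
  ext a
  refine hj ((hh _).trans ?_)
  exact l.commutes a

theorem HasMonicRoots.surjective_of_isIntegral {U W : Type*} [CommRing U] [Nontrivial U]
    (hU : HasMonicRoots U) [CommRing W] [IsDomain W] (e : U →+* W) (he : e.IsIntegral) :
    Function.Surjective e := fun w => by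
  obtain ⟨P, hP, hw⟩ := he w
  exact hU.mem_of_root e hP hw

/-- Absolute integral closures are unique. -/
theorem exists_ringEquiv_of_ker_eq {A U W : Type*} [CommRing A] [CommRing U] [IsDomain U]
    [CommRing W] [IsDomain W] (hU : HasMonicRoots U) (hW : HasMonicRoots W) (φ : A →+* U)
    (hφ : φ.IsIntegral) (g : A →+* W) (hg : g.IsIntegral) (hker : RingHom.ker φ = RingHom.ker g) :
    ∃ e : U ≃+* W, (e : U →+* W).comp φ = g := by
  obtain ⟨e, he⟩ := hW.exists_extension φ hφ g hker.le
  have hs : Function.Surjective e := by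
    refine hU.surjective_of_isIntegral e (RingHom.IsIntegral.tower_top φ e ?_)
    rwa [he]
  have hi : Function.Injective e := by
    rw [injective_iff_map_eq_zero]
    intro x hx
    by_contra hx0
    algebraize [φ]
    have h1 := Ideal.comap_lt_comap_of_integral_mem_sdiff (R := A) (I := (⊥ : Ideal U))
      (J := RingHom.ker e) bot_le (x := x) ⟨hx, hx0⟩ (hφ x)
    refine h1.ne ?_
    change (⊥ : Ideal U).comap φ = (RingHom.ker e).comap φ
    rw [RingHom.comap_ker, he, ← hker, RingHom.ker_eq_comap_bot]
  exact ⟨RingEquiv.ofBijective e ⟨hi, hs⟩, he⟩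

end

section

open IsLocalRing

section WittFiltration

variable (p : ℕ) [Fact p.Prime] {Q : Type*} [CommRing Q] (J : Ideal Q)

/-- Witt vectors whose first `n` components lie in `J ^ n`. -/
noncomputable def wittFiltration (n : ℕ) : Ideal (WittVector p Q) :=
  (RingHom.ker (WittVector.truncate (p := p) n)).comap
    (WittVector.map (Ideal.Quotient.mk (J ^ n)))

variable {p J}

theorem mem_wittFiltration {n : ℕ} {w : WittVector p Q} :
    w ∈ wittFiltration p J n ↔ ∀ i < n, w.coeff i ∈ J ^ n := by
  rw [wittFiltration, Ideal.mem_comap, WittVector.mem_ker_truncate]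
  simp only [WittVector.map_coeff, Ideal.Quotient.eq_zero_iff_mem]

theorem sub_mem_wittFiltration {n : ℕ} {v w : WittVector p Q} :
    v - w ∈ wittFiltration p J n ↔ ∀ i < n, v.coeff i - w.coeff i ∈ J ^ n := by
  rw [wittFiltration, RingHom.comap_ker, RingHom.sub_mem_ker_iff]
  simp only [RingHom.comp_apply, TruncatedWittVector.ext_iff, WittVector.coeff_truncate,
    WittVector.map_coeff, Ideal.Quotient.eq, Fin.forall_iff]

theorem completeFiltration_wittFiltration [IsAdicComplete J Q] :
    CompleteFiltration (wittFiltration p J) where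
  anti := fun m n hmn w hw => mem_wittFiltration.2 fun i hi =>
    Ideal.pow_le_pow_right hmn (mem_wittFiltration.1 hw i (hi.trans_le hmn))
  haus := fun w hw => by
    ext i
    rw [WittVector.zero_coeff]
    refine (completeFiltration_pow J).haus _ fun n => ?_
    exact Ideal.pow_le_pow_right (le_max_left n (i + 1))
      (mem_wittFiltration.1 (hw _) i (by omega))
  lim := fun f hf => by
    have h : ∀ i, ∃ L, ∀ n, L - (f (max n (i + 1))).coeff i ∈ J ^ n := fun i => by
      refine exists_limit J (fun n => (f (max n (i + 1))).coeff i) fun n => ?_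
      rcases lt_or_ge n (i + 1) with hn | hn
      · rw [max_eq_right hn, max_eq_right (by omega), sub_self]
        exact zero_mem _
      · rw [max_eq_left hn, max_eq_left (by omega)]
        exact sub_mem_wittFiltration.1 (hf n) i hn
    choose L hL using h
    refine ⟨WittVector.mk p L, fun n => sub_mem_wittFiltration.2 fun i hi => ?_⟩
    have := hL i n
    rwa [max_eq_left (by omega)] at this

theorem teichmuller_pow_mem_wittFiltration {x : Q} (hx : x ∈ J) (n : ℕ) :
    WittVector.teichmuller p x ^ n ∈ wittFiltration p J n := by
  rw [← map_pow, mem_wittFiltration]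
  intro i _
  rcases i with _ | i
  · rw [WittVector.teichmuller_coeff_zero]
    exact Ideal.pow_mem_pow hx n
  · rw [WittVector.teichmuller_coeff_pos _ _ _ (Nat.succ_pos i)]
    exact zero_mem _

end WittFiltration

theorem IsCohenPower.exists_perfectBase {p : ℕ} [hp : Fact p.Prime] {Λ k A : Type} [CommRing Λ]
    [Field k] [CharP k p] [CommRing A] [IsLocalRing A] {π : Λ →+* k} {ι : Λ →+* A} {xs : List A}
    (h : IsCohenPower p π ι xs) : ∃ (T : Type) (_ : CommRing T), Nonempty (PerfectBase p xs T) := by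
  let κ := AlgebraicClosure k
  have : CharP κ p := charP_of_injective_algebraMap (algebraMap k κ).injective p
  have : PerfectRing κ p := PerfectField.toPerfectRing p
  have hbot : maximalIdeal κ = ⊥ := maximalIdeal_eq_bot
  have : IsAdicComplete (maximalIdeal κ) κ := by rw [hbot]; infer_instance
  obtain ⟨Q, _, _, _, i, qs, hlen, hQ, hQc, hm, hr⟩ := exists_isFormalPower κ (zs := [])
    (by rw [hbot, Ideal.ofList_nil]) trivial xs.length
  simp only [List.map_nil, List.append_nil] at hm hr
  have : CharP Q p := charP_of_injective_ringHom i.injective p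
  have hcs : Function.Surjective (WittVector.constantCoeff : WittVector p κ →+* κ) := fun a =>
    ⟨WittVector.teichmuller p a, by simp [WittVector.constantCoeff]⟩
  obtain ⟨l, -⟩ := h.cohen.exists_lift hcs
    (by rw [WittVector.ker_constantCoeff]; infer_instance) (by rw [map_natCast, CharP.cast_eq_zero])
    ((algebraMap k κ).comp π)
  obtain ⟨ρ, -, hρ⟩ := h.formal.exists_hom (completeFiltration_wittFiltration (p := p))
    ((WittVector.map i).comp l) (qs.map (WittVector.teichmuller p)) (by simp [hlen]) (by
      intro b hb N
      obtain ⟨q, hq, rfl⟩ := List.mem_map.1 hb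
      exact ⟨N, teichmuller_pow_mem_wittFiltration (mem_of_mem_ofList hm q hq) N⟩)
  let S := Polynomial Q
  have : CharP S p := inferInstance
  let T := PerfectClosure S p
  let of : S →+* T := PerfectClosure.of S p
  have e0 : (qs.map (Polynomial.C : Q →+* S)).map (Polynomial.evalRingHom 0) = qs := by
    rw [List.map_map]
    simp [Function.comp_def]
  have hev : Function.Surjective (Polynomial.evalRingHom (0 : Q)) := fun a =>
    ⟨Polynomial.C a, by simp⟩
  have hregS : RegMod ⊥ ((Polynomial.X : S) :: qs.map (Polynomial.C : Q →+* S)) := by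
    refine ⟨fun b hb => ?_, ?_⟩
    · rw [Ideal.mem_bot] at hb ⊢
      ext n
      have := congrArg (fun P => Polynomial.coeff P (n + 1)) hb
      simpa using this
    · have e : (⊥ : Ideal S) ⊔ Ideal.span {(Polynomial.X : S)} =
          (⊥ : Ideal Q).comap (Polynomial.evalRingHom 0) := by
        rw [bot_sup_eq, ← RingHom.ker_eq_comap_bot]
        ext a
        rw [Ideal.mem_span_singleton, RingHom.mem_ker, Polynomial.X_dvd_iff,
          Polynomial.coeff_zero_eq_eval_zero]
        rfl
      rw [e]
      refine (regMod_comap_iff _ hev ⊥ _).2 ?_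
      rwa [e0]
  have hneS : Ideal.ofList ((Polynomial.X : S) :: qs.map (Polynomial.C : Q →+* S)) ≠ ⊤ := by
    intro e
    have := congrArg (Ideal.map (Polynomial.evalRingHom (0 : Q))) e
    rw [Ideal.map_top, Ideal.map_ofList, List.map_cons, e0, Ideal.ofList_cons, ← hm] at this
    simp only [Polynomial.coe_evalRingHom, Polynomial.eval_X, Ideal.span_singleton_zero,
      bot_sup_eq] at this
    exact (Ideal.IsMaximal.ne_top inferInstance) this
  refine ⟨T, inferInstance, ⟨⟨inferInstance, inferInstance, of Polynomial.X,
    (qs.map (Polynomial.C : Q →+* S)).map of, ?_, ?_,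
    (WittVector.map (of.comp Polynomial.C)).comp ρ, ?_⟩⟩⟩
  · exact RegMod.isPRadical (P := T) p of hregS
  · exact ofList_ne_top_of_isPRadical (P := T) p of hneS
  · have : xs.map ((WittVector.map (of.comp Polynomial.C)).comp ρ) =
      (xs.map ρ).map (WittVector.map (of.comp Polynomial.C)) := by rw [List.map_map]; rfl
    rw [this, hρ, List.map_map, List.map_map, List.map_map]
    refine List.map_congr_left fun q _ => ?_
    simp only [Function.comp_apply, WittVector.map_teichmuller, RingHom.comp_apply]

end

section

open IsLocalRing

theorem IsFormalPower.trans {Λ A B : Type} [CommRing Λ] [CommRing A] [CommRing B] {ι : Λ →+* A}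
    {xs : List A} (h : IsFormalPower ι xs) {κ : A →+* B} {ys : List B} (h' : IsFormalPower κ ys) :
    IsFormalPower (κ.comp ι) (ys ++ xs.map κ) where
  exists_hom := by
    intro D _ F hF l bs hbs hb
    rw [List.length_append, List.length_map] at hbs
    obtain ⟨φ, hφ, hx⟩ := h.exists_hom hF l (bs.drop ys.length) (by simp; omega)
      fun b hb' => hb b (List.mem_of_mem_drop hb')
    obtain ⟨φ', hφ', hy⟩ := h'.exists_hom hF φ (bs.take ys.length) (by simp; omega)
      fun b hb' => hb b (List.mem_of_mem_take hb')
    refine ⟨φ', by rw [← RingHom.comp_assoc, hφ', hφ], ?_⟩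
    rw [List.map_append, hy, List.map_map, ← RingHom.coe_comp, hφ', hx, List.take_append_drop]
  hom_ext := by
    intro D _ F hF φ ψ h1 h2 h3
    rw [List.map_append, List.map_append] at h2
    obtain ⟨h4, h5⟩ := List.append_inj h2 (by simp)
    refine h'.hom_ext hF φ ψ ?_ h4 fun y hy => h3 y (List.mem_append_left _ hy)
    refine h.hom_ext hF _ _ h1 ?_ fun x hx =>
      h3 _ (List.mem_append_right _ (List.mem_map_of_mem hx))
    rwa [List.map_map, List.map_map] at h5

theorem completeFiltration_const_bot (D : Type*) [CommRing D] :
    CompleteFiltration fun _ : ℕ => (⊥ : Ideal D) where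
  anti := fun _ _ _ => le_rfl
  haus := fun _ h => h 0
  lim := fun f h => ⟨f 0, fun n => by
    have : ∀ n, f n = f 0 := fun n => by
      induction n with
      | zero => rfl
      | succ n ih => rw [← ih]; exact sub_eq_zero.1 (h n)
    rw [this n, sub_self]; exact zero_mem _⟩

theorem IsFormalPower.exists_retraction {A B : Type} [CommRing A] [CommRing B] {κ : A →+* B}
    {ys : List B} (h : IsFormalPower κ ys) :
    ∃ ε : B →+* A, ε.comp κ = RingHom.id A ∧ (Ideal.ofList ys).map ε = ⊥ ∧
      ∀ b, b - κ (ε b) ∈ Ideal.ofList ys := by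
  obtain ⟨ε, h1, h2⟩ := h.exists_hom (completeFiltration_const_bot A) (RingHom.id A)
    (List.replicate ys.length 0) (by simp) fun b hb _ => ⟨1, by
      rw [List.eq_of_mem_replicate hb, zero_pow one_ne_zero]; exact zero_mem _⟩
  have h3 : ∀ y ∈ ys, ε y = 0 := fun y hy =>
    List.eq_of_mem_replicate (h2 ▸ List.mem_map_of_mem hy)
  refine ⟨ε, h1, ?_, ?_⟩
  · rw [Ideal.map_ofList, h2, eq_bot_iff, Ideal.ofList, Ideal.span_le]
    intro b hb
    exact List.eq_of_mem_replicate hb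
  · obtain ⟨D, _, χ, -, hχ⟩ := exists_quotient (Ideal.ofList ys)
    have h4 : ∀ y ∈ ys, χ y = 0 := fun y hy => by
      rw [← RingHom.mem_ker, hχ]; exact Ideal.subset_span hy
    have : χ = (χ.comp κ).comp ε := by
      refine h.hom_ext (completeFiltration_const_bot D) _ _ ?_ ?_ fun y hy _ => ⟨1, ?_⟩
      · rw [RingHom.comp_assoc, h1, RingHom.comp_id]
      · refine List.map_congr_left fun y hy => ?_
        rw [h4 y hy, RingHom.comp_apply, h3 y hy, map_zero]
      · rw [h4 y hy, zero_pow one_ne_zero]; exact zero_mem _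
    intro b
    rw [← hχ, RingHom.sub_mem_ker_iff]
    exact RingHom.congr_fun this b

theorem IsFormalPower.ker_comp {A B W : Type} [CommRing A] [CommRing B] [CommRing W] {κ : A →+* B}
    {ys : List B} (h : IsFormalPower κ ys) {φ : B →+* W} {K : Ideal A}
    (hφ : RingHom.ker φ = Ideal.ofList ys ⊔ K.map κ) : RingHom.ker (φ.comp κ) = K := by
  obtain ⟨ε, h1, h2, -⟩ := h.exists_retraction
  refine le_antisymm (fun a ha => ?_) fun a ha => ?_
  · have : κ a ∈ RingHom.ker φ := ha
    rw [hφ] at this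
    have := Ideal.mem_map_of_mem ε this
    rwa [Ideal.map_sup, h2, bot_sup_eq, Ideal.map_map, h1, Ideal.map_id, ← RingHom.comp_apply, h1]
      at this
  · change κ a ∈ RingHom.ker φ
    rw [hφ]
    exact Ideal.mem_sup_right (Ideal.mem_map_of_mem κ ha)

theorem IsFormalPower.range_comp {A B W : Type} [CommRing A] [CommRing B] [CommRing W] {κ : A →+* B}
    {ys : List B} (h : IsFormalPower κ ys) {φ : B →+* W}
    (hφ : Ideal.ofList ys ≤ RingHom.ker φ) (b : B) : ∃ a, φ (κ a) = φ b := by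
  obtain ⟨ε, h1, h2, h3⟩ := h.exists_retraction
  exact ⟨ε b, ((RingHom.sub_mem_ker_iff φ).1 (hφ (h3 b))).symm⟩

theorem IsCohenPower.exists_isFormalPower {p : ℕ} {Λ k A : Type} [CommRing Λ]
    [CommRing k] [CommRing A] [IsNoetherianRing A] [IsLocalRing A] {π : Λ →+* k} {ι : Λ →+* A}
    {xs : List A} (h : IsCohenPower p π ι xs) (n : ℕ) :
    ∃ (B : Type) (_ : CommRing B) (_ : IsNoetherianRing B) (_ : IsLocalRing B) (κ : A →+* B)
      (ys : List B), ys.length = n ∧ IsFormalPower κ ys ∧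
      IsCohenPower p π (κ.comp ι) (ys ++ xs.map κ) := by
  have := h.complete
  obtain ⟨B, _, _, _, κ, ys, hn, hf, hc, hm, hr⟩ := BigCM.exists_isFormalPower A h.max_eq h.reg n
  have e : (ys ++ (xs ++ [(p : A)]).map κ) = (ys ++ xs.map κ) ++ [(p : B)] := by simp
  exact ⟨B, inferInstance, inferInstance, inferInstance, κ, ys, hn, hf, h.cohen, h.formal.trans hf,
    hc, by rw [hm, e], by rwa [e] at hr⟩

end

section

open IsLocalRing Polynomial

/-- A finite map from formal power series over a Cohen ring onto its image, presenting a
complete local domain; `ys` generates the kernel and `zs` gives parameters of the target. -/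
structure IsPresentation (p : ℕ) {Λ k A R : Type} [CommRing Λ] [CommRing k] [CommRing A]
    [IsLocalRing A] [CommRing R] [IsLocalRing R] (π : Λ →+* k) (ι : Λ →+* A) (xs : List A)
    (ψ : A →+* R) (ys zs : List A) : Prop where
  power : IsCohenPower p π ι xs
  finite : ψ.Finite
  map_le : (maximalIdeal A).map ψ ≤ maximalIdeal R
  le_radical : maximalIdeal R ≤ ((maximalIdeal A).map ψ).radical
  perm : (xs ++ [(p : A)]).Perm (ys ++ zs)
  ker_eq : RingHom.ker ψ = Ideal.ofList ys
  length_eq : (zs.length : WithBot ℕ∞) = ringKrullDim R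

theorem exists_isPresentation (p : ℕ) [hp : Fact p.Prime] (R : Type) [CommRing R] [IsDomain R]
    [IsNoetherianRing R] [IsLocalRing R] [IsAdicComplete (maximalIdeal R) R]
    (hpR : (p : R) ∈ maximalIdeal R) :
    ∃ (Λ A : Type) (_ : CommRing Λ) (_ : CommRing A) (_ : IsNoetherianRing A) (_ : IsLocalRing A)
      (π : Λ →+* ResidueField R) (ι : Λ →+* A) (xs : List A) (ψ : A →+* R) (ys zs : List A),
      IsPresentation p π ι xs ψ ys zs ∧
      ((p : R) = 0 ∧ ys = [(p : A)] ∧ zs = xs ∨ (p : R) ≠ 0 ∧ ys = [] ∧ zs = (p : A) :: xs) := by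
  have hk : CharP (ResidueField R) p := charP_of_natCast_eq_zero p (by
    rw [← map_natCast (residue R), residue_eq_zero_iff]; exact hpR)
  obtain ⟨ts, hts, htm, htr⟩ := exists_ofList_radical R
  by_cases hp0 : (p : R) = 0
  · obtain ⟨Λ, A, _, _, _, _, π, ι, xs, h, hl⟩ := exists_isCohenPower p (ResidueField R) ts.length
    obtain ⟨ψ, hf, hx, hm, hr, -⟩ := h.exists_finite hpR hl.symm htm (htr.trans
      (Ideal.radical_mono (by rw [Ideal.ofList_cons]; exact le_sup_right)))
    refine ⟨Λ, A, inferInstance, inferInstance, inferInstance, inferInstance, π, ι, xs, ψ,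
        [(p : A)],
      xs, ⟨h, hf, hm, hr, ?_, ?_, ?_⟩, Or.inl ⟨hp0, rfl, rfl⟩⟩
    · simp
    · rw [Ideal.ofList_singleton]
      refine ker_eq_of_length ψ hm hr h.isPrime_p ?_ h.isParam_p (by rw [hl, hts])
      rw [Ideal.span_singleton_le_iff_mem, RingHom.mem_ker, map_natCast, hp0]
    · rw [hl, hts]
  · obtain ⟨us, hul, hum, hur⟩ := exists_sop_cons (K := (⊥ : Ideal R)) Ideal.isPrime_bot htm
      (by rwa [bot_sup_eq]) hpR hp0
    rw [bot_sup_eq] at hur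
    obtain ⟨Λ, A, _, _, _, _, π, ι, xs, h, hl⟩ := exists_isCohenPower p (ResidueField R) us.length
    obtain ⟨ψ, hf, hx, hm, hr, -⟩ := h.exists_finite hpR hl.symm hum hur
    have := h.isDomain
    have hzl : ((((p : A) :: xs).length : ℕ) : WithBot ℕ∞) = ringKrullDim R := by
      rw [← hts, ← hul, List.length_cons, List.length_cons, hl]
    refine ⟨Λ, A, inferInstance, inferInstance, inferInstance, inferInstance, π, ι, xs, ψ, [],
      p :: xs, ⟨h, hf, hm, hr, ?_, ?_, hzl⟩, Or.inr ⟨hp0, rfl, rfl⟩⟩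
    · simp
    · rw [Ideal.ofList_nil]
      exact ker_eq_of_length ψ hm hr Ideal.isPrime_bot bot_le h.isParam hzl

theorem HasMonicRoots.exists_root_of_eval₂ {U : Type*} [CommRing U] (h : HasMonicRoots U)
    {K : Type*} [CommRing K] [IsDomain K] (φ : U →+* K) [Nontrivial U] {P : U[X]} (hP : P.Monic)
    {x : K} (hx : P.eval₂ φ x = 0) : ∃ u, P.eval u = 0 ∧ φ u = x := by
  induction hn : P.natDegree generalizing P with
  | zero =>
    rw [hP.natDegree_eq_zero.1 hn, eval₂_one] at hx
    exact absurd hx one_ne_zero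
  | succ n ih =>
    obtain ⟨a, ha⟩ := h P hP (natDegree_pos_iff_degree_pos.1 (by omega))
    obtain ⟨Q, rfl⟩ := dvd_iff_isRoot.2 ha
    have hQ : Q.Monic := (monic_X_sub_C a).of_mul_monic_left hP
    rw [eval₂_mul, mul_eq_zero] at hx
    rcases hx with hx | hx
    · refine ⟨a, ha, ?_⟩
      rw [eval₂_sub, eval₂_X, eval₂_C, sub_eq_zero] at hx
      exact hx.symm
    · obtain ⟨u, hu, hux⟩ := ih hQ hx (by
        rw [(monic_X_sub_C a).natDegree_mul hQ, natDegree_X_sub_C] at hn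
        omega)
      exact ⟨u, by rw [eval_mul, hu, mul_zero], hux⟩

/-- Elements integral over a subring lift, integrally over it, along homomorphisms from an
absolutely integrally closed ring. -/
theorem HasMonicRoots.exists_isIntegralElem {A U V : Type*} [CommRing A] [CommRing U] [IsDomain U]
    [CommRing V] [IsDomain V] (hU : HasMonicRoots U) (a : A →+* U) (χ : U →+* V)
    (h : (χ.comp a).IsIntegral) :
    ∃ l : V → U, (∀ v, χ (l v) = v) ∧ ∀ v, a.IsIntegralElem (l v) := by
  have (v : V) : ∃ u, χ u = v ∧ a.IsIntegralElem u := by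
    obtain ⟨P, hP, hv⟩ := h v
    obtain ⟨u, hu, huv⟩ := hU.exists_root_of_eval₂ χ (hP.map a) (x := v) (by rwa [eval₂_map])
    exact ⟨u, huv, P, hP, by rwa [eval_map] at hu⟩
  choose l h1 h2 using this
  exact ⟨l, h1, h2⟩

theorem HasMonicRoots.exists_section {A U V : Type*} [CommRing A] [IsDomain A]
    [IsIntegrallyClosed A] [CharZero A] [CommRing U] [IsDomain U] [CommRing V] [IsDomain V]
    (hU : HasMonicRoots U) (hV : HasMonicRoots V) (a : A →+* U) (χ : U →+* V)
    (h : (χ.comp a).IsIntegral) (hi : Function.Injective (χ.comp a)) :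
    ∃ l : V →+* U, χ.comp l = RingHom.id V ∧ l.comp (χ.comp a) = a := by
  obtain ⟨s, hs⟩ := hU.exists_extension (χ.comp a) h a (by
    rw [(RingHom.injective_iff_ker_eq_bot _).1 hi]; exact bot_le)
  obtain ⟨σ, hσ, hσ'⟩ := exists_ringEquiv_of_comp_eq hV (χ.comp a) hi h (RingHom.id V) (χ.comp s)
    (by rw [RingHom.comp_assoc, hs, RingHom.id_comp])
  refine ⟨s.comp σ, by rw [hσ', RingHom.comp_assoc], by rw [RingHom.comp_assoc, hσ, hs]⟩

end

section

open IsLocalRing Polynomial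

theorem exists_finite_subring {B U : Type} [CommRing B] [IsNoetherianRing B] [IsLocalRing B]
    [IsAdicComplete (maximalIdeal B) B] [CommRing U] [IsDomain U] (φ : B →+* U) (hφ : φ.IsIntegral)
    {S : Set U} (hS : S.Finite) :
    ∃ (M : Type) (_ : CommRing M) (_ : IsDomain M) (_ : IsNoetherianRing M) (_ : IsLocalRing M)
      (i : B →+* M) (s : M →+* U), IsAdicComplete (maximalIdeal M) M ∧
      (maximalIdeal B).map i ≤ maximalIdeal M ∧ maximalIdeal M ≤ ((maximalIdeal B).map i).radical ∧
      s.comp i = φ ∧ Function.Injective s ∧ (∀ u ∈ S, ∃ m, s m = u) ∧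
      ∀ T : Subring U, (∀ b, φ b ∈ T) → (∀ u ∈ S, u ∈ T) → ∀ m, s m ∈ T := by
  algebraize [φ]
  let M := Algebra.adjoin B S
  have hfin : Module.Finite B M := by
    have := fg_adjoin_of_finite hS fun u _ => Algebra.IsIntegral.isIntegral (R := B) u
    exact Module.Finite.iff_fg.2 this
  have hN : IsNoetherianRing M := IsNoetherianRing.of_finite B M
  have hL : IsLocalRing M := isLocalRing_of_finite B
  refine ⟨M, inferInstance, inferInstance, hN, hL, algebraMap B M, M.val.toRingHom,
    isAdicComplete_maximalIdeal_of_finite B, map_le_maximalIdeal_of_finite (B := B),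
    maximalIdeal_le_radical_of_finite, rfl, Subtype.val_injective,
    fun u hu => ⟨⟨u, Algebra.subset_adjoin hu⟩, rfl⟩, fun T h1 h2 m => ?_⟩
  let T' : Subalgebra B U := { T with algebraMap_mem' := h1 }
  have : M ≤ T' := Algebra.adjoin_le h2
  exact this m.2

theorem mem_of_isIntegralElem {A M : Type*} [CommRing A] [IsLocalRing A] [CommRing M]
    [IsLocalRing M]
    (φ : A →+* M) {Q : Ideal M} [hQ : Q.IsPrime] (h : (maximalIdeal A).map φ ≤ Q) {t : M}
    (ht : t ∈ maximalIdeal M) (hi : φ.IsIntegralElem t) : t ∈ Q := by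
  obtain ⟨P, hP, hP0⟩ := hi
  have hPt : P.eval₂ φ t ∈ Q := by rw [hP0]; exact zero_mem _
  clear hP0
  induction hn : P.natDegree generalizing P with
  | zero =>
    rw [hP.natDegree_eq_zero.1 hn, eval₂_one] at hPt
    exact absurd ((Ideal.eq_top_iff_one Q).2 hPt) hQ.ne_top
  | succ n ih =>
    have e : P.eval₂ φ t = P.divX.eval₂ φ t * t + φ (P.coeff 0) := by
      conv_lhs => rw [← divX_mul_X_add P]
      rw [eval₂_add, eval₂_mul, eval₂_X, eval₂_C]
    have hQm : Q ≤ maximalIdeal M := le_maximalIdeal hQ.ne_top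
    by_cases hc : P.coeff 0 ∈ maximalIdeal A
    · have h1 : P.divX.eval₂ φ t * t ∈ Q := by
        rw [e] at hPt
        exact (Q.add_mem_iff_left (h (Ideal.mem_map_of_mem φ hc))).1 hPt
      refine (hQ.mem_or_mem h1).elim (fun h2 => ih P.divX ?_ h2 ?_) id
      · rw [Monic, leadingCoeff, natDegree_divX_eq_natDegree_tsub_one, coeff_divX, hn]
        have := hP.coeff_natDegree
        rwa [hn] at this
      · rw [natDegree_divX_eq_natDegree_tsub_one, hn]; rfl
    · rw [mem_maximalIdeal, mem_nonunits_iff, not_not] at hc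
      have h2 : φ (P.coeff 0) ∈ maximalIdeal M := by
        rw [e] at hPt
        exact ((maximalIdeal M).add_mem_iff_right (Ideal.mul_mem_left _ _ ht)).1 (hQm hPt)
      exact absurd (hc.map φ) h2

theorem CompleteCM.of_comp {B M E : Type*} [CommRing B] [IsLocalRing B] [CommRing M]
    [IsNoetherianRing M] [IsLocalRing M] [CommRing E] {i : B →+* M} {j : M →+* E}
    {xs : List B} (h : CompleteCM (j.comp i) xs) (hi : (maximalIdeal B).map i ≤ maximalIdeal M)
    (hr : maximalIdeal M ≤ ((maximalIdeal B).map i).radical) : CompleteCM j (xs.map i) := by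
  have hr' : (maximalIdeal M).map j ≤ ((maximalIdeal B).map (j.comp i)).radical := by
    rw [← Ideal.map_map]
    exact (Ideal.map_mono hr).trans (Ideal.map_radical_le j)
  have := h.complete
  refine ⟨isAdicComplete_of_le_radical (J := (maximalIdeal B).map (j.comp i)) ?_
    (Ideal.FG.map (IsNoetherian.noetherian _) j) hr', ?_, fun e => h.ne_top ?_⟩
  · rw [← Ideal.map_map]; exact Ideal.map_mono hi
  · rw [List.map_map]; exact h.reg
  · rw [e, top_le_iff] at hr'
    exact Ideal.radical_eq_top.1 hr'

theorem CompleteCM.comp_of_map_eq {A B E : Type*} [CommRing A] [IsLocalRing A] [CommRing B]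
    [IsLocalRing B] [CommRing E] {κ : A →+* B} {j : B →+* E} {xs : List A}
    (h : CompleteCM j (xs.map κ)) (e : (maximalIdeal B).map j = (maximalIdeal A).map (j.comp κ)) :
    CompleteCM (j.comp κ) xs :=
  ⟨e ▸ h.complete, by have := h.reg; rwa [List.map_map] at this, e ▸ h.ne_top⟩

end

section

open IsLocalRing Polynomial

theorem exists_hasMonicRoots (B : Type) [CommRing B] [IsDomain B] :
    ∃ (U : Type) (_ : CommRing U) (_ : IsDomain U) (φ : B →+* U),
      HasMonicRoots U ∧ Function.Injective φ ∧ φ.IsIntegral := by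
  let Ω := AlgebraicClosure (FractionRing B)
  have hBΩ : Function.Injective (algebraMap B Ω) := by
    rw [IsScalarTower.algebraMap_eq B (FractionRing B) Ω]
    exact (algebraMap (FractionRing B) Ω).injective.comp (IsFractionRing.injective B _)
  refine ⟨integralClosure B Ω, inferInstance, inferInstance, algebraMap B _, fun P hP hd => ?_, ?_,
      ?_⟩
  · have hd' : (P.map (algebraMap (integralClosure B Ω) Ω)).degree ≠ 0 := by
      rw [hP.degree_map]; exact hd.ne'
    obtain ⟨x, hx⟩ := IsAlgClosed.exists_root _ hd'
    have hx' : P.eval₂ (algebraMap (integralClosure B Ω) Ω) x = 0 := by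
      rwa [IsRoot, eval_map] at hx
    have hi : IsIntegral B x := isIntegral_trans (A := integralClosure B Ω) x ⟨P, hP, hx'⟩
    refine ⟨⟨x, hi⟩, ?_⟩
    apply Subtype.val_injective
    change algebraMap (integralClosure B Ω) Ω _ = _
    rw [← eval₂_at_apply]
    exact hx'
  · exact fun a b h => hBΩ (congrArg Subtype.val h)
  · exact algebraMap_isIntegral_iff.2 inferInstance

/-- Algebras over a power series extension of a presentation of `R`, specializing to a
Cohen-Macaulay algebra over an absolute integral closure of `R`. -/
theorem IsPresentation.exists_specialization {p : ℕ} [hp : Fact p.Prime] {Λ k A R V : Type}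
    [CommRing Λ] [Field k] [CharP k p] [CommRing A] [IsNoetherianRing A] [IsLocalRing A]
    [CommRing R] [IsNoetherianRing R] [IsLocalRing R] {π : Λ →+* k} {ι : Λ →+* A} {xs : List A}
    {ψ : A →+* R}
    {ys zs : List A} (h : IsPresentation p π ι xs ψ ys zs) [CommRing V] [IsDomain V]
    (hV : HasMonicRoots V) (g : R →+* V) (hg : Function.Injective g) (hgi : g.IsIntegral) (n : ℕ) :
    ∃ (B : Type) (_ : CommRing B) (_ : IsNoetherianRing B) (_ : IsLocalRing B) (κ : A →+* B)
      (Ys : List B) (U : Type) (_ : CommRing U) (_ : IsDomain U) (φ : B →+* U) (C C' : Type)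
      (_ : CommRing C) (_ : CommRing C') (j : U →+* C) (χ : U →+* V) (τ : C →+* C') (j' : V →+* C'),
      Ys.length = n ∧ IsCohenPower p π (κ.comp ι) (Ys ++ xs.map κ) ∧ HasMonicRoots U ∧
      Function.Injective φ ∧ φ.IsIntegral ∧
      CompleteCM (j.comp φ) ((p : B) :: (Ys ++ xs.map κ)) ∧
      (χ.comp φ).comp κ = g.comp ψ ∧ (∀ y ∈ Ys, χ (φ y) = 0) ∧ (∀ b, ∃ a, χ (φ (κ a)) = χ (φ b)) ∧
      τ.comp j = j'.comp χ ∧ CompleteCM (j'.comp g) (zs.map ψ) := by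
  obtain ⟨B, _, _, _, κ, Ys, hYs, hκ, hB⟩ := h.power.exists_isFormalPower n
  have := hB.isDomain
  have := hB.isIntegrallyClosed
  have := hB.charZero
  obtain ⟨U, _, _, φ, hU, hφ, hφi⟩ := exists_hasMonicRoots B
  have hker : RingHom.ker φ = ⊥ := (RingHom.injective_iff_ker_eq_bot φ).1 hφ
  obtain ⟨T, _, ⟨b⟩⟩ := hB.exists_perfectBase
  obtain ⟨C, _, j, hC⟩ : ∃ (C : Type) (_ : CommRing C) (j : U →+* C),
      CompleteCM (j.comp φ) ((p : B) :: (Ys ++ xs.map κ)) := by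
    let := φ.toAlgebra
    have : FaithfulSMul B U := (faithfulSMul_iff_algebraMap_injective B U).2 hφ
    have : Algebra.IsIntegral B U := algebraMap_isIntegral_iff.1 hφi
    exact exists_completeCM_of_isIntegral p hB.isParam b U
  have hperm : ((Ys ++ xs.map κ) ++ [(p : B)]).Perm ((Ys ++ ys.map κ) ++ zs.map κ) := by
    have := h.perm.map κ
    simp only [List.map_append, List.map_cons, map_natCast, List.map_nil] at this
    rw [List.append_assoc, List.append_assoc]
    exact this.append_left Ys
  have hpar : IsParam (⊥ : Ideal B) ((Ys ++ ys.map κ) ++ zs.map κ) := by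
    have := hB.max_eq_perm hperm
    exact ⟨mem_of_mem_ofList this, by rw [bot_sup_eq, ← this]; exact Ideal.le_radical⟩
  have hC2 : CompleteCM (j.comp φ) ((Ys ++ ys.map κ) ++ zs.map κ) :=
    hC.exchange hB.isParam hpar (by rw [← hperm.length_eq]; simp; omega) Ideal.map_bot
  have hchain : PrimeChain (⊥ : Ideal B) (Ys ++ ys.map κ) :=
    primeChain_of_regMod (hB.reg_perm hperm) (by rw [bot_sup_eq, ← hB.max_eq_perm hperm])
  obtain ⟨U', _, _, χ, C', _, τ, j', hχ, hχk, hτ, hC'⟩ := exists_kill p φ hφi hU j hC2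
    (by rwa [hker]) (by rwa [hker])
  rw [hker, bot_sup_eq, Ideal.ofList_append, ← Ideal.map_ofList] at hχk
  have hU' : HasMonicRoots U' := hU.of_surjective χ hχ
  have hYk : Ideal.ofList Ys ≤ RingHom.ker (χ.comp φ) := hχk ▸ le_sup_left
  have hκk : RingHom.ker ((χ.comp φ).comp κ) = RingHom.ker (g.comp ψ) := by
    rw [hκ.ker_comp hχk, ← h.ker_eq, RingHom.ker_comp_of_injective ψ hg]
  have hκi : ((χ.comp φ).comp κ).IsIntegral := fun u => by
    obtain ⟨P, hP, hPu⟩ := (hφi.trans _ χ (χ.isIntegral_of_surjective hχ)) u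
    obtain ⟨ε, -, -, hε⟩ := hκ.exists_retraction
    refine ⟨P.map ε, hP.map ε, ?_⟩
    rw [eval₂_map, ← hPu]
    congr 1
    ext b
    exact ((RingHom.sub_mem_ker_iff _).1 (hYk (hε b))).symm
  obtain ⟨e, he⟩ := exists_ringEquiv_of_ker_eq hU' hV ((χ.comp φ).comp κ) hκi (g.comp ψ)
    (h.finite.to_isIntegral.trans _ _ hgi) hκk
  refine ⟨B, inferInstance, inferInstance, inferInstance, κ, Ys, U, inferInstance, inferInstance, φ,
    C, C', inferInstance, inferInstance, j, (e : U' →+* V).comp χ, τ, j'.comp (e.symm : V →+* U'),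
    hYs, hB, hU, hφ, hφi, hC, he, fun y hy => ?_, fun b => ?_, ?_, ?_⟩
  · have : χ (φ y) = 0 := hYk (Ideal.subset_span hy)
    rw [RingHom.comp_apply, this, map_zero]
  · obtain ⟨a, ha⟩ := hκ.range_comp hYk b
    exact ⟨a, congrArg e ha⟩
  · rw [hτ]
    ext u
    simp
  · have e1 : ((j'.comp χ).comp φ).comp κ = ((j'.comp (e.symm : V →+* U')).comp g).comp ψ := by
      rw [RingHom.comp_assoc ψ g, ← he]
      ext a
      simp
    have h1 : CompleteCM (((j'.comp χ).comp φ).comp κ) zs := by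
      refine hC'.comp_of_map_eq ?_
      rw [hB.max_eq, h.power.max_eq, Ideal.map_ofList, Ideal.map_ofList, List.append_assoc,
        List.map_append, Ideal.ofList_append]
      have : Ideal.ofList (Ys.map ((j'.comp χ).comp φ)) = ⊥ := by
        rw [← Ideal.map_ofList, RingHom.comp_assoc, ← Ideal.map_map,
          (Ideal.map_eq_bot_iff_le_ker _).2 hYk, Ideal.map_bot]
      rw [this, bot_sup_eq]
      congr 1
      simp
    rw [e1] at h1
    exact h1.of_comp h.map_le h.le_radical

end

section

open IsLocalRing Polynomial

theorem exists_comp_eq_of_forall_mem_range {M R V : Type*} [CommRing M] [CommRing R] [CommRing V]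
    {g : R →+* V} (hg : Function.Injective g) (h : M →+* V) (hm : ∀ m, h m ∈ g.range) :
    ∃ q : M →+* R, g.comp q = h := by
  let e := RingEquiv.ofBijective g.rangeRestrict
    ⟨fun a b hab => hg (congrArg Subtype.val hab), g.rangeRestrict_surjective⟩
  refine ⟨(e.symm : g.range →+* R).comp (h.codRestrict g.range hm), RingHom.ext fun m => ?_⟩
  have : e (e.symm (h.codRestrict g.range hm m)) = h.codRestrict g.range hm m :=
    e.apply_symm_apply _
  exact congrArg Subtype.val this

theorem exists_finite_generators {A R : Type*} [CommRing A] [CommRing R] {ψ : A →+* R}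
    (h : ψ.Finite) : ∃ t : Set R, t.Finite ∧
      ∀ T : Subring R, (∀ a, ψ a ∈ T) → t ⊆ T → T = ⊤ := by
  algebraize [ψ]
  obtain ⟨t, ht⟩ := Module.Finite.fg_top (R := A) (M := R)
  refine ⟨t, t.finite_toSet, fun T h1 h2 => eq_top_iff.2 fun r _ => ?_⟩
  have hr : r ∈ Submodule.span A (t : Set R) := ht ▸ trivial
  induction hr using Submodule.span_induction with
  | mem x hx => exact h2 hx
  | zero => exact zero_mem T
  | add x y _ _ hx hy => exact add_mem (hx trivial) (hy trivial)
  | smul a x _ hx => rw [Algebra.smul_def]; exact mul_mem (h1 a) (hx trivial)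

section Zip

variable {α β γ : Type*} {f : α → β → γ} {xs : List α} {ys : List β}

theorem exists_of_mem_zipWith {c : γ} (h : c ∈ List.zipWith f xs ys) :
    ∃ a ∈ xs, ∃ b ∈ ys, c = f a b := by
  obtain ⟨n, hn, rfl⟩ := List.mem_iff_getElem.1 h
  rw [List.length_zipWith, lt_min_iff] at hn
  exact ⟨xs[n], List.getElem_mem _, ys[n], List.getElem_mem _, List.getElem_zipWith⟩

theorem exists_mem_zipWith (hl : ys.length = xs.length) {b : β} (h : b ∈ ys) :
    ∃ a ∈ xs, f a b ∈ List.zipWith f xs ys := by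
  obtain ⟨n, hn, rfl⟩ := List.mem_iff_getElem.1 h
  refine ⟨xs[n], List.getElem_mem _, List.mem_iff_getElem.2 ⟨n, by simp; omega, ?_⟩⟩
  exact List.getElem_zipWith

end Zip

/-- Power series over a Cohen ring deform along a specialization: a local homomorphism to `R`
lifts to an absolutely integrally closed domain specializing to that of `R`. -/
theorem IsPresentation.exists_deformation {p : ℕ} [hp : Fact p.Prime] {Λ₀ k₀ A₀ : Type}
    [CommRing Λ₀] [Field k₀] [CommRing A₀] [IsNoetherianRing A₀] [IsLocalRing A₀] {π₀ : Λ₀ →+* k₀}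
    {ι₀ : Λ₀ →+* A₀} {xs₀ : List A₀} (h₀ : IsCohenPower p π₀ ι₀ xs₀)
    {Λ k A R V : Type} [CommRing Λ] [Field k] [CharP k p] [CommRing A] [IsNoetherianRing A]
    [IsLocalRing A] [CommRing R] [IsNoetherianRing R] [IsLocalRing R]
    [IsAdicComplete (maximalIdeal R) R] {π : Λ →+* k} {ι : Λ →+* A} {xs : List A} {ψ : A →+* R}
    {ys zs : List A} (h : IsPresentation p π ι xs ψ ys zs) (hys : (p : R) = 0 ∨ ys = [])
    [CommRing V] [IsDomain V] (hV : HasMonicRoots V) (g : R →+* V) (hg : Function.Injective g)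
    (hgi : g.IsIntegral) (f : A₀ →+* R) (hf : (maximalIdeal A₀).map f ≤ maximalIdeal R) :
    ∃ (U C C' : Type) (_ : CommRing U) (_ : IsDomain U) (_ : CommRing C) (_ : CommRing C')
      (j : U →+* C) (χ : U →+* V) (τ : C →+* C') (j' : V →+* C') (β : A₀ →+* U),
      HasMonicRoots U ∧ τ.comp j = j'.comp χ ∧ CompleteCM (j'.comp g) (zs.map ψ) ∧
      χ.comp β = g.comp f ∧ RegMod ⊥ (((p : A₀) :: xs₀).map (j.comp β)) ∧
      (maximalIdeal A₀).map (j.comp β) ≠ ⊤ := by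
  obtain ⟨B, _, _, _, κ, Ys, U, _, _, φ, C, C', _, _, j, χ, τ, j', hYs, hB, hU, hφ, hφi, hC, hχκ,
    hχY, hχr, hτ, hC'⟩ := h.exists_specialization hV g hg hgi xs₀.length
  have := hB.complete
  have := h.power.isDomain
  have := h.power.isIntegrallyClosed
  have := h.power.charZero
  have hχi : (χ.comp (φ.comp κ)).IsIntegral := by
    rw [← RingHom.comp_assoc, hχκ]; exact h.finite.to_isIntegral.trans _ _ hgi
  have hχκ' : ∀ a, χ (φ (κ a)) = g (ψ a) := fun a => RingHom.congr_fun hχκ a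
  -- a lifting function along `χ`
  obtain ⟨l, hl, hli, hl0⟩ : ∃ l : V → U, (∀ v, χ (l v) = v) ∧
      (∀ v, (φ.comp κ).IsIntegralElem (l v)) ∧
      ((p : R) ≠ 0 → ∃ L : V →+* U, (∀ v, L v = l v) ∧ ∀ a, L (g (ψ a)) = φ (κ a)) := by
    by_cases hp0 : (p : R) = 0
    · obtain ⟨l, h1, h2⟩ := hU.exists_isIntegralElem (φ.comp κ) χ hχi
      exact ⟨l, h1, h2, fun h => absurd hp0 h⟩
    · have hψ : Function.Injective ψ := by
        rw [RingHom.injective_iff_ker_eq_bot, h.ker_eq, hys.resolve_left hp0, Ideal.ofList_nil]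
      obtain ⟨L, h1, h2⟩ := hU.exists_section hV (φ.comp κ) χ hχi (by
        rw [← RingHom.comp_assoc, hχκ]; exact hg.comp hψ)
      refine ⟨L, RingHom.congr_fun h1, fun v => ?_, fun _ => ⟨L, fun _ => rfl, fun a => ?_⟩⟩
      · obtain ⟨P, hP, hv⟩ := hχi v
        refine ⟨P, hP, ?_⟩
        nth_rw 1 [← h2]
        rw [← hom_eval₂, hv, map_zero]
      · rw [← hχκ']
        exact RingHom.congr_fun h2 a
  obtain ⟨t, htf, ht⟩ := exists_finite_generators h.finite
  obtain ⟨M, _, _, _, _, i, s, _, hiM, hMi, hsi, hs, hsS, hsT⟩ := exists_finite_subring φ hφi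
    (S := ((fun x => l (g (f x))) '' {x | x ∈ xs₀}) ∪ ((fun r => l (g r)) '' t))
    (((List.finite_toSet xs₀).image _).union (htf.image _))
  have hsi' : ∀ b, s (i b) = φ b := RingHom.congr_fun hsi
  obtain ⟨q, hq⟩ := exists_comp_eq_of_forall_mem_range hg (χ.comp s) (hsT (g.range.comap χ)
    (fun b => by
      obtain ⟨a, ha⟩ := hχr b
      exact ⟨ψ a, by rw [← ha, hχκ']⟩)
    (by
      rintro _ (⟨x, -, rfl⟩ | ⟨r, -, rfl⟩)
      · exact ⟨f x, (hl _).symm⟩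
      · exact ⟨r, (hl _).symm⟩))
  have hq' : ∀ m, g (q m) = χ (s m) := RingHom.congr_fun hq
  have hqκ : ∀ a, q (i (κ a)) = ψ a := fun a => hg (by rw [hq', hsi', hχκ'])
  have hqs : Function.Surjective q := by
    rw [← RingHom.range_eq_top]
    refine ht _ (fun a => ⟨_, hqκ a⟩) fun r hr => ?_
    obtain ⟨m, hm⟩ := hsS (l (g r)) (Or.inr ⟨r, hr, rfl⟩)
    exact ⟨m, hg (by rw [hq', hm, hl])⟩
  have hqm : ∀ m, q m ∈ maximalIdeal R ↔ m ∈ maximalIdeal M := fun m =>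
    mem_maximalIdeal_map_iff hqs
  -- the coefficient ring
  obtain ⟨l₁, hl₁⟩ : ∃ l₁ : Λ₀ →+* M, q.comp l₁ = f.comp ι₀ := by
    by_cases hp0 : (p : R) = 0
    · refine h₀.cohen.exists_lift hqs (isAdicComplete_of_le_maximalIdeal fun m hm => ?_)
        (by rw [map_natCast, hp0]) _
      rw [← hqm, RingHom.mem_ker.1 hm]
      exact zero_mem _
    · obtain ⟨L, hL, hLa⟩ := hl0 hp0
      obtain ⟨σ, hσ⟩ := exists_comp_eq_of_forall_mem_range hs (L.comp g) fun r => by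
        have : s.range.comap (L.comp g) = ⊤ := ht _ (fun a => ⟨i (κ a), by
          rw [hsi', RingHom.comp_apply, hLa]⟩) fun r hr => by
            obtain ⟨m, hm⟩ := hsS (l (g r)) (Or.inr ⟨r, hr, rfl⟩)
            exact ⟨m, by rw [hm, RingHom.comp_apply, hL]⟩
        have hr : r ∈ s.range.comap (L.comp g) := this ▸ trivial
        exact hr
      refine ⟨σ.comp (f.comp ι₀), ?_⟩
      rw [← RingHom.comp_assoc]
      convert RingHom.id_comp _
      ext r
      refine hg ?_
      have : s (σ r) = L (g r) := RingHom.congr_fun hσ r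
      rw [RingHom.comp_apply, hq', this, hL, hl, RingHom.id_apply]
  -- the parameters
  have hθ : ∀ x, ∃ m, x ∈ xs₀ → s m = l (g (f x)) := fun x => by
    by_cases hx : x ∈ xs₀
    · obtain ⟨m, hm⟩ := hsS (l (g (f x))) (Or.inl ⟨x, hx, rfl⟩)
      exact ⟨m, fun _ => hm⟩
    · exact ⟨0, fun h => absurd h hx⟩
  choose θ hθ using hθ
  have hqθ : ∀ x ∈ xs₀, q (θ x) = f x := fun x hx => hg (by rw [hq', hθ x hx, hl])
  have hfm : ∀ x ∈ xs₀, f x ∈ maximalIdeal R := fun x hx =>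
    hf (Ideal.mem_map_of_mem f (h₀.mem hx))
  have hθm : ∀ x ∈ xs₀, θ x ∈ maximalIdeal M := fun x hx => by
    rw [← hqm, hqθ x hx]; exact hfm x hx
  have hYm : ∀ y ∈ Ys, i y ∈ maximalIdeal M := fun y hy =>
    hiM (Ideal.mem_map_of_mem i (hB.mem (List.mem_append_left _ hy)))
  have hqY : ∀ y ∈ Ys, q (i y) = 0 := fun y hy => hg (by rw [hq', hsi', hχY y hy, map_zero])
  let bs := List.zipWith (fun x y => θ x + i y) xs₀ Ys
  have hbl : bs.length = xs₀.length := by simp [bs, hYs]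
  have hbm : ∀ b ∈ bs, b ∈ maximalIdeal M := fun b hb => by
    obtain ⟨x, hx, y, hy, rfl⟩ := exists_of_mem_zipWith hb
    exact add_mem (hθm x hx) (hYm y hy)
  obtain ⟨α, hα, hαx⟩ := h₀.formal.exists_hom (completeFiltration_pow (maximalIdeal M)) l₁ bs hbl
    fun b hb N => ⟨N, Ideal.pow_mem_pow (hbm b hb) N⟩
  have hqα : q.comp α = f := by
    have e : xs₀.map (q.comp α) = xs₀.map f := by
      have e1 : xs₀.map (q.comp α) = (xs₀.map α).map q := by rw [List.map_map]; rfl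
      rw [e1, hαx]
      refine List.ext_getElem (by simp [hbl]) fun n h1 h2 => ?_
      rw [List.length_map] at h2
      simp only [bs, List.getElem_map, List.getElem_zipWith, map_add]
      rw [hqθ _ (List.getElem_mem _), hqY _ (List.getElem_mem _), add_zero]
    refine h₀.formal.hom_ext (completeFiltration_pow (maximalIdeal R)) _ _
      (by rw [RingHom.comp_assoc, hα, hl₁]) e fun x hx N => ⟨N, Ideal.pow_mem_pow ?_ N⟩
    rw [List.map_inj_left.1 e x hx]
    exact hfm x hx
  have hmB : maximalIdeal B = Ideal.ofList ((p : B) :: (Ys ++ xs.map κ)) :=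
    hB.max_eq_perm (List.perm_append_singleton _ _)
  have hCM : CompleteCM (j.comp s) (((p : B) :: (Ys ++ xs.map κ)).map i) :=
    CompleteCM.of_comp (by rwa [RingHom.comp_assoc, hsi]) hiM hMi
  have hparB : IsParam (⊥ : Ideal M) (((p : B) :: (Ys ++ xs.map κ)).map i) := by
    rw [hmB, Ideal.map_ofList] at hMi hiM
    exact ⟨fun x hx => hiM (Ideal.subset_span hx), by rwa [bot_sup_eq]⟩
  have hpar : IsParam (⊥ : Ideal M) (((p : A₀) :: xs₀).map α ++ xs.map (i.comp κ)) := by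
    rw [List.map_cons, map_natCast, hαx]
    refine ⟨fun x hx => ?_, ?_⟩
    · rw [List.mem_append, List.mem_cons] at hx
      rcases hx with (rfl | hx) | hx
      · have := hiM (Ideal.mem_map_of_mem i hB.p_mem)
        rwa [map_natCast] at this
      · exact hbm x hx
      · obtain ⟨a, ha, rfl⟩ := List.mem_map.1 hx
        exact hiM (Ideal.mem_map_of_mem i
            (hB.mem (List.mem_append_right _ (List.mem_map_of_mem ha))))
    · rw [bot_sup_eq, Ideal.radical_eq_sInf, le_sInf_iff]
      rintro Q ⟨hQJ, hQ⟩
      have hQm : ∀ x ∈ (p : M) :: bs ++ xs.map (i.comp κ), x ∈ Q := fun x hx =>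
        hQJ (Ideal.subset_span hx)
      have hAQ : (maximalIdeal A).map (i.comp κ) ≤ Q := by
        rw [h.power.max_eq, Ideal.map_ofList, Ideal.ofList, Ideal.span_le]
        intro x hx
        refine hQm x ?_
        have hx : x ∈ (xs ++ [(p : A)]).map (i.comp κ) := hx
        rw [List.map_append, List.mem_append] at hx
        rcases hx with hx | hx
        · exact List.mem_append_right _ hx
        · simp only [List.map_cons, map_natCast, List.map_nil, List.mem_singleton] at hx
          simp [hx]
      have hθQ : ∀ x ∈ xs₀, θ x ∈ Q := fun x hx => by
        refine mem_of_isIntegralElem (i.comp κ) hAQ (hθm x hx) ?_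
        obtain ⟨P, hP, hPx⟩ := hli (g (f x))
        refine ⟨P, hP, hs ?_⟩
        rw [hom_eval₂, map_zero, ← RingHom.comp_assoc, hsi, hθ x hx, hPx]
      have hYQ : ∀ y ∈ Ys, i y ∈ Q := fun y hy => by
        obtain ⟨x, hx, hxy⟩ := exists_mem_zipWith (f := fun x y => θ x + i y) hYs hy
        have := hQm _ (List.mem_append_left _ (List.mem_cons_of_mem _ hxy))
        exact (Q.add_mem_iff_right (hθQ x hx)).1 this
      refine hMi.trans (hQ.radical_le_iff.2 ?_)
      rw [hmB, Ideal.map_ofList, Ideal.ofList, Ideal.span_le]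
      intro x hx
      obtain ⟨y, hy, rfl⟩ := List.mem_map.1 hx
      rw [List.mem_cons, List.mem_append] at hy
      rcases hy with rfl | hy | hy
      · rw [map_natCast]; exact hQm _ (by simp)
      · exact hYQ y hy
      · obtain ⟨a, ha, rfl⟩ := List.mem_map.1 hy
        exact hQm _ (List.mem_append_right _ (List.mem_map_of_mem (f := i.comp κ) ha))
  have hCM2 := hCM.exchange hparB hpar (by simp [hYs]) Ideal.map_bot
  refine ⟨U, C, C', inferInstance, inferInstance, inferInstance, inferInstance, j, χ, τ, j',
    s.comp α, hU, hτ, hC', ?_, ?_, fun e => hCM2.ne_top ?_⟩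
  · rw [← RingHom.comp_assoc, ← hq, RingHom.comp_assoc, hqα]
  · have := hCM2.reg
    rw [List.map_append, regMod_append, List.map_map] at this
    exact this.1
  · rw [← top_le_iff, ← e, ← RingHom.comp_assoc, ← Ideal.map_map]
    refine Ideal.map_mono ?_
    rw [h₀.max_eq_perm (zs := (p : A₀) :: xs₀) (by simp), Ideal.map_ofList, Ideal.ofList,
        Ideal.span_le]
    exact fun x hx => hpar.mem x (List.mem_append_left _ hx)

end

section

open IsLocalRing

theorem IsPresentation.isParam {p : ℕ} {Λ k A R : Type} [CommRing Λ] [CommRing k] [CommRing A]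
    [IsNoetherianRing A] [IsLocalRing A] [CommRing R] [IsLocalRing R] {π : Λ →+* k} {ι : Λ →+* A}
    {xs : List A}
    {ψ : A →+* R} {ys zs : List A} (h : IsPresentation p π ι xs ψ ys zs) :
    IsParam (⊥ : Ideal R) (zs.map ψ) where
  mem := fun x hx => by
    obtain ⟨z, hz, rfl⟩ := List.mem_map.1 hx
    refine h.map_le (Ideal.mem_map_of_mem ψ ?_)
    rw [h.power.max_eq_perm h.perm]
    exact Ideal.subset_span (List.mem_append_right _ hz)
  le_radical := by
    have := h.le_radical
    rwa [h.power.max_eq_perm h.perm, Ideal.ofList_append, Ideal.map_sup, ← h.ker_eq,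
      (Ideal.map_eq_bot_iff_le_ker ψ).2 le_rfl, Ideal.map_ofList] at this

/-- Weak functoriality of completed Cohen-Macaulay algebras. -/
theorem exists_completeCM_square {p : ℕ} [hp : Fact p.Prime] {R R' V V' : Type} [CommRing R]
    [CommRing R'] [IsDomain R] [IsDomain R'] [IsNoetherianRing R] [IsNoetherianRing R']
    [IsLocalRing R] [IsLocalRing R'] [IsAdicComplete (maximalIdeal R) R]
    [IsAdicComplete (maximalIdeal R') R'] (hpR : (p : R) ∈ maximalIdeal R) (hp0 : (p : R) ≠ 0)
    (f : R →+* R') (hf : (maximalIdeal R).map f ≤ maximalIdeal R') [CommRing V] [IsDomain V]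
    [CommRing V'] [IsDomain V'] (hV : HasMonicRoots V) (hV' : HasMonicRoots V') (g : R →+* V)
    (hg : Function.Injective g) (hgi : g.IsIntegral) (g' : R' →+* V')
    (hg' : Function.Injective g') (hgi' : g'.IsIntegral) (fp : V →+* V')
    (hfp : fp.comp g = g'.comp f) :
    ∃ (E C' : Type) (_ : CommRing E) (_ : CommRing C') (j : V →+* E) (j' : V' →+* C')
      (τ : E →+* C') (ts : List R) (ts' : List R'), τ.comp j = j'.comp fp ∧
      CompleteCM (j.comp g) ts ∧ IsParam ⊥ ts ∧ (ts.length : WithBot ℕ∞) = ringKrullDim R ∧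
      CompleteCM (j'.comp g') ts' ∧ IsParam ⊥ ts' ∧
      (ts'.length : WithBot ℕ∞) = ringKrullDim R' := by
  obtain ⟨Λ, A, _, _, _, _, π, ι, xs, ψ, ys, zs, h, hcase⟩ := exists_isPresentation p R hpR
  obtain ⟨-, rfl, rfl⟩ := hcase.resolve_left fun h => hp0 h.1
  have hpR' : (p : R') ∈ maximalIdeal R' := by
    rw [← map_natCast f]; exact hf (Ideal.mem_map_of_mem f hpR)
  obtain ⟨Λ', A', _, _, _, _, π', ι', xs', ψ', ys', zs', h', hcase'⟩ :=
    exists_isPresentation p R' hpR'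
  have hk' : CharP (ResidueField R') p := charP_of_natCast_eq_zero p (by
    rw [← map_natCast (residue R'), residue_eq_zero_iff]; exact hpR')
  have := h.power.isDomain
  have := h.power.isIntegrallyClosed
  have := h.power.charZero
  obtain ⟨U, C, C', _, _, _, _, j, χ, τ, j', β, hU, hτ, hC', hβ, hreg, hne⟩ :=
    h'.exists_deformation h.power (hcase'.imp (fun h => h.1) fun h => h.2.1) hV' g' hg' hgi'
      (f.comp ψ) (by rw [← Ideal.map_map]; exact (Ideal.map_mono h.map_le).trans hf)
  have hψ : Function.Injective ψ := by
    rw [RingHom.injective_iff_ker_eq_bot, h.ker_eq, Ideal.ofList_nil]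
  have hgψ : Function.Injective (g.comp ψ) := hg.comp hψ
  have hgψi : (g.comp ψ).IsIntegral := h.finite.to_isIntegral.trans _ _ hgi
  obtain ⟨e₀, he₀⟩ := hU.exists_extension (g.comp ψ) hgψi β (by
    rw [(RingHom.injective_iff_ker_eq_bot _).1 hgψ]; exact bot_le)
  obtain ⟨σ, hσ, hσ'⟩ := exists_ringEquiv_of_comp_eq hV (g.comp ψ) hgψ hgψi fp (χ.comp e₀) (by
    rw [← RingHom.comp_assoc, hfp, RingHom.comp_assoc, RingHom.comp_assoc, he₀, hβ])
  let e := e₀.comp σ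
  have he : (e.comp g).comp ψ = β := by
    rw [RingHom.comp_assoc, RingHom.comp_assoc, hσ, he₀]
  have hχe : χ.comp e = fp := by rw [hσ', RingHom.comp_assoc]
  have hjβ : ((j.comp e).comp g).comp ψ = j.comp β := by
    rw [← he]; rfl
  obtain ⟨E, _, i, hi, hE⟩ := exists_completeCM h.isParam ((j.comp e).comp g) Ideal.map_bot
    (by rw [List.map_map, ← RingHom.coe_comp, hjβ]; exact hreg) (fun e1 => hne (by
      have := (Ideal.map_mono (f := (j.comp e).comp g) h.le_radical).trans (Ideal.map_radical_le _)
      rwa [e1, Ideal.map_map, hjβ, top_le_iff, Ideal.radical_eq_top] at this))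
  have hτe : τ.comp (j.comp e) = j'.comp fp := by
    rw [← RingHom.comp_assoc, hτ, RingHom.comp_assoc, hχe]
  have := hC'.complete
  obtain ⟨ρ, hρ⟩ := hi.exists_lift τ ((maximalIdeal R').map (j'.comp g')) (by
    rw [Ideal.map_map, ← RingHom.comp_assoc, hτe, RingHom.comp_assoc, hfp, ← RingHom.comp_assoc,
      ← Ideal.map_map]
    exact Ideal.map_mono hf)
  exact ⟨E, C', inferInstance, inferInstance, i.comp (j.comp e), j', ρ, _, _,
    by rw [← RingHom.comp_assoc, hρ, hτe], hE, h.isParam,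
    by rw [List.length_map]; exact h.length_eq,
    hC', h'.isParam, by rw [List.length_map]; exact h'.length_eq⟩

theorem isRegSeq_of_regMod {B : Type*} [CommRing B] {m : ℕ} {y : Fin m → B}
    (h : RegMod ⊥ (List.ofFn y)) (hne : Ideal.ofList (List.ofFn y) ≠ ⊤) : IsRegSeq y := by
  refine ⟨fun i b hb => ?_, fun e => hne ?_⟩
  · have hspan : Ideal.span (y '' {j : Fin m | j < i}) =
        ⊥ ⊔ Ideal.ofList ((List.ofFn y).take i) := by
      rw [bot_sup_eq, Ideal.ofList]
      congr 1
      ext c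
      simp only [Set.mem_image, Set.mem_ofPred_eq, List.mem_take_iff_getElem, List.getElem_ofFn]
      constructor
      · rintro ⟨j, hj, rfl⟩
        exact ⟨j, lt_min hj (by simp), rfl⟩
      · rintro ⟨j, hj, rfl⟩
        exact ⟨⟨j, _⟩, Fin.lt_def.2 (lt_min_iff.1 hj).1, rfl⟩
    rw [hspan] at hb ⊢
    refine regMod_iff_forall_append.1 h _ (y i) ((List.ofFn y).drop (i + 1)) ?_ b hb
    have hi : (i : ℕ) < (List.ofFn y).length := by simp
    conv_lhs => rw [← List.take_append_drop i (List.ofFn y), List.drop_eq_getElem_cons hi]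
    simp
  · rw [← e, Ideal.ofList]
    congr 1
    ext c
    simp [List.mem_ofFn']

theorem isParam_of_isSOP {R : Type*} [CommRing R] [IsLocalRing R] {d : ℕ} {x : Fin d → R}
    (h : IsSOP R x) : IsParam (⊥ : Ideal R) (List.ofFn x) where
  mem := fun a ha => by
    obtain ⟨i, rfl⟩ := (List.mem_ofFn' x a).1 ha
    exact h.2.1 i
  le_radical := by
    have : {a | a ∈ List.ofFn x} = Set.range x := by ext a; simp [List.mem_ofFn']
    rw [bot_sup_eq, Ideal.ofList, this, h.2.2]

section
variable {R E : Type*} [CommRing R] [IsNoetherianRing R] [IsLocalRing R] [CommRing E]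
  {φ : R →+* E} {ts : List R}

theorem CompleteCM.regMod_ofFn (h : CompleteCM φ ts) (ht : IsParam (⊥ : Ideal R) ts)
    (hl : (ts.length : WithBot ℕ∞) = ringKrullDim R) {d : ℕ} {x : Fin d → R} (hx : IsSOP R x) :
    RegMod ⊥ (List.ofFn fun i => φ (x i)) ∧ Ideal.ofList (List.ofFn fun i => φ (x i)) ≠ ⊤ := by
  have hlen : (List.ofFn x).length = ts.length := by
    rw [List.length_ofFn]
    exact_mod_cast hx.1.trans hl.symm
  have hm : (List.ofFn fun i => φ (x i)) = (List.ofFn x).map φ := by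
    rw [List.map_ofFn]; rfl
  have hpx := isParam_of_isSOP hx
  have hc := h.exchange ht hpx hlen.symm Ideal.map_bot
  refine ⟨hm ▸ hc.reg, fun e => hc.ne_top (top_le_iff.1 ?_)⟩
  rw [← e, hm, ← Ideal.map_ofList]
  exact Ideal.map_mono (Ideal.span_le.2 hpx.mem)

theorem CompleteCM.isBigCM (h : CompleteCM φ ts) (ht : IsParam (⊥ : Ideal R) ts)
    (hl : (ts.length : WithBot ℕ∞) = ringKrullDim R) : IsBigCM φ := fun _ _ hx =>
  isRegSeq_of_regMod (h.regMod_ofFn ht hl hx).1 (h.regMod_ofFn ht hl hx).2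

theorem CompleteCM.isBigCM_perfectClosure (p : ℕ) [Fact p.Prime] [CharP E p]
    (h : CompleteCM φ ts) (ht : IsParam (⊥ : Ideal R) ts)
    (hl : (ts.length : WithBot ℕ∞) = ringKrullDim R) :
    IsBigCM ((PerfectClosure.of E p).comp φ) := fun d x hx => by
  have hm : (List.ofFn fun i => ((PerfectClosure.of E p).comp φ) (x i)) =
      (List.ofFn fun i => φ (x i)).map (PerfectClosure.of E p) := by
    rw [List.map_ofFn]; rfl
  obtain ⟨h1, h2⟩ := h.regMod_ofFn ht hl hx
  exact isRegSeq_of_regMod (hm ▸ RegMod.isPRadical p (PerfectClosure.of E p) h1)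
    (hm ▸ ofList_ne_top_of_isPRadical p (PerfectClosure.of E p) h2)

end

end

end BigCM

/-- **Theorem 1.2 (precise form in mixed characteristic)**: a local homomorphism
`f : R → R'` of complete noetherian local domains with `R` of mixed characteristic `(0,p)`,
together with any lifting `f⁺ : R⁺ → R'⁺` to absolute integral closures, fits into a
commutative square where `C` is an `R⁺`-algebra which is a big Cohen-Macaulay `R`-algebra,
`C'` is an `R'⁺`-algebra which is a big Cohen-Macaulay `R'`-algebra; moreover `C'` may be
taken perfect when `R'` has characteristic `p`. -/
theorem weak_functoriality_with_abs_int_closures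
    (p : ℕ) (hp : p.Prime)
    (R R' : Type) [CommRing R] [CommRing R'] [IsDomain R] [IsDomain R']
    [IsNoetherianRing R] [IsNoetherianRing R'] [IsLocalRing R] [IsLocalRing R']
    [IsAdicComplete (IsLocalRing.maximalIdeal R) R]
    [IsAdicComplete (IsLocalRing.maximalIdeal R') R']
    [CharZero R] [CharP (IsLocalRing.ResidueField R) p]
    (f : R →+* R')
    (hf : ∀ a ∈ IsLocalRing.maximalIdeal R, f a ∈ IsLocalRing.maximalIdeal R')
    (Rplus R'plus : Type) [CommRing Rplus] [CommRing R'plus]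
    [Algebra R Rplus] [Algebra R' R'plus]
    (hRplus : IsAbsIntClosure R Rplus) (hR'plus : IsAbsIntClosure R' R'plus)
    (fplus : Rplus →+* R'plus)
    (hfplus : ∀ r : R, fplus (algebraMap R Rplus r) = algebraMap R' R'plus (f r)) :
    ∃ (C C' : Type) (_ : CommRing C) (_ : CommRing C')
      (ι : Rplus →+* C) (ι' : R'plus →+* C') (g : C →+* C'),
      IsBigCM (ι.comp (algebraMap R Rplus)) ∧
      IsBigCM (ι'.comp (algebraMap R' R'plus)) ∧
      g.comp ι = ι'.comp fplus ∧
      (CharP R' p → Function.Bijective fun c : C' => c ^ p) := by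
  have : Fact p.Prime := ⟨hp⟩
  have := hRplus.isDomain
  have := hR'plus.isDomain
  have hpR : (p : R) ∈ IsLocalRing.maximalIdeal R := by
    rw [← IsLocalRing.residue_eq_zero_iff, map_natCast, CharP.cast_eq_zero]
  obtain ⟨E, C', _, _, j, j', τ, ts, ts', hτ, hE, ht, hl, hC', ht', hl'⟩ :=
    BigCM.exists_completeCM_square hpR (Nat.cast_ne_zero.2 hp.ne_zero)
        f (Ideal.map_le_iff_le_comap.2 hf)
      hRplus.monic_root hR'plus.monic_root (algebraMap R Rplus) hRplus.injective
      (algebraMap_isIntegral_iff.2 hRplus.isIntegral) (algebraMap R' R'plus) hR'plus.injective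
      (algebraMap_isIntegral_iff.2 hR'plus.isIntegral) fplus (RingHom.ext hfplus)
  by_cases hchar : CharP R' p
  · have := hC'.nontrivial
    have : CharP C' p := BigCM.charP_of_natCast_eq_zero p (by
      rw [← map_natCast (j'.comp (algebraMap R' R'plus)), CharP.cast_eq_zero, map_zero])
    refine ⟨E, PerfectClosure C' p, inferInstance, inferInstance, j,
      (PerfectClosure.of C' p).comp j', (PerfectClosure.of C' p).comp τ, hE.isBigCM ht hl,
      hC'.isBigCM_perfectClosure p ht' hl', ?_, fun _ => ?_⟩
    · rw [RingHom.comp_assoc, hτ, RingHom.comp_assoc]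
    · exact bijective_frobenius (PerfectClosure C' p) p
  · exact ⟨E, C', inferInstance, inferInstance, j, j', τ, hE.isBigCM ht hl, hC'.isBigCM ht' hl',
      hτ, fun h => absurd h hchar⟩
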